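/- Let n ≥ 2 be an integer, γ > 1, κ = (γ−1)²/(4γ), and p(ρ) = κρ^γ. Let (ρ₀, m₀) ∈ L¹_loc(ℝ₊; ℝ²) with ρ₀ ≥ 0, m₀ = ρ₀u₀, and finite energy E[ρ₀,m₀] = ∫₀^∞ (½ m₀²/ρ₀ + κρ₀^γ/(γ−1)) r^{n−1} dr < ∞. Then there exists a finite-energy weak solution (ρ, m) of the spherically symmetric Euler equations with this initial data: (ρ,m) ∈ L¹_loc(ℝ₊²; ℝ²) with ρ ≥ 0, E[ρ,m](t) < ∞ for almost every t > 0, for all φ ∈ C_c^∞([0,∞)²) one has ∫₀^∞∫₀^∞ (ρφ_t + mφ_r) r^{n−1} dr dt + ∫₀^∞ ρ₀(r)φ(0,r) r^{n−1} dr = 0, and for all φ ∈ C_c^∞([0,∞)²) with φ(t,0) = 0 for all t ≥ 0 one has ∫₀^∞∫₀^∞ (mφ_t + (m²/ρ)φ_r + p(ρ)(φ_r + ((n−1)/r)φ)) r^{n−1} dr dt + ∫₀^∞ m₀(r)φ(0,r) r^{n−1} dr = 0. -/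

import Mathlib

open MeasureTheory Real Set

noncomputable section

namespace RadialEuler

open Filter Topology Function
open scoped ContDiff

/-- State space `(ρ, m, q, P)` of the linear relaxed system. -/
abbrev St := ℝ × ℝ × ℝ × ℝ

/-- The pressure law. -/
def pres (κ γ x : ℝ) : ℝ := κ * x ^ γ

/-- Slope of the chord of the pressure law. -/
def chord (κ γ x y : ℝ) : ℝ := (pres κ γ y - pres κ γ x) / (y - x)

/-- Relative mass flux of the two-state lamination. -/
def flux (κ γ x y : ℝ) : ℝ := √(x * y * chord κ γ x y)

/-- The point of the constraint set with density `x`, relative mass flux `j`, shock speed `s`. -/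
def endpt (κ γ j s x : ℝ) : St :=
  (x, j + s * x, j ^ 2 / x + 2 * s * j + s ^ 2 * x + pres κ γ x, pres κ γ x)

/-- Oscillation direction. -/
def dir (s b : ℝ) : St := (1, s, s ^ 2, b)

/-- Points of the lamination segment. -/
def lam (κ γ x y s θ : ℝ) : St :=
  endpt κ γ (flux κ γ x y) s x + (θ * (y - x)) • dir s (chord κ γ x y)

/-- Cost of a lamination segment. -/
def lcost (κ γ x y s : ℝ) : ℝ :=
  2 * ((y - x) * (1 + |s| + s ^ 2 + chord κ γ x y)) + 2 * ((y - x) / x ^ 2)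

/-- Laminable states together with an admissible bound for their distance to the constraint. -/
def lamSet (κ γ : ℝ) : Set (St × ℝ) :=
  {w | ∃ x y s θ, 0 < x ∧ x < y ∧ 0 < θ ∧ θ < 1 ∧ w.1 = lam κ γ x y s θ ∧
    θ * (1 - θ) * lcost κ γ x y s < w.2}

lemma pres_strictMono {κ γ x y : ℝ} (hκ : 0 < κ) (hγ : 1 < γ) (hx : 0 < x) (hxy : x < y) :
    pres κ γ x < pres κ γ y := by
  unfold pres
  have := Real.rpow_lt_rpow hx.le hxy (by linarith : 0 < γ)
  nlinarith

lemma chord_pos {κ γ x y : ℝ} (hκ : 0 < κ) (hγ : 1 < γ) (hx : 0 < x) (hxy : x < y) :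
    0 < chord κ γ x y :=
  div_pos (sub_pos.2 (pres_strictMono hκ hγ hx hxy)) (sub_pos.2 hxy)

lemma flux_sq {κ γ x y : ℝ} (hκ : 0 < κ) (hγ : 1 < γ) (hx : 0 < x) (hxy : x < y) :
    flux κ γ x y ^ 2 = x * y * chord κ γ x y := by
  have := chord_pos hκ hγ hx hxy
  have : 0 < y := hx.trans hxy
  exact Real.sq_sqrt (by positivity)

lemma lcost_pos {κ γ x y : ℝ} (s : ℝ) (hκ : 0 < κ) (hγ : 1 < γ) (hx : 0 < x) (hxy : x < y) :
    0 < lcost κ γ x y s := by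
  have := chord_pos hκ hγ hx hxy
  have : 0 < y - x := sub_pos.2 hxy
  unfold lcost; positivity

lemma lamSet_mono {κ γ : ℝ} {z : St} {c c' : ℝ} (h : (z, c) ∈ lamSet κ γ) (hc : c ≤ c') :
    (z, c') ∈ lamSet κ γ := by
  obtain ⟨x, y, s, θ, h1, h2, h3, h4, h5, h6⟩ := h
  exact ⟨x, y, s, θ, h1, h2, h3, h4, h5, h6.trans_le hc⟩

lemma lamSet_pos {κ γ : ℝ} (hκ : 0 < κ) (hγ : 1 < γ) {z : St} {c : ℝ}
    (h : (z, c) ∈ lamSet κ γ) : 0 < c := by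
  obtain ⟨x, y, s, θ, h1, h2, h3, h4, h5, h6⟩ := h
  have := lcost_pos s hκ hγ h1 h2
  have : 0 < 1 - θ := by linarith
  exact lt_trans (by positivity) h6

lemma norm_dir_le {κ γ x y s : ℝ} (hκ : 0 < κ) (hγ : 1 < γ) (hx : 0 < x) (hxy : x < y) :
    2 * ((y - x) * ‖dir s (chord κ γ x y)‖) ≤ lcost κ γ x y s := by
  have h1 := chord_pos hκ hγ hx hxy
  have h2 : 0 < y - x := sub_pos.2 hxy
  have h3 : ‖dir s (chord κ γ x y)‖ ≤ 1 + |s| + s ^ 2 + chord κ γ x y := by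
    simp only [dir, Prod.norm_def, Real.norm_eq_abs, abs_one, abs_pow, sq_abs, abs_of_pos h1]
    have := abs_nonneg s
    have := sq_nonneg s
    refine max_le (by linarith) (max_le (by linarith) (max_le (by linarith) (by linarith)))
  unfold lcost
  have : 0 ≤ (y - x) / x ^ 2 := by positivity
  nlinarith [mul_le_mul_of_nonneg_left h3 h2.le]

lemma endpt_right {κ γ x y : ℝ} (s : ℝ) (hκ : 0 < κ) (hγ : 1 < γ) (hx : 0 < x) (hxy : x < y) :
    endpt κ γ (flux κ γ x y) s y =
      endpt κ γ (flux κ γ x y) s x + (y - x) • dir s (chord κ γ x y) := by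
  have h1 := flux_sq hκ hγ hx hxy
  have h2 : y - x ≠ 0 := (sub_pos.2 hxy).ne'
  have hy : 0 < y := hx.trans hxy
  have h3 : (y - x) * chord κ γ x y = pres κ γ y - pres κ γ x := by
    unfold chord; field_simp
  simp only [endpt, dir, h1, Prod.smul_mk, Prod.mk_add_mk, smul_eq_mul, h3]
  refine Prod.ext (by simp) (Prod.ext (by simp; ring) (Prod.ext ?_ (by simp)))
  have e1 : x * y * chord κ γ x y / y = x * chord κ γ x y := by field_simp
  have e2 : x * y * chord κ γ x y / x = y * chord κ γ x y := by field_simp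
  simp only [e1, e2]
  linarith [h3, mul_comm (y-x) (s^2)]

lemma lam_eq_convex {κ γ x y : ℝ} (s θ : ℝ) (hκ : 0 < κ) (hγ : 1 < γ) (hx : 0 < x) (hxy : x < y) :
    lam κ γ x y s θ = endpt κ γ (flux κ γ x y) s y
      - ((1 - θ) * (y - x)) • dir s (chord κ γ x y) := by
  rw [endpt_right s hκ hγ hx hxy, lam]
  module

lemma exists_constraint_near {κ γ : ℝ} (hκ : 0 < κ) (hγ : 1 < γ) {z : St} {c : ℝ}
    (h : (z, c) ∈ lamSet κ γ) :
    ∃ e : St, 0 ≤ e.1 ∧ e.2.2.2 = pres κ γ e.1 ∧ e.1 * (e.2.2.1 - e.2.2.2) = e.2.1 ^ 2 ∧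
      ‖z - e‖ ≤ c := by
  obtain ⟨x, y, s, θ, hx, hxy, h3, h4, h5, h6⟩ := h
  simp only at h5 h6
  have hy : 0 < y := hx.trans hxy
  have hd := norm_dir_le (s := s) hκ hγ hx hxy
  have key : ∀ w, 0 < w → 0 ≤ (endpt κ γ (flux κ γ x y) s w).1 ∧
      (endpt κ γ (flux κ γ x y) s w).2.2.2 = pres κ γ (endpt κ γ (flux κ γ x y) s w).1 ∧
      (endpt κ γ (flux κ γ x y) s w).1 * ((endpt κ γ (flux κ γ x y) s w).2.2.1
        - (endpt κ γ (flux κ γ x y) s w).2.2.2) = (endpt κ γ (flux κ γ x y) s w).2.1 ^ 2 := by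
    intro w hw
    refine ⟨hw.le, rfl, ?_⟩
    simp only [endpt]
    field_simp
    ring
  have hyx : 0 < y - x := sub_pos.2 hxy
  set N := ‖dir s (chord κ γ x y)‖ with hN
  have hN0 : 0 ≤ N := norm_nonneg _
  have hl := lcost_pos s hκ hγ hx hxy
  rcases le_total θ (1 / 2) with ht | ht
  · refine ⟨_, (key x hx).1, (key x hx).2.1, (key x hx).2.2, ?_⟩
    rw [h5, lam, add_sub_cancel_left, norm_smul, Real.norm_eq_abs, abs_of_pos (by positivity)]
    nlinarith [mul_nonneg hyx.le hN0, mul_nonneg h3.le hl.le]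
  · refine ⟨_, (key y hy).1, (key y hy).2.1, (key y hy).2.2, ?_⟩
    have h1t : 0 < 1 - θ := by linarith
    rw [h5, lam_eq_convex s θ hκ hγ hx hxy, sub_sub_cancel_left, norm_neg, norm_smul,
      Real.norm_eq_abs, abs_of_pos (by positivity)]
    nlinarith [mul_nonneg hyx.le hN0, mul_nonneg h1t.le hl.le]

/-- Moments of the two-point law charging `x` with mass `1 - θ` and `y` with mass `θ`. -/
def moments (γ : ℝ) (v : ℝ × ℝ × ℝ) : ℝ × ℝ × ℝ :=
  ((1 - v.2.2) * v.1 + v.2.2 * v.2.1,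
   (1 - v.2.2) * v.1 ^ γ + v.2.2 * v.2.1 ^ γ,
   (1 - v.2.2) * v.1 ^ (γ + 1) + v.2.2 * v.2.1 ^ (γ + 1))

lemma lam_fst (κ γ x y s θ : ℝ) : (lam κ γ x y s θ).1 = (1 - θ) * x + θ * y := by
  simp [lam, endpt, dir]; ring

lemma moments_lam {κ γ x y : ℝ} (s θ : ℝ) (hκ : 0 < κ) (hγ : 1 < γ) (hx : 0 < x) (hxy : x < y) :
    moments γ (x, y, θ) = ((lam κ γ x y s θ).1, (lam κ γ x y s θ).2.2.2 / κ,
      ((lam κ γ x y s θ).1 * (lam κ γ x y s θ).2.2.1 - (lam κ γ x y s θ).2.1 ^ 2) / κ) := by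
  have h1 := flux_sq hκ hγ hx hxy
  have h2 : y - x ≠ 0 := (sub_pos.2 hxy).ne'
  have hy : 0 < y := hx.trans hxy
  have h3 : (y - x) * chord κ γ x y = κ * y ^ γ - κ * x ^ γ := by
    unfold chord pres; field_simp
  have ex : x ^ (γ + 1) = x ^ γ * x := by rw [Real.rpow_add hx, Real.rpow_one]
  have ey : y ^ (γ + 1) = y ^ γ * y := by rw [Real.rpow_add hy, Real.rpow_one]
  simp only [moments, lam, endpt, dir, Prod.smul_mk, Prod.mk_add_mk, smul_eq_mul, pres]
  generalize flux κ γ x y = j at *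
  generalize hC : chord κ γ x y = C at *
  refine Prod.ext (by simp; ring) (Prod.ext ?_ ?_)
  · simp only
    field_simp
    linear_combination -θ * h3
  · simp only [ex, ey]
    field_simp
    linear_combination (-θ * (y - x)) * h1 - θ * x * y * h3

lemma lam_of_moments {κ γ x y θ : ℝ} (hκ : 0 < κ) (hγ : 1 < γ) (hx : 0 < x) (hxy : x < y)
    (h0 : 0 < θ) (h1' : θ < 1) (z : St)
    (h : moments γ (x, y, θ) = (z.1, z.2.2.2 / κ, (z.1 * z.2.2.1 - z.2.1 ^ 2) / κ)) :
    z = lam κ γ x y ((z.2.1 - flux κ γ x y) / ((1 - θ) * x + θ * y)) θ := by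
  obtain ⟨ρ, m, q, P⟩ := z
  set s := (m - flux κ γ x y) / ((1 - θ) * x + θ * y) with hs
  have hy : 0 < y := hx.trans hxy
  have hρ : 0 < (1 - θ) * x + θ * y := by
    have : 0 < 1 - θ := by linarith
    positivity
  have hm : flux κ γ x y + s * ((1 - θ) * x + θ * y) = m := by rw [hs]; field_simp; ring
  have hl := moments_lam s θ hκ hγ hx hxy
  rw [h] at hl
  simp only [Prod.mk.injEq] at hl
  obtain ⟨a1, a2, a3⟩ := hl
  have b1 : (lam κ γ x y s θ).2.1 = m := by
    rw [← hm]; simp [lam, endpt, dir]; ring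
  have hρ' : 0 < ρ := by rw [a1, lam_fst]; exact hρ
  rw [div_left_inj' hκ.ne'] at a2 a3
  rw [← a1, b1] at a3
  refine Prod.ext a1 (Prod.ext b1.symm (Prod.ext ?_ a2))
  have : ρ * q = ρ * (lam κ γ x y s θ).2.2.1 := by linarith
  exact mul_left_cancel₀ hρ'.ne' this

lemma sinh_mul_gt {γ h : ℝ} (hγ : 1 < γ) (hh : 0 < h) : γ * sinh h < sinh (γ * h) := by
  have hd : ∀ x : ℝ, HasDerivAt (fun x => sinh (γ * x) - γ * sinh x)
      (cosh (γ * x) * γ - γ * cosh x) x := fun x => by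
    have h1 : HasDerivAt (fun x => γ * x) γ x := by simpa using (hasDerivAt_id x).const_mul γ
    exact h1.sinh.sub ((Real.hasDerivAt_sinh x).const_mul γ)
  have hm : StrictMonoOn (fun x => sinh (γ * x) - γ * sinh x) (Ici 0) := by
    refine strictMonoOn_of_deriv_pos (convex_Ici 0)
      (fun x _ => (hd x).continuousAt.continuousWithinAt) ?_
    intro x hx
    rw [interior_Ici] at hx
    rw [(hd x).deriv]
    have hx' : 0 < x := hx
    have : cosh x < cosh (γ * x) := by
      rw [Real.cosh_lt_cosh, abs_of_pos hx', abs_of_pos (by positivity)]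
      nlinarith
    nlinarith
  have := hm (show (0:ℝ) ∈ Ici 0 by simp) (show h ∈ Ici 0 from hh.le) hh
  simp at this
  linarith

lemma chord_gt_geometric {γ x y : ℝ} (hγ : 1 < γ) (hx : 0 < x) (hxy : x < y) :
    γ ^ 2 * (x ^ γ * y ^ γ) * (y - x) ^ 2 < (y ^ γ - x ^ γ) ^ 2 * (x * y) := by
  have hy : 0 < y := hx.trans hxy
  set a := (log x + log y) / 2
  set h := (log y - log x) / 2
  have hh : 0 < h := by
    have := Real.log_lt_log hx hxy
    simp only [h]; linarith
  have ex : x = rexp a * rexp (-h) := by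
    rw [← Real.exp_add, show a + -h = log x by simp only [a, h]; ring, Real.exp_log hx]
  have ey : y = rexp a * rexp h := by
    rw [← Real.exp_add, show a + h = log y by simp only [a, h]; ring, Real.exp_log hy]
  have exg : x ^ γ = rexp (γ * a) * rexp (-(γ * h)) := by
    rw [Real.rpow_def_of_pos hx, ← Real.exp_add]; congr 1; simp only [a, h]; ring
  have eyg : y ^ γ = rexp (γ * a) * rexp (γ * h) := by
    rw [Real.rpow_def_of_pos hy, ← Real.exp_add]; congr 1; simp only [a, h]; ring
  have d1 : y - x = rexp a * (2 * sinh h) := by rw [ex, ey, Real.sinh_eq]; ring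
  have d2 : y ^ γ - x ^ γ = rexp (γ * a) * (2 * sinh (γ * h)) := by
    rw [exg, eyg, Real.sinh_eq]; ring
  have p1 : x * y = rexp a ^ 2 := by
    have : rexp (-h) * rexp h = 1 := by rw [← Real.exp_add]; simp
    rw [ex, ey]; linear_combination (rexp a)^2 * this
  have p2 : x ^ γ * y ^ γ = rexp (γ * a) ^ 2 := by
    have : rexp (-(γ * h)) * rexp (γ * h) = 1 := by rw [← Real.exp_add]; simp
    rw [exg, eyg]; linear_combination (rexp (γ*a))^2 * this
  rw [d1, d2, p1, p2]
  have hs := sinh_mul_gt hγ hh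
  have hs0 : 0 < sinh h := Real.sinh_pos_iff.2 hh
  have : (γ * sinh h) ^ 2 < sinh (γ * h) ^ 2 := by
    apply pow_lt_pow_left₀ hs (by positivity) two_ne_zero
  have hp : 0 < 4 * rexp (γ * a) ^ 2 * rexp a ^ 2 := by positivity
  nlinarith [mul_lt_mul_of_pos_left this hp]

lemma moments_map_nhds {γ x y θ : ℝ} (hγ : 1 < γ) (hx : 0 < x) (hxy : x < y)
    (h0 : 0 < θ) (h1 : θ < 1) :
    map (moments γ) (𝓝 (x, y, θ)) = 𝓝 (moments γ (x, y, θ)) := by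
  have hy : 0 < y := hx.trans hxy
  set v : ℝ × ℝ × ℝ := (x, y, θ)
  have hX : HasStrictFDerivAt (fun v : ℝ × ℝ × ℝ => v.1) (ContinuousLinearMap.fst ℝ ℝ (ℝ × ℝ)) v :=
    hasStrictFDerivAt_fst
  have hY : HasStrictFDerivAt (fun v : ℝ × ℝ × ℝ => v.2.1)
      ((ContinuousLinearMap.fst ℝ ℝ ℝ).comp (ContinuousLinearMap.snd ℝ ℝ (ℝ × ℝ))) v :=
    hasStrictFDerivAt_fst.comp v hasStrictFDerivAt_snd
  have hT : HasStrictFDerivAt (fun v : ℝ × ℝ × ℝ => v.2.2)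
      ((ContinuousLinearMap.snd ℝ ℝ ℝ).comp (ContinuousLinearMap.snd ℝ ℝ (ℝ × ℝ))) v :=
    hasStrictFDerivAt_snd.comp v hasStrictFDerivAt_snd
  have hT' := (hasStrictFDerivAt_const (1:ℝ) v).sub hT
  have pw : ∀ e : ℝ, ∀ w : ℝ, 0 < w → HasStrictDerivAt (fun w : ℝ => w ^ e) (e * w ^ (e - 1)) w :=
    fun e w hw => by
      simpa using Real.hasStrictDerivAt_rpow_const_of_ne hw.ne' e
  have hd := ((hT'.mul hX).add (hT.mul hY)).prodMk
    (((hT'.mul ((pw γ x hx).comp_hasStrictFDerivAt v hX)).add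
      (hT.mul ((pw γ y hy).comp_hasStrictFDerivAt v hY))).prodMk
     ((hT'.mul ((pw (γ+1) x hx).comp_hasStrictFDerivAt v hX)).add
      (hT.mul ((pw (γ+1) y hy).comp_hasStrictFDerivAt v hY))))
  refine HasStrictFDerivAt.map_nhds_eq_of_surj hd ?_
  rw [LinearMap.range_eq_top]
  refine LinearMap.injective_iff_surjective.1 ?_
  rw [← LinearMap.ker_eq_bot, LinearMap.ker_eq_bot']
  rintro ⟨a, b, c⟩ hv
  have exg : x ^ γ = x ^ (γ - 1) * x := by
    rw [← Real.rpow_add_one hx.ne', sub_add_cancel]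
  have eyg : y ^ γ = y ^ (γ - 1) * y := by
    rw [← Real.rpow_add_one hy.ne', sub_add_cancel]
  have ex1 : x ^ (γ + 1) = x ^ γ * x := Real.rpow_add_one hx.ne' _
  have ey1 : y ^ (γ + 1) = y ^ γ * y := Real.rpow_add_one hy.ne' _
  simp [v, ex1, ey1] at hv
  rw [exg, eyg] at hv
  obtain ⟨e1, e2, e3⟩ := hv
  have hdet := chord_gt_geometric hγ hx hxy
  have hXY : x ^ (γ - 1) < y ^ (γ - 1) := Real.rpow_lt_rpow hx.le hxy (by linarith)
  rw [exg, eyg] at hdet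
  have h1t : (1 - θ) ≠ 0 := by linarith
  set X := x ^ (γ - 1)
  set Y := y ^ (γ - 1)
  have hc : c = 0 := by
    have : c * ((Y * y - X * x) ^ 2  - γ ^ 2 * (X * Y) * (y - x) ^ 2) = 0 := by
      linear_combination -(γ * (γ + 1) * X * Y * (y - x)) * e1 +
        (γ + 1) * (Y * y - X * x) * e2 - (γ * Y - γ * X) * e3
    rcases mul_eq_zero.1 this with h | h
    · exact h
    · nlinarith [mul_pos hx hy]
  subst hc
  have hA : a = 0 := by
    have : (1 - θ) * a * (γ * (Y - X)) = 0 := by linear_combination γ * Y * e1 - e2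
    have h2 : γ * (Y - X) ≠ 0 := by
      have : 0 < Y - X := by linarith
      positivity
    simpa [h1t, h2] using this
  subst hA
  have hB : b = 0 := by
    have : θ * b = 0 := by linear_combination e1
    simpa [h0.ne'] using this
  rw [hB]; rfl

lemma isOpen_lamSet {κ γ : ℝ} (hκ : 0 < κ) (hγ : 1 < γ) : IsOpen (lamSet κ γ) := by
  rw [isOpen_iff_mem_nhds]
  rintro ⟨z, c⟩ ⟨x, y, s, θ, hx, hxy, h0, h1, hz, hc⟩
  simp only at hz hc
  have hy : 0 < y := hx.trans hxy
  have hyx : y - x ≠ 0 := (sub_pos.2 hxy).ne'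
  let S : (ℝ × ℝ × ℝ) × (ℝ × ℝ) → ℝ := fun w =>
    (w.2.1 - flux κ γ w.1.1 w.1.2.1) / ((1 - w.1.2.2) * w.1.1 + w.1.2.2 * w.1.2.1)
  have hρ : 0 < (1 - θ) * x + θ * y := by
    have : 0 < 1 - θ := by linarith
    positivity
  have hS : S ((x, y, θ), (z.2.1, c)) = s := by
    have : z.2.1 = flux κ γ x y + s * ((1 - θ) * x + θ * y) := by
      rw [hz]; simp [lam, endpt, dir]; ring
    simp only [S, this]; field_simp; ring
  have hch : ContinuousAt (fun w : (ℝ × ℝ × ℝ) × (ℝ × ℝ) => chord κ γ w.1.1 w.1.2.1)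
      ((x, y, θ), (z.2.1, c)) := by
    unfold chord pres
    refine ContinuousAt.div (.sub (.mul continuousAt_const (.rpow_const (by fun_prop) (.inl hy.ne')))
      (.mul continuousAt_const (.rpow_const (by fun_prop) (.inl hx.ne')))) (by fun_prop) hyx
  have hSc : ContinuousAt S ((x, y, θ), (z.2.1, c)) := by
    refine ContinuousAt.div (.sub (by fun_prop) ?_) (by fun_prop) hρ.ne'
    unfold flux
    exact (ContinuousAt.mul (by fun_prop) hch).sqrt
  have hL : ContinuousAt (fun w : (ℝ × ℝ × ℝ) × (ℝ × ℝ) =>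
      w.1.2.2 * (1 - w.1.2.2) * lcost κ γ w.1.1 w.1.2.1 (S w)) ((x, y, θ), (z.2.1, c)) := by
    unfold lcost
    refine ContinuousAt.mul (by fun_prop) (.add (.mul continuousAt_const (.mul (by fun_prop)
      (.add (.add (.add continuousAt_const hSc.abs) (hSc.pow 2)) hch)))
      (.mul continuousAt_const (.div (by fun_prop) (by fun_prop) (by positivity))))
  have hev : ∀ᶠ w in 𝓝 (((x, y, θ), (z.2.1, c)) : (ℝ × ℝ × ℝ) × (ℝ × ℝ)),
      0 < w.1.1 ∧ w.1.1 < w.1.2.1 ∧ 0 < w.1.2.2 ∧ w.1.2.2 < 1 ∧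
      w.1.2.2 * (1 - w.1.2.2) * lcost κ γ w.1.1 w.1.2.1 (S w) < w.2.2 := by
    refine (ContinuousAt.eventually_lt (by fun_prop) (by fun_prop) hx).and
      ((ContinuousAt.eventually_lt (by fun_prop) (by fun_prop) hxy).and
      ((ContinuousAt.eventually_lt (by fun_prop) (by fun_prop) h0).and
      ((ContinuousAt.eventually_lt (by fun_prop) (by fun_prop) h1).and
      (ContinuousAt.eventually_lt hL (by fun_prop) ?_))))
    simpa only [hS] using hc
  have hmap : map (Prod.map (moments γ) id) (𝓝 (((x, y, θ), (z.2.1, c)) : (ℝ × ℝ × ℝ) × (ℝ × ℝ)))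
      = 𝓝 (moments γ (x, y, θ), (z.2.1, c)) := by
    rw [nhds_prod_eq, ← Filter.prod_map_map_eq', moments_map_nhds hγ hx hxy h0 h1, map_id,
      ← nhds_prod_eq]
  let f : St × ℝ → (ℝ × ℝ × ℝ) × (ℝ × ℝ) := fun w =>
    ((w.1.1, w.1.2.2.2 / κ, (w.1.1 * w.1.2.2.1 - w.1.2.1 ^ 2) / κ), (w.1.2.1, w.2))
  have hf : Tendsto f (𝓝 (z, c)) (𝓝 (moments γ (x, y, θ), (z.2.1, c))) := by
    have : f (z, c) = (moments γ (x, y, θ), (z.2.1, c)) := by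
      rw [moments_lam s θ hκ hγ hx hxy, ← hz]
    rw [← this]
    have : Continuous f := by simp only [f]; fun_prop
    exact this.tendsto _
  have him := image_mem_map (m := Prod.map (moments γ) id) hev
  rw [hmap] at him
  filter_upwards [hf him]
  rintro ⟨z', c'⟩ ⟨⟨⟨x', y', θ'⟩, ⟨m', d'⟩⟩, ⟨a1, a2, a3, a4, a5⟩, hw⟩
  simp only [f, Prod.map_apply, id_eq, Prod.mk.injEq] at hw
  obtain ⟨b1, rfl, rfl⟩ := hw
  have a6 := lam_of_moments hκ hγ a1 a2 a3 a4 z' b1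
  exact ⟨x', y', _, θ', a1, a2, a3, a4, a6, a5⟩

/-- Threshold for the third moment of a two-point law with mean one and `γ`-moment two. -/
def critMoment (γ : ℝ) : ℝ := ((2:ℝ) ^ (1 / (γ - 1))) ^ γ

lemma rpow_chord_unique {γ x x' y M : ℝ} (hγ : 1 < γ) (hx : 0 ≤ x) (hx' : 0 ≤ x') (hx1 : x ≤ 1)
    (hx1' : x' ≤ 1) (hy : 1 < y) (h : (y - 1) * x ^ γ + (1 - x) * y ^ γ = M * (y - x))
    (h' : (y - 1) * x' ^ γ + (1 - x') * y ^ γ = M * (y - x')) : x = x' := by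
  have key : ∀ w, w ≤ 1 → (y - 1) * w ^ γ + (1 - w) * y ^ γ = M * (y - w) →
      (w ^ γ - y ^ γ) / (w - y) = (y ^ γ - M) / (y - 1) := by
    intro w hw h
    rw [div_eq_div_iff (by linarith) (by linarith)]
    linear_combination h
  have e := (key x hx1 h).trans (key x' hx1' h').symm
  have hc := strictConvexOn_rpow hγ
  have hys : y ∈ Ici (0:ℝ) := by simp; linarith
  rcases lt_trichotomy x x' with hlt | heq | hgt
  · exact absurd e (hc.secant_strict_mono hys hx hx' (by linarith) (by linarith) hlt).ne
  · exact heq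
  · exact absurd e (hc.secant_strict_mono hys hx' hx (by linarith) (by linarith) hgt).ne'

lemma exists_two_point_law {γ B : ℝ} (hγ : 1 < γ) (hB : critMoment γ < B) :
    ∃ x y θ, 0 < x ∧ x < y ∧ 0 < θ ∧ θ < 1 ∧ moments γ (x, y, θ) = (1, 2, B) := by
  set Y : ℝ := (2:ℝ) ^ (1 / (γ - 1)) with hYd
  have hg1 : 0 < γ - 1 := by linarith
  have hY1 : 1 < Y := Real.one_lt_rpow (by norm_num) (by positivity)
  have hY2 : Y ^ (γ - 1) = 2 := by
    rw [hYd, ← Real.rpow_mul (by norm_num), one_div_mul_cancel hg1.ne', Real.rpow_one]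
  have hYB : Y < B := by
    refine lt_of_le_of_lt ?_ hB
    calc Y = Y ^ (1:ℝ) := (Real.rpow_one _).symm
      _ ≤ Y ^ γ := Real.rpow_le_rpow_of_exponent_le hY1.le hγ.le
  have cx : ∀ e : ℝ, 0 ≤ e → Continuous fun w : ℝ × ℝ => w.1 ^ e := fun e he =>
    continuous_fst.rpow_const fun _ => .inr he
  have cy : ∀ e : ℝ, 0 ≤ e → Continuous fun w : ℝ × ℝ => w.2 ^ e := fun e he =>
    continuous_snd.rpow_const fun _ => .inr he
  let A : ℝ → ℝ × ℝ → ℝ := fun e w => (w.2 - 1) * w.1 ^ e + (1 - w.1) * w.2 ^ e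
  have cA : ∀ e : ℝ, 0 ≤ e → Continuous (A e) := fun e he =>
    ((continuous_snd.sub continuous_const).mul (cx e he)).add
      ((continuous_const.sub continuous_fst).mul (cy e he))
  let G : Set (ℝ × ℝ) := {w | w ∈ Icc (0:ℝ) 1 ×ˢ Icc Y B ∧ A γ w = 2 * (w.2 - w.1)}
  have hG : IsCompact G := (isCompact_Icc.prod isCompact_Icc).inter_right
    (isClosed_eq (cA γ (by linarith)) (by fun_prop))
  let D : ℝ × ℝ → ℝ := fun w => A (γ + 1) w - B * (w.2 - w.1)
  have cD : Continuous D := (cA _ (by linarith)).sub (by fun_prop)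
  have hG1 : IsClosed (Prod.snd '' (G ∩ {w | D w ≤ 0})) :=
    ((hG.inter_right (isClosed_le cD continuous_const)).image continuous_snd).isClosed
  have hG2 : IsClosed (Prod.snd '' (G ∩ {w | 0 ≤ D w})) :=
    ((hG.inter_right (isClosed_le continuous_const cD)).image continuous_snd).isClosed
  have hex : ∀ y ∈ Icc Y B, ∃ x, (x, y) ∈ G := by
    intro y hy
    have hy1 : 1 < y := hY1.trans_le hy.1
    have hy0 : 0 < y := by linarith
    have hcont : ContinuousOn (fun x => A γ (x, y) - 2 * (y - x)) (Icc 0 1) :=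
      (((cA γ (by linarith)).comp (by fun_prop : Continuous fun x : ℝ => (x, y))).sub
        (by fun_prop)).continuousOn
    have h0 : 0 ≤ A γ (0, y) - 2 * (y - 0) := by
      have : 2 ≤ y ^ (γ - 1) := hY2 ▸ Real.rpow_le_rpow (by linarith) hy.1 hg1.le
      have e : y ^ γ = y ^ (γ - 1) * y := by rw [← Real.rpow_add_one hy0.ne', sub_add_cancel]
      simp only [A, Real.zero_rpow (by linarith : γ ≠ 0), e]
      nlinarith
    have h1 : A γ (1, y) - 2 * (y - 1) ≤ 0 := by
      simp only [A, Real.one_rpow]; linarith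
    obtain ⟨x, hx, hx'⟩ := intermediate_value_Icc' zero_le_one hcont ⟨h1, h0⟩
    exact ⟨x, ⟨hx, hy⟩, by simpa [sub_eq_zero] using hx'⟩
  have hcover : Icc Y B ⊆ Prod.snd '' (G ∩ {w | D w ≤ 0}) ∪ Prod.snd '' (G ∩ {w | 0 ≤ D w}) := by
    intro y hy
    obtain ⟨x, hx⟩ := hex y hy
    rcases le_total (D (x, y)) 0 with h | h
    · exact .inl ⟨_, ⟨hx, h⟩, rfl⟩
    · exact .inr ⟨_, ⟨hx, h⟩, rfl⟩
  have hYpow : Y ^ γ = 2 * Y := by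
    rw [← hY2, ← Real.rpow_add_one (by linarith), sub_add_cancel]
  have hleft : (Icc Y B ∩ Prod.snd '' (G ∩ {w | D w ≤ 0})).Nonempty := by
    refine ⟨Y, ⟨le_rfl, hYB.le⟩, (0, Y), ⟨⟨⟨⟨le_rfl, zero_le_one⟩, ⟨le_rfl, hYB.le⟩⟩, ?_⟩, ?_⟩, rfl⟩
    · simp [A, Real.zero_rpow (by linarith : γ ≠ 0), hYpow]
    · have : Y ^ γ < B := hB
      simp only [mem_ofPred_eq, D, A, Real.zero_rpow (by linarith : γ + 1 ≠ 0),
        Real.rpow_add_one (by linarith : Y ≠ 0)]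
      nlinarith
  have hright : (Icc Y B ∩ Prod.snd '' (G ∩ {w | 0 ≤ D w})).Nonempty := by
    obtain ⟨x, hx⟩ := hex B ⟨hYB.le, le_rfl⟩
    refine ⟨B, ⟨hYB.le, le_rfl⟩, (x, B), ⟨hx, ?_⟩, rfl⟩
    obtain ⟨⟨⟨x0, x1⟩, -⟩, h⟩ := hx
    simp only at x0 x1
    have hB1 : 1 < B := hY1.trans hYB
    have hxp : x ^ γ ≤ 1 := Real.rpow_le_one x0 x1 (by linarith)
    have hxp1 : 0 ≤ x ^ (γ + 1) := Real.rpow_nonneg x0 _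
    simp only [mem_ofPred_eq, D, A, Real.rpow_add_one (by linarith : B ≠ 0)] at h ⊢
    have : (B - x) ≤ (1 - x) * B ^ γ := by nlinarith
    nlinarith
  obtain ⟨y, hy, ⟨⟨x₁, y₁⟩, ⟨g₁, d₁⟩, e₁⟩, ⟨⟨x₂, y₂⟩, ⟨g₂, d₂⟩, e₂⟩⟩ :=
    (isPreconnected_closed_iff.1 isPreconnected_Icc) _ _ hG1 hG2 hcover hleft hright
  simp only at e₁ e₂
  subst e₁ e₂
  have hy1 : 1 < y₂ := hY1.trans_le hy.1
  obtain rfl : x₁ = x₂ := rpow_chord_unique hγ g₁.1.1.1 g₂.1.1.1 g₁.1.1.2 g₂.1.1.2 hy1 g₁.2 g₂.2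
  have hD : D (x₁, y₂) = 0 := le_antisymm d₁ d₂
  obtain ⟨⟨⟨x0, x1⟩, -⟩, h⟩ := g₁
  simp only [A, D] at x0 x1 h hD
  have hx0 : 0 < x₁ := by
    rcases x0.lt_or_eq with h0 | rfl
    · exact h0
    exfalso
    simp only [Real.zero_rpow (by linarith : γ ≠ 0), Real.zero_rpow (by linarith : γ + 1 ≠ 0),
      Real.rpow_add_one (by linarith : y₂ ≠ 0)] at h hD
    have hyY : y₂ = Y := by
      have e : y₂ ^ γ = y₂ ^ (γ - 1) * y₂ := by
        rw [← Real.rpow_add_one (by linarith), sub_add_cancel]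
      rw [e] at h
      have : y₂ ^ (γ - 1) = 2 := by
        apply mul_right_cancel₀ (by linarith : y₂ ≠ 0); linarith
      rw [← hY2] at this
      exact (Real.rpow_left_inj (by linarith) (by linarith) hg1.ne').1 this
    have : Y ^ γ < B := hB
    rw [hyY] at hD h
    nlinarith
  have hx1 : x₁ < 1 := by
    rcases x1.lt_or_eq with h0 | rfl
    · exact h0
    simp at h; linarith
  have hyx : 0 < y₂ - x₁ := by linarith
  refine ⟨x₁, y₂, (1 - x₁) / (y₂ - x₁), hx0, by linarith, by apply div_pos <;> linarith,
    by rw [div_lt_one hyx]; linarith, ?_⟩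
  have e1 : 1 - (1 - x₁) / (y₂ - x₁) = (y₂ - 1) / (y₂ - x₁) := by field_simp; ring
  simp only [moments, e1, Prod.mk.injEq]
  refine ⟨by field_simp; ring, ?_, ?_⟩
  · field_simp; linarith
  · field_simp; linarith

lemma exists_mem_lamSet {κ γ : ℝ} (hκ : 0 < κ) (hγ : 1 < γ) {z : St} (hρ : 0 < z.1)
    (hP : z.2.2.2 = 2 * pres κ γ z.1)
    (hq : critMoment γ * pres κ γ z.1 * z.1 < z.1 * z.2.2.1 - z.2.1 ^ 2) :
    ∃ c, (z, c) ∈ lamSet κ γ := by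
  obtain ⟨ρ, m, q, P⟩ := z
  simp only [pres] at *
  have hpg : 0 < ρ ^ γ := Real.rpow_pos_of_pos hρ _
  obtain ⟨x, y, θ, hx, hxy, h0, h1, hm⟩ := exists_two_point_law (B := (ρ * q - m ^ 2) / (κ * ρ ^ γ * ρ))
    hγ (by rw [lt_div_iff₀ (by positivity)]; linarith)
  simp only [moments, Prod.mk.injEq] at hm
  obtain ⟨m1, m2, m3⟩ := hm
  have hy : 0 < y := hx.trans hxy
  have := lam_of_moments hκ hγ (x := ρ * x) (y := ρ * y) (by positivity)
    (by gcongr) h0 h1 (ρ, m, q, P) (by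
      simp only [moments, Prod.mk.injEq, Real.mul_rpow hρ.le hx.le, Real.mul_rpow hρ.le hy.le,
        Real.rpow_add_one hρ.ne']
      refine ⟨by linear_combination ρ * m1, ?_, ?_⟩
      · rw [hP]; field_simp; linear_combination m2
      · field_simp at m3 ⊢
        linear_combination m3)
  exact ⟨_, _, _, _, θ, by positivity, by gcongr, h0, h1, this, lt_add_one _⟩

/-- Time derivative of a function of `(t, r)`. -/
def dt (F : ℝ × ℝ → ℝ) (x : ℝ × ℝ) : ℝ := fderiv ℝ F x (1, 0)

/-- Radial derivative of a function of `(t, r)`. -/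
def dr (F : ℝ × ℝ → ℝ) (x : ℝ × ℝ) : ℝ := fderiv ℝ F x (0, 1)

lemma exists_periodic_primitive {g : ℝ → ℝ} (hg : Continuous g) (hp : Periodic g 1)
    (h0 : ∫ x in (0:ℝ)..1, g x = 0) :
    ∃ H : ℝ → ℝ, (∀ x, HasDerivAt H (g x) x) ∧ Periodic H 1 ∧ ∫ x in (0:ℝ)..1, H x = 0 := by
  let G : ℝ → ℝ := fun x => ∫ y in (0:ℝ)..x, g y
  have hG : ∀ x, HasDerivAt G (g x) x := fun x =>
    intervalIntegral.integral_hasDerivAt_right (hg.intervalIntegrable _ _)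
      (hg.stronglyMeasurableAtFilter _ _) hg.continuousAt
  have hGc : Continuous G := continuous_iff_continuousAt.2 fun x => (hG x).continuousAt
  have hGp : Periodic G 1 := fun x => by
    have h1 := hp.intervalIntegral_add_eq x 0
    rw [zero_add, h0] at h1
    simp only [G]
    rw [← intervalIntegral.integral_add_adjacent_intervals (hg.intervalIntegrable 0 x)
      (hg.intervalIntegrable x (x + 1)), h1, add_zero]
  refine ⟨fun x => G x - ∫ y in (0:ℝ)..1, G y, fun x => (hG x).sub_const _, fun x => ?_, ?_⟩
  · simp only [hGp x]
  · rw [intervalIntegral.integral_sub (hGc.intervalIntegrable _ _)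
      (continuous_const.intervalIntegrable _ _)]
    simp

lemma exists_bounded_primitives {g : ℝ → ℝ} (hg : Continuous g) (hp : Periodic g 1)
    (h0 : ∫ x in (0:ℝ)..1, g x = 0) :
    ∃ (H₁ H₂ : ℝ → ℝ) (C : ℝ), (∀ x, HasDerivAt H₁ (g x) x) ∧ (∀ x, HasDerivAt H₂ (H₁ x) x) ∧
      (∀ x, |H₁ x| ≤ C) ∧ ∀ x, |H₂ x| ≤ C := by
  obtain ⟨H₁, d1, p1, i1⟩ := exists_periodic_primitive hg hp h0
  have c1 : Continuous H₁ := continuous_iff_continuousAt.2 fun x => (d1 x).continuousAt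
  obtain ⟨H₂, d2, p2, -⟩ := exists_periodic_primitive c1 p1 i1
  have c2 : Continuous H₂ := continuous_iff_continuousAt.2 fun x => (d2 x).continuousAt
  obtain ⟨C1, hC1⟩ := (p1.isBounded_of_continuous one_ne_zero c1).exists_norm_le
  obtain ⟨C2, hC2⟩ := (p2.isBounded_of_continuous one_ne_zero c2).exists_norm_le
  exact ⟨H₁, H₂, max C1 C2, d1, d2, fun x => (hC1 _ ⟨x, rfl⟩).trans (le_max_left _ _),
    fun x => (hC2 _ ⟨x, rfl⟩).trans (le_max_right _ _)⟩

/-- A modulated travelling wave. -/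
def wave (h f k : ℝ → ℝ) (l s : ℝ) (x : ℝ × ℝ) : ℝ := h (l * (x.2 - s * x.1)) * f x.1 * k x.2

lemma hasFDerivAt_wave {h h' f f' k k' : ℝ → ℝ} (l s : ℝ) (hh : ∀ x, HasDerivAt h (h' x) x)
    (hf : ∀ x, HasDerivAt f (f' x) x) (hk : ∀ x, HasDerivAt k (k' x) x) (x : ℝ × ℝ) :
    HasFDerivAt (wave h f k l s)
      ((-(s * l) * wave h' f k l s x + wave h f' k l s x) • ContinuousLinearMap.fst ℝ ℝ ℝ +
        (l * wave h' f k l s x + wave h f k' l s x) • ContinuousLinearMap.snd ℝ ℝ ℝ) x := by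
  have hu : HasFDerivAt (fun x : ℝ × ℝ => l * (x.2 - s * x.1))
      (l • (ContinuousLinearMap.snd ℝ ℝ ℝ - s • ContinuousLinearMap.fst ℝ ℝ ℝ)) x :=
    (hasFDerivAt_snd.sub (hasFDerivAt_fst.const_mul s)).const_mul l
  have := (((hh _).comp_hasFDerivAt x hu).mul ((hf _).comp_hasFDerivAt x hasFDerivAt_fst)).mul
    ((hk _).comp_hasFDerivAt x hasFDerivAt_snd)
  refine HasFDerivAt.congr_fderiv this ?_
  ext <;> simp [wave] <;> ring

lemma contDiff_wave {h h' f k : ℝ → ℝ} (l s : ℝ) (hh : ∀ x, HasDerivAt h (h' x) x)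
    (hc : Continuous h') (hf : ContDiff ℝ 1 f) (hk : ContDiff ℝ 1 k) :
    ContDiff ℝ 1 (wave h f k l s) := by
  have : ContDiff ℝ 1 h := by
    rw [contDiff_one_iff_deriv]
    refine ⟨fun x => (hh x).differentiableAt, ?_⟩
    rwa [show deriv h = h' from funext fun x => (hh x).deriv]
  unfold wave
  fun_prop

lemma tsupport_wave_subset (h f k : ℝ → ℝ) (l s : ℝ) :
    tsupport (wave h f k l s) ⊆ tsupport f ×ˢ tsupport k := by
  refine closure_minimal ?_ ((isClosed_tsupport _).prod (isClosed_tsupport _))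
  intro x hx
  simp only [wave, mem_support, ne_eq, mul_eq_zero, not_or] at hx
  exact ⟨subset_tsupport _ hx.1.2, subset_tsupport _ hx.2⟩

/-- Perturbation of the state generated by potentials. -/
def pert (α β : ℝ → ℝ) (X Y S : ℝ × ℝ → ℝ) (x : ℝ × ℝ) : St :=
  (dr X x / α x.2, -dt X x / α x.2, (dt Y x + S x) / α x.2, dr S x / β x.2)

/-- Potentials of size at most `ε`, supported in `Q`, generating a perturbation. -/
structure Potentials (Q : Set (ℝ × ℝ)) (ε : ℝ) (X Y S Z : ℝ × ℝ → ℝ) : Prop where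
  smoothX : ContDiff ℝ 1 X
  smoothY : ContDiff ℝ 1 Y
  smoothS : ContDiff ℝ 1 S
  smoothZ : ContDiff ℝ 1 Z
  suppX : tsupport X ⊆ Q
  suppY : tsupport Y ⊆ Q
  suppS : tsupport S ⊆ Q
  suppZ : tsupport Z ⊆ Q
  compat : ∀ x, dt X x = dr Y x
  leX : ∀ x, |X x| ≤ ε
  leY : ∀ x, |Y x| ≤ ε
  leS : ∀ x, |S x| ≤ ε
  leZ : ∀ x, |Z x| ≤ ε
  leRem : ∀ x, |dt Y x + S x - dr Z x| ≤ ε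

lemma exists_bound_div {w α : ℝ → ℝ} {K : Set ℝ} (hK : IsCompact K) (hw : Continuous w)
    (hα : Continuous α) (hα0 : ∀ r ∈ K, α r ≠ 0) (h0 : ∀ r, r ∉ K → w r = 0) :
    ∃ C, ∀ r, |w r / α r| ≤ C := by
  obtain ⟨C, hC⟩ := hK.exists_bound_of_continuousOn (hw.continuousOn.div hα.continuousOn hα0)
  refine ⟨max C 0, fun r => ?_⟩
  by_cases hr : r ∈ K
  · exact (hC r hr).trans (le_max_left _ _)
  · simp [h0 r hr]

lemma abs_mul_three_le {a b c A : ℝ} (ha : |a| ≤ A) (hb : |b| ≤ A) (hc : |c| ≤ A) :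
    |a * b * c| ≤ A ^ 3 := by
  rw [abs_mul, abs_mul, pow_three']
  have : 0 ≤ A := (abs_nonneg a).trans ha
  gcongr

lemma abs_wave_le {h f k : ℝ → ℝ} {l s A : ℝ} (ha : ∀ x, |h x| ≤ A) (hb : ∀ x, |f x| ≤ A)
    (hc : ∀ x, |k x| ≤ A) (x : ℝ × ℝ) : |wave h f k l s x| ≤ A ^ 3 :=
  abs_mul_three_le (ha _) (hb _) (hc _)

lemma wave_div (h f k : ℝ → ℝ) (l s : ℝ) (α : ℝ → ℝ) (x : ℝ × ℝ) :
    wave h f k l s x / α x.2 = wave h f (fun r => k r / α r) l s x := by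
  simp only [wave]; ring

lemma Potentials.mono {Q Q' : Set (ℝ × ℝ)} {ε ε' : ℝ} {X Y S Z : ℝ × ℝ → ℝ}
    (h : Potentials Q ε X Y S Z) (hQ : Q ⊆ Q') (hε : ε ≤ ε') : Potentials Q' ε' X Y S Z where
  smoothX := h.smoothX
  smoothY := h.smoothY
  smoothS := h.smoothS
  smoothZ := h.smoothZ
  suppX := h.suppX.trans hQ
  suppY := h.suppY.trans hQ
  suppS := h.suppS.trans hQ
  suppZ := h.suppZ.trans hQ
  compat := h.compat
  leX x := (h.leX x).trans hε
  leY x := (h.leY x).trans hε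
  leS x := (h.leS x).trans hε
  leZ x := (h.leZ x).trans hε
  leRem x := (h.leRem x).trans hε

lemma fderiv_eq_zero_of_notMem {F : ℝ × ℝ → ℝ} {Q : Set (ℝ × ℝ)} (h : tsupport F ⊆ Q) {x : ℝ × ℝ}
    (hx : x ∉ Q) : fderiv ℝ F x = 0 :=
  notMem_support.1 fun h' => hx (h (support_fderiv_subset ℝ h'))

lemma Potentials.pert_eq_zero {Q : Set (ℝ × ℝ)} {ε : ℝ} {X Y S Z : ℝ × ℝ → ℝ}
    (h : Potentials Q ε X Y S Z) (α β : ℝ → ℝ) {x : ℝ × ℝ} (hx : x ∉ Q) :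
    pert α β X Y S x = 0 := by
  have hS : S x = 0 := image_eq_zero_of_notMem_tsupport fun h' => hx (h.suppS h')
  simp [pert, dt, dr, fderiv_eq_zero_of_notMem h.suppX hx, fderiv_eq_zero_of_notMem h.suppY hx,
    fderiv_eq_zero_of_notMem h.suppS hx, hS]

lemma tsupport_lincomb_subset {F G : ℝ × ℝ → ℝ} {Q : Set (ℝ × ℝ)} (a b : ℝ) (hF : tsupport F ⊆ Q)
    (hG : tsupport G ⊆ Q) : tsupport (fun x => a * F x + b * G x) ⊆ Q := by
  refine (closure_minimal ?_ ((isClosed_tsupport F).union (isClosed_tsupport G))).trans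
    (union_subset hF hG)
  intro x hx
  by_contra h
  rw [mem_union, not_or] at h
  exact hx (by simp [image_eq_zero_of_notMem_tsupport h.1, image_eq_zero_of_notMem_tsupport h.2])

lemma abs_sub_le_of_lincomb {l a b A B D : ℝ} (hl : 1 ≤ l) (ha : |a| ≤ A) (hb : |b| ≤ B)
    (hD : A + B ≤ D) : |l⁻¹ * a + (l ^ 2)⁻¹ * b| ≤ D / l := by
  have h1 : (l ^ 2)⁻¹ ≤ l⁻¹ := by
    apply inv_anti₀ (by linarith); nlinarith
  have h2 : 0 < l⁻¹ := by positivity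
  have h3 : 0 ≤ (l ^ 2)⁻¹ := by positivity
  calc |l⁻¹ * a + (l ^ 2)⁻¹ * b| ≤ |l⁻¹ * a| + |(l ^ 2)⁻¹ * b| := abs_add_le _ _
    _ = l⁻¹ * |a| + (l ^ 2)⁻¹ * |b| := by rw [abs_mul, abs_mul, abs_of_pos h2, abs_of_nonneg h3]
    _ ≤ l⁻¹ * A + l⁻¹ * B := by gcongr
    _ ≤ D / l := by rw [div_eq_inv_mul, ← mul_add]; gcongr

set_option maxHeartbeats 1000000 in
lemma exists_atom {α β g f k : ℝ → ℝ} (s b : ℝ) (hα : ContDiff ℝ ∞ α) (hβ : ContDiff ℝ ∞ β)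
    (hα0 : ∀ r, 0 < r → 0 < α r) (hβ0 : ∀ r, 0 < r → 0 < β r)
    (hg : Continuous g) (hp : Periodic g 1) (h0 : ∫ x in (0:ℝ)..1, g x = 0)
    (hf : ContDiff ℝ ∞ f) (hk : ContDiff ℝ ∞ k) (hfs : HasCompactSupport f)
    (hks : HasCompactSupport k) (hk0 : tsupport k ⊆ Ioi 0) :
    ∃ C, ∀ l, 1 ≤ l → ∃ X Y S Z, Potentials (tsupport f ×ˢ tsupport k) (C / l) X Y S Z ∧
      ∀ x : ℝ × ℝ, ‖pert α β X Y S x - (g (l * (x.2 - s * x.1)) * f x.1 * k x.2) • dir s b‖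
        ≤ C / l := by
  obtain ⟨H₁, H₂, C₀, d1, d2, b1, b2⟩ := exists_bounded_primitives hg hp h0
  have c1 : Continuous H₁ := continuous_iff_continuousAt.2 fun x => (d1 x).continuousAt
  have deriv_data : ∀ w v : ℝ → ℝ, ContDiff ℝ ∞ w → tsupport w ⊆ tsupport v →
      ∃ w' : ℝ → ℝ, (∀ x, HasDerivAt w (w' x) x) ∧ ContDiff ℝ ∞ w' ∧ tsupport w' ⊆ tsupport v :=
    fun w v hw ht => ⟨deriv w, fun x => (hw.differentiable (by simp) x).hasDerivAt,
      (contDiff_infty_iff_deriv.1 hw).2, tsupport_deriv_subset.trans ht⟩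
  set K : ℝ → ℝ := fun r => α r * k r with hK
  set J : ℝ → ℝ := fun r => b * (β r * k r) with hJ
  have sK : ContDiff ℝ ∞ K := hα.mul hk
  have sJ : ContDiff ℝ ∞ J := contDiff_const.mul (hβ.mul hk)
  have tK : tsupport K ⊆ tsupport k := tsupport_mul_subset_right
  have tJ : tsupport J ⊆ tsupport k :=
    (tsupport_mul_subset_right (f := fun _ => b) (g := fun r => β r * k r)).trans
      tsupport_mul_subset_right
  have bdk : ∀ w : ℝ → ℝ, ContDiff ℝ ∞ w → tsupport w ⊆ tsupport k →
      ∃ C, (∀ r, |w r| ≤ C) ∧ (∀ r, |w r / α r| ≤ C) ∧ ∀ r, |w r / β r| ≤ C := by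
    intro w hw ht
    have hz : ∀ r, r ∉ tsupport k → w r = 0 := fun r hr =>
      image_eq_zero_of_notMem_tsupport fun h => hr (ht h)
    obtain ⟨A, hA⟩ := exists_bound_div (α := fun _ => 1) hks hw.continuous continuous_const
      (fun _ _ => one_ne_zero) hz
    obtain ⟨B, hB⟩ := exists_bound_div hks hw.continuous hα.continuous
      (fun r hr => (hα0 r (hk0 hr)).ne') hz
    obtain ⟨D, hD⟩ := exists_bound_div hks hw.continuous hβ.continuous
      (fun r hr => (hβ0 r (hk0 hr)).ne') hz
    exact ⟨max A (max B D), fun r => (by simpa using hA r : |w r| ≤ A).trans (le_max_left _ _),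
      fun r => (hB r).trans (by simp), fun r => (hD r).trans (by simp)⟩
  have bdf : ∀ w : ℝ → ℝ, ContDiff ℝ ∞ w → tsupport w ⊆ tsupport f → ∃ C, ∀ r, |w r| ≤ C := by
    intro w hw ht
    obtain ⟨A, hA⟩ := exists_bound_div (α := fun _ => 1) hfs hw.continuous continuous_const
      (fun _ _ => one_ne_zero) (fun r hr => image_eq_zero_of_notMem_tsupport fun h => hr (ht h))
    exact ⟨A, fun r => by simpa using hA r⟩
  obtain ⟨f', hf', sf', tf'⟩ := deriv_data f f hf subset_rfl
  obtain ⟨f'', hf'', sf'', tf''⟩ := deriv_data f' f sf' tf'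
  obtain ⟨K', hK', sK', tK'⟩ := deriv_data K k sK tK
  obtain ⟨K'', hK'', sK'', tK''⟩ := deriv_data K' k sK' tK'
  obtain ⟨J', hJ', sJ', tJ'⟩ := deriv_data J k sJ tJ
  obtain ⟨C₁, a1⟩ := bdf f hf subset_rfl
  obtain ⟨C₂, a2⟩ := bdf f' sf' tf'
  obtain ⟨C₃, a3⟩ := bdf f'' sf'' tf''
  obtain ⟨C₄, a4, a4', -⟩ := bdk K sK tK
  obtain ⟨C₅, a5, a5', -⟩ := bdk K' sK' tK'
  obtain ⟨C₆, a6, a6', -⟩ := bdk K'' sK'' tK''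
  obtain ⟨C₇, a7, a7', -⟩ := bdk J sJ tJ
  obtain ⟨C₈, -, -, a8⟩ := bdk J' sJ' tJ'
  obtain ⟨A, hA⟩ : ∃ A, ∀ C ∈ ({C₀, C₁, C₂, C₃, C₄, C₅, C₆, C₇, C₈} : Set ℝ), C ≤ A :=
    (Set.toFinite ({C₀, C₁, C₂, C₃, C₄, C₅, C₆, C₇, C₈} : Set ℝ)).bddAbove
  simp only [mem_insert_iff, mem_singleton_iff, forall_eq_or_imp, forall_eq] at hA
  obtain ⟨u0, u1, u2, u3, u4, u5, u6, u7, u8⟩ := hA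
  replace b1 := fun x => (b1 x).trans u0
  replace b2 := fun x => (b2 x).trans u0
  replace a1 := fun x => (a1 x).trans u1
  replace a2 := fun x => (a2 x).trans u2
  replace a3 := fun x => (a3 x).trans u3
  replace a4 := fun x => (a4 x).trans u4
  replace a4' := fun x => (a4' x).trans u4
  replace a5 := fun x => (a5 x).trans u5
  replace a5' := fun x => (a5' x).trans u5
  replace a6' := fun x => (a6' x).trans u6
  replace a7 := fun x => (a7 x).trans u7
  replace a7' := fun x => (a7' x).trans u7
  replace a8 := fun x => (a8 x).trans u8
  have hA0 : 0 ≤ A := (abs_nonneg _).trans (b1 0)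
  set M := 1 + |s| + s ^ 2 with hM
  have hs0 := abs_nonneg s
  have hs2 := sq_nonneg s
  have hM1 : 1 ≤ M := by linarith
  set T := A ^ 3 with hT
  have hT0 : 0 ≤ T := by positivity
  refine ⟨6 * M * T, fun l hl => ?_⟩
  have hl0 : 0 < l := by linarith
  have hlne : l ≠ 0 := hl0.ne'
  have one_le : (1 : WithTop ℕ∞) ≤ ∞ := by exact_mod_cast le_top
  -- the elementary waves
  have w1 := hasFDerivAt_wave l s d1 hf' hK'
  have w2 := hasFDerivAt_wave l s d2 hf' hK''
  have w3 := hasFDerivAt_wave l s d2 hf'' hK'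
  have w4 := hasFDerivAt_wave l s d1 hf' hJ'
  have v1 := contDiff_wave l s d1 hg (hf.of_le one_le) (sK.of_le one_le)
  have v2 := contDiff_wave l s d2 c1 (hf.of_le one_le) (sK'.of_le one_le)
  have v3 := contDiff_wave l s d2 c1 (sf'.of_le one_le) (sK.of_le one_le)
  have v4 := contDiff_wave l s d1 hg (hf.of_le one_le) (sJ.of_le one_le)
  have t1 : tsupport (wave H₁ f K l s) ⊆ tsupport f ×ˢ tsupport k :=
    (tsupport_wave_subset _ _ _ _ _).trans (prod_mono subset_rfl tK)
  have t2 : tsupport (wave H₂ f K' l s) ⊆ tsupport f ×ˢ tsupport k :=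
    (tsupport_wave_subset _ _ _ _ _).trans (prod_mono subset_rfl tK')
  have t3 : tsupport (wave H₂ f' K l s) ⊆ tsupport f ×ˢ tsupport k :=
    (tsupport_wave_subset _ _ _ _ _).trans (prod_mono tf' tK)
  have t4 : tsupport (wave H₁ f J l s) ⊆ tsupport f ×ˢ tsupport k :=
    (tsupport_wave_subset _ _ _ _ _).trans (prod_mono subset_rfl tJ)
  let X : ℝ × ℝ → ℝ := fun x => l⁻¹ * wave H₁ f K l s x + (l ^ 2)⁻¹ * wave H₂ f K' l s x
  let Y : ℝ × ℝ → ℝ := fun x => (-(s * l⁻¹)) * wave H₁ f K l s x + (l ^ 2)⁻¹ * wave H₂ f' K l s x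
  let S : ℝ × ℝ → ℝ := fun x => l⁻¹ * wave H₁ f J l s x + 0 * wave H₁ f J l s x
  let Z : ℝ × ℝ → ℝ := fun x => (s ^ 2 * l⁻¹) * wave H₁ f K l s x + 0 * wave H₁ f K l s x
  have fX := fun x => ((w1 x).const_mul l⁻¹).add ((w2 x).const_mul (l ^ 2)⁻¹)
  have fY := fun x => ((w1 x).const_mul (-(s * l⁻¹))).add ((w3 x).const_mul (l ^ 2)⁻¹)
  have fS := fun x => ((w4 x).const_mul l⁻¹).add ((w4 x).const_mul 0)
  have fZ := fun x => ((w1 x).const_mul (s ^ 2 * l⁻¹)).add ((w1 x).const_mul 0)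
  have eXr : ∀ x, dr X x = wave g f K l s x +
      (l⁻¹ * (2 * wave H₁ f K' l s x) + (l ^ 2)⁻¹ * wave H₂ f K'' l s x) := fun x => by
    rw [dr, HasFDerivAt.fderiv (f := X) (fX x)]; simp; field_simp; ring
  have eXt : ∀ x, dt X x = -s * wave g f K l s x +
      (l⁻¹ * (wave H₁ f' K l s x - s * wave H₁ f K' l s x) + (l ^ 2)⁻¹ * wave H₂ f' K' l s x) :=
    fun x => by
    rw [dt, HasFDerivAt.fderiv (f := X) (fX x)]; simp; field_simp; ring
  have eYr : ∀ x, dr Y x = -s * wave g f K l s x +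
      (l⁻¹ * (wave H₁ f' K l s x - s * wave H₁ f K' l s x) + (l ^ 2)⁻¹ * wave H₂ f' K' l s x) :=
    fun x => by
    rw [dr, HasFDerivAt.fderiv (f := Y) (fY x)]; simp; field_simp; ring
  have eYt : ∀ x, dt Y x = s ^ 2 * wave g f K l s x +
      (l⁻¹ * (-2 * s * wave H₁ f' K l s x) + (l ^ 2)⁻¹ * wave H₂ f'' K l s x) := fun x => by
    rw [dt, HasFDerivAt.fderiv (f := Y) (fY x)]; simp; field_simp; ring
  have eSr : ∀ x, dr S x = wave g f J l s x + l⁻¹ * wave H₁ f J' l s x := fun x => by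
    rw [dr, HasFDerivAt.fderiv (f := S) (fS x)]; simp; field_simp
  have eZr : ∀ x, dr Z x = s ^ 2 * wave g f K l s x + l⁻¹ * (s ^ 2 * wave H₁ f K' l s x) :=
    fun x => by
    rw [dr, HasFDerivAt.fderiv (f := Z) (fZ x)]; simp; field_simp
  have hD : 6 * M * T = 6 * T + 6 * (|s| * T) + 6 * (s ^ 2 * T) := by rw [hM]; ring
  have hsT : 0 ≤ |s| * T := by positivity
  have hs2T : 0 ≤ s ^ 2 * T := by positivity
  have z0 : |(0:ℝ)| ≤ 0 := abs_zero.le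
  have habs : ∀ w, |w| ≤ T → |s * w| ≤ |s| * T := fun w hw => by rw [abs_mul]; gcongr
  have habs2 : ∀ w, |w| ≤ T → |s ^ 2 * w| ≤ s ^ 2 * T := fun w hw => by
    rw [abs_mul, abs_of_nonneg hs2]; exact mul_le_mul_of_nonneg_left hw hs2
  refine ⟨X, Y, S, Z, ⟨?_, ?_, ?_, ?_, ?_, ?_, ?_, ?_, fun x => (eXt x).trans (eYr x).symm,
    fun x => ?_, fun x => ?_, fun x => ?_, fun x => ?_, fun x => ?_⟩, fun x => ?_⟩
  · exact (contDiff_const.mul v1).add (contDiff_const.mul v2)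
  · exact (contDiff_const.mul v1).add (contDiff_const.mul v3)
  · exact (contDiff_const.mul v4).add (contDiff_const.mul v4)
  · exact (contDiff_const.mul v1).add (contDiff_const.mul v1)
  · exact tsupport_lincomb_subset _ _ t1 t2
  · exact tsupport_lincomb_subset _ _ t1 t3
  · exact tsupport_lincomb_subset _ _ t4 t4
  · exact tsupport_lincomb_subset _ _ t1 t1
  · exact abs_sub_le_of_lincomb hl (abs_wave_le b1 a1 a4 x) (abs_wave_le b2 a1 a5 x) (by linarith)
  · have : Y x = l⁻¹ * (-(s * wave H₁ f K l s x)) + (l ^ 2)⁻¹ * wave H₂ f' K l s x := by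
      simp only [Y]; ring
    rw [this]
    exact abs_sub_le_of_lincomb (A := |s| * T) hl (by rw [abs_neg]; exact habs _ (abs_wave_le b1 a1 a4 x))
      (abs_wave_le b2 a2 a4 x) (by linarith)
  · have : S x = l⁻¹ * wave H₁ f J l s x + (l ^ 2)⁻¹ * 0 := by simp only [S]; ring
    rw [this]
    exact abs_sub_le_of_lincomb hl (abs_wave_le b1 a1 a7 x) z0 (by linarith)
  · have : Z x = l⁻¹ * (s ^ 2 * wave H₁ f K l s x) + (l ^ 2)⁻¹ * 0 := by simp only [Z]; ring
    rw [this]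
    exact abs_sub_le_of_lincomb hl (habs2 _ (abs_wave_le b1 a1 a4 x)) z0 (by linarith)
  · have : dt Y x + S x - dr Z x = l⁻¹ * ((-2 * (s * wave H₁ f' K l s x) + wave H₁ f J l s x)
        - s ^ 2 * wave H₁ f K' l s x) + (l ^ 2)⁻¹ * wave H₂ f'' K l s x := by
      rw [eYt, eZr]; simp only [S]; ring
    rw [this]
    have q1 := habs _ (abs_wave_le (l := l) (s := s) b1 a2 a4 x)
    have q2 := habs2 _ (abs_wave_le (l := l) (s := s) b1 a1 a5 x)
    have q3 := abs_wave_le (l := l) (s := s) b1 a1 a7 x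
    refine abs_sub_le_of_lincomb (A := 2 * (|s| * T) + T + s ^ 2 * T) hl ?_
      (abs_wave_le b2 a3 a4 x) (by linarith)
    rw [abs_le] at *
    constructor <;> linarith [q1.1, q1.2, q2.1, q2.2, q3.1, q3.2]
  · have gK : wave g f K l s x / α x.2 = wave g f k l s x := by
      by_cases hr : x.2 ∈ tsupport k
      · have := (hα0 _ (hk0 hr)).ne'
        simp only [wave, K]; field_simp
      · simp [wave, K, image_eq_zero_of_notMem_tsupport hr]
    have gJ : wave g f J l s x / β x.2 = b * wave g f k l s x := by
      by_cases hr : x.2 ∈ tsupport k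
      · have := (hβ0 _ (hk0 hr)).ne'
        simp only [wave, J]; field_simp
      · simp [wave, J, image_eq_zero_of_notMem_tsupport hr]
    have p1 := abs_wave_le (l := l) (s := s) b1 a1 a5' x
    have p2 := abs_wave_le (l := l) (s := s) b1 a2 a4' x
    have p3 := abs_wave_le (l := l) (s := s) b1 a1 a7' x
    change ‖pert α β X Y S x - wave g f k l s x • dir s b‖ ≤ _
    simp only [pert, dir, Prod.norm_def, Prod.fst_sub, Prod.snd_sub, Prod.smul_fst, Prod.smul_snd,
      smul_eq_mul, Real.norm_eq_abs]
    refine max_le ?_ (max_le ?_ (max_le ?_ ?_))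
    · have : dr X x / α x.2 - wave g f k l s x * 1 = l⁻¹ * (2 * wave H₁ f (fun r => K' r / α r) l s x)
          + (l ^ 2)⁻¹ * wave H₂ f (fun r => K'' r / α r) l s x := by
        rw [eXr, ← wave_div, ← wave_div, ← gK]; ring
      rw [this]
      refine abs_sub_le_of_lincomb (A := 2 * T) hl ?_ (abs_wave_le b2 a1 a6' x) (by linarith)
      rw [abs_mul, abs_two]; gcongr
    · have : -dt X x / α x.2 - wave g f k l s x * s =
          l⁻¹ * (s * wave H₁ f (fun r => K' r / α r) l s x - wave H₁ f' (fun r => K r / α r) l s x)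
          + (l ^ 2)⁻¹ * -wave H₂ f' (fun r => K' r / α r) l s x := by
        rw [eXt, ← wave_div, ← wave_div, ← wave_div, ← gK]; ring
      rw [this]
      refine abs_sub_le_of_lincomb (A := |s| * T + T) (B := T) hl ?_
        (by rw [abs_neg]; exact abs_wave_le b2 a2 a5' x) (by linarith)
      exact (abs_sub _ _).trans (add_le_add (habs _ p1) p2)
    · have : (dt Y x + S x) / α x.2 - wave g f k l s x * s ^ 2 =
          l⁻¹ * (-(2 * (s * wave H₁ f' (fun r => K r / α r) l s x)) +
            wave H₁ f (fun r => J r / α r) l s x)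
          + (l ^ 2)⁻¹ * wave H₂ f'' (fun r => K r / α r) l s x := by
        rw [eYt, ← wave_div, ← wave_div, ← wave_div, ← gK]; simp only [S]; ring
      rw [this]
      refine abs_sub_le_of_lincomb (A := 2 * (|s| * T) + T) hl ?_ (abs_wave_le b2 a3 a4' x)
        (by linarith)
      refine (abs_add_le _ _).trans (add_le_add ?_ p3)
      rw [abs_neg, abs_mul, abs_two]
      have := habs _ p2
      linarith
    · have : dr S x / β x.2 - wave g f k l s x * b =
          l⁻¹ * wave H₁ f (fun r => J' r / β r) l s x + (l ^ 2)⁻¹ * 0 := by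
        rw [eSr, ← wave_div, add_div, gJ]; ring
      rw [this]
      exact abs_sub_le_of_lincomb hl (abs_wave_le b1 a1 a8 x) z0 (by linarith)

/-- A trapezoidal profile on the unit interval, with ramps of slope `Λ` and basis `[0, w]`. -/
def trapezoid (Λ w y : ℝ) : ℝ := max 0 (min 1 (Λ * min y (w - y)))

lemma trapezoid_nonneg (Λ w y : ℝ) : 0 ≤ trapezoid Λ w y := le_max_left _ _

lemma trapezoid_le_one (Λ w y : ℝ) : trapezoid Λ w y ≤ 1 :=
  max_le zero_le_one (min_le_left _ _)

lemma continuous_trapezoid (Λ : ℝ) : Continuous (uncurry (trapezoid Λ)) := by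
  unfold trapezoid uncurry
  fun_prop

lemma trapezoid_eq_zero {Λ w y : ℝ} (hΛ : 0 < Λ) (h : y ≤ 0 ∨ w ≤ y) : trapezoid Λ w y = 0 := by
  have : min y (w - y) ≤ 0 := by rcases h with h | h <;> simp [h]
  exact max_eq_left ((min_le_right _ _).trans (mul_nonpos_of_nonneg_of_nonpos hΛ.le this))

lemma trapezoid_eq_one {Λ w y : ℝ} (hΛ : 0 < Λ) (h : Λ⁻¹ ≤ y) (h' : Λ⁻¹ ≤ w - y) :
    trapezoid Λ w y = 1 := by
  have : 1 ≤ Λ * min y (w - y) := by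
    calc 1 = Λ * Λ⁻¹ := (mul_inv_cancel₀ hΛ.ne').symm
      _ ≤ _ := by gcongr; exact le_min h h'
  simp [trapezoid, this]

lemma integral_le_of_ramp {F : ℝ → ℝ} (hF : Continuous F) {δ w : ℝ} (hδ : 0 ≤ δ)
    (h1 : ∀ y, F y ≤ 1) (h0 : ∀ y, 0 ≤ y → y ≤ 1 → (y < 0 ∨ δ < y) → (y < w - δ ∨ w < y) → F y ≤ 0) :
    ∫ y in (0:ℝ)..1, F y ≤ 2 * δ := by
  have hi : ∀ a : ℝ, Integrable (indicator (Icc a (a + δ)) fun _ => (1:ℝ)) volume := fun a => by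
    rw [integrable_indicator_iff measurableSet_Icc]
    exact continuous_const.integrableOn_Icc
  have hInt : ∀ a : ℝ, ∫ y in (0:ℝ)..1, indicator (Icc a (a + δ)) (fun _ => (1:ℝ)) y ≤ δ := by
    intro a
    rw [intervalIntegral.integral_of_le zero_le_one]
    calc _ ≤ ∫ y, indicator (Icc a (a + δ)) (fun _ => (1:ℝ)) y :=
          setIntegral_le_integral (hi a) (Eventually.of_forall fun y => by
            simp only [Pi.zero_apply]; exact indicator_nonneg (fun _ _ => zero_le_one) y)
      _ = δ := by
          rw [integral_indicator measurableSet_Icc]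
          simp [hδ]
  calc ∫ y in (0:ℝ)..1, F y ≤ ∫ y in (0:ℝ)..1, (indicator (Icc 0 (0 + δ)) (fun _ => (1:ℝ)) y
        + indicator (Icc (w - δ) (w - δ + δ)) (fun _ => (1:ℝ)) y) := by
        refine intervalIntegral.integral_mono_on zero_le_one (hF.intervalIntegrable _ _)
          ((hi _).add (hi _)).intervalIntegrable fun y hy => ?_
        have p1 : (0:ℝ) ≤ indicator (Icc 0 (0 + δ)) (fun _ => (1:ℝ)) y :=
          indicator_nonneg (fun _ _ => zero_le_one) y
        have p2 : (0:ℝ) ≤ indicator (Icc (w - δ) (w - δ + δ)) (fun _ => (1:ℝ)) y :=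
          indicator_nonneg (fun _ _ => zero_le_one) y
        by_cases c1 : y ∈ Icc 0 (0 + δ)
        · rw [indicator_of_mem c1]; linarith [h1 y]
        by_cases c2 : y ∈ Icc (w - δ) (w - δ + δ)
        · rw [indicator_of_mem c2]; linarith [h1 y]
        refine (h0 y hy.1 hy.2 ?_ ?_).trans (by linarith)
        · simp only [mem_Icc, not_and_or, not_le, zero_add] at c1; exact c1
        · simp only [mem_Icc, not_and_or, not_le, sub_add_cancel] at c2; exact c2
    _ ≤ 2 * δ := by
        rw [intervalIntegral.integral_add (hi _).intervalIntegrable (hi _).intervalIntegrable]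
        linarith [hInt 0, hInt (w - δ)]

/-- A continuous periodic profile with prescribed mean, taking mostly values near `0` and `1`. -/
lemma exists_profile {θ ε : ℝ} (h0 : 0 < θ) (h1 : θ < 1) (hε : 0 < ε) :
    ∃ (μ : ℝ) (g : ℝ → ℝ), 0 < μ ∧ μ ≤ θ ∧ θ ≤ 1 - μ ∧ Continuous g ∧ Periodic g 1 ∧
      (∀ x, μ ≤ g x ∧ g x ≤ 1 - μ) ∧ ∫ x in (0:ℝ)..1, g x = θ ∧
      ∫ x in (0:ℝ)..1, g x * (1 - g x) ≤ ε := by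
  obtain ⟨μ, hμ0, hμθ, hμθ', hμε⟩ : ∃ μ : ℝ, 0 < μ ∧ μ < θ ∧ θ < 1 - μ ∧ μ ≤ ε / 2 :=
    ⟨min (ε / 2) (min (θ / 2) ((1 - θ) / 2)), by
      refine lt_min (by linarith) (lt_min (by linarith) (by linarith)),
      by linarith [(min_le_right (ε / 2) (min (θ / 2) ((1 - θ) / 2))).trans (min_le_left _ _)],
      by linarith [(min_le_right (ε / 2) (min (θ / 2) ((1 - θ) / 2))).trans (min_le_right _ _)],
      min_le_left _ _⟩
  have hμ2 : 0 < 1 - 2 * μ := by linarith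
  set θ' := (θ - μ) / (1 - 2 * μ) with hθ'
  have hθ'0 : 0 ≤ θ' := div_nonneg (by linarith) hμ2.le
  have hθ'1 : θ' < 1 := by rw [hθ', div_lt_one hμ2]; linarith
  obtain ⟨δ, hδ0, hδ1, hδε⟩ : ∃ δ : ℝ, 0 < δ ∧ 2 * δ ≤ 1 - θ' ∧ 2 * δ ≤ ε / 2 :=
    ⟨min ((1 - θ') / 2) (ε / 4), lt_min (by linarith) (by linarith),
      by linarith [min_le_left ((1 - θ') / 2) (ε / 4)],
      by linarith [min_le_right ((1 - θ') / 2) (ε / 4)]⟩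
  have hΛ : 0 < δ⁻¹ := inv_pos.2 hδ0
  have hc : ∀ w, Continuous (trapezoid δ⁻¹ w) := fun w =>
    (continuous_trapezoid δ⁻¹).comp (by fun_prop : Continuous fun y : ℝ => (w, y))
  have hmc : Continuous fun w => ∫ y in (0:ℝ)..1, trapezoid δ⁻¹ w y :=
    intervalIntegral.continuous_parametric_intervalIntegral_of_continuous'
      (continuous_trapezoid δ⁻¹) 0 1
  have hm0 : ∫ y in (0:ℝ)..1, trapezoid δ⁻¹ 0 y = 0 := by
    simp [trapezoid_eq_zero hΛ (le_total _ 0)]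
  have hm1 : θ' ≤ ∫ y in (0:ℝ)..1, trapezoid δ⁻¹ 1 y := by
    have := integral_le_of_ramp (F := fun y => 1 - trapezoid δ⁻¹ 1 y)
      (continuous_const.sub (hc 1)) (w := 1) hδ0.le
      (fun y => by linarith [trapezoid_nonneg δ⁻¹ 1 y]) (fun y hy hy' a b => by
        have : trapezoid δ⁻¹ 1 y = 1 := by
          apply trapezoid_eq_one hΛ <;> rw [inv_inv] <;> rcases a with a | a <;>
            rcases b with b | b <;> linarith
        rw [this]; simp)
    rw [intervalIntegral.integral_sub (continuous_const.intervalIntegrable _ _)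
      ((hc 1).intervalIntegrable _ _)] at this
    simp only [intervalIntegral.integral_const, sub_zero, smul_eq_mul, mul_one] at this
    linarith
  obtain ⟨w, ⟨hw0, hw1⟩, hw⟩ := intermediate_value_Icc zero_le_one hmc.continuousOn
    ⟨hm0.le.trans hθ'0, hm1⟩
  simp only at hw
  set T := trapezoid δ⁻¹ w with hT
  have hcT : Continuous T := hc w
  have hTf : Continuous fun x => T (Int.fract x) :=
    ContinuousOn.comp_fract'' (hc w).continuousOn (by
      rw [trapezoid_eq_zero hΛ (Or.inl le_rfl), trapezoid_eq_zero hΛ (Or.inr hw1)])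
  have hfr : ∀ F : ℝ → ℝ, ∫ x in (0:ℝ)..1, F (T (Int.fract x)) = ∫ x in (0:ℝ)..1, F (T x) := by
    intro F
    rw [intervalIntegral.integral_of_le zero_le_one, intervalIntegral.integral_of_le zero_le_one,
      integral_Ioc_eq_integral_Ioo, integral_Ioc_eq_integral_Ioo]
    refine setIntegral_congr_fun measurableSet_Ioo fun x hx => ?_
    simp only [Int.fract_eq_self.2 ⟨hx.1.le, hx.2⟩]
  have hT0 : ∀ x, 0 ≤ T x := trapezoid_nonneg _ _
  have hT1 : ∀ x, T x ≤ 1 := trapezoid_le_one _ _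
  refine ⟨μ, fun x => μ + (1 - 2 * μ) * T (Int.fract x), hμ0, hμθ.le, hμθ'.le,
    continuous_const.add (continuous_const.mul hTf),
    fun x => by simp [Int.fract_add_one], fun x => ⟨?_, ?_⟩, ?_, ?_⟩
  · nlinarith [hT0 (Int.fract x)]
  · nlinarith [hT1 (Int.fract x)]
  · rw [hfr fun v => μ + (1 - 2 * μ) * v, intervalIntegral.integral_add
      (continuous_const.intervalIntegrable _ _) (Continuous.intervalIntegrable (by fun_prop) _ _),
      intervalIntegral.integral_const_mul, hw, hθ',
      mul_div_cancel₀ _ hμ2.ne']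
    simp
  · rw [hfr fun v => (μ + (1 - 2 * μ) * v) * (1 - (μ + (1 - 2 * μ) * v))]
    have hr : ∫ x in (0:ℝ)..1, T x * (1 - T x) ≤ 2 * δ :=
      integral_le_of_ramp (F := fun x => T x * (1 - T x)) (by fun_prop) (w := w) hδ0.le
        (fun y => by nlinarith [hT0 y, hT1 y]) (fun y hy hy' a b => by
          have : T y = 0 ∨ T y = 1 := by
            rcases b with b | b
            · right
              apply trapezoid_eq_one hΛ <;> rw [inv_inv] <;> rcases a with a | a <;> linarith
            · exact Or.inl (trapezoid_eq_zero hΛ (Or.inr b.le))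
          rcases this with h | h <;> rw [h] <;> simp)
    calc _ ≤ ∫ x in (0:ℝ)..1, (μ + T x * (1 - T x)) := by
          refine intervalIntegral.integral_mono_on zero_le_one
            (Continuous.intervalIntegrable (by fun_prop) _ _)
            (Continuous.intervalIntegrable (by fun_prop) _ _) fun y _ => ?_
          have := mul_nonneg (hT0 y) (sub_nonneg.2 (hT1 y))
          nlinarith [mul_nonneg this hμ0.le, mul_nonneg this (by linarith : (0:ℝ) ≤ 1 - μ)]
      _ = μ + ∫ x in (0:ℝ)..1, T x * (1 - T x) := by
          rw [intervalIntegral.integral_add (continuous_const.intervalIntegrable _ _)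
            (Continuous.intervalIntegrable (by fun_prop) _ _)]
          simp
      _ ≤ ε := by linarith

lemma integral_abs_sub_mean_le {g : ℝ → ℝ} {θ : ℝ} (hg : Continuous g) (h01 : ∀ x, 0 ≤ g x ∧ g x ≤ 1)
    (h0 : 0 ≤ θ) (h1 : θ ≤ 1) (hm : ∫ x in (0:ℝ)..1, g x = θ) :
    ∫ x in (0:ℝ)..1, |g x - θ| ≤ 2 * (θ * (1 - θ)) := by
  calc _ ≤ ∫ x in (0:ℝ)..1, (g x * (1 - 2 * θ) + θ) := by
        refine intervalIntegral.integral_mono_on zero_le_one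
          (Continuous.intervalIntegrable (by fun_prop) _ _)
          (Continuous.intervalIntegrable (by fun_prop) _ _) fun y _ => ?_
        rw [abs_le]
        constructor <;> nlinarith [h01 y, mul_nonneg (h01 y).1 h0,
          mul_nonneg (h01 y).1 (sub_nonneg.2 h1), mul_nonneg (sub_nonneg.2 (h01 y).2) h0]
    _ = 2 * (θ * (1 - θ)) := by
        rw [intervalIntegral.integral_add (Continuous.intervalIntegrable (by fun_prop) _ _)
          (Continuous.intervalIntegrable (by fun_prop) _ _), intervalIntegral.integral_mul_const, hm]
        simp; ring

lemma integral_periodic_le {G : ℝ → ℝ} (hG : Continuous G) (hp : Periodic G 1) (h0 : ∀ x, 0 ≤ G x)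
    {a b : ℝ} (hab : a ≤ b) : ∫ x in a..b, G x ≤ (b - a + 1) * ∫ x in (0:ℝ)..1, G x := by
  have hi : ∀ u v, IntervalIntegrable G volume u v := fun u v => hG.intervalIntegrable _ _
  have hn : ∀ N : ℕ, ∫ x in a..(a + N), G x = N * ∫ x in (0:ℝ)..1, G x := by
    intro N
    induction N with
    | zero => simp
    | succ N ih =>
      rw [← intervalIntegral.integral_add_adjacent_intervals (hi a (a + N)) (hi _ _), ih]
      have := hp.intervalIntegral_add_eq (a + N) 0
      rw [zero_add] at this
      push_cast
      rw [← add_assoc, this]; ring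
  have h1 : b ≤ a + ⌈b - a⌉₊ := by linarith [Nat.le_ceil (b - a)]
  have hI : 0 ≤ ∫ x in (0:ℝ)..1, G x := intervalIntegral.integral_nonneg zero_le_one fun x _ => h0 x
  calc ∫ x in a..b, G x ≤ ∫ x in a..(a + ⌈b - a⌉₊), G x :=
        intervalIntegral.integral_mono_interval le_rfl hab h1 (Eventually.of_forall h0) (hi _ _)
    _ = ⌈b - a⌉₊ * ∫ x in (0:ℝ)..1, G x := hn _
    _ ≤ _ := by
        gcongr
        exact (Nat.ceil_lt_add_one (by linarith)).le

lemma integral_periodic_comp_le {G : ℝ → ℝ} (hG : Continuous G) (hp : Periodic G 1)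
    (h0 : ∀ x, 0 ≤ G x) {a b l : ℝ} (hab : a ≤ b) (hl : 0 < l) (w : ℝ) :
    ∫ x in a..b, G (l * (x - w)) ≤ (b - a + l⁻¹) * ∫ x in (0:ℝ)..1, G x := by
  have h1 : ∫ x in a..b, G (l * (x - w)) = l⁻¹ * ∫ x in (l * a - l * w)..(l * b - l * w), G x := by
    have := intervalIntegral.integral_comp_mul_sub (a := a) (b := b) G hl.ne' (l * w)
    rw [smul_eq_mul] at this
    rw [← this]
    congr 1; ext x; ring_nf
  rw [h1]
  have := integral_periodic_le hG hp h0 (a := l * a - l * w) (b := l * b - l * w) (by gcongr)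
  calc _ ≤ l⁻¹ * ((l * b - l * w - (l * a - l * w) + 1) * ∫ x in (0:ℝ)..1, G x) := by gcongr
    _ = _ := by field_simp; ring

/-- A half-open space-time box. -/
def box (a b p q : ℝ) : Set (ℝ × ℝ) := Ioc a b ×ˢ Ioc p q

/-- The interior of a space-time box. -/
def openBox (a b p q : ℝ) : Set (ℝ × ℝ) := Ioo a b ×ˢ Ioo p q

lemma measurableSet_box (a b p q : ℝ) : MeasurableSet (box a b p q) :=
  measurableSet_Ioc.prod measurableSet_Ioc

lemma openBox_subset_box (a b p q : ℝ) : openBox a b p q ⊆ box a b p q :=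
  prod_mono Ioo_subset_Ioc_self Ioo_subset_Ioc_self

lemma box_subset_Icc (a b p q : ℝ) : box a b p q ⊆ Icc a b ×ˢ Icc p q :=
  prod_mono Ioc_subset_Icc_self Ioc_subset_Icc_self

lemma volume_real_box {a b p q : ℝ} (hab : a ≤ b) (hpq : p ≤ q) :
    volume.real (box a b p q) = (b - a) * (q - p) := by
  rw [box, Measure.volume_eq_prod, measureReal_def, Measure.prod_prod, Real.volume_Ioc,
    Real.volume_Ioc, ENNReal.toReal_mul, ENNReal.toReal_ofReal (by linarith),
    ENNReal.toReal_ofReal (by linarith)]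

lemma integrableOn_box {E : Type*} [NormedAddCommGroup E] {F : ℝ × ℝ → E} (hF : Continuous F)
    (a b p q : ℝ) : IntegrableOn F (box a b p q) :=
  (hF.continuousOn.integrableOn_compact (isCompact_Icc.prod isCompact_Icc)).mono_set
    (box_subset_Icc a b p q)

lemma setIntegral_box {F : ℝ × ℝ → ℝ} (hF : Continuous F) {a b p q : ℝ} (hab : a ≤ b) (hpq : p ≤ q) :
    ∫ x in box a b p q, F x = ∫ t in a..b, ∫ r in p..q, F (t, r) := by
  have hi := integrableOn_box hF a b p q
  rw [box, Measure.volume_eq_prod] at *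
  rw [setIntegral_prod F hi, intervalIntegral.integral_of_le hab]
  simp_rw [intervalIntegral.integral_of_le hpq]

lemma setIntegral_box_wave_le {G : ℝ → ℝ} (hG : Continuous G) (hp : Periodic G 1)
    (h0 : ∀ x, 0 ≤ G x) {a b p q l : ℝ} (hab : a ≤ b) (hpq : p ≤ q) (hl : 0 < l) (s : ℝ) :
    ∫ x in box a b p q, G (l * (x.2 - s * x.1)) ≤
      (b - a) * ((q - p + l⁻¹) * ∫ x in (0:ℝ)..1, G x) := by
  rw [setIntegral_box (by fun_prop) hab hpq]
  calc _ ≤ ∫ t in a..b, (q - p + l⁻¹) * ∫ x in (0:ℝ)..1, G x := by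
        refine intervalIntegral.integral_mono_on hab (Continuous.intervalIntegrable ?_ _ _)
          (continuous_const.intervalIntegrable _ _)
          fun t _ => integral_periodic_comp_le hG hp h0 hpq hl (s * t)
        exact intervalIntegral.continuous_parametric_intervalIntegral_of_continuous'
          (f := fun t r => G (l * (r - s * t))) (by unfold uncurry; fun_prop) _ _
    _ = _ := by simp; ring

lemma exists_cutoff {a b μ : ℝ} (hab : a < b) (h0 : 0 < μ) (h1 : μ < 1) :
    ∃ f : ℝ → ℝ, ContDiff ℝ ∞ f ∧ HasCompactSupport f ∧ tsupport f ⊆ Ioo a b ∧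
      (∀ x, 0 ≤ f x) ∧ (∀ x, f x ≤ 1) ∧ ∫ x in a..b, (1 - f x) ≤ μ * (b - a) := by
  have hh : 0 < (b - a) / 2 := by linarith
  let f : ContDiffBump ((a + b) / 2) :=
    ⟨(b - a) / 2 * (1 - μ), (b - a) / 2 * (1 - μ / 2), mul_pos hh (by linarith), by
      gcongr; linarith⟩
  have hf1 : f.rIn = (b - a) / 2 * (1 - μ) := rfl
  have hf2 : f.rOut = (b - a) / 2 * (1 - μ / 2) := rfl
  refine ⟨f, f.contDiff, f.hasCompactSupport, ?_, fun x => f.nonneg, fun x => f.le_one, ?_⟩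
  · rw [f.tsupport_eq, Real.closedBall_eq_Icc, hf2]
    intro x hx
    constructor <;> nlinarith [hx.1, hx.2, mul_pos hh h0]
  · rw [intervalIntegral.integral_sub (continuous_const.intervalIntegrable _ _)
      (f.continuous.intervalIntegrable _ _)]
    have h2 : (b - a) * (1 - μ) ≤ ∫ x in a..b, f x := by
      calc (b - a) * (1 - μ) = ∫ x in ((a + b) / 2 - f.rIn)..((a + b) / 2 + f.rIn), (1:ℝ) := by
            simp [hf1]; ring
        _ = ∫ x in ((a + b) / 2 - f.rIn)..((a + b) / 2 + f.rIn), f x := by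
            refine intervalIntegral.integral_congr fun x hx => ?_
            rw [uIcc_of_le (by linarith [f.rIn_pos]), ← Real.closedBall_eq_Icc] at hx
            exact (f.one_of_mem_closedBall hx).symm
        _ ≤ ∫ x in a..b, f x := by
            refine intervalIntegral.integral_mono_interval ?_ (by linarith [f.rIn_pos]) ?_
              (Eventually.of_forall fun x => f.nonneg) (f.continuous.intervalIntegrable _ _)
            · rw [hf1]; nlinarith [mul_pos hh h0]
            · rw [hf1]; nlinarith [mul_pos hh h0]
    simp only [intervalIntegral.integral_const, smul_eq_mul, mul_one]
    linarith

lemma setIntegral_box_one_sub_mul_le {f k : ℝ → ℝ} (hf : Continuous f) (hk : Continuous k)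
    (hf1 : ∀ x, f x ≤ 1) (hk1 : ∀ x, k x ≤ 1) {a b p q μ : ℝ} (hab : a ≤ b) (hpq : p ≤ q)
    (hfi : ∫ x in a..b, (1 - f x) ≤ μ * (b - a)) (hki : ∫ x in p..q, (1 - k x) ≤ μ * (q - p)) :
    ∫ x in box a b p q, (1 - f x.1 * k x.2) ≤ 2 * μ * ((b - a) * (q - p)) := by
  calc _ ≤ ∫ x in box a b p q, ((1 - f x.1) + (1 - k x.2)) := by
        refine setIntegral_mono (integrableOn_box (by fun_prop) _ _ _ _)
          (integrableOn_box (by fun_prop) _ _ _ _) fun x => ?_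
        nlinarith [mul_nonneg (sub_nonneg.2 (hf1 x.1)) (sub_nonneg.2 (hk1 x.2))]
    _ = (∫ x in a..b, (1 - f x)) * (q - p) + (b - a) * ∫ x in p..q, (1 - k x) := by
        rw [integral_add (integrableOn_box (by fun_prop) _ _ _ _)
          (integrableOn_box (by fun_prop) _ _ _ _), setIntegral_box (by fun_prop) hab hpq,
          setIntegral_box (by fun_prop) hab hpq]
        simp only [intervalIntegral.integral_const, smul_eq_mul,
          intervalIntegral.integral_const_mul]
        ring
    _ ≤ _ := by nlinarith [mul_le_mul_of_nonneg_right hfi (sub_nonneg.2 hpq),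
          mul_le_mul_of_nonneg_left hki (sub_nonneg.2 hab)]

/-- Distance between two states which also controls the specific volume. -/
def gap (z z' : St) : ℝ := max ‖z - z'‖ |z.1⁻¹ - z'.1⁻¹|

lemma gap_nonneg (z z' : St) : 0 ≤ gap z z' := le_max_of_le_left (norm_nonneg _)

lemma continuous_dt {F : ℝ × ℝ → ℝ} (hF : ContDiff ℝ 1 F) : Continuous (dt F) :=
  (hF.continuous_fderiv one_ne_zero).clm_apply continuous_const

lemma continuous_dr {F : ℝ × ℝ → ℝ} (hF : ContDiff ℝ 1 F) : Continuous (dr F) :=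
  (hF.continuous_fderiv one_ne_zero).clm_apply continuous_const

lemma Potentials.continuous_pert {Q : Set (ℝ × ℝ)} {ε : ℝ} {X Y S Z : ℝ × ℝ → ℝ}
    (h : Potentials Q ε X Y S Z) {α β : ℝ → ℝ} (hα : Continuous α) (hβ : Continuous β)
    (hα0 : ∀ r, 0 < α r) (hβ0 : ∀ r, 0 < β r) : Continuous (pert α β X Y S) := by
  have h1 := continuous_dr h.smoothX
  have h2 := continuous_dt h.smoothX
  have h3 := continuous_dt h.smoothY
  have h4 := continuous_dr h.smoothS
  have h5 := h.smoothS.continuous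
  have ha : ∀ x : ℝ × ℝ, α x.2 ≠ 0 := fun x => (hα0 _).ne'
  have hb : ∀ x : ℝ × ℝ, β x.2 ≠ 0 := fun x => (hβ0 _).ne'
  have a1 : Continuous fun x : ℝ × ℝ => α x.2 := hα.comp continuous_snd
  have a2 : Continuous fun x : ℝ × ℝ => β x.2 := hβ.comp continuous_snd
  exact (h1.div a1 ha).prodMk ((h2.neg.div a1 ha).prodMk
    (((h3.add h5).div a1 ha).prodMk (h4.div a2 hb)))

lemma continuous_gap {z z' : ℝ × ℝ → St} (hz : Continuous z) (hz' : Continuous z')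
    (h : ∀ x, (z x).1 ≠ 0) (hne : ∀ x, (z' x).1 ≠ 0) : Continuous fun x => gap (z x) (z' x) := by
  unfold gap
  exact (hz.sub hz').norm.max ((hz.fst.inv₀ h).sub (hz'.fst.inv₀ hne)).abs

/-- A refinement of the subsolution `(z, c)` by oscillations supported in `U`. -/
structure Refinement (κ γ : ℝ) (α β : ℝ → ℝ) (z : ℝ × ℝ → St) (c : ℝ × ℝ → ℝ) (U Q : Set (ℝ × ℝ))
    (ε : ℝ) (X Y S Z c' : ℝ × ℝ → ℝ) : Prop where
  pot : Potentials U ε X Y S Z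
  cont : Continuous c'
  eq_off : ∀ x, x ∉ U → c' x = c x
  mem : ∀ x, (z x + pert α β X Y S x, c' x) ∈ lamSet κ γ
  int_le : ∫ x in Q, c' x ≤ ε * volume.real Q
  gap_le : ∫ x in Q, gap (z x + pert α β X Y S x) (z x) ≤ (∫ x in Q, c x) + ε * volume.real Q

/-- The subsolution `(z, c)` can be refined in `U`. -/
def Refinable (κ γ : ℝ) (α β : ℝ → ℝ) (z : ℝ × ℝ → St) (c : ℝ × ℝ → ℝ) (U Q : Set (ℝ × ℝ))
    (ε : ℝ) : Prop :=
  ∃ X Y S Z c', Refinement κ γ α β z c U Q ε X Y S Z c'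

lemma abs_inv_sub_inv_le {u v a : ℝ} (ha : 0 < a) (hu : a / 2 ≤ u) (hv : a ≤ v) :
    |u⁻¹ - v⁻¹| ≤ |u - v| * (2 / a ^ 2) := by
  have hu0 : 0 < u := by linarith
  have hv0 : 0 < v := by linarith
  rw [inv_sub_inv hu0.ne' hv0.ne', abs_div, abs_of_pos (mul_pos hu0 hv0), abs_sub_comm,
    div_eq_mul_inv]
  gcongr
  rw [inv_le_comm₀ (by positivity) (by positivity), inv_div]
  nlinarith

lemma exists_atom_params {C e ε d c₀ : ℝ} (he : 0 < e) (hε : 0 < ε) (hd : 0 < d) :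
    ∃ l : ℝ, 1 ≤ l ∧ C / l ≤ e ∧ C / l ≤ ε ∧ l⁻¹ ≤ d ∧ c₀ * l⁻¹ ≤ ε / 4 * d := by
  have h1 : Tendsto (fun l : ℝ => C / l) atTop (𝓝 0) := tendsto_const_nhds.div_atTop tendsto_id
  have h2 : Tendsto (fun l : ℝ => l⁻¹) atTop (𝓝 0) := tendsto_inv_atTop_zero
  have h3 : Tendsto (fun l : ℝ => c₀ * l⁻¹) atTop (𝓝 0) := by simpa using h2.const_mul c₀
  exact ((eventually_ge_atTop (1:ℝ)).and ((h1.eventually_le_const he).and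
    ((h1.eventually_le_const hε).and ((h2.eventually_le_const hd).and
      (h3.eventually_le_const (by positivity)))))).exists

lemma exists_tube {κ γ x y s ε₁ μ : ℝ} (hκ : 0 < κ) (hγ : 1 < γ) (hx : 0 < x) (hxy : x < y)
    (hμ : 0 < μ) (hε₁ : 0 < ε₁) :
    ∃ δ > 0, ∀ τ c' : ℝ, ∀ w : St, μ ≤ τ → τ ≤ 1 - μ → ‖w - lam κ γ x y s τ‖ < δ →
      τ * (1 - τ) * lcost κ γ x y s + ε₁ ≤ c' → (w, c') ∈ lamSet κ γ := by
  let F : ℝ → St × ℝ := fun τ => (lam κ γ x y s τ, τ * (1 - τ) * lcost κ γ x y s + ε₁)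
  have hF : Continuous F := by
    simp only [F, lam]
    fun_prop
  have hsub : F '' Icc μ (1 - μ) ⊆ lamSet κ γ := by
    rintro _ ⟨τ, hτ, rfl⟩
    exact ⟨x, y, s, τ, hx, hxy, hμ.trans_le hτ.1, by linarith [hτ.2], rfl, by simp [F, hε₁]⟩
  obtain ⟨δ, hδ, hδs⟩ := (isCompact_Icc.image hF).exists_thickening_subset_open
    (isOpen_lamSet hκ hγ) hsub
  refine ⟨δ, hδ, fun τ c' w h1 h2 h3 h4 => lamSet_mono (hδs ?_) h4⟩
  refine Metric.mem_thickening_iff.2 ⟨F τ, mem_image_of_mem _ ⟨h1, h2⟩, ?_⟩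
  simp only [F, dist_eq_norm]
  simp [h3]

lemma gap_le_of_near {κ γ x y s θ τ e : ℝ} {z w : St} (hκ : 0 < κ) (hγ : 1 < γ) (hx : 0 < x)
    (hxy : x < y) (hθ0 : 0 < θ) (hθ1 : θ < 1) (hτ0 : 0 < τ) (hτ1 : τ < 1) (he : 4 * e ≤ x)
    (hz : ‖z - lam κ γ x y s θ‖ ≤ e) (hw : ‖w - lam κ γ x y s τ‖ ≤ 2 * e) :
    gap w z ≤ |τ - θ| * (lcost κ γ x y s / 2) + e * (3 + 6 / x ^ 2) := by
  have he0 : 0 ≤ e := (norm_nonneg _).trans hz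
  have hd := norm_dir_le (s := s) hκ hγ hx hxy
  have hch := chord_pos hκ hγ hx hxy
  have hyx : 0 < y - x := sub_pos.2 hxy
  have hL : 2 * ((y - x) / x ^ 2) ≤ lcost κ γ x y s := by
    have : 0 ≤ 2 * ((y - x) * (1 + |s| + s ^ 2 + chord κ γ x y)) := by positivity
    unfold lcost; linarith
  have hx2 : 0 ≤ 6 / x ^ 2 := by positivity
  have hlam : lam κ γ x y s τ - lam κ γ x y s θ = ((τ - θ) * (y - x)) • dir s (chord κ γ x y) := by
    simp only [lam]; module
  have hfst : ∀ u v : St, |u.1 - v.1| ≤ ‖u - v‖ := fun u v => norm_fst_le (u - v)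
  refine max_le ?_ ?_
  · have h1 : ‖lam κ γ x y s τ - lam κ γ x y s θ‖ ≤ |τ - θ| * (lcost κ γ x y s / 2) := by
      rw [hlam, norm_smul, norm_mul, Real.norm_eq_abs, Real.norm_eq_abs, abs_of_pos hyx, mul_assoc]
      gcongr; linarith
    have h2 : w - z = (w - lam κ γ x y s τ) + (lam κ γ x y s τ - lam κ γ x y s θ)
        - (z - lam κ γ x y s θ) := by abel
    rw [h2]
    refine (norm_sub_le _ _).trans ?_
    have := norm_add_le (w - lam κ γ x y s τ) (lam κ γ x y s τ - lam κ γ x y s θ)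
    nlinarith
  · have l1 : ∀ σ, 0 < σ → σ < 1 → x ≤ (lam κ γ x y s σ).1 := fun σ h0 h1 => by
      rw [lam_fst]; nlinarith
    have b1 := (hfst _ _).trans hz
    have b2 := (hfst _ _).trans hw
    have a1 : |w.1⁻¹ - (lam κ γ x y s τ).1⁻¹| ≤ 2 * e * (2 / x ^ 2) :=
      (abs_inv_sub_inv_le hx (by linarith [(abs_le.1 b2).1, l1 τ hτ0 hτ1]) (l1 τ hτ0 hτ1)).trans
        (by gcongr)
    have a2 : |z.1⁻¹ - (lam κ γ x y s θ).1⁻¹| ≤ e * (2 / x ^ 2) :=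
      (abs_inv_sub_inv_le hx (by linarith [(abs_le.1 b1).1, l1 θ hθ0 hθ1]) (l1 θ hθ0 hθ1)).trans
        (by gcongr)
    have a3 : |(lam κ γ x y s τ).1⁻¹ - (lam κ γ x y s θ).1⁻¹| ≤
        |τ - θ| * (lcost κ γ x y s / 2) := by
      have p1 := l1 τ hτ0 hτ1
      have p2 := l1 θ hθ0 hθ1
      have q1 := hx.trans_le p1
      have q2 := hx.trans_le p2
      rw [inv_sub_inv q1.ne' q2.ne', abs_div, abs_of_pos (mul_pos q1 q2), abs_sub_comm,
        ← Prod.fst_sub, hlam]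
      have : |(((τ - θ) * (y - x)) • dir s (chord κ γ x y)).1| = |τ - θ| * (y - x) := by
        simp [dir, abs_mul, abs_of_pos hyx]
      rw [this]
      calc _ ≤ |τ - θ| * (y - x) / (x ^ 2) := by
            gcongr; rw [sq]; gcongr
        _ = |τ - θ| * ((y - x) / x ^ 2) := by ring
        _ ≤ _ := mul_le_mul_of_nonneg_left (by linarith) (abs_nonneg _)
    have e1 : w.1⁻¹ - z.1⁻¹ = (w.1⁻¹ - (lam κ γ x y s τ).1⁻¹) +
      ((lam κ γ x y s τ).1⁻¹ - (lam κ γ x y s θ).1⁻¹) - (z.1⁻¹ - (lam κ γ x y s θ).1⁻¹) := by ring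
    rw [e1]
    refine (abs_sub _ _).trans ?_
    have := abs_add_le (w.1⁻¹ - (lam κ γ x y s τ).1⁻¹)
      ((lam κ γ x y s τ).1⁻¹ - (lam κ γ x y s θ).1⁻¹)
    have e2 : e * (3 + 6 / x ^ 2) = 3 * e + 2 * e * (2 / x ^ 2) + e * (2 / x ^ 2) := by ring
    linarith

set_option maxHeartbeats 1000000 in
lemma exists_radius_refinable {κ γ : ℝ} {α β : ℝ → ℝ} (hκ : 0 < κ) (hγ : 1 < γ)
    (hα : ContDiff ℝ ∞ α) (hβ : ContDiff ℝ ∞ β) (hα0 : ∀ r, 0 < α r) (hβ0 : ∀ r, 0 < β r)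
    {z : ℝ × ℝ → St} {c : ℝ × ℝ → ℝ} (hz : Continuous z) (hc : Continuous c)
    (hW : ∀ x, (z x, c x) ∈ lamSet κ γ) (x₀ : ℝ × ℝ) {ε : ℝ} (hε : 0 < ε) :
    ∃ δ > 0, ∀ a b p q, a < b → p < q → 0 < p → box a b p q ⊆ Metric.ball x₀ δ →
      Refinable κ γ α β z c (openBox a b p q) (box a b p q) ε := by
  obtain ⟨x, y, s, θ, hx, hxy, hθ0, hθ1, hz0, hc0⟩ := hW x₀
  simp only at hz0 hc0
  set L := lcost κ γ x y s with hLdef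
  have hL : 0 < L := lcost_pos s hκ hγ hx hxy
  have hyx : 0 < y - x := sub_pos.2 hxy
  have hcpos : ∀ v, 0 < c v := fun v => lamSet_pos hκ hγ (hW v)
  obtain ⟨ε₁, hε₁0, hε₁ε, hε₁c⟩ : ∃ ε₁, 0 < ε₁ ∧ ε₁ ≤ ε / 4 ∧ θ * (1 - θ) * L + ε₁ < c x₀ :=
    ⟨min (ε / 4) ((c x₀ - θ * (1 - θ) * L) / 2), lt_min (by linarith) (by linarith),
      min_le_left _ _, by linarith [min_le_right (ε / 4) ((c x₀ - θ * (1 - θ) * L) / 2)]⟩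
  obtain ⟨μ, g, hμ, hμθ, hμθ', gc, gp, gb, gm, gi⟩ :=
    exists_profile hθ0 hθ1 (ε := ε / (8 * L)) (by positivity)
  obtain ⟨δ₀, hδ₀, tube⟩ := exists_tube (s := s) hκ hγ hx hxy hμ hε₁0
  obtain ⟨e, he0, he1, he2, he3⟩ : ∃ e : ℝ, 0 < e ∧ 4 * e ≤ δ₀ ∧ 4 * e ≤ x ∧
      e * (3 + 6 / x ^ 2) ≤ ε / 4 := by
    have hk : 0 < 3 + 6 / x ^ 2 := by positivity
    refine ⟨min (δ₀ / 4) (min (x / 4) (ε / 4 / (3 + 6 / x ^ 2))),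
      lt_min (by positivity) (lt_min (by positivity) (by positivity)), ?_, ?_, ?_⟩
    · linarith [min_le_left (δ₀ / 4) (min (x / 4) (ε / 4 / (3 + 6 / x ^ 2)))]
    · linarith [(min_le_right (δ₀ / 4) (min (x / 4) (ε / 4 / (3 + 6 / x ^ 2)))).trans
        (min_le_left _ _)]
    · rw [← le_div_iff₀ hk]
      exact (min_le_right _ _).trans (min_le_right _ _)
  obtain ⟨δ, hδ, hball⟩ : ∃ δ > 0, ∀ v ∈ Metric.ball x₀ δ, ‖z v - lam κ γ x y s θ‖ < e ∧
      (c x₀ < c v + ε / 4 ∧ c v < c x₀ + 1) ∧ θ * (1 - θ) * L + ε₁ < c v := by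
    have h1 : ∀ᶠ v in 𝓝 x₀, ‖z v - lam κ γ x y s θ‖ < e := by
      have : Tendsto (fun v => ‖z v - lam κ γ x y s θ‖) (𝓝 x₀) (𝓝 0) := by
        have h := (hz.sub (continuous_const (y := lam κ γ x y s θ))).norm.tendsto x₀
        simpa [hz0] using h
      exact this.eventually_lt_const he0
    have h2 := (hc.tendsto x₀).eventually_const_lt (by linarith : c x₀ - ε / 4 < c x₀)
    have h3 := (hc.tendsto x₀).eventually_lt_const (by linarith : c x₀ < c x₀ + 1)
    have h4 := (hc.tendsto x₀).eventually_const_lt hε₁c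
    obtain ⟨δ, hδ, h⟩ := Metric.eventually_nhds_iff_ball.1 (h1.and (h2.and (h3.and h4)))
    exact ⟨δ, hδ, fun v hv => ⟨(h v hv).1, ⟨by linarith [(h v hv).2.1], (h v hv).2.2.1⟩,
      (h v hv).2.2.2⟩⟩
  refine ⟨δ, hδ, fun a b p q hab hpq hp hbox => ?_⟩
  have hM : 0 < L + c x₀ + 1 := by linarith [hcpos x₀]
  obtain ⟨ν, hν0, hν1, hν⟩ : ∃ ν : ℝ, 0 < ν ∧ ν < 1 ∧ (L + c x₀ + 1) * (2 * ν) ≤ ε / 4 := by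
    refine ⟨min (1 / 2) (ε / (8 * (L + c x₀ + 1))), lt_min (by norm_num) (by positivity),
      (min_le_left _ _).trans_lt (by norm_num), ?_⟩
    have := min_le_right (1 / 2) (ε / (8 * (L + c x₀ + 1)))
    rw [le_div_iff₀ (by positivity)] at this
    linarith
  obtain ⟨f, sf, cf, tf, f0, f1, fi⟩ := exists_cutoff hab hν0 hν1
  obtain ⟨k, sk, ck, tk, k0, k1, ki⟩ := exists_cutoff hpq hν0 hν1
  have hgc : Continuous fun u => (y - x) * (g u - θ) := by fun_prop
  obtain ⟨C, hC⟩ := exists_atom (g := fun u => (y - x) * (g u - θ)) s (chord κ γ x y) hα hβ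
    (fun r _ => hα0 r) (fun r _ => hβ0 r) hgc (fun u => by simp only [gp u]) (by
      rw [intervalIntegral.integral_const_mul, intervalIntegral.integral_sub
        (gc.intervalIntegrable _ _) (continuous_const.intervalIntegrable _ _), gm]
      simp) sf sk cf ck (fun r hr => hp.trans (tk hr).1)
  obtain ⟨l, hl1, hle, hlε, hld, hlc⟩ := exists_atom_params (C := C) (c₀ := c x₀) he0 hε
    (sub_pos.2 hpq)
  obtain ⟨X, Y, S, Z, hpot, hpert⟩ := hC l hl1
  have hl0 : 0 < l := by linarith
  let G : ℝ × ℝ → ℝ := fun v => g (l * (v.2 - s * v.1))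
  let η : ℝ × ℝ → ℝ := fun v => f v.1 * k v.2
  let τ : ℝ × ℝ → ℝ := fun v => θ + η v * (G v - θ)
  let c' : ℝ × ℝ → ℝ := fun v =>
    τ v * (1 - τ v) * L + ε₁ + (1 - η v) * (c v - θ * (1 - θ) * L - ε₁)
  have hG : Continuous G := by simp only [G]; fun_prop
  have hη : Continuous η := by
    have := sf.continuous; have := sk.continuous
    simp only [η]; fun_prop
  have hη0 : ∀ v, 0 ≤ η v := fun v => mul_nonneg (f0 _) (k0 _)
  have hη1 : ∀ v, η v ≤ 1 := fun v => mul_le_one₀ (f1 _) (k0 _) (k1 _)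
  have hGb : ∀ v, μ ≤ G v ∧ G v ≤ 1 - μ := fun v => gb _
  have hτ : ∀ v, μ ≤ τ v ∧ τ v ≤ 1 - μ := fun v => by
    have := hGb v; have := hη0 v; have := hη1 v
    simp only [τ]
    constructor <;> nlinarith
  have hpot' : Potentials (openBox a b p q) ε X Y S Z := hpot.mono (prod_mono tf tk) hlε
  have hηoff : ∀ v, v ∉ openBox a b p q → η v = 0 := by
    intro v hv
    by_cases h1 : v.1 ∈ tsupport f
    · have h2 : v.2 ∉ tsupport k := fun h2 => hv ⟨tf h1, tk h2⟩
      simp [η, image_eq_zero_of_notMem_tsupport h2]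
    · simp [η, image_eq_zero_of_notMem_tsupport h1]
  have hoff : ∀ v, v ∉ openBox a b p q → c' v = c v := by
    intro v hv
    simp only [c', τ, hηoff v hv]; ring
  have hnear : ∀ v ∈ box a b p q,
      ‖z v + pert α β X Y S v - lam κ γ x y s (τ v)‖ ≤ 2 * e := by
    intro v hv
    have h1 := (hball v (hbox hv)).1.le
    have h2 := (hpert v).trans hle
    have h3 : z v + pert α β X Y S v - lam κ γ x y s (τ v) = (z v - lam κ γ x y s θ) +
        (pert α β X Y S v - ((y - x) * (g (l * (v.2 - s * v.1)) - θ) * f v.1 * k v.2) •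
          dir s (chord κ γ x y)) := by
      simp only [lam, τ, η, G]; module
    rw [h3]
    linarith [norm_add_le (z v - lam κ γ x y s θ) (pert α β X Y S v -
      ((y - x) * (g (l * (v.2 - s * v.1)) - θ) * f v.1 * k v.2) • dir s (chord κ γ x y))]
  have hτc : Continuous τ := by simp only [τ]; fun_prop
  have hc'c : Continuous c' := by simp only [c']; fun_prop
  have hmem : ∀ v, (z v + pert α β X Y S v, c' v) ∈ lamSet κ γ := by
    intro v
    by_cases hv : v ∈ openBox a b p q
    · have hv' := openBox_subset_box _ _ _ _ hv
      refine tube (τ v) _ _ (hτ v).1 (hτ v).2 ((hnear v hv').trans_lt (by linarith)) ?_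
      have := mul_nonneg (sub_nonneg.2 (hη1 v)) (sub_nonneg.2 (hball v (hbox hv')).2.2.le)
      simp only [c']
      linarith
    · rw [hpot'.pert_eq_zero α β hv, add_zero, hoff v hv]
      exact hW v
  have hV := volume_real_box hab.le hpq.le
  have hba : 0 < b - a := sub_pos.2 hab
  have hqp : 0 < q - p := sub_pos.2 hpq
  have hVp : 0 < (b - a) * (q - p) := mul_pos hba hqp
  have hεV : 0 < ε * ((b - a) * (q - p)) := mul_pos hε hVp
  refine ⟨X, Y, S, Z, c', hpot', hc'c, hoff, hmem, ?_, ?_⟩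
  · have h1 : ∫ v in box a b p q, c' v ≤ ∫ v in box a b p q,
        (G v * (1 - G v) * L + ε₁ + (1 - η v) * (L + c x₀ + 1)) := by
      refine setIntegral_mono_on (integrableOn_box hc'c _ _ _ _)
        (integrableOn_box (by fun_prop) _ _ _ _) (measurableSet_box _ _ _ _) fun v hv => ?_
      have b1 := hGb v
      have b2 := hτ v
      have b3 := hη0 v
      have b4 := hη1 v
      have b5 := (hball v (hbox hv)).2.1.2
      have b6 : τ v * (1 - τ v) - G v * (1 - G v) = (1 - η v) * ((θ - G v) * (1 - τ v - G v)) := by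
        simp only [τ]; ring
      have b7 : (θ - G v) * (1 - τ v - G v) ≤ 1 := by nlinarith
      have b8 : (1 - η v) * ((θ - G v) * (1 - τ v - G v)) ≤ (1 - η v) * 1 :=
        mul_le_mul_of_nonneg_left b7 (by linarith)
      have b9 : 0 < θ * (1 - θ) * L := mul_pos (mul_pos hθ0 (by linarith)) hL
      have b10 : (1 - η v) * (c v - θ * (1 - θ) * L - ε₁) ≤ (1 - η v) * (c x₀ + 1) :=
        mul_le_mul_of_nonneg_left (by linarith) (by linarith)
      have b11 := mul_le_mul_of_nonneg_right (b6.le.trans b8) hL.le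
      simp only [c']
      linarith
    have h2 : ∫ v in box a b p q, (G v * (1 - G v) * L + ε₁ + (1 - η v) * (L + c x₀ + 1)) =
        (∫ v in box a b p q, G v * (1 - G v)) * L + ε₁ * ((b - a) * (q - p)) +
          (∫ v in box a b p q, (1 - η v)) * (L + c x₀ + 1) := by
      rw [integral_add (integrableOn_box (by fun_prop) _ _ _ _)
        (integrableOn_box (by fun_prop) _ _ _ _), integral_add
        (integrableOn_box (by fun_prop) _ _ _ _) (integrableOn_box (by fun_prop) _ _ _ _),
        integral_mul_const, integral_mul_const, setIntegral_const, hV, smul_eq_mul]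
      ring
    have h3 : ∫ v in box a b p q, G v * (1 - G v) ≤
        (b - a) * ((q - p + l⁻¹) * ∫ u in (0:ℝ)..1, g u * (1 - g u)) :=
      setIntegral_box_wave_le (G := fun u => g u * (1 - g u)) (by fun_prop)
        (fun u => by simp only [gp u])
        (fun u => mul_nonneg (hμ.le.trans (gb u).1) (by linarith [(gb u).2])) hab.le hpq.le hl0 s
    have h4 : ∫ v in box a b p q, (1 - η v) ≤ 2 * ν * ((b - a) * (q - p)) :=
      setIntegral_box_one_sub_mul_le sf.continuous sk.continuous f1 k1 hab.le hpq.le fi ki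
    have h5 : (b - a) * ((q - p + l⁻¹) * ∫ u in (0:ℝ)..1, g u * (1 - g u)) ≤
        (b - a) * ((q - p + (q - p)) * (ε / (8 * L))) := by
      have : 0 ≤ q - p + l⁻¹ := by positivity
      refine mul_le_mul_of_nonneg_left ((mul_le_mul_of_nonneg_left gi this).trans ?_) hba.le
      gcongr
    have h6 : (b - a) * ((q - p + (q - p)) * (ε / (8 * L))) * L = ε / 4 * ((b - a) * (q - p)) := by
      field_simp; ring
    have h7 := mul_le_mul_of_nonneg_right (h3.trans h5) hL.le
    have h8 := mul_le_mul_of_nonneg_right h4 hM.le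
    have h9 := mul_le_mul_of_nonneg_right hν hVp.le
    have h10 := mul_le_mul_of_nonneg_right hε₁ε hVp.le
    rw [hV]
    linarith
  · have h1 : ∫ v in box a b p q, gap (z v + pert α β X Y S v) (z v) ≤
        ∫ v in box a b p q, (|G v - θ| * (L / 2) + ε / 4) := by
      refine integral_mono_of_nonneg (Eventually.of_forall fun v => gap_nonneg _ _)
        (integrableOn_box (by fun_prop) _ _ _ _) ?_
      refine (ae_restrict_iff' (measurableSet_box _ _ _ _)).2 (Eventually.of_forall fun v hv => ?_)
      have b2 := hτ v
      have h := gap_le_of_near hκ hγ hx hxy hθ0 hθ1 (hμ.trans_le b2.1) (by linarith [b2.2]) he2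
        (hball v (hbox hv)).1.le (hnear v hv)
      have h' : |τ v - θ| ≤ |G v - θ| := by
        have : τ v - θ = η v * (G v - θ) := by simp only [τ]; ring
        rw [this, abs_mul, abs_of_nonneg (hη0 v)]
        exact mul_le_of_le_one_left (abs_nonneg _) (hη1 v)
      have := mul_le_mul_of_nonneg_right h' (half_pos hL).le
      linarith
    have h2 : ∫ v in box a b p q, (|G v - θ| * (L / 2) + ε / 4) =
        (∫ v in box a b p q, |G v - θ|) * (L / 2) + ε / 4 * ((b - a) * (q - p)) := by
      rw [integral_add (integrableOn_box (by fun_prop) _ _ _ _)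
        (integrableOn_box (by fun_prop) _ _ _ _), integral_mul_const, setIntegral_const, hV,
        smul_eq_mul]
      ring
    have h3 : ∫ v in box a b p q, |G v - θ| ≤
        (b - a) * ((q - p + l⁻¹) * ∫ u in (0:ℝ)..1, |g u - θ|) :=
      setIntegral_box_wave_le (G := fun u => |g u - θ|) (by fun_prop)
        (fun u => by simp only [gp u]) (fun u => abs_nonneg _) hab.le hpq.le hl0 s
    have h4 := integral_abs_sub_mean_le gc
      (fun u => ⟨hμ.le.trans (gb u).1, by linarith [(gb u).2]⟩) hθ0.le hθ1.le gm
    have h5 : (b - a) * ((q - p + l⁻¹) * ∫ u in (0:ℝ)..1, |g u - θ|) ≤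
        (b - a) * ((q - p + l⁻¹) * (2 * (θ * (1 - θ)))) := by
      have : 0 ≤ q - p + l⁻¹ := by positivity
      gcongr
    have h6 := mul_le_mul_of_nonneg_right (h3.trans h5) (half_pos hL).le
    have h7 : c x₀ * ((b - a) * (q - p)) ≤
        (∫ v in box a b p q, c v) + ε / 4 * ((b - a) * (q - p)) := by
      have e1 : c x₀ * ((b - a) * (q - p)) = ∫ v in box a b p q, c x₀ := by
        rw [setIntegral_const, hV, smul_eq_mul]; ring
      have e2 : (∫ v in box a b p q, c v) + ε / 4 * ((b - a) * (q - p)) =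
          ∫ v in box a b p q, (c v + ε / 4) := by
        rw [integral_add (integrableOn_box (by fun_prop) _ _ _ _)
          (integrableOn_box (by fun_prop) _ _ _ _), setIntegral_const, hV, smul_eq_mul]; ring
      rw [e1, e2]
      exact setIntegral_mono_on (integrableOn_box (by fun_prop) _ _ _ _)
        (integrableOn_box (by fun_prop) _ _ _ _) (measurableSet_box _ _ _ _)
        fun v hv => (hball v (hbox hv)).2.1.1.le
    have hli : 0 < l⁻¹ := by positivity
    have h8 : (b - a) * ((q - p + l⁻¹) * (2 * (θ * (1 - θ)))) * (L / 2) ≤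
        (b - a) * ((q - p + l⁻¹) * c x₀) := by
      have : (b - a) * ((q - p + l⁻¹) * (2 * (θ * (1 - θ)))) * (L / 2) =
        (b - a) * ((q - p + l⁻¹) * (θ * (1 - θ) * L)) := by ring
      rw [this]
      gcongr
    have h9 := mul_le_mul_of_nonneg_left hlc hba.le
    rw [hV]
    linarith

lemma tsupport_add_subset' {F G : ℝ × ℝ → ℝ} {U V : Set (ℝ × ℝ)} (hF : tsupport F ⊆ U)
    (hG : tsupport G ⊆ V) : tsupport (fun x => F x + G x) ⊆ U ∪ V := by
  refine (closure_minimal ?_ ((isClosed_tsupport F).union (isClosed_tsupport G))).trans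
    (union_subset_union hF hG)
  intro x hx
  by_contra h
  rw [mem_union, not_or] at h
  exact hx (by simp [image_eq_zero_of_notMem_tsupport h.1, image_eq_zero_of_notMem_tsupport h.2])

lemma dt_add {F G : ℝ × ℝ → ℝ} (hF : ContDiff ℝ 1 F) (hG : ContDiff ℝ 1 G) (x : ℝ × ℝ) :
    dt (fun x => F x + G x) x = dt F x + dt G x := by
  rw [dt, fderiv_fun_add (hF.differentiable one_ne_zero x) (hG.differentiable one_ne_zero x)]
  rfl

lemma dr_add {F G : ℝ × ℝ → ℝ} (hF : ContDiff ℝ 1 F) (hG : ContDiff ℝ 1 G) (x : ℝ × ℝ) :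
    dr (fun x => F x + G x) x = dr F x + dr G x := by
  rw [dr, fderiv_fun_add (hF.differentiable one_ne_zero x) (hG.differentiable one_ne_zero x)]
  rfl

lemma dt_eq_zero_of_notMem {F : ℝ × ℝ → ℝ} {Q : Set (ℝ × ℝ)} (h : tsupport F ⊆ Q) {x : ℝ × ℝ}
    (hx : x ∉ Q) : dt F x = 0 := by
  rw [dt, fderiv_eq_zero_of_notMem h hx]; rfl

lemma dr_eq_zero_of_notMem {F : ℝ × ℝ → ℝ} {Q : Set (ℝ × ℝ)} (h : tsupport F ⊆ Q) {x : ℝ × ℝ}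
    (hx : x ∉ Q) : dr F x = 0 := by
  rw [dr, fderiv_eq_zero_of_notMem h hx]; rfl

lemma eq_zero_of_notMem {F : ℝ × ℝ → ℝ} {Q : Set (ℝ × ℝ)} (h : tsupport F ⊆ Q) {x : ℝ × ℝ}
    (hx : x ∉ Q) : F x = 0 :=
  image_eq_zero_of_notMem_tsupport fun h' => hx (h h')

lemma abs_add_le_of_disjoint {U V : Set (ℝ × ℝ)} (hUV : Disjoint U V) {F G : ℝ × ℝ → ℝ} {ε : ℝ}
    (hF : ∀ x, x ∉ U → F x = 0) (hG : ∀ x, x ∉ V → G x = 0) (h1 : ∀ x, |F x| ≤ ε)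
    (h2 : ∀ x, |G x| ≤ ε) (x : ℝ × ℝ) : |F x + G x| ≤ ε := by
  by_cases hx : x ∈ U
  · rw [hG x (disjoint_left.1 hUV hx), add_zero]; exact h1 x
  · rw [hF x hx, zero_add]; exact h2 x

lemma Potentials.add {U V : Set (ℝ × ℝ)} (hUV : Disjoint U V) {ε : ℝ}
    {X Y S Z X' Y' S' Z' : ℝ × ℝ → ℝ} (h : Potentials U ε X Y S Z)
    (h' : Potentials V ε X' Y' S' Z') :
    Potentials (U ∪ V) ε (fun x => X x + X' x) (fun x => Y x + Y' x) (fun x => S x + S' x)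
      (fun x => Z x + Z' x) where
  smoothX := h.smoothX.add h'.smoothX
  smoothY := h.smoothY.add h'.smoothY
  smoothS := h.smoothS.add h'.smoothS
  smoothZ := h.smoothZ.add h'.smoothZ
  suppX := tsupport_add_subset' h.suppX h'.suppX
  suppY := tsupport_add_subset' h.suppY h'.suppY
  suppS := tsupport_add_subset' h.suppS h'.suppS
  suppZ := tsupport_add_subset' h.suppZ h'.suppZ
  compat x := by
    rw [dt_add h.smoothX h'.smoothX, dr_add h.smoothY h'.smoothY, h.compat, h'.compat]
  leX := abs_add_le_of_disjoint hUV (fun _ => eq_zero_of_notMem h.suppX)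
    (fun _ => eq_zero_of_notMem h'.suppX) h.leX h'.leX
  leY := abs_add_le_of_disjoint hUV (fun _ => eq_zero_of_notMem h.suppY)
    (fun _ => eq_zero_of_notMem h'.suppY) h.leY h'.leY
  leS := abs_add_le_of_disjoint hUV (fun _ => eq_zero_of_notMem h.suppS)
    (fun _ => eq_zero_of_notMem h'.suppS) h.leS h'.leS
  leZ := abs_add_le_of_disjoint hUV (fun _ => eq_zero_of_notMem h.suppZ)
    (fun _ => eq_zero_of_notMem h'.suppZ) h.leZ h'.leZ
  leRem x := by
    rw [dt_add h.smoothY h'.smoothY, dr_add h.smoothZ h'.smoothZ]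
    have := abs_add_le_of_disjoint hUV (F := fun x => dt Y x + S x - dr Z x)
      (G := fun x => dt Y' x + S' x - dr Z' x)
      (fun x hx => by simp [dt_eq_zero_of_notMem h.suppY hx, eq_zero_of_notMem h.suppS hx,
        dr_eq_zero_of_notMem h.suppZ hx])
      (fun x hx => by simp [dt_eq_zero_of_notMem h'.suppY hx, eq_zero_of_notMem h'.suppS hx,
        dr_eq_zero_of_notMem h'.suppZ hx]) h.leRem h'.leRem x
    convert this using 2
    ring

lemma Potentials.pert_add {U V : Set (ℝ × ℝ)} {ε ε' : ℝ}
    {X Y S Z X' Y' S' Z' : ℝ × ℝ → ℝ} (h : Potentials U ε X Y S Z)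
    (h' : Potentials V ε' X' Y' S' Z') (α β : ℝ → ℝ) (x : ℝ × ℝ) :
    pert α β (fun x => X x + X' x) (fun x => Y x + Y' x) (fun x => S x + S' x) x =
      pert α β X Y S x + pert α β X' Y' S' x := by
  simp only [pert, dt_add h.smoothX h'.smoothX, dr_add h.smoothX h'.smoothX,
    dt_add h.smoothY h'.smoothY, dr_add h.smoothS h'.smoothS, Prod.mk_add_mk]
  ring_nf

lemma Refinable.union {κ γ : ℝ} {α β : ℝ → ℝ} {z : ℝ × ℝ → St} {c : ℝ × ℝ → ℝ}
    {U V P Q : Set (ℝ × ℝ)} {ε : ℝ}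
    (hα : Continuous α) (hβ : Continuous β) (hα0 : ∀ r, 0 < α r) (hβ0 : ∀ r, 0 < β r)
    (hz : Continuous z) (hc : Continuous c)
    (hW : ∀ x, (z x, c x) ∈ lamSet κ γ)
    (hUP : U ⊆ P) (hVQ : V ⊆ Q) (hPQ : Disjoint P Q) (hP : MeasurableSet P) (hQ : MeasurableSet Q)
    (hPc : ∃ K, IsCompact K ∧ P ⊆ K) (hQc : ∃ K, IsCompact K ∧ Q ⊆ K)
    (h : Refinable κ γ α β z c U P ε) (h' : Refinable κ γ α β z c V Q ε) :
    Refinable κ γ α β z c (U ∪ V) (P ∪ Q) ε := by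
  obtain ⟨X, Y, S, Z, c₁, h⟩ := h
  obtain ⟨X', Y', S', Z', c₂, h'⟩ := h'
  obtain ⟨K, hK, hPK⟩ := hPc
  obtain ⟨K', hK', hQK⟩ := hQc
  have hUV : Disjoint U V := hPQ.mono hUP hVQ
  have int1 : ∀ F : ℝ × ℝ → ℝ, Continuous F → IntegrableOn F P := fun F hF =>
    (hF.continuousOn.integrableOn_compact hK).mono_set hPK
  have int2 : ∀ F : ℝ × ℝ → ℝ, Continuous F → IntegrableOn F Q := fun F hF =>
    (hF.continuousOn.integrableOn_compact hK').mono_set hQK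
  have hpos : ∀ (w : St) (e : ℝ), (w, e) ∈ lamSet κ γ → w.1 ≠ 0 := by
    rintro w e ⟨x, y, s, θ, hx, hxy, h0, h1, h2, -⟩
    simp only at h2
    rw [h2, lam_fst]
    have : 0 < (1 - θ) * x + θ * y := by nlinarith
    exact this.ne'
  have hpot := h.pot.add hUV h'.pot
  have hpa := h.pot.pert_add h'.pot α β
  let c' : ℝ × ℝ → ℝ := fun x => c₁ x + c₂ x - c x
  have e1 : ∀ x, x ∉ V → pert α β (fun x => X x + X' x) (fun x => Y x + Y' x)
      (fun x => S x + S' x) x = pert α β X Y S x ∧ c' x = c₁ x := fun x hx => by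
    rw [hpa, h'.pot.pert_eq_zero α β hx]
    simp [c', h'.eq_off x hx]
  have e2 : ∀ x, x ∉ U → pert α β (fun x => X x + X' x) (fun x => Y x + Y' x)
      (fun x => S x + S' x) x = pert α β X' Y' S' x ∧ c' x = c₂ x := fun x hx => by
    rw [hpa, h.pot.pert_eq_zero α β hx]
    simp [c', h.eq_off x hx]
  have hmem : ∀ x, (z x + pert α β (fun x => X x + X' x) (fun x => Y x + Y' x)
      (fun x => S x + S' x) x, c' x) ∈ lamSet κ γ := fun x => by
    by_cases hx : x ∈ U
    · rw [(e1 x (disjoint_left.1 hUV hx)).1, (e1 x (disjoint_left.1 hUV hx)).2]; exact h.mem x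
    · rw [(e2 x hx).1, (e2 x hx).2]; exact h'.mem x
  have hc' : Continuous c' := (h.cont.add h'.cont).sub hc
  have hV : volume.real (P ∪ Q) = volume.real P + volume.real Q :=
    measureReal_union hPQ hQ ((measure_mono hPK).trans_lt hK.measure_lt_top).ne
      ((measure_mono hQK).trans_lt hK'.measure_lt_top).ne
  have hP' : ∀ x ∈ P, x ∉ V := fun x hx hx' => disjoint_left.1 hPQ hx (hVQ hx')
  have hQ' : ∀ x ∈ Q, x ∉ U := fun x hx hx' => disjoint_left.1 hPQ (hUP hx') hx
  refine ⟨_, _, _, _, c', hpot, hc', fun x hx => ?_, hmem, ?_, ?_⟩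
  · rw [mem_union, not_or] at hx
    rw [(e1 x hx.2).2, h.eq_off x hx.1]
  · rw [setIntegral_union hPQ hQ (int1 _ hc') (int2 _ hc'),
      setIntegral_congr_fun hP fun x hx => (e1 x (hP' x hx)).2,
      setIntegral_congr_fun hQ fun x hx => (e2 x (hQ' x hx)).2, hV]
    linarith [h.int_le, h'.int_le]
  · have hg : Continuous fun x => gap (z x + pert α β (fun x => X x + X' x) (fun x => Y x + Y' x)
      (fun x => S x + S' x) x) (z x) :=
      continuous_gap (hz.add (hpot.continuous_pert hα hβ hα0 hβ0)) hz
        (fun x => hpos _ _ (hmem x)) (fun x => hpos _ _ (hW x))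
    rw [setIntegral_union hPQ hQ (int1 _ hg) (int2 _ hg),
      setIntegral_union hPQ hQ (int1 _ hc) (int2 _ hc),
      setIntegral_congr_fun hP fun x hx => congrArg (fun w => gap (z x + w) (z x)) (e1 x (hP' x hx)).1,
      setIntegral_congr_fun hQ fun x hx => congrArg (fun w => gap (z x + w) (z x)) (e2 x (hQ' x hx)).1,
      hV]
    linarith [h.gap_le, h'.gap_le]

lemma Refinable.mono {κ γ : ℝ} {α β : ℝ → ℝ} {z : ℝ × ℝ → St} {c : ℝ × ℝ → ℝ}
    {U V P Q : Set (ℝ × ℝ)} {ε : ℝ} (h : Refinable κ γ α β z c U P ε) (hUV : U ⊆ V) (hPQ : P = Q) :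
    Refinable κ γ α β z c V Q ε := by
  obtain ⟨X, Y, S, Z, c', h⟩ := h
  subst hPQ
  exact ⟨X, Y, S, Z, c', h.pot.mono hUV le_rfl, h.cont, fun x hx => h.eq_off x fun h' => hx (hUV h'),
    h.mem, h.int_le, h.gap_le⟩

lemma box_split_left {a b m p q : ℝ} (h1 : a ≤ m) (h2 : m ≤ b) :
    box a m p q ∪ box m b p q = box a b p q ∧ Disjoint (box a m p q) (box m b p q) ∧
      openBox a m p q ∪ openBox m b p q ⊆ openBox a b p q := by
  refine ⟨?_, ?_, union_subset (prod_mono (Ioo_subset_Ioo_right h2) subset_rfl)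
    (prod_mono (Ioo_subset_Ioo_left h1) subset_rfl)⟩
  · rw [box, box, box, ← union_prod, Ioc_union_Ioc_eq_Ioc h1 h2]
  · exact Disjoint.set_prod_left (Ioc_disjoint_Ioc_of_le le_rfl) _ _

lemma box_split_right {a b m p q : ℝ} (h1 : p ≤ m) (h2 : m ≤ q) :
    box a b p m ∪ box a b m q = box a b p q ∧ Disjoint (box a b p m) (box a b m q) ∧
      openBox a b p m ∪ openBox a b m q ⊆ openBox a b p q := by
  refine ⟨?_, ?_, union_subset (prod_mono subset_rfl (Ioo_subset_Ioo_right h2))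
    (prod_mono subset_rfl (Ioo_subset_Ioo_left h1))⟩
  · rw [box, box, box, ← prod_union, Ioc_union_Ioc_eq_Ioc h1 h2]
  · exact Disjoint.set_prod_right (Ioc_disjoint_Ioc_of_le le_rfl) _ _

/-- A subsolution can be refined on any box away from the origin. -/
lemma refinable_box {κ γ : ℝ} {α β : ℝ → ℝ} (hκ : 0 < κ) (hγ : 1 < γ)
    (hα : ContDiff ℝ ∞ α) (hβ : ContDiff ℝ ∞ β) (hα0 : ∀ r, 0 < α r) (hβ0 : ∀ r, 0 < β r)
    {z : ℝ × ℝ → St} {c : ℝ × ℝ → ℝ} (hz : Continuous z) (hc : Continuous c)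
    (hW : ∀ x, (z x, c x) ∈ lamSet κ γ) {ε a b p q : ℝ} (hε : 0 < ε) (hab : a < b) (hp : 0 < p)
    (hpq : p < q) : Refinable κ γ α β z c (openBox a b p q) (box a b p q) ε := by
  choose δ hδ hloc using fun x₀ =>
    exists_radius_refinable hκ hγ hα hβ hα0 hβ0 hz hc hW x₀ hε
  obtain ⟨ε', hε', hleb⟩ := lebesgue_number_lemma_of_metric
    (isCompact_Icc.prod isCompact_Icc : IsCompact (Icc a b ×ˢ Icc p q))
    (c := fun x₀ => Metric.ball x₀ (δ x₀)) (fun _ => Metric.isOpen_ball)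
    (fun x _ => mem_iUnion.2 ⟨x, Metric.mem_ball_self (hδ x)⟩)
  have key : ∀ (N : ℕ) (a' b' p' q' : ℝ), a' < b' → p' < q' → a ≤ a' → b' ≤ b → p ≤ p' → q' ≤ q →
      b' - a' ≤ 2 ^ N * (ε' / 2) → q' - p' ≤ 2 ^ N * (ε' / 2) →
      Refinable κ γ α β z c (openBox a' b' p' q') (box a' b' p' q') ε := by
    intro N
    induction N with
    | zero =>
      intro a' b' p' q' h1 h2 h3 h4 h5 h6 h7 h8
      obtain ⟨x₀, hx₀⟩ := hleb (a', p') ⟨⟨h3, by linarith⟩, ⟨h5, by linarith⟩⟩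
      refine hloc x₀ a' b' p' q' h1 h2 (by linarith) fun v hv => hx₀ ?_
      rw [Metric.mem_ball, Prod.dist_eq, Real.dist_eq, Real.dist_eq]
      obtain ⟨⟨q1, q2⟩, q3, q4⟩ := hv
      refine max_lt ?_ ?_ <;> rw [abs_of_nonneg (by simp only; linarith)] <;> simp only at * <;>
        linarith
    | succ N ih =>
      intro a' b' p' q' h1 h2 h3 h4 h5 h6 h7 h8
      rw [pow_succ] at h7 h8
      have glue := fun (U V P Q : Set (ℝ × ℝ)) => Refinable.union (U := U) (V := V) (P := P) (Q := Q)
        (ε := ε) hα.continuous hβ.continuous hα0 hβ0 hz hc hW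
      have hcpt : ∀ a b p q : ℝ, ∃ K, IsCompact K ∧ box a b p q ⊆ K := fun a b p q =>
        ⟨_, isCompact_Icc.prod isCompact_Icc, box_subset_Icc a b p q⟩
      have half : ∀ a'' b'', a'' < b'' → a ≤ a'' → b'' ≤ b → b'' - a'' ≤ 2 ^ N * (ε' / 2) →
          Refinable κ γ α β z c (openBox a'' b'' p' q') (box a'' b'' p' q') ε := by
        intro a'' b'' g1 g2 g3 g4
        obtain ⟨s1, s2, s3⟩ := box_split_right (a := a'') (b := b'') (p := p') (q := q')
          (m := (p' + q') / 2) (by linarith) (by linarith)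
        exact (glue _ _ _ _ (openBox_subset_box _ _ _ _) (openBox_subset_box _ _ _ _) s2
          (measurableSet_box _ _ _ _) (measurableSet_box _ _ _ _) (hcpt _ _ _ _) (hcpt _ _ _ _)
          (ih a'' b'' p' ((p' + q') / 2) g1 (by linarith) g2 g3 h5 (by linarith) g4 (by linarith))
          (ih a'' b'' ((p' + q') / 2) q' g1 (by linarith) g2 g3 (by linarith) h6 g4
            (by linarith))).mono s3 s1
      obtain ⟨s1, s2, s3⟩ := box_split_left (a := a') (b := b') (p := p') (q := q')
        (m := (a' + b') / 2) (by linarith) (by linarith)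
      exact (glue _ _ _ _ (openBox_subset_box _ _ _ _) (openBox_subset_box _ _ _ _) s2
        (measurableSet_box _ _ _ _) (measurableSet_box _ _ _ _) (hcpt _ _ _ _) (hcpt _ _ _ _)
        (half a' ((a' + b') / 2) (by linarith) h3 (by linarith) (by linarith))
        (half ((a' + b') / 2) b' (by linarith) (by linarith) h4 (by linarith))).mono s3 s1
  obtain ⟨N, hN⟩ := pow_unbounded_of_one_lt ((b - a + (q - p)) / (ε' / 2)) one_lt_two
  rw [div_lt_iff₀ (by positivity)] at hN
  exact key N a b p q hab hpq le_rfl le_rfl le_rfl le_rfl (by linarith) (by linarith)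

/-- The coordinatewise pairing of state vectors. -/
def pairing (w v : St) : ℝ :=
  w.1 * v.1 + w.2.1 * v.2.1 + w.2.2.1 * v.2.2.1 + w.2.2.2 * v.2.2.2

lemma continuous_pairing : Continuous fun y : St × St => pairing y.1 y.2 := by
  unfold pairing; fun_prop

lemma abs_coords_le (v : St) : |v.1| ≤ ‖v‖ ∧ |v.2.1| ≤ ‖v‖ ∧ |v.2.2.1| ≤ ‖v‖ ∧ |v.2.2.2| ≤ ‖v‖ := by
  have h1 := norm_snd_le v
  have h2 := norm_snd_le v.2
  exact ⟨norm_fst_le v, (norm_fst_le v.2).trans h1, (norm_fst_le v.2.2).trans (h2.trans h1),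
    (norm_snd_le v.2.2).trans (h2.trans h1)⟩

lemma abs_pairing_le (w v : St) : |pairing w v| ≤ 4 * (‖w‖ * ‖v‖) := by
  obtain ⟨a1, a2, a3, a4⟩ := abs_coords_le w
  obtain ⟨b1, b2, b3, b4⟩ := abs_coords_le v
  have key : ∀ {x y : ℝ}, |x| ≤ ‖w‖ → |y| ≤ ‖v‖ → |x * y| ≤ ‖w‖ * ‖v‖ := fun hx hy => by
    rw [abs_mul]; exact mul_le_mul hx hy (abs_nonneg _) (norm_nonneg _)
  have h1 := abs_le.1 (key a1 b1)
  have h2 := abs_le.1 (key a2 b2)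
  have h3 := abs_le.1 (key a3 b3)
  have h4 := abs_le.1 (key a4 b4)
  unfold pairing
  rw [abs_le]; constructor <;> linarith [h1.1, h1.2, h2.1, h2.2, h3.1, h3.2, h4.1, h4.2]

lemma hasSum_pairing_right {d : ℕ → St} {s : St} (h : HasSum d s) (w : St) :
    HasSum (fun k => pairing w (d k)) (pairing w s) := by
  let L : St →+ ℝ :=
    { toFun := pairing w
      map_zero' := by simp [pairing]
      map_add' := fun x y => by simp only [pairing, Prod.fst_add, Prod.snd_add]; ring }
  exact h.map L (continuous_pairing.comp (by fun_prop : Continuous fun v : St => (w, v)))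

lemma ae_summable_of_summable_integral {Ω : Type*} [MeasurableSpace Ω] {μ : Measure Ω}
    {F : ℕ → Ω → ℝ} (hF : ∀ k, Integrable (F k) μ) (h0 : ∀ k x, 0 ≤ F k x)
    (hs : Summable fun k => ∫ x, F k x ∂μ) : ∀ᵐ x ∂μ, Summable fun k => F k x := by
  have h1 : ∀ k, ∫⁻ x, ENNReal.ofReal (F k x) ∂μ = ENNReal.ofReal (∫ x, F k x ∂μ) := fun k =>
    (ofReal_integral_eq_lintegral_ofReal (hF k) (Eventually.of_forall (h0 k))).symm
  have h2 : ∫⁻ x, ∑' k, ENNReal.ofReal (F k x) ∂μ ≠ ⊤ := by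
    rw [lintegral_tsum fun k => (hF k).aestronglyMeasurable.aemeasurable.ennreal_ofReal]
    simp_rw [h1]
    exact hs.tsum_ofReal_ne_top
  have h3 := ae_lt_top' (AEMeasurable.tsum fun k =>
    (hF k).aestronglyMeasurable.aemeasurable.ennreal_ofReal) h2
  filter_upwards [h3] with x hx
  have h4 := ENNReal.summable_toReal hx.ne
  simpa [ENNReal.toReal_ofReal (h0 _ x)] using h4

lemma integrable_tsum_of_summable {Ω E : Type*} [MeasurableSpace Ω] [NormedAddCommGroup E]
    [CompleteSpace E] {μ : Measure Ω} {d : ℕ → Ω → E} (hd : ∀ k, Integrable (d k) μ)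
    (hs : Summable fun k => ∫ x, ‖d k x‖ ∂μ) : Integrable (fun x => ∑' k, d k x) μ := by
  have h1 := ae_summable_of_summable_integral (fun k => (hd k).norm)
    (fun k x => norm_nonneg _) hs
  have h2 : AEStronglyMeasurable (fun x => ∑' k, d k x) μ := by
    refine aestronglyMeasurable_of_tendsto_ae atTop (f := fun N x => ∑ k ∈ Finset.range N, d k x)
      (fun N => ?_) ?_
    · exact Finset.aestronglyMeasurable_fun_sum _ fun k _ => (hd k).aestronglyMeasurable
    · filter_upwards [h1] with x hx
      exact hx.of_norm.hasSum.tendsto_sum_nat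
  refine ⟨h2, ?_⟩
  have h3 : ∀ k, ∫⁻ x, ‖d k x‖ₑ ∂μ = ENNReal.ofReal (∫ x, ‖d k x‖ ∂μ) := fun k =>
    (ofReal_integral_norm_eq_lintegral_enorm (hd k)).symm
  have h4 : ∫⁻ x, ∑' k, ‖d k x‖ₑ ∂μ < ⊤ := by
    rw [lintegral_tsum fun k => (hd k).aestronglyMeasurable.enorm]
    simp_rw [h3]
    exact hs.tsum_ofReal_lt_top
  refine lt_of_le_of_lt (lintegral_mono_ae ?_) h4
  filter_upwards [h1] with x hx
  have h5 := norm_tsum_le_tsum_norm hx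
  rw [← ofReal_norm]
  calc ENNReal.ofReal ‖∑' k, d k x‖ ≤ ENNReal.ofReal (∑' k, ‖d k x‖) := ENNReal.ofReal_le_ofReal h5
    _ = ∑' k, ‖d k x‖ₑ := by
      rw [ENNReal.ofReal_tsum_of_nonneg (fun _ => norm_nonneg _) hx]
      simp

lemma integrable_pairing {Ω : Type*} [MeasurableSpace Ω] {μ : Measure Ω} {W d : Ω → St} {C : ℝ}
    (hW : AEStronglyMeasurable W μ) (hC : ∀ᵐ x ∂μ, ‖W x‖ ≤ C) (hd : Integrable d μ) :
    Integrable (fun x => pairing (W x) (d x)) μ := by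
  refine Integrable.mono' (hd.norm.const_mul (4 * C))
    (continuous_pairing.comp_aestronglyMeasurable (hW.prodMk hd.aestronglyMeasurable)) ?_
  filter_upwards [hC] with x hx
  rw [norm_eq_abs]
  refine (abs_pairing_le _ _).trans ?_
  nlinarith [mul_le_mul_of_nonneg_right hx (norm_nonneg (d x))]

lemma hasSum_integral_pairing {Ω : Type*} [MeasurableSpace Ω] {μ : Measure Ω} {d : ℕ → Ω → St}
    (hd : ∀ k, Integrable (d k) μ) (hs : Summable fun k => ∫ x, ‖d k x‖ ∂μ) {W : Ω → St} {C : ℝ}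
    (hW : AEStronglyMeasurable W μ) (hC : ∀ᵐ x ∂μ, ‖W x‖ ≤ C) :
    HasSum (fun k => ∫ x, pairing (W x) (d k x) ∂μ) (∫ x, pairing (W x) (∑' k, d k x) ∂μ) := by
  have h1 := ae_summable_of_summable_integral (fun k => (hd k).norm)
    (fun k x => norm_nonneg _) hs
  have h2 : ∀ k, Integrable (fun x => pairing (W x) (d k x)) μ := fun k =>
    integrable_pairing hW hC (hd k)
  have h3 : Summable fun k => ∫ x, ‖pairing (W x) (d k x)‖ ∂μ := by
    refine Summable.of_nonneg_of_le (fun k => integral_nonneg fun _ => norm_nonneg _)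
      (fun k => ?_) (hs.mul_left (4 * C))
    rw [← integral_const_mul]
    refine integral_mono_ae (h2 k).norm ((hd k).norm.const_mul _) ?_
    filter_upwards [hC] with x hx
    rw [norm_eq_abs]
    refine (abs_pairing_le _ _).trans ?_
    nlinarith [mul_le_mul_of_nonneg_right hx (norm_nonneg (d k x))]
  have h4 := hasSum_integral_of_summable_integral_norm h2 h3
  have h5 : ∫ x, ∑' k, pairing (W x) (d k x) ∂μ = ∫ x, pairing (W x) (∑' k, d k x) ∂μ := by
    refine integral_congr_ae ?_
    filter_upwards [h1] with x hx
    exact (hasSum_pairing_right hx.of_norm.hasSum (W x)).tsum_eq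
  rwa [h5] at h4

lemma continuous_fderiv_apply_const {F : ℝ × ℝ → ℝ} (hF : ContDiff ℝ 1 F) (v : ℝ × ℝ) :
    Continuous fun x => fderiv ℝ F x v :=
  (hF.continuous_fderiv one_ne_zero).clm_apply continuous_const

lemma integral_fderiv_mul_eq_neg {F G : ℝ × ℝ → ℝ} (hF : ContDiff ℝ 1 F) (hG : ContDiff ℝ 1 G)
    (hc : HasCompactSupport F) (v : ℝ × ℝ) :
    ∫ x, fderiv ℝ F x v * G x = - ∫ x, F x * fderiv ℝ G x v := by
  have hF' := continuous_fderiv_apply_const hF v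
  have hG' := continuous_fderiv_apply_const hG v
  have h := integral_mul_fderiv_eq_neg_fderiv_mul_of_integrable (μ := volume) (f := F) (g := G)
    (v := v) ?_ ?_ ?_ (fun x _ => (hF.differentiable one_ne_zero) x)
    (fun x _ => (hG.differentiable one_ne_zero) x)
  · rw [h, neg_neg]
  · exact (hF'.mul hG.continuous).integrable_of_hasCompactSupport
      ((hc.fderiv_apply ℝ v).mul_right)
  · exact (hF.continuous.mul hG').integrable_of_hasCompactSupport hc.mul_right
  · exact (hF.continuous.mul hG.continuous).integrable_of_hasCompactSupport hc.mul_right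

lemma dt_dr_comm {φ : ℝ × ℝ → ℝ} (hφ : ContDiff ℝ 2 φ) (x : ℝ × ℝ) : dt (dr φ) x = dr (dt φ) x := by
  have h := (hφ.contDiffAt (x := x)).isSymmSndFDerivAt (by simp)
  have hd : DifferentiableAt ℝ (fderiv ℝ φ) x :=
    ((hφ.fderiv_right (m := 1) (by norm_num)).differentiable one_ne_zero) x
  have key : ∀ v w : ℝ × ℝ, fderiv ℝ (fun y => fderiv ℝ φ y v) x w = fderiv ℝ (fderiv ℝ φ) x w v := by
    intro v w
    rw [fderiv_clm_apply hd (differentiableAt_const v)]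
    simp
  change fderiv ℝ (fun y => fderiv ℝ φ y (0, 1)) x (1, 0) = fderiv ℝ (fun y => fderiv ℝ φ y (1, 0)) x (0, 1)
  rw [key, key]
  exact h _ _

lemma contDiff_dt {φ : ℝ × ℝ → ℝ} (hφ : ContDiff ℝ 2 φ) : ContDiff ℝ 1 (dt φ) :=
  (hφ.fderiv_right (m := 1) (by norm_num)).clm_apply contDiff_const

lemma contDiff_dr {φ : ℝ × ℝ → ℝ} (hφ : ContDiff ℝ 2 φ) : ContDiff ℝ 1 (dr φ) :=
  (hφ.fderiv_right (m := 1) (by norm_num)).clm_apply contDiff_const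

lemma integral_curl_mul_grad {F φ : ℝ × ℝ → ℝ} (hF : ContDiff ℝ 1 F) (hφ : ContDiff ℝ 2 φ)
    (hc : HasCompactSupport F) : ∫ x, (dr F x * dt φ x - dt F x * dr φ x) = 0 := by
  have h1 := integral_fderiv_mul_eq_neg hF (contDiff_dt hφ) hc (0, 1)
  have h2 := integral_fderiv_mul_eq_neg hF (contDiff_dr hφ) hc (1, 0)
  have i1 : Integrable fun x => dr F x * dt φ x :=
    ((continuous_dr hF).mul (contDiff_dt hφ).continuous).integrable_of_hasCompactSupport
      ((hc.fderiv_apply ℝ (0, 1)).mul_right)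
  have i2 : Integrable fun x => dt F x * dr φ x :=
    ((continuous_dt hF).mul (contDiff_dr hφ).continuous).integrable_of_hasCompactSupport
      ((hc.fderiv_apply ℝ (1, 0)).mul_right)
  rw [integral_sub i1 i2]
  have h3 : ∫ x, F x * fderiv ℝ (dt φ) x (0, 1) = ∫ x, F x * fderiv ℝ (dr φ) x (1, 0) := by
    congr 1; ext x; congr 1; exact (dt_dr_comm hφ x).symm
  change (∫ x, fderiv ℝ F x (0, 1) * dt φ x) - ∫ x, fderiv ℝ F x (1, 0) * dr φ x = 0
  rw [h1, h2, h3]; ring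

lemma hasCompactSupport_of_subset_openBox {F : ℝ × ℝ → ℝ} {a b p q : ℝ}
    (h : tsupport F ⊆ openBox a b p q) : HasCompactSupport F :=
  HasCompactSupport.of_support_subset_isCompact (isCompact_Icc.prod isCompact_Icc)
    ((subset_tsupport F).trans (h.trans ((openBox_subset_box a b p q).trans (box_subset_Icc a b p q))))

/-- Weights of the continuity equation. -/
def massWeight (α : ℝ → ℝ) (φ : ℝ × ℝ → ℝ) (x : ℝ × ℝ) : St :=
  (α x.2 * dt φ x, α x.2 * dr φ x, 0, 0)

/-- Weights of the momentum equation. -/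
def momWeight (α β : ℝ → ℝ) (φ : ℝ × ℝ → ℝ) (x : ℝ × ℝ) : St :=
  (0, α x.2 * dt φ x, α x.2 * dr φ x, β x.2 * φ x)

lemma Potentials.integral_mass {α β : ℝ → ℝ} {ε a b p q : ℝ} {X Y S Z : ℝ × ℝ → ℝ}
    (h : Potentials (openBox a b p q) ε X Y S Z) (hα0 : ∀ r, 0 < α r) {φ : ℝ × ℝ → ℝ}
    (hφ : ContDiff ℝ 2 φ) :
    ∫ x in box a b p q, pairing (massWeight α φ x) (pert α β X Y S x) = 0 := by
  rw [setIntegral_eq_integral_of_forall_compl_eq_zero, ← integral_curl_mul_grad h.smoothX hφ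
    (hasCompactSupport_of_subset_openBox h.suppX)]
  · congr 1; ext x
    have := (hα0 x.2).ne'
    simp only [pairing, massWeight, pert]
    field_simp; ring
  · intro x hx
    rw [h.pert_eq_zero _ _ fun hx' => hx (openBox_subset_box _ _ _ _ hx')]
    simp [pairing]

lemma Potentials.integral_mom {α β : ℝ → ℝ} {ε a b p q : ℝ} {X Y S Z : ℝ × ℝ → ℝ}
    (h : Potentials (openBox a b p q) ε X Y S Z) (hα0 : ∀ r, 0 < α r) (hβ0 : ∀ r, 0 < β r)
    {φ : ℝ × ℝ → ℝ} (hφ : ContDiff ℝ 2 φ) :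
    ∫ x in box a b p q, pairing (momWeight α β φ x) (pert α β X Y S x) = 0 := by
  have hφ1 : ContDiff ℝ 1 φ := hφ.of_le (by norm_num)
  have hS := hasCompactSupport_of_subset_openBox h.suppS
  have hY := hasCompactSupport_of_subset_openBox h.suppY
  have e1 := integral_curl_mul_grad h.smoothY hφ hY
  have e2 := integral_fderiv_mul_eq_neg h.smoothS hφ1 hS (0, 1)
  have i1 : Integrable fun x => dr Y x * dt φ x - dt Y x * dr φ x :=
    (((continuous_dr h.smoothY).mul (contDiff_dt hφ).continuous).integrable_of_hasCompactSupport
      ((hY.fderiv_apply ℝ (0, 1)).mul_right)).sub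
    (((continuous_dt h.smoothY).mul (contDiff_dr hφ).continuous).integrable_of_hasCompactSupport
      ((hY.fderiv_apply ℝ (1, 0)).mul_right))
  have i2 : Integrable fun x => dr S x * φ x :=
    ((continuous_dr h.smoothS).mul hφ.continuous).integrable_of_hasCompactSupport
      ((hS.fderiv_apply ℝ (0, 1)).mul_right)
  have i3 : Integrable fun x => S x * dr φ x :=
    (h.smoothS.continuous.mul (contDiff_dr hφ).continuous).integrable_of_hasCompactSupport
      hS.mul_right
  rw [setIntegral_eq_integral_of_forall_compl_eq_zero]
  · have e3 : ∀ x, pairing (momWeight α β φ x) (pert α β X Y S x)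
        = -(dr Y x * dt φ x - dt Y x * dr φ x) + (dr S x * φ x + S x * dr φ x) := fun x => by
      have := (hα0 x.2).ne'
      have := (hβ0 x.2).ne'
      simp only [pairing, momWeight, pert, h.compat x]
      field_simp; ring
    simp_rw [e3]
    have i4 : Integrable fun x => dr S x * φ x + S x * dr φ x := i2.add i3
    have i5 : Integrable fun x => -(dr Y x * dt φ x - dt Y x * dr φ x) := i1.neg
    rw [integral_add i5 i4, integral_neg, e1, integral_add i2 i3]
    change -0 + ((∫ x, fderiv ℝ S x (0, 1) * φ x) + ∫ x, S x * fderiv ℝ φ x (0, 1)) = 0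
    rw [e2]; ring
  · intro x hx
    rw [h.pert_eq_zero _ _ fun hx' => hx (openBox_subset_box _ _ _ _ hx')]
    simp [pairing]

lemma hasDerivAt_slice {F : ℝ × ℝ → ℝ} (hF : ContDiff ℝ 1 F) (t r : ℝ) :
    HasDerivAt (fun y => F (t, y)) (dr F (t, r)) r := by
  have h1 : HasDerivAt (fun y : ℝ => (t, y)) (0, 1) r :=
    (hasDerivAt_const r t).prodMk (hasDerivAt_id r)
  exact ((hF.differentiable one_ne_zero (t, r)).hasFDerivAt).comp_hasDerivAt r h1

/-- A test function on a slice together with its derivative and a common bound. -/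
structure SliceTest (p q M : ℝ) (ψ ψ' : ℝ → ℝ) : Prop where
  deriv : ∀ r, HasDerivAt ψ (ψ' r) r
  cont : Continuous ψ'
  le : ∀ r ∈ Ioc p q, |ψ r| ≤ M
  le' : ∀ r ∈ Ioc p q, |ψ' r| ≤ M

lemma SliceTest.continuous {p q M : ℝ} {ψ ψ' : ℝ → ℝ} (h : SliceTest p q M ψ ψ') : Continuous ψ :=
  continuous_iff_continuousAt.2 fun r => (h.deriv r).continuousAt

lemma abs_setIntegral_dr_mul_le {F : ℝ × ℝ → ℝ} {ε a b p q M t : ℝ} {ψ ψ' : ℝ → ℝ}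
    (hF : ContDiff ℝ 1 F) (hs : tsupport F ⊆ openBox a b p q) (hε : ∀ x, |F x| ≤ ε) (hpq : p ≤ q)
    (hψ : SliceTest p q M ψ ψ') : |∫ r in Ioc p q, dr F (t, r) * ψ r| ≤ ε * M * (q - p) := by
  have hz : ∀ r, r ∉ Ioo p q → F (t, r) = 0 := fun r hr =>
    eq_zero_of_notMem hs fun h => hr h.2
  have hc : Continuous fun r => dr F (t, r) := (continuous_dr hF).comp (by fun_prop)
  rw [← intervalIntegral.integral_of_le hpq]
  have h := intervalIntegral.integral_mul_deriv_eq_deriv_mul (a := p) (b := q) (u := ψ) (u' := ψ')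
    (v := fun r => F (t, r)) (v' := fun r => dr F (t, r)) (fun r _ => hψ.deriv r)
    (fun r _ => hasDerivAt_slice hF t r) (hψ.cont.intervalIntegrable _ _) (hc.intervalIntegrable _ _)
  rw [hz p (by simp), hz q (by simp)] at h
  simp only [mul_zero, sub_zero, zero_sub] at h
  simp_rw [mul_comm (dr F _)]
  rw [h, abs_neg, ← norm_eq_abs]
  have := intervalIntegral.norm_integral_le_of_norm_le_const (a := p) (b := q) (C := M * ε)
    (f := fun r => ψ' r * F (t, r)) (fun r hr => by
      rw [uIoc_of_le hpq] at hr
      rw [norm_mul]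
      exact mul_le_mul (hψ.le' r hr) (hε _) (norm_nonneg _) ((abs_nonneg _).trans (hψ.le' r hr)))
  rw [abs_of_nonneg (sub_nonneg.2 hpq)] at this
  linarith

/-- The four weighted coordinates tested against `ψ`. -/
def coordWeight (α β : ℝ → ℝ) (ψ : ℝ → ℝ) (i : Fin 4) (r : ℝ) : St :=
  match i with
  | 0 => (α r * ψ r, 0, 0, 0)
  | 1 => (0, α r * ψ r, 0, 0)
  | 2 => (0, 0, α r * ψ r, 0)
  | 3 => (0, 0, 0, β r * ψ r)

lemma continuous_coordWeight {α β ψ : ℝ → ℝ} (hα : Continuous α) (hβ : Continuous β)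
    (hψ : Continuous ψ) (i : Fin 4) : Continuous (coordWeight α β ψ i) := by
  fin_cases i <;> dsimp only [coordWeight]
  · change Continuous fun r => ((α r * ψ r, 0, 0, 0) : St); fun_prop
  · change Continuous fun r => ((0, α r * ψ r, 0, 0) : St); fun_prop
  · change Continuous fun r => ((0, 0, α r * ψ r, 0) : St); fun_prop
  · change Continuous fun r => ((0, 0, 0, β r * ψ r) : St); fun_prop

lemma Potentials.abs_slice_le {α β : ℝ → ℝ} {ε a b p q M t : ℝ} {X Y S Z : ℝ × ℝ → ℝ}
    {ψ ψ' : ℝ → ℝ} (h : Potentials (openBox a b p q) ε X Y S Z) (hα0 : ∀ r, 0 < α r)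
    (hβ0 : ∀ r, 0 < β r) (hpq : p < q) (hψ : SliceTest p q M ψ ψ') (i : Fin 4) :
    |∫ r in Ioc p q, pairing (coordWeight α β ψ i r) (pert α β X Y S (t, r))|
      ≤ 2 * (ε * M * (q - p)) := by
  have hε : 0 ≤ ε := (abs_nonneg _).trans (h.leX 0)
  have hM : 0 ≤ M := (abs_nonneg _).trans (hψ.le q ⟨hpq, le_rfl⟩)
  have h0 : 0 ≤ ε * M * (q - p) := mul_nonneg (mul_nonneg hε hM) (sub_nonneg.2 hpq.le)
  have a0 := fun r => (hα0 r).ne'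
  have b0 := fun r => (hβ0 r).ne'
  fin_cases i
  · have e : ∀ r, pairing (coordWeight α β ψ 0 r) (pert α β X Y S (t, r)) = dr X (t, r) * ψ r :=
      fun r => by have := a0 r; simp only [pairing, coordWeight, pert]; field_simp; ring
    simp only [Fin.zero_eta, e]
    linarith [abs_setIntegral_dr_mul_le (t := t) h.smoothX h.suppX h.leX hpq.le hψ]
  · have e : ∀ r, pairing (coordWeight α β ψ 1 r) (pert α β X Y S (t, r)) = -(dr Y (t, r) * ψ r) :=
      fun r => by have := a0 r; simp only [pairing, coordWeight, pert, h.compat]; field_simp; ring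
    simp only [Fin.mk_one, e]
    rw [integral_neg, abs_neg]
    linarith [abs_setIntegral_dr_mul_le (t := t) h.smoothY h.suppY h.leY hpq.le hψ]
  · have e : ∀ r, pairing (coordWeight α β ψ 2 r) (pert α β X Y S (t, r))
        = dr Z (t, r) * ψ r + (dt Y (t, r) + S (t, r) - dr Z (t, r)) * ψ r :=
      fun r => by have := a0 r; simp only [pairing, coordWeight, pert]; field_simp; ring
    simp only [Fin.reduceFinMk, e]
    have cZ : Continuous fun r => dr Z (t, r) := (continuous_dr h.smoothZ).comp (by fun_prop)
    have cY : Continuous fun r => dt Y (t, r) := (continuous_dt h.smoothY).comp (by fun_prop)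
    have cS : Continuous fun r => S (t, r) := h.smoothS.continuous.comp (by fun_prop)
    have hi : ∀ {g : ℝ → ℝ}, Continuous g → IntegrableOn g (Ioc p q) := fun hg =>
      (hg.integrableOn_Icc).mono_set Ioc_subset_Icc_self
    have i1 : IntegrableOn (fun r => dr Z (t, r) * ψ r) (Ioc p q) := hi (cZ.mul hψ.continuous)
    have i2 : IntegrableOn (fun r => (dt Y (t, r) + S (t, r) - dr Z (t, r)) * ψ r) (Ioc p q) :=
      hi (((cY.add cS).sub cZ).mul hψ.continuous)
    rw [integral_add i1 i2]
    have h1 := abs_setIntegral_dr_mul_le (t := t) h.smoothZ h.suppZ h.leZ hpq.le hψ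
    have h2 := norm_setIntegral_le_of_norm_le_const (μ := volume) (s := Ioc p q) (C := ε * M)
      (f := fun r => (dt Y (t, r) + S (t, r) - dr Z (t, r)) * ψ r) measure_Ioc_lt_top
      (fun r hr => by
        rw [norm_mul]; exact mul_le_mul (h.leRem _) (hψ.le r hr) (norm_nonneg _) hε)
    rw [Real.volume_real_Ioc_of_le hpq.le, norm_eq_abs] at h2
    exact (abs_add_le _ _).trans (by linarith)
  · have e : ∀ r, pairing (coordWeight α β ψ 3 r) (pert α β X Y S (t, r)) = dr S (t, r) * ψ r :=
      fun r => by have := b0 r; simp only [pairing, coordWeight, pert]; field_simp; ring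
    simp only [Fin.reduceFinMk, e]
    linarith [abs_setIntegral_dr_mul_le (t := t) h.smoothS h.suppS h.leS hpq.le hψ]

lemma lamSet_fst_pos {κ γ : ℝ} {w : St × ℝ} (h : w ∈ lamSet κ γ) : 0 < w.1.1 := by
  obtain ⟨x, y, s, θ, h1, h2, h3, h4, h5, -⟩ := h
  rw [h5, lam_fst]
  nlinarith [mul_pos h3 (h1.trans h2), mul_pos (sub_pos.2 h4) h1]

/-- A corrector turning the subsolution `z₀` into an exact solution in a box. -/
structure CellSolution (κ γ : ℝ) (α β : ℝ → ℝ) (z₀ : ℝ × ℝ → St) (a b p q ε : ℝ)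
    (D : ℝ × ℝ → St) : Prop where
  integrable : IntegrableOn D (box a b p q)
  exact : ∀ᵐ x ∂volume.restrict (box a b p q), 0 < (z₀ x + D x).1 ∧
    (z₀ x + D x).2.2.2 = pres κ γ (z₀ x + D x).1 ∧
    (z₀ x + D x).1 * ((z₀ x + D x).2.2.1 - (z₀ x + D x).2.2.2) = (z₀ x + D x).2.1 ^ 2
  mass : ∀ φ : ℝ × ℝ → ℝ, ContDiff ℝ 2 φ →
    ∫ x in box a b p q, pairing (massWeight α φ x) (D x) = 0
  mom : ∀ φ : ℝ × ℝ → ℝ, ContDiff ℝ 2 φ →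
    ∫ x in box a b p q, pairing (momWeight α β φ x) (D x) = 0
  slice : ∀ᵐ t ∂volume.restrict (Ioc a b), IntegrableOn (fun r => D (t, r)) (Ioc p q) ∧
    ∀ M ψ ψ', SliceTest p q M ψ ψ' → ∀ i,
      |∫ r in Ioc p q, pairing (coordWeight α β ψ i r) (D (t, r))| ≤ ε * M

lemma exists_refinement_seq {κ γ : ℝ} {α β : ℝ → ℝ} (hκ : 0 < κ) (hγ : 1 < γ)
    (hα : ContDiff ℝ ∞ α) (hβ : ContDiff ℝ ∞ β) (hα0 : ∀ r, 0 < α r) (hβ0 : ∀ r, 0 < β r)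
    {z₀ : ℝ × ℝ → St} {c₀ : ℝ × ℝ → ℝ} (hz : Continuous z₀) (hc : Continuous c₀)
    (hW : ∀ x, (z₀ x, c₀ x) ∈ lamSet κ γ) {a b p q : ℝ} (hab : a < b) (hp : 0 < p)
    (hpq : p < q) {ε : ℕ → ℝ} (hε : ∀ k, 0 < ε k) :
    ∃ (z : ℕ → ℝ × ℝ → St) (c X Y S Z : ℕ → ℝ × ℝ → ℝ), z 0 = z₀ ∧
      (∀ k, Continuous (z k) ∧ Continuous (c k) ∧ ∀ x, (z k x, c k x) ∈ lamSet κ γ) ∧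
      (∀ k, Refinement κ γ α β (z k) (c k) (openBox a b p q) (box a b p q) (ε k) (X k) (Y k) (S k)
        (Z k) (c (k + 1))) ∧
      ∀ k x, z (k + 1) x = z k x + pert α β (X k) (Y k) (S k) x := by
  let Sub := {v : (ℝ × ℝ → St) × (ℝ × ℝ → ℝ) //
    Continuous v.1 ∧ Continuous v.2 ∧ ∀ x, (v.1 x, v.2 x) ∈ lamSet κ γ}
  choose X Y S Z c' hR using fun (v : Sub) (k : ℕ) =>
    refinable_box hκ hγ hα hβ hα0 hβ0 v.2.1 v.2.2.1 v.2.2.2 (hε k) hab hp hpq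
  let step : ℕ → Sub → Sub := fun k v => ⟨(fun x => v.1.1 x + pert α β (X v k) (Y v k) (S v k) x,
    c' v k), v.2.1.add ((hR v k).pot.continuous_pert hα.continuous hβ.continuous hα0 hβ0),
    (hR v k).cont, (hR v k).mem⟩
  let s : ℕ → Sub := fun k => Nat.rec ⟨(z₀, c₀), hz, hc, hW⟩ step k
  exact ⟨fun k => (s k).1.1, fun k => (s k).1.2, fun k => X (s k) k, fun k => Y (s k) k,
    fun k => S (s k) k, fun k => Z (s k) k, rfl, fun k => (s k).2, fun k => hR (s k) k,
    fun k x => rfl⟩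

lemma exact_of_tendsto {κ γ : ℝ} (hκ : 0 < κ) (hγ : 1 < γ) {z : ℕ → St} {c : ℕ → ℝ} {w : St}
    (hW : ∀ k, (z k, c k) ∈ lamSet κ γ) (hz : Tendsto z atTop (𝓝 w)) (hc : Tendsto c atTop (𝓝 0))
    (hs : Summable fun k => |(z (k + 1)).1⁻¹ - (z k).1⁻¹|) :
    0 < w.1 ∧ w.2.2.2 = pres κ γ w.1 ∧ w.1 * (w.2.2.1 - w.2.2.2) = w.2.1 ^ 2 := by
  have hpos : ∀ k, 0 < (z k).1 := fun k => lamSet_fst_pos (hW k)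
  have h1 : Tendsto (fun k => (z k).1) atTop (𝓝 w.1) := (continuous_fst.tendsto w).comp hz
  obtain ⟨l, hl⟩ : ∃ l, Tendsto (fun k => (z k).1⁻¹) atTop (𝓝 l) := by
    have h2' : Summable fun k => (z (k + 1)).1⁻¹ - (z k).1⁻¹ := summable_abs_iff.1 hs
    have h2 := h2'.hasSum.tendsto_sum_nat
    simp_rw [Finset.sum_range_sub (fun k => (z k).1⁻¹)] at h2
    exact ⟨_, by simpa using h2.add_const (z 0).1⁻¹⟩
  have h3 : w.1 * l = 1 := by
    refine tendsto_nhds_unique (h1.mul hl) (tendsto_const_nhds.congr fun k => ?_)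
    exact (mul_inv_cancel₀ (hpos k).ne').symm
  have h4 : 0 < w.1 := lt_of_le_of_ne (ge_of_tendsto' h1 fun k => (hpos k).le)
    (fun h => by rw [← h] at h3; simp at h3)
  choose e he0 heP heq hen using fun k => exists_constraint_near hκ hγ (hW k)
  have h5 : Tendsto e atTop (𝓝 w) := by
    have h6 : Tendsto (fun k => z k - e k) atTop (𝓝 0) := squeeze_zero_norm hen hc
    simpa using hz.sub h6
  have g1 : Tendsto (fun k => (e k).1) atTop (𝓝 w.1) := (continuous_fst.tendsto w).comp h5
  have g2 : Tendsto (fun k => (e k).2.1) atTop (𝓝 w.2.1) :=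
    ((by fun_prop : Continuous fun v : St => v.2.1).tendsto w).comp h5
  have g3 : Tendsto (fun k => (e k).2.2.1) atTop (𝓝 w.2.2.1) :=
    ((by fun_prop : Continuous fun v : St => v.2.2.1).tendsto w).comp h5
  have g4 : Tendsto (fun k => (e k).2.2.2) atTop (𝓝 w.2.2.2) :=
    ((by fun_prop : Continuous fun v : St => v.2.2.2).tendsto w).comp h5
  refine ⟨h4, ?_, ?_⟩
  · refine tendsto_nhds_unique g4 ?_
    simp_rw [heP, pres]
    exact (g1.rpow_const (Or.inl h4.ne')).const_mul κ
  · refine tendsto_nhds_unique (g1.mul (g3.sub g4)) ?_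
    simp_rw [heq]
    exact g2.pow 2

lemma exists_bound_box {W : ℝ × ℝ → St} (hW : Continuous W) (a b p q : ℝ) :
    ∃ C, ∀ x ∈ box a b p q, ‖W x‖ ≤ C := by
  obtain ⟨C, hC⟩ := ((isCompact_Icc.prod isCompact_Icc : IsCompact (Icc a b ×ˢ Icc p q))).exists_bound_of_continuousOn
    hW.continuousOn
  exact ⟨C, fun x hx => hC x (box_subset_Icc _ _ _ _ hx)⟩

lemma exists_cellSolution_of_smooth {κ γ : ℝ} {α β : ℝ → ℝ} (hκ : 0 < κ) (hγ : 1 < γ)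
    (hα : ContDiff ℝ ∞ α) (hβ : ContDiff ℝ ∞ β) (hα0 : ∀ r, 0 < α r) (hβ0 : ∀ r, 0 < β r)
    {z₀ : ℝ × ℝ → St} {c₀ : ℝ × ℝ → ℝ} (hz : Continuous z₀) (hc : Continuous c₀)
    (hW : ∀ x, (z₀ x, c₀ x) ∈ lamSet κ γ) {ε a b p q : ℝ} (hε : 0 < ε) (hab : a < b) (hp : 0 < p)
    (hpq : p < q) : ∃ D, CellSolution κ γ α β z₀ a b p q ε D := by
  have hL : 0 < q - p := sub_pos.2 hpq
  set η : ℝ := ε / (4 * (q - p)) with hη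
  have hη0 : 0 < η := by positivity
  obtain ⟨z, c, X, Y, S, Z, hz0, hsub, hR, hstep⟩ := exists_refinement_seq hκ hγ hα hβ hα0 hβ0 hz hc
    hW hab hp hpq (ε := fun k => η * (1 / 2) ^ k) (fun k => by positivity)
  set d : ℕ → ℝ × ℝ → St := fun k => pert α β (X k) (Y k) (S k) with hd
  have hpos : ∀ k x, (z k x).1 ≠ 0 := fun k x => (lamSet_fst_pos ((hsub k).2.2 x)).ne'
  have hdc : ∀ k, Continuous (d k) := fun k =>
    (hR k).pot.continuous_pert hα.continuous hβ.continuous hα0 hβ0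
  have hdi : ∀ k, IntegrableOn (d k) (box a b p q) := fun k => integrableOn_box (hdc k) a b p q
  set G : ℕ → ℝ × ℝ → ℝ := fun k x => gap (z (k + 1) x) (z k x) with hG
  have hGc : ∀ k, Continuous (G k) := fun k =>
    continuous_gap (hsub (k + 1)).1 (hsub k).1 (hpos _) (hpos _)
  have hGi : ∀ k, IntegrableOn (G k) (box a b p q) := fun k => integrableOn_box (hGc k) a b p q
  have hci : ∀ k, IntegrableOn (c k) (box a b p q) := fun k =>
    integrableOn_box (hsub k).2.1 a b p q
  have hgeo : Summable fun k : ℕ => η * (1 / 2 : ℝ) ^ k * volume.real (box a b p q) :=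
    (summable_geometric_two.mul_left η).mul_right _
  have hc0 : ∀ k x, 0 ≤ c k x := fun k x => (lamSet_pos hκ hγ ((hsub k).2.2 x)).le
  have hcs : Summable fun k => ∫ x in box a b p q, c k x := by
    rw [← summable_nat_add_iff 1]
    exact Summable.of_nonneg_of_le (fun k => integral_nonneg (hc0 _)) (fun k => (hR k).int_le) hgeo
  have hGs : Summable fun k => ∫ x in box a b p q, G k x := by
    refine Summable.of_nonneg_of_le (fun k => integral_nonneg fun x => gap_nonneg _ _) (fun k => ?_)
      (hcs.add hgeo)
    have := (hR k).gap_le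
    simpa only [hG, hstep] using this
  have hdG : ∀ k x, ‖d k x‖ ≤ G k x := fun k x => by
    refine le_trans (le_of_eq ?_) (le_max_left _ _)
    rw [hstep]; simp [hd]
  have hds : Summable fun k => ∫ x in box a b p q, ‖d k x‖ :=
    Summable.of_nonneg_of_le (fun k => integral_nonneg fun x => norm_nonneg _)
      (fun k => integral_mono (hdi k).norm (hGi k) (hdG k)) hGs
  refine ⟨fun x => ∑' k, d k x, ⟨integrable_tsum_of_summable hdi hds, ?_, ?_, ?_, ?_⟩⟩
  · filter_upwards [ae_summable_of_summable_integral hGi (fun k x => gap_nonneg _ _) hGs,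
      ae_summable_of_summable_integral hci hc0 hcs] with x hx hx'
    have hsum : Summable fun k => d k x := Summable.of_norm_bounded hx fun k => hdG k x
    have hzk : ∀ N, z N x = z₀ x + ∑ k ∈ Finset.range N, d k x := fun N => by
      induction N with
      | zero => simp [hz0]
      | succ N ih => rw [hstep, Finset.sum_range_succ, ih, add_assoc]
    refine exact_of_tendsto hκ hγ (z := fun k => z k x) (c := fun k => c k x)
      (fun k => (hsub k).2.2 x) ?_ hx'.tendsto_atTop_zero ?_
    · simp_rw [hzk]
      exact hsum.hasSum.tendsto_sum_nat.const_add _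
    · exact Summable.of_nonneg_of_le (fun k => abs_nonneg _) (fun k => le_max_right _ _) hx
  · intro φ hφ
    have hWc : Continuous (massWeight α φ) := by
      have h1 := (contDiff_dt hφ).continuous
      have h2 := (contDiff_dr hφ).continuous
      have h3 : Continuous fun x : ℝ × ℝ => α x.2 := hα.continuous.comp continuous_snd
      exact (h3.mul h1).prodMk ((h3.mul h2).prodMk continuous_const)
    obtain ⟨C, hC⟩ := exists_bound_box hWc a b p q
    have h := hasSum_integral_pairing hdi hds hWc.aestronglyMeasurable
      (ae_restrict_of_forall_mem (measurableSet_box a b p q) hC)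
    have h0 : ∀ k, ∫ x in box a b p q, pairing (massWeight α φ x) (d k x) = 0 := fun k =>
      (hR k).pot.integral_mass hα0 hφ
    simp_rw [h0] at h
    exact h.unique hasSum_zero
  · intro φ hφ
    have hWc : Continuous (momWeight α β φ) := by
      have h1 := (contDiff_dt hφ).continuous
      have h2 := (contDiff_dr hφ).continuous
      have h3 : Continuous fun x : ℝ × ℝ => α x.2 := hα.continuous.comp continuous_snd
      have h4 : Continuous fun x : ℝ × ℝ => β x.2 := hβ.continuous.comp continuous_snd
      exact continuous_const.prodMk ((h3.mul h1).prodMk ((h3.mul h2).prodMk (h4.mul hφ.continuous)))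
    obtain ⟨C, hC⟩ := exists_bound_box hWc a b p q
    have h := hasSum_integral_pairing hdi hds hWc.aestronglyMeasurable
      (ae_restrict_of_forall_mem (measurableSet_box a b p q) hC)
    have h0 : ∀ k, ∫ x in box a b p q, pairing (momWeight α β φ x) (d k x) = 0 := fun k =>
      (hR k).pot.integral_mom hα0 hβ0 hφ
    simp_rw [h0] at h
    exact h.unique hasSum_zero
  · have hprod : (volume : Measure (ℝ × ℝ)).restrict (box a b p q)
        = (volume.restrict (Ioc a b)).prod (volume.restrict (Ioc p q)) := by
      rw [Measure.prod_restrict]; rfl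
    have hsl : ∀ k, Integrable (fun t => ∫ r in Ioc p q, ‖d k (t, r)‖) (volume.restrict (Ioc a b)) :=
      fun k => by
        have := hdi k
        rw [IntegrableOn, hprod] at this
        exact this.norm.integral_prod_left
    have hsls : Summable fun k => ∫ t in Ioc a b, ∫ r in Ioc p q, ‖d k (t, r)‖ := by
      refine hds.congr fun k => ?_
      have := hdi k
      rw [IntegrableOn, hprod] at this
      rw [hprod, integral_prod _ this.norm]
    filter_upwards [ae_summable_of_summable_integral hsl
      (fun k t => integral_nonneg fun r => norm_nonneg _) hsls] with t ht
    have hdt : ∀ k, IntegrableOn (fun r => d k (t, r)) (Ioc p q) := fun k =>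
      (((hdc k).comp (by fun_prop : Continuous fun r : ℝ => (t, r))).integrableOn_Icc).mono_set
        Ioc_subset_Icc_self
    refine ⟨integrable_tsum_of_summable hdt ht, fun M ψ ψ' hψ i => ?_⟩
    have hwc := continuous_coordWeight hα.continuous hβ.continuous hψ.continuous i
    obtain ⟨C, hC⟩ := (isCompact_Icc (a := p) (b := q)).exists_bound_of_continuousOn hwc.continuousOn
    have h := hasSum_integral_pairing hdt ht hwc.aestronglyMeasurable
      (ae_restrict_of_forall_mem measurableSet_Ioc fun r hr => hC r (Ioc_subset_Icc_self hr))
    have hb : ∀ k, ‖∫ r in Ioc p q, pairing (coordWeight α β ψ i r) (d k (t, r))‖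
        ≤ 2 * (η * M * (q - p)) * (1 / 2) ^ k := fun k => by
      refine ((hR k).pot.abs_slice_le (t := t) hα0 hβ0 hpq hψ i).trans (le_of_eq ?_)
      ring
    have hg : HasSum (fun k : ℕ => 2 * (η * M * (q - p)) * (1 / 2) ^ k)
        (2 * (η * M * (q - p)) * 2) := hasSum_geometric_two.mul_left _
    rw [← h.tsum_eq, ← norm_eq_abs]
    refine (tsum_of_norm_bounded hg hb).trans (le_of_eq ?_)
    rw [hη]; field_simp; ring

/-- The weight `r^(n-1)`. -/
def rad (n : ℕ) (r : ℝ) : ℝ := r ^ (n - 1)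

/-- The derivative of the weight `r^(n-1)`. -/
def rad' (n : ℕ) (r : ℝ) : ℝ := (n - 1) * r ^ (n - 2)

lemma CellSolution.congr {κ γ : ℝ} {α β α' β' : ℝ → ℝ} {z₀ z₀' : ℝ × ℝ → St} {a b p q ε : ℝ}
    {D : ℝ × ℝ → St} (h : CellSolution κ γ α β z₀ a b p q ε D) (hα : ∀ r ∈ Ioc p q, α' r = α r)
    (hβ : ∀ r ∈ Ioc p q, β' r = β r) (hz : ∀ x ∈ box a b p q, z₀' x = z₀ x) :
    CellSolution κ γ α' β' z₀' a b p q ε D where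
  integrable := h.integrable
  exact := by
    filter_upwards [h.exact, ae_restrict_mem (measurableSet_box a b p q)] with x hx hx'
    rwa [hz x hx']
  mass φ hφ := by
    rw [← h.mass φ hφ]
    refine setIntegral_congr_fun (measurableSet_box a b p q) fun x hx => ?_
    simp only [massWeight, hα x.2 hx.2]
  mom φ hφ := by
    rw [← h.mom φ hφ]
    refine setIntegral_congr_fun (measurableSet_box a b p q) fun x hx => ?_
    simp only [momWeight, hα x.2 hx.2, hβ x.2 hx.2]
  slice := by
    filter_upwards [h.slice] with t ht
    refine ⟨ht.1, fun M ψ ψ' hψ i => ?_⟩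
    rw [setIntegral_congr_fun measurableSet_Ioc (g := fun r =>
      pairing (coordWeight α β ψ i r) (D (t, r))) fun r hr => ?_]
    · exact ht.2 M ψ ψ' hψ i
    · fin_cases i <;> simp [coordWeight, hα r hr, hβ r hr]

lemma exists_smooth_pos_extension {p : ℝ} (hp : 0 < p) :
    ∃ σ : ℝ → ℝ, ContDiff ℝ ∞ σ ∧ (∀ r, 0 < σ r) ∧ ∀ r, p ≤ r → σ r = r := by
  refine ⟨fun r => smoothTransition ((r - p / 2) / (p / 2)) * r
    + (1 - smoothTransition ((r - p / 2) / (p / 2))) * p, ?_, fun r => ?_, fun r hr => ?_⟩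
  · have h : ContDiff ℝ ∞ fun r : ℝ => smoothTransition ((r - p / 2) / (p / 2)) :=
      smoothTransition.contDiff.comp (by fun_prop)
    fun_prop
  · rcases le_or_gt r (p / 2) with hr | hr
    · have h0 : (r - p / 2) / (p / 2) ≤ 0 :=
        div_nonpos_of_nonpos_of_nonneg (by linarith) (by linarith)
      simp only [smoothTransition.zero_of_nonpos h0]
      simpa using hp
    · have h0 := smoothTransition.nonneg ((r - p / 2) / (p / 2))
      have h1 := smoothTransition.le_one ((r - p / 2) / (p / 2))
      have hr0 : 0 < r := by linarith
      rcases h0.eq_or_lt with h | h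
      · simp only [← h]; simpa using hp
      · exact add_pos_of_pos_of_nonneg (mul_pos h hr0) (mul_nonneg (by linarith) hp.le)
  · have : 1 ≤ (r - p / 2) / (p / 2) := by rw [le_div_iff₀ (by linarith)]; linarith
    simp only [smoothTransition.one_of_one_le this]; ring

lemma exists_uniform_cost {κ γ : ℝ} (hκ : 0 < κ) (hγ : 1 < γ) {z₀ : ℝ × ℝ → St}
    {K : Set (ℝ × ℝ)} (hK : IsCompact K) (hz : ContinuousOn z₀ K)
    (hW : ∀ x ∈ K, ∃ c, (z₀ x, c) ∈ lamSet κ γ) : ∃ c, ∀ x ∈ K, (z₀ x, c) ∈ lamSet κ γ := by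
  refine hK.induction_on (p := fun s => ∃ c, ∀ x ∈ s, (z₀ x, c) ∈ lamSet κ γ) ⟨0, by simp⟩
    (fun s t hst ⟨c, hc⟩ => ⟨c, fun x hx => hc x (hst hx)⟩) ?_ ?_
  · rintro s t ⟨c, hc⟩ ⟨c', hc'⟩
    refine ⟨max c c', fun x hx => ?_⟩
    rcases hx with hx | hx
    · exact lamSet_mono (hc x hx) (le_max_left _ _)
    · exact lamSet_mono (hc' x hx) (le_max_right _ _)
  · intro x hx
    obtain ⟨c, hc⟩ := hW x hx
    have h1 : ContinuousWithinAt (fun y => (z₀ y, c)) K x := (hz x hx).prodMk continuousWithinAt_const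
    exact ⟨_, h1 ((isOpen_lamSet hκ hγ).mem_nhds hc), c, fun y hy => hy⟩

lemma exists_cellSolution {κ γ : ℝ} {n : ℕ} (hκ : 0 < κ) (hγ : 1 < γ) (hn : 2 ≤ n)
    {z₀ : ℝ × ℝ → St} (hz : ContinuousOn z₀ (Ioi 0 ×ˢ Ioi 0))
    (hW : ∀ x ∈ (Ioi 0 ×ˢ Ioi 0 : Set (ℝ × ℝ)), ∃ c, (z₀ x, c) ∈ lamSet κ γ) {ε a b p q : ℝ}
    (hε : 0 < ε) (ha : 0 < a) (hab : a < b) (hp : 0 < p) (hpq : p < q) :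
    ∃ D, CellSolution κ γ (rad n) (rad' n) z₀ a b p q ε D := by
  obtain ⟨σ, hσ, hσ0, hσr⟩ := exists_smooth_pos_extension hp
  set K : Set (ℝ × ℝ) := Icc a b ×ˢ Icc p q with hK
  have hKsub : K ⊆ Ioi 0 ×ˢ Ioi 0 := fun x hx => ⟨ha.trans_le hx.1.1, hp.trans_le hx.2.1⟩
  obtain ⟨c, hc⟩ := exists_uniform_cost hκ hγ (isCompact_Icc.prod isCompact_Icc) (hz.mono hKsub)
    (fun x hx => hW x (hKsub hx))
  set Φ : ℝ × ℝ → ℝ × ℝ := fun x => (max a (min b x.1), max p (min q x.2)) with hΦ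
  have hΦK : ∀ x, Φ x ∈ K := fun x =>
    ⟨⟨le_max_left _ _, max_le hab.le (min_le_left _ _)⟩,
      ⟨le_max_left _ _, max_le hpq.le (min_le_left _ _)⟩⟩
  have hΦid : ∀ x ∈ box a b p q, Φ x = x := fun x hx => by
    simp [hΦ, min_eq_right hx.1.2, min_eq_right hx.2.2, max_eq_right hx.1.1.le,
      max_eq_right hx.2.1.le]
  have hΦc : Continuous Φ := by rw [hΦ]; fun_prop
  have hzΦ : Continuous (z₀ ∘ Φ) :=
    (hz.mono hKsub).comp_continuous hΦc hΦK
  have hn' : (0:ℝ) < n - 1 := by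
    have : (2:ℝ) ≤ n := by exact_mod_cast hn
    linarith
  obtain ⟨D, hD⟩ := exists_cellSolution_of_smooth (α := fun r => σ r ^ (n - 1))
    (β := fun r => (n - 1) * σ r ^ (n - 2)) hκ hγ (by fun_prop) (by fun_prop)
    (fun r => pow_pos (hσ0 r) _) (fun r => mul_pos hn' (pow_pos (hσ0 r) _)) hzΦ
    (continuous_const (y := c)) (fun x => hc _ (hΦK x)) hε hab hp hpq
  refine ⟨D, hD.congr (fun r hr => ?_) (fun r hr => ?_) fun x hx => ?_⟩
  · simp [rad, hσr r hr.1.le]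
  · simp [rad', hσr r hr.1.le]
  · simp [hΦid x hx]

/-- A countable partition of the open quadrant into half-open boxes. -/
structure Cells (a b p q : ℕ → ℝ) : Prop where
  pos : ∀ k, 0 < a k
  lt : ∀ k, a k < b k
  pos' : ∀ k, 0 < p k
  lt' : ∀ k, p k < q k
  disjoint : Pairwise fun k l => Disjoint (box (a k) (b k) (p k) (q k)) (box (a l) (b l) (p l) (q l))
  near : ∀ x ∈ (Ioi 0 ×ˢ Ioi 0 : Set (ℝ × ℝ)), ∃ s : Finset ℕ,
    (⋃ k ∈ s, box (a k) (b k) (p k) (q k)) ∈ 𝓝 x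

lemma dyadic_index_unique {x : ℝ} {i j : ℤ} (hi : x ∈ Ioc ((2:ℝ) ^ i) (2 ^ (i + 1)))
    (hj : x ∈ Ioc ((2:ℝ) ^ j) (2 ^ (j + 1))) : i = j := by
  have h1 : i < j + 1 := (zpow_lt_zpow_iff_right₀ (by norm_num : (1:ℝ) < 2)).1 (hi.1.trans_le hj.2)
  have h2 : j < i + 1 := (zpow_lt_zpow_iff_right₀ (by norm_num : (1:ℝ) < 2)).1 (hj.1.trans_le hi.2)
  omega

lemma dyadic_union_mem_nhds {x : ℝ} {i : ℤ} (hi : x ∈ Ioc ((2:ℝ) ^ i) (2 ^ (i + 1))) :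
    Ioc ((2:ℝ) ^ i) (2 ^ (i + 1)) ∪ Ioc ((2:ℝ) ^ (i + 1)) (2 ^ (i + 1 + 1)) ∈ 𝓝 x := by
  have h : ∀ j : ℤ, (2:ℝ) ^ j < 2 ^ (j + 1) := fun j =>
    zpow_lt_zpow_right₀ (by norm_num) (by omega)
  rw [Ioc_union_Ioc_eq_Ioc (h i).le (h _).le]
  exact Ioc_mem_nhds hi.1 (hi.2.trans_lt (h _))

lemma exists_cells : ∃ a b p q : ℕ → ℝ, Cells a b p q := by
  let e : ℕ ≃ ℤ × ℤ := (Denumerable.eqv (ℤ × ℤ)).symm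
  have h2 : ∀ j : ℤ, (0:ℝ) < 2 ^ j := fun j => by positivity
  have hlt : ∀ j : ℤ, (2:ℝ) ^ j < 2 ^ (j + 1) := fun j =>
    zpow_lt_zpow_right₀ (by norm_num) (by omega)
  refine ⟨fun k => 2 ^ (e k).1, fun k => 2 ^ ((e k).1 + 1), fun k => 2 ^ (e k).2,
    fun k => 2 ^ ((e k).2 + 1), fun k => h2 _, fun k => hlt _, fun k => h2 _, fun k => hlt _, ?_, ?_⟩
  · intro k l hkl
    rw [Set.disjoint_left]
    rintro x ⟨h1, h2⟩ ⟨h3, h4⟩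
    exact hkl (e.injective (Prod.ext (dyadic_index_unique h1 h3) (dyadic_index_unique h2 h4)))
  · rintro x ⟨hx1, hx2⟩
    obtain ⟨i, hi⟩ := exists_mem_Ioc_zpow hx1 (by norm_num : (1:ℝ) < 2)
    obtain ⟨j, hj⟩ := exists_mem_Ioc_zpow hx2 (by norm_num : (1:ℝ) < 2)
    refine ⟨{e.symm (i, j), e.symm (i + 1, j), e.symm (i, j + 1), e.symm (i + 1, j + 1)}, ?_⟩
    have := prod_mem_nhds (dyadic_union_mem_nhds hi) (dyadic_union_mem_nhds hj)
    refine mem_of_superset this ?_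
    rintro y ⟨h1 | h1, h2 | h2⟩ <;>
      simp only [Finset.mem_insert, Finset.mem_singleton, iUnion_iUnion_eq_or_left,
        iUnion_iUnion_eq_left, mem_union, Equiv.apply_symm_apply]
    · exact Or.inl ⟨h1, h2⟩
    · exact Or.inr (Or.inr (Or.inl ⟨h1, h2⟩))
    · exact Or.inr (Or.inl ⟨h1, h2⟩)
    · exact Or.inr (Or.inr (Or.inr ⟨h1, h2⟩))

namespace Cells

variable {a b p q : ℕ → ℝ}

lemma exists_mem (h : Cells a b p q) {x : ℝ × ℝ} (hx : x ∈ (Ioi 0 ×ˢ Ioi 0 : Set (ℝ × ℝ))) :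
    ∃ k, x ∈ box (a k) (b k) (p k) (q k) := by
  obtain ⟨s, hs⟩ := h.near x hx
  have := mem_of_mem_nhds hs
  simp only [mem_iUnion] at this
  obtain ⟨k, -, hk⟩ := this
  exact ⟨k, hk⟩

lemma iUnion_eq (h : Cells a b p q) :
    ⋃ k, box (a k) (b k) (p k) (q k) = (Ioi 0 ×ˢ Ioi 0 : Set (ℝ × ℝ)) := by
  ext x
  rw [mem_iUnion]
  refine ⟨fun ⟨k, hk⟩ => ⟨(h.pos k).trans hk.1.1, (h.pos' k).trans hk.2.1⟩, fun hx => h.exists_mem hx⟩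

lemma index_unique (h : Cells a b p q) {x : ℝ × ℝ} {k l : ℕ} (hk : x ∈ box (a k) (b k) (p k) (q k))
    (hl : x ∈ box (a l) (b l) (p l) (q l)) : k = l := by
  by_contra hkl
  exact Set.disjoint_left.1 (h.disjoint hkl) hk hl

end Cells

/-- The section at time `t` of the `k`-th cell. -/
def cellSlice (a b p q : ℕ → ℝ) (t : ℝ) (k : ℕ) : Set ℝ :=
  {r | (t, r) ∈ box (a k) (b k) (p k) (q k)}

section Slices

variable {a b p q : ℕ → ℝ} {t : ℝ}

lemma cellSlice_of_mem {k : ℕ} (h : t ∈ Ioc (a k) (b k)) : cellSlice a b p q t k = Ioc (p k) (q k) := by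
  ext r; simp [cellSlice, box, h.1, h.2]

lemma cellSlice_of_notMem {k : ℕ} (h : t ∉ Ioc (a k) (b k)) : cellSlice a b p q t k = ∅ := by
  ext r
  simp only [cellSlice, box, mem_prod, mem_ofPred_eq, mem_empty_iff_false, iff_false, not_and]
  exact fun h' => absurd h' h

lemma measurableSet_cellSlice (k : ℕ) : MeasurableSet (cellSlice a b p q t k) := by
  by_cases h : t ∈ Ioc (a k) (b k)
  · rw [cellSlice_of_mem h]; exact measurableSet_Ioc
  · rw [cellSlice_of_notMem h]; exact MeasurableSet.empty

lemma Cells.disjoint_slice (h : Cells a b p q) : Pairwise (Disjoint on cellSlice a b p q t) :=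
  fun _ _ hkl => Set.disjoint_left.2 fun _ hr hr' => hkl (h.index_unique hr hr')

lemma Cells.iUnion_slice (h : Cells a b p q) (ht : 0 < t) : ⋃ k, cellSlice a b p q t k = Ioi 0 := by
  ext r
  rw [mem_iUnion]
  refine ⟨fun ⟨k, hk⟩ => (h.pos' k).trans hk.2.1, fun hr => h.exists_mem (x := (t, r)) ⟨ht, hr⟩⟩

lemma Cells.hasSum_setIntegral (h : Cells a b p q) (ht : 0 < t) {g : ℝ → ℝ}
    (hg : IntegrableOn g (Ioi 0)) :
    HasSum (fun k => ∫ r in cellSlice a b p q t k, g r) (∫ r in Ioi 0, g r) := by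
  rw [← h.iUnion_slice ht] at hg ⊢
  exact hasSum_integral_iUnion measurableSet_cellSlice h.disjoint_slice hg

lemma Cells.integrableOn_Ioi (h : Cells a b p q) (ht : 0 < t) {f f₀ : ℝ → ℝ} {ε : ℕ → ℝ}
    (hε : Summable ε) (hf : ∀ k, IntegrableOn f (cellSlice a b p q t k))
    (hf0 : ∀ᵐ r ∂volume.restrict (Ioi 0), 0 ≤ f r) (hf₀ : IntegrableOn f₀ (Ioi 0))
    (hle : ∀ k, ∫ r in cellSlice a b p q t k, f r ≤ (∫ r in cellSlice a b p q t k, f₀ r) + ε k) :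
    IntegrableOn f (Ioi 0) := by
  rw [← h.iUnion_slice ht]
  refine integrableOn_iUnion_of_summable_integral_norm hf ?_
  refine Summable.of_nonneg_of_le (fun k => integral_nonneg fun r => norm_nonneg _) (fun k => ?_)
    ((h.hasSum_setIntegral ht hf₀).summable.add hε)
  refine le_trans (le_of_eq ?_) (hle k)
  refine integral_congr_ae ?_
  have hsub : cellSlice a b p q t k ⊆ Ioi 0 := fun r hr => (h.pos' k).trans hr.2.1
  filter_upwards [ae_restrict_of_ae_restrict_of_subset hsub hf0] with r hr
  exact norm_of_nonneg hr

end Slices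

/-- Structural bounds satisfied by exact solutions and by subsolutions. -/
def StBounds (v : St) : Prop := 0 ≤ v.1 ∧ v.2.1 ^ 2 ≤ v.1 * v.2.2.1 ∧ 0 ≤ v.2.2.2 ∧ v.2.2.2 ≤ v.2.2.1

lemma StBounds.abs_le {v : St} (h : StBounds v) : |v.2.1| ≤ v.1 + v.2.2.1 := by
  obtain ⟨h1, h2, h3, h4⟩ := h
  have h5 : 0 ≤ v.2.2.1 := h3.trans h4
  exact abs_le_of_sq_le_sq (by nlinarith [mul_nonneg h1 h5, sq_nonneg v.1, sq_nonneg v.2.2.1])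
    (by linarith)

/-- Bounds for a test function and its first and mixed derivatives. -/
structure TestBounds (φ : ℝ × ℝ → ℝ) (M R : ℝ) : Prop where
  smooth : ContDiff ℝ 3 φ
  nonneg : 0 ≤ M
  pos : 0 < R
  le : ∀ x, |φ x| ≤ M
  le_dt : ∀ x, |dt φ x| ≤ M
  le_dr : ∀ x, |dr φ x| ≤ M
  le_dr_dt : ∀ x, |dr (dt φ) x| ≤ M
  le_dr_dr : ∀ x, |dr (dr φ) x| ≤ M
  zero : ∀ x : ℝ × ℝ, R ≤ x.2 → φ x = 0 ∧ dt φ x = 0 ∧ dr φ x = 0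

lemma exists_testBounds {φ : ℝ × ℝ → ℝ} (hφ : ContDiff ℝ 3 φ) (hc : HasCompactSupport φ) :
    ∃ M R, TestBounds φ M R := by
  have h1 : ContDiff ℝ 2 (dt φ) := (hφ.fderiv_right (m := 2) (by norm_num)).clm_apply contDiff_const
  have h2 : ContDiff ℝ 2 (dr φ) := (hφ.fderiv_right (m := 2) (by norm_num)).clm_apply contDiff_const
  have c1 : HasCompactSupport (dt φ) := hc.fderiv_apply ℝ (1, 0)
  have c2 : HasCompactSupport (dr φ) := hc.fderiv_apply ℝ (0, 1)
  have c3 : HasCompactSupport (dr (dt φ)) := c1.fderiv_apply ℝ (0, 1)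
  have c4 : HasCompactSupport (dr (dr φ)) := c2.fderiv_apply ℝ (0, 1)
  obtain ⟨M0, b0⟩ := hc.exists_bound_of_continuous hφ.continuous
  obtain ⟨M1, b1⟩ := c1.exists_bound_of_continuous h1.continuous
  obtain ⟨M2, b2⟩ := c2.exists_bound_of_continuous h2.continuous
  obtain ⟨M3, b3⟩ := c3.exists_bound_of_continuous (contDiff_dr h1).continuous
  obtain ⟨M4, b4⟩ := c4.exists_bound_of_continuous (contDiff_dr h2).continuous
  have n0 := (norm_nonneg _).trans (b0 0)
  have n1 := (norm_nonneg _).trans (b1 0)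
  have n2 := (norm_nonneg _).trans (b2 0)
  have n3 := (norm_nonneg _).trans (b3 0)
  have n4 := (norm_nonneg _).trans (b4 0)
  obtain ⟨R, hR⟩ := hc.isCompact.isBounded.subset_closedBall 0
  refine ⟨M0 + M1 + M2 + M3 + M4, max R 0 + 1, hφ, by linarith, by positivity, fun x => ?_,
    fun x => ?_, fun x => ?_, fun x => ?_, fun x => ?_, fun x hx => ?_⟩
  · exact (b0 x).trans (by linarith)
  · exact (b1 x).trans (by linarith)
  · exact (b2 x).trans (by linarith)
  · exact (b3 x).trans (by linarith)
  · exact (b4 x).trans (by linarith)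
  · have hx' : x ∉ Metric.closedBall (0 : ℝ × ℝ) R := fun h => by
      rw [mem_closedBall_zero_iff] at h
      have := (norm_snd_le x).trans h
      rw [norm_eq_abs] at this
      linarith [le_abs_self x.2, le_max_left R 0]
    exact ⟨eq_zero_of_notMem hR hx', dt_eq_zero_of_notMem hR hx', dr_eq_zero_of_notMem hR hx'⟩

lemma TestBounds.abs_le_mul {φ : ℝ × ℝ → ℝ} {M R t r : ℝ} (h : TestBounds φ M R) (hr : 0 ≤ r)
    (h0 : φ (t, 0) = 0) : |φ (t, r)| ≤ M * r := by
  have := (convex_univ : Convex ℝ (univ : Set ℝ)).norm_image_sub_le_of_norm_hasDerivWithin_le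
    (f := fun y => φ (t, y)) (f' := fun y => dr φ (t, y)) (C := M) (x := 0) (y := r)
    (fun y _ => (hasDerivAt_slice (h.smooth.of_le (by norm_num)) t y).hasDerivWithinAt)
    (fun y _ => h.le_dr _) (mem_univ _) (mem_univ _)
  simpa [h0, abs_of_nonneg hr] using this

lemma continuous_massWeight {n : ℕ} {φ : ℝ × ℝ → ℝ} (hφ : ContDiff ℝ 2 φ) :
    Continuous (massWeight (rad n) φ) := by
  have h1 := (contDiff_dt hφ).continuous
  have h2 := (contDiff_dr hφ).continuous
  unfold massWeight rad
  fun_prop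

lemma continuous_momWeight {n : ℕ} {φ : ℝ × ℝ → ℝ} (hφ : ContDiff ℝ 2 φ) :
    Continuous (momWeight (rad n) (rad' n) φ) := by
  have h1 := (contDiff_dt hφ).continuous
  have h2 := (contDiff_dr hφ).continuous
  have h3 := hφ.continuous
  unfold momWeight rad rad'
  fun_prop

lemma rad_nonneg (n : ℕ) {r : ℝ} (hr : 0 ≤ r) : 0 ≤ rad n r := pow_nonneg hr _

lemma rad'_mul {n : ℕ} (hn : 2 ≤ n) (r : ℝ) : rad' n r * r = (n - 1) * rad n r := by
  unfold rad rad'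
  obtain ⟨k, rfl⟩ := Nat.exists_eq_add_of_le hn
  have : 2 + k - 1 = (2 + k - 2) + 1 := by omega
  rw [this, pow_succ]; ring

/-- The density and energy flux of a time slice are integrable. -/
structure SliceIntegrable (n : ℕ) (v : ℝ → St) : Prop where
  meas : AEStronglyMeasurable v (volume.restrict (Ioi 0))
  bounds : ∀ᵐ r ∂volume.restrict (Ioi 0), StBounds (v r)
  mass : ∀ R, IntegrableOn (fun r => rad n r * (v r).1) (Ioc 0 R)
  flux : IntegrableOn (fun r => rad n r * (v r).2.2.1) (Ioi 0)

lemma SliceIntegrable.integrable_dominating {n : ℕ} {v : ℝ → St} (h : SliceIntegrable n v) (R : ℝ) :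
    IntegrableOn (fun r => (Ioc 0 R).indicator (fun r => rad n r * (v r).1) r
      + rad n r * (v r).2.2.1) (Ioi 0) :=
  (((integrable_indicator_iff measurableSet_Ioc).2 (h.mass R)).integrableOn).add h.flux

lemma SliceIntegrable.integrableOn_mass {n : ℕ} {v : ℝ → St} (h : SliceIntegrable n v)
    {φ : ℝ × ℝ → ℝ} {M R : ℝ} (hφ : TestBounds φ M R) (t : ℝ) :
    IntegrableOn (fun r => pairing (massWeight (rad n) φ (t, r)) (v r)) (Ioi 0) := by
  have hW : Continuous fun r => massWeight (rad n) φ (t, r) :=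
    (continuous_massWeight (hφ.smooth.of_le (by norm_num))).comp (by fun_prop)
  refine Integrable.mono' ((h.integrable_dominating R).const_mul (2 * M))
    (continuous_pairing.comp_aestronglyMeasurable (hW.aestronglyMeasurable.prodMk h.meas)) ?_
  filter_upwards [h.bounds, ae_restrict_mem measurableSet_Ioi] with r hr hr0
  have h0 : 0 ≤ rad n r := rad_nonneg n (le_of_lt hr0)
  have hq : 0 ≤ (v r).2.2.1 := hr.2.2.1.trans hr.2.2.2
  have hM := hφ.nonneg
  by_cases hR : r ≤ R
  · rw [indicator_of_mem (show r ∈ Ioc 0 R from ⟨hr0, hR⟩), norm_eq_abs]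
    simp only [pairing, massWeight, zero_mul, add_zero]
    refine (abs_add_le _ _).trans ?_
    rw [abs_mul, abs_mul, abs_mul, abs_mul, abs_of_nonneg h0, abs_of_nonneg hr.1]
    have e1 := mul_le_mul_of_nonneg_right (hφ.le_dt (t, r)) (mul_nonneg h0 hr.1)
    have e2 := mul_le_mul (hφ.le_dr (t, r)) (mul_le_mul_of_nonneg_left hr.abs_le h0)
      (mul_nonneg h0 (abs_nonneg _)) hM
    have e3 : 0 ≤ M * (rad n r * (v r).2.2.1) := by positivity
    nlinarith
  · obtain ⟨-, z1, z2⟩ := hφ.zero (t, r) (not_le.1 hR).le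
    simp only [pairing, massWeight, z1, z2, mul_zero, zero_mul, add_zero, norm_zero]
    rw [indicator_of_notMem (show r ∉ Ioc 0 R from fun h => hR h.2)]
    positivity

lemma SliceIntegrable.integrableOn_mom {n : ℕ} (hn : 2 ≤ n) {v : ℝ → St} (h : SliceIntegrable n v)
    {φ : ℝ × ℝ → ℝ} {M R : ℝ} (hφ : TestBounds φ M R) {t : ℝ} (ht : φ (t, 0) = 0) :
    IntegrableOn (fun r => pairing (momWeight (rad n) (rad' n) φ (t, r)) (v r)) (Ioi 0) := by
  have hW : Continuous fun r => momWeight (rad n) (rad' n) φ (t, r) :=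
    (continuous_momWeight (hφ.smooth.of_le (by norm_num))).comp (by fun_prop)
  have hn1 : (1:ℝ) ≤ n := by exact_mod_cast (by omega : 1 ≤ n)
  refine Integrable.mono' ((h.integrable_dominating R).const_mul ((n + 2) * M))
    (continuous_pairing.comp_aestronglyMeasurable (hW.aestronglyMeasurable.prodMk h.meas)) ?_
  filter_upwards [h.bounds, ae_restrict_mem measurableSet_Ioi] with r hr hr0
  have hr0' : 0 < r := hr0
  have h0 : 0 ≤ rad n r := rad_nonneg n hr0'.le
  have h0' : 0 ≤ rad' n r := mul_nonneg (by linarith) (pow_nonneg hr0'.le _)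
  have hq : 0 ≤ (v r).2.2.1 := hr.2.2.1.trans hr.2.2.2
  have hM := hφ.nonneg
  by_cases hR : r ≤ R
  · rw [indicator_of_mem (show r ∈ Ioc 0 R from ⟨hr0, hR⟩), norm_eq_abs]
    simp only [pairing, momWeight, zero_mul, zero_add]
    refine (abs_add_three _ _ _).trans ?_
    simp only [abs_mul, abs_of_nonneg h0, abs_of_nonneg h0', abs_of_nonneg hq, abs_of_nonneg hr.2.2.1]
    have e1 := mul_le_mul (hφ.le_dt (t, r)) (mul_le_mul_of_nonneg_left hr.abs_le h0)
      (mul_nonneg h0 (abs_nonneg _)) hM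
    have e2 := mul_le_mul_of_nonneg_right (hφ.le_dr (t, r)) (mul_nonneg h0 hq)
    have e3 : rad' n r * |φ (t, r)| * (v r).2.2.2 ≤ rad' n r * (M * r) * (v r).2.2.1 :=
      mul_le_mul (mul_le_mul_of_nonneg_left (hφ.abs_le_mul hr0'.le ht) h0') hr.2.2.2 hr.2.2.1
        (by positivity)
    have e4 : rad' n r * (M * r) * (v r).2.2.1 = (n - 1) * (M * (rad n r * (v r).2.2.1)) := by
      linear_combination M * (v r).2.2.1 * rad'_mul hn r
    have e5 : 0 ≤ M * (rad n r * (v r).2.2.1) := by positivity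
    have e6 : 0 ≤ M * (rad n r * (v r).1) := mul_nonneg hM (mul_nonneg h0 hr.1)
    nlinarith [mul_nonneg (sub_nonneg.2 hn1) e5, mul_nonneg (sub_nonneg.2 hn1) e6]
  · obtain ⟨z0, z1, z2⟩ := hφ.zero (t, r) (not_le.1 hR).le
    simp only [pairing, momWeight, z0, z1, z2, mul_zero, zero_mul, add_zero, norm_zero]
    rw [indicator_of_notMem (show r ∉ Ioc 0 R from fun h => hR h.2)]
    positivity

lemma pairing_add_right (w u v : St) : pairing w (u + v) = pairing w u + pairing w v := by
  simp only [pairing, Prod.fst_add, Prod.snd_add]; ring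

lemma Cells.integral_pairing_add_eq {a b p q : ℕ → ℝ} (h : Cells a b p q) {ε : ℕ → ℝ} {C : ℝ}
    (hε : Summable fun k => ε k * (b k - a k)) {W z₀ D : ℝ × ℝ → St} (hW : Continuous W)
    (hD : ∀ k, IntegrableOn D (box (a k) (b k) (p k) (q k)))
    (hnull : ∀ k, ∫ x in box (a k) (b k) (p k) (q k), pairing (W x) (D x) = 0)
    (hle : ∀ᵐ t ∂volume.restrict (Ioi 0), ∀ k,
      |∫ r in cellSlice a b p q t k, pairing (W (t, r)) (D (t, r))| ≤ C * ε k)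
    (h0 : ∀ᵐ t ∂volume.restrict (Ioi 0),
      IntegrableOn (fun r => pairing (W (t, r)) (z₀ (t, r))) (Ioi 0))
    (h1 : ∀ᵐ t ∂volume.restrict (Ioi 0),
      IntegrableOn (fun r => pairing (W (t, r)) (z₀ (t, r) + D (t, r))) (Ioi 0))
    (hF : IntegrableOn (fun t => ∫ r in Ioi 0, pairing (W (t, r)) (z₀ (t, r))) (Ioi 0)) :
    ∫ t in Ioi 0, ∫ r in Ioi 0, pairing (W (t, r)) (z₀ (t, r) + D (t, r))
      = ∫ t in Ioi 0, ∫ r in Ioi 0, pairing (W (t, r)) (z₀ (t, r)) := by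
  set e : ℕ → ℝ → ℝ := fun k t => ∫ r in cellSlice a b p q t k, pairing (W (t, r)) (D (t, r)) with he
  set e' : ℕ → ℝ → ℝ := fun k t => ∫ r in Ioc (p k) (q k), pairing (W (t, r)) (D (t, r)) with he'
  have hind : ∀ k, e k = (Ioc (a k) (b k)).indicator (e' k) := fun k => by
    ext t
    by_cases ht : t ∈ Ioc (a k) (b k)
    · rw [indicator_of_mem ht]; simp only [he, he', cellSlice_of_mem ht]
    · rw [indicator_of_notMem ht]; simp [he, cellSlice_of_notMem ht]
  have hprod : ∀ k, (volume : Measure (ℝ × ℝ)).restrict (box (a k) (b k) (p k) (q k))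
      = (volume.restrict (Ioc (a k) (b k))).prod (volume.restrict (Ioc (p k) (q k))) := fun k => by
    rw [Measure.prod_restrict]; rfl
  have hpi : ∀ k, Integrable (fun x => pairing (W x) (D x))
      ((volume.restrict (Ioc (a k) (b k))).prod (volume.restrict (Ioc (p k) (q k)))) := fun k => by
    obtain ⟨B, hB⟩ := exists_bound_box hW (a k) (b k) (p k) (q k)
    rw [← hprod]
    exact integrable_pairing hW.aestronglyMeasurable
      (ae_restrict_of_forall_mem (measurableSet_box _ _ _ _) hB) (hD k)
  have hei' : ∀ k, IntegrableOn (e' k) (Ioc (a k) (b k)) := fun k => (hpi k).integral_prod_left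
  have hsub : ∀ k, Ioc (a k) (b k) ⊆ Ioi 0 := fun k t ht => (h.pos k).trans ht.1
  have hei : ∀ k, IntegrableOn (e k) (Ioi 0) := fun k => by
    rw [hind]
    exact ((integrable_indicator_iff measurableSet_Ioc).2 (hei' k)).integrableOn
  have hInt : ∀ k (g : ℝ → ℝ), ∫ t in Ioi 0, (Ioc (a k) (b k)).indicator g t
      = ∫ t in Ioc (a k) (b k), g t := fun k g => by
    rw [setIntegral_indicator measurableSet_Ioc, inter_eq_right.2 (hsub k)]
  have he0 : ∀ k, ∫ t in Ioi 0, e k t = 0 := fun k => by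
    rw [hind, hInt, ← hnull k, hprod, integral_prod _ (hpi k)]
  have hsum : Summable fun k => ∫ t in Ioi 0, ‖e k t‖ := by
    refine Summable.of_nonneg_of_le (fun k => integral_nonneg fun t => norm_nonneg _) (fun k => ?_)
      (hε.mul_left C)
    have e1 : ∀ t, ‖e k t‖ = (Ioc (a k) (b k)).indicator (fun t => ‖e k t‖) t := fun t => by
      by_cases ht : t ∈ Ioc (a k) (b k)
      · rw [indicator_of_mem ht]
      · rw [indicator_of_notMem ht, hind, indicator_of_notMem ht, norm_zero]
    rw [integral_congr_ae (Eventually.of_forall e1), hInt]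
    calc ∫ t in Ioc (a k) (b k), ‖e k t‖ ≤ ∫ t in Ioc (a k) (b k), C * ε k := by
          refine integral_mono_ae ((hei k).mono_set (hsub k)).norm (integrable_const _) ?_
          filter_upwards [ae_restrict_of_ae_restrict_of_subset (hsub k) hle] with t ht using ht k
      _ = C * (ε k * (b k - a k)) := by
          rw [setIntegral_const, Real.volume_real_Ioc_of_le (h.lt k).le, smul_eq_mul]; ring
  have hkey : ∀ᵐ t ∂volume.restrict (Ioi 0),
      ∫ r in Ioi 0, pairing (W (t, r)) (z₀ (t, r) + D (t, r))
        = (∫ r in Ioi 0, pairing (W (t, r)) (z₀ (t, r))) + ∑' k, e k t := by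
    filter_upwards [h0, h1, ae_restrict_mem measurableSet_Ioi] with t ht0 ht1 ht
    have hdiff : IntegrableOn (fun r => pairing (W (t, r)) (D (t, r))) (Ioi 0) := by
      refine (ht1.sub ht0).congr (Eventually.of_forall fun r => ?_)
      simp only [Pi.sub_apply, pairing_add_right]; ring
    rw [(h.hasSum_setIntegral ht hdiff).tsum_eq, ← integral_add ht0 hdiff]
    simp only [pairing_add_right]
  have htot := hasSum_integral_of_summable_integral_norm hei hsum
  simp_rw [he0] at htot
  have hz : ∫ t in Ioi 0, ∑' k, e k t = 0 := htot.unique hasSum_zero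
  rw [integral_congr_ae hkey, integral_add hF (integrable_tsum_of_summable hei hsum), hz, add_zero]

lemma stBounds_of_exact {κ γ : ℝ} (hκ : 0 < κ) {v : St} (h1 : 0 < v.1)
    (h2 : v.2.2.2 = pres κ γ v.1) (h3 : v.1 * (v.2.2.1 - v.2.2.2) = v.2.1 ^ 2) : StBounds v := by
  have hP : 0 ≤ v.2.2.2 := by rw [h2]; exact mul_nonneg hκ.le (rpow_nonneg h1.le _)
  refine ⟨h1.le, ?_, hP, ?_⟩
  · nlinarith [mul_nonneg h1.le hP]
  · have : 0 ≤ v.1 * (v.2.2.1 - v.2.2.2) := by rw [h3]; positivity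
    linarith [nonneg_of_mul_nonneg_right this h1]

/-- A continuous strict subsolution on the open quadrant attaining given initial data. -/
structure BaseSubsolution (κ γ : ℝ) (n : ℕ) (ρ₀ m₀ : ℝ → ℝ) (z₀ : ℝ × ℝ → St) : Prop where
  cont : ContinuousOn z₀ (Ioi 0 ×ˢ Ioi 0)
  mem : ∀ x ∈ (Ioi 0 ×ˢ Ioi 0 : Set (ℝ × ℝ)), ∃ c, (z₀ x, c) ∈ lamSet κ γ
  slice : ∀ t, 0 < t → SliceIntegrable n fun r => z₀ (t, r)
  mass : ∀ φ : ℝ × ℝ → ℝ, ContDiff ℝ 3 φ → HasCompactSupport φ →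
    IntegrableOn (fun t => ∫ r in Ioi 0, pairing (massWeight (rad n) φ (t, r)) (z₀ (t, r))) (Ioi 0) ∧
    (∫ t in Ioi 0, ∫ r in Ioi 0, pairing (massWeight (rad n) φ (t, r)) (z₀ (t, r)))
      + ∫ r in Ioi 0, ρ₀ r * φ (0, r) * r ^ (n - 1) = 0
  mom : ∀ φ : ℝ × ℝ → ℝ, ContDiff ℝ 3 φ → HasCompactSupport φ → (∀ t, 0 ≤ t → φ (t, 0) = 0) →
    IntegrableOn (fun t => ∫ r in Ioi 0, pairing (momWeight (rad n) (rad' n) φ (t, r)) (z₀ (t, r)))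
      (Ioi 0) ∧
    (∫ t in Ioi 0, ∫ r in Ioi 0, pairing (momWeight (rad n) (rad' n) φ (t, r)) (z₀ (t, r)))
      + ∫ r in Ioi 0, m₀ r * φ (0, r) * r ^ (n - 1) = 0

lemma exists_slice_cutoff (R : ℝ) : ∃ (M : ℝ) (ψ ψ' : ℝ → ℝ), 0 ≤ M ∧ (∀ p q, SliceTest p q M ψ ψ') ∧
    (∀ r, 0 ≤ ψ r) ∧ (∀ r ∈ Ioc 0 R, ψ r = 1) ∧ ∃ R', ∀ r ∉ Ioc (-R') R', ψ r = 0 := by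
  let f : ContDiffBump (0:ℝ) := ⟨|R| + 1, |R| + 2, by positivity, by linarith⟩
  have hf : ContDiff ℝ ∞ (f : ℝ → ℝ) := f.contDiff
  have hf1 : ContDiff ℝ 1 (f : ℝ → ℝ) := f.contDiff
  obtain ⟨M, hM⟩ := f.hasCompactSupport.deriv.exists_bound_of_continuous
    (hf1.continuous_deriv le_rfl)
  refine ⟨max M 1, f, deriv f, by positivity, fun p q => ⟨fun r =>
    (hf1.differentiable one_ne_zero r).hasDerivAt, hf1.continuous_deriv le_rfl, fun r _ => ?_,
    fun r _ => (hM r).trans (le_max_left _ _)⟩, fun r => f.nonneg, fun r hr => ?_, |R| + 2, fun r hr => ?_⟩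
  · rw [abs_of_nonneg f.nonneg]; exact f.le_one.trans (le_max_right _ _)
  · refine f.one_of_mem_closedBall ?_
    rw [mem_closedBall_zero_iff, norm_eq_abs, abs_of_pos hr.1]
    exact hr.2.trans ((le_abs_self R).trans (by simp [f]))
  · refine f.zero_of_le_dist ?_
    rw [Real.dist_0_eq_abs]
    change |R| + 2 ≤ |r|
    by_contra hlt
    rw [not_le, abs_lt] at hlt
    exact hr ⟨hlt.1, hlt.2.le⟩

/-- The algebraic relations turning a subsolution into a solution. -/
def IsExact (κ γ : ℝ) (v : St) : Prop :=
  0 < v.1 ∧ v.2.2.2 = pres κ γ v.1 ∧ v.1 * (v.2.2.1 - v.2.2.2) = v.2.1 ^ 2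

lemma CellSolution.congr_right {κ γ : ℝ} {α β : ℝ → ℝ} {z₀ D D' : ℝ × ℝ → St} {a b p q ε : ℝ}
    (h : CellSolution κ γ α β z₀ a b p q ε D) (hE : EqOn D D' (box a b p q)) :
    CellSolution κ γ α β z₀ a b p q ε D' where
  integrable := h.integrable.congr_fun hE (measurableSet_box _ _ _ _)
  exact := by
    filter_upwards [h.exact, ae_restrict_mem (measurableSet_box _ _ _ _)] with x hx hm
    rwa [← hE hm]
  mass φ hφ := by
    rw [← h.mass φ hφ]
    exact setIntegral_congr_fun (measurableSet_box _ _ _ _) fun x hx => by simp only [hE hx]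
  mom φ hφ := by
    rw [← h.mom φ hφ]
    exact setIntegral_congr_fun (measurableSet_box _ _ _ _) fun x hx => by simp only [hE hx]
  slice := by
    filter_upwards [h.slice, ae_restrict_mem measurableSet_Ioc] with t ht htm
    have hE' : EqOn (fun r => D (t, r)) (fun r => D' (t, r)) (Ioc p q) := fun r hr => hE ⟨htm, hr⟩
    refine ⟨ht.1.congr_fun hE' measurableSet_Ioc, fun M ψ ψ' hψ i => ?_⟩
    refine le_of_eq_of_le (congrArg _ ?_) (ht.2 M ψ ψ' hψ i)
    exact setIntegral_congr_fun measurableSet_Ioc fun r hr => by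
      have := hE' hr
      simp only at this
      simp only [this]

/-- A correction solving the inclusion on every cell of a partition of the quadrant. -/
structure CellSystem (κ γ : ℝ) (n : ℕ) (z₀ : ℝ × ℝ → St) (a b p q ε : ℕ → ℝ)
    (D : ℝ × ℝ → St) : Prop where
  cells : Cells a b p q
  pos : ∀ k, 0 < ε k
  summable : Summable ε
  summable_mul : Summable fun k => ε k * (b k - a k)
  sol : ∀ k, CellSolution κ γ (rad n) (rad' n) z₀ (a k) (b k) (p k) (q k) (ε k) D

lemma exists_cellSystem {κ γ : ℝ} {n : ℕ} (hκ : 0 < κ) (hγ : 1 < γ) (hn : 2 ≤ n)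
    {z₀ : ℝ × ℝ → St} (hz : ContinuousOn z₀ (Ioi 0 ×ˢ Ioi 0))
    (hW : ∀ x ∈ (Ioi 0 ×ˢ Ioi 0 : Set (ℝ × ℝ)), ∃ c, (z₀ x, c) ∈ lamSet κ γ) :
    ∃ a b p q ε D, CellSystem κ γ n z₀ a b p q ε D := by
  obtain ⟨a, b, p, q, h⟩ := exists_cells
  have hd : ∀ k, 0 < b k - a k := fun k => sub_pos.2 (h.lt k)
  set ε : ℕ → ℝ := fun k => (1 / 2) ^ k / (1 + (b k - a k)) with hε
  have hεp : ∀ k, 0 < ε k := fun k => by have := hd k; positivity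
  choose D hD using fun k => exists_cellSolution hκ hγ hn hz hW (hεp k) (h.pos k) (h.lt k) (h.pos' k)
    (h.lt' k)
  classical
  let G : ℝ × ℝ → St := fun x => if hx : ∃ k, x ∈ box (a k) (b k) (p k) (q k) then D hx.choose x else 0
  have hG : ∀ k, EqOn (D k) G (box (a k) (b k) (p k) (q k)) := fun k x hx => by
    have hex : ∃ k, x ∈ box (a k) (b k) (p k) (q k) := ⟨k, hx⟩
    simp only [G, dif_pos hex]
    rw [h.index_unique hx hex.choose_spec]
  refine ⟨a, b, p, q, ε, G, h, hεp, ?_, ?_, fun k => (hD k).congr_right (hG k)⟩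
  · refine Summable.of_nonneg_of_le (fun k => (hεp k).le) (fun k => ?_) summable_geometric_two
    exact div_le_self (by positivity) (by linarith [hd k])
  · refine Summable.of_nonneg_of_le (fun k => (mul_pos (hεp k) (hd k)).le) (fun k => ?_)
      summable_geometric_two
    rw [hε, div_mul_eq_mul_div, div_le_iff₀ (by linarith [hd k])]
    exact mul_le_mul_of_nonneg_left (by linarith) (by positivity)

namespace CellSystem

variable {κ γ : ℝ} {n : ℕ} {z₀ : ℝ × ℝ → St} {a b p q ε : ℕ → ℝ} {D : ℝ × ℝ → St}

lemma ae_exact (h : CellSystem κ γ n z₀ a b p q ε D) :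
    ∀ᵐ x ∂volume.restrict (Ioi 0 ×ˢ Ioi 0 : Set (ℝ × ℝ)), IsExact κ γ (z₀ x + D x) := by
  rw [← h.cells.iUnion_eq, ae_restrict_iUnion_iff]
  exact fun k => (h.sol k).exact

lemma ae_slice_exact (h : CellSystem κ γ n z₀ a b p q ε D) :
    ∀ᵐ t ∂volume.restrict (Ioi (0:ℝ)), ∀ᵐ r ∂volume.restrict (Ioi (0:ℝ)),
      IsExact κ γ (z₀ (t, r) + D (t, r)) := by
  have := h.ae_exact
  rw [Measure.volume_eq_prod, ← Measure.prod_restrict] at this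
  exact Measure.ae_ae_of_ae_prod this

lemma ae_slice (h : CellSystem κ γ n z₀ a b p q ε D) :
    ∀ᵐ t ∂volume.restrict (Ioi (0:ℝ)), ∀ k,
      IntegrableOn (fun r => D (t, r)) (cellSlice a b p q t k) ∧
      ∀ M ψ ψ', 0 ≤ M → SliceTest (p k) (q k) M ψ ψ' → ∀ i,
        |∫ r in cellSlice a b p q t k, pairing (coordWeight (rad n) (rad' n) ψ i r) (D (t, r))|
          ≤ ε k * M := by
  rw [ae_all_iff]
  intro k
  filter_upwards [ae_restrict_of_ae ((ae_restrict_iff' measurableSet_Ioc).1 (h.sol k).slice)] with t ht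
  by_cases htm : t ∈ Ioc (a k) (b k)
  · rw [cellSlice_of_mem htm]
    exact ⟨(ht htm).1, fun M ψ ψ' _ => (ht htm).2 M ψ ψ'⟩
  · rw [cellSlice_of_notMem htm]
    refine ⟨integrableOn_empty, fun M ψ ψ' hM _ i => ?_⟩
    simpa using mul_nonneg (h.pos k).le hM

lemma locallyIntegrableOn (h : CellSystem κ γ n z₀ a b p q ε D)
    (hz : ContinuousOn z₀ (Ioi 0 ×ˢ Ioi 0)) :
    LocallyIntegrableOn (fun x => z₀ x + D x) (Ioi 0 ×ˢ Ioi 0) := by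
  intro x hx
  obtain ⟨s, hs⟩ := h.cells.near x hx
  refine ⟨_, mem_nhdsWithin_of_mem_nhds hs, integrableOn_finset_iUnion.2 fun k _ => ?_⟩
  refine Integrable.add ?_ (h.sol k).integrable
  refine IntegrableOn.mono_set (ContinuousOn.integrableOn_compact
    (isCompact_Icc.prod isCompact_Icc) (hz.mono fun y hy => ?_)) (box_subset_Icc (a k) (b k) (p k) (q k))
  exact ⟨(h.cells.pos k).trans_le hy.1.1, (h.cells.pos' k).trans_le hy.2.1⟩

end CellSystem

lemma continuous_rad (n : ℕ) : Continuous (rad n) := by unfold rad; fun_prop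

lemma continuous_rad' (n : ℕ) : Continuous (rad' n) := by unfold rad'; fun_prop

namespace CellSystem

variable {κ γ : ℝ} {n : ℕ} {z₀ : ℝ × ℝ → St} {a b p q ε : ℕ → ℝ} {D : ℝ × ℝ → St} {t : ℝ}

lemma integrableOn_slice (h : CellSystem κ γ n z₀ a b p q ε D)
    (hz : ContinuousOn z₀ (Ioi 0 ×ˢ Ioi 0)) (ht : 0 < t) (k : ℕ) :
    IntegrableOn (fun r => z₀ (t, r)) (cellSlice a b p q t k) := by
  have hc : ContinuousOn (fun r => z₀ (t, r)) (Icc (p k) (q k)) :=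
    hz.comp (by fun_prop) fun r hr => ⟨ht, (h.cells.pos' k).trans_le hr.1⟩
  exact (hc.integrableOn_compact isCompact_Icc).mono_set fun r hr => Ioc_subset_Icc_self hr.2

lemma integrableOn_pairing_slice {W : ℝ → St}
    (hW : Continuous W) {v : ℝ → St} {k : ℕ} (hv : IntegrableOn v (cellSlice a b p q t k)) :
    IntegrableOn (fun r => pairing (W r) (v r)) (cellSlice a b p q t k) := by
  obtain ⟨C, hC⟩ := (isCompact_Icc (a := p k) (b := q k)).exists_bound_of_continuousOn hW.continuousOn
  exact integrable_pairing hW.aestronglyMeasurable (ae_restrict_of_forall_mem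
    (measurableSet_cellSlice k) fun r hr => hC r (Ioc_subset_Icc_self hr.2)) hv

lemma integrableOn_coord (h : CellSystem κ γ n z₀ a b p q ε D)
    (hz : ContinuousOn z₀ (Ioi 0 ×ˢ Ioi 0)) (ht : 0 < t)
    (hs : ∀ k, IntegrableOn (fun r => D (t, r)) (cellSlice a b p q t k) ∧
      ∀ M ψ ψ', 0 ≤ M → SliceTest (p k) (q k) M ψ ψ' → ∀ i,
        |∫ r in cellSlice a b p q t k, pairing (coordWeight (rad n) (rad' n) ψ i r) (D (t, r))|
          ≤ ε k * M) {M : ℝ} {ψ ψ' : ℝ → ℝ} (hM : 0 ≤ M) (hψ : ∀ p q, SliceTest p q M ψ ψ') (i : Fin 4)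
    (h0 : ∀ᵐ r ∂volume.restrict (Ioi 0),
      0 ≤ pairing (coordWeight (rad n) (rad' n) ψ i r) (z₀ (t, r) + D (t, r)))
    (h₀ : IntegrableOn (fun r => pairing (coordWeight (rad n) (rad' n) ψ i r) (z₀ (t, r))) (Ioi 0)) :
    IntegrableOn (fun r => pairing (coordWeight (rad n) (rad' n) ψ i r) (z₀ (t, r) + D (t, r)))
      (Ioi 0) := by
  have hW : Continuous (coordWeight (rad n) (rad' n) ψ i) :=
    continuous_coordWeight (continuous_rad n) (continuous_rad' n) (hψ 0 0).continuous i
  have i0 := fun k => integrableOn_pairing_slice hW (h.integrableOn_slice hz ht k)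
  have i1 := fun k => integrableOn_pairing_slice hW (hs k).1
  refine h.cells.integrableOn_Ioi ht (h.summable.mul_right M) (fun k => ?_) h0 h₀ fun k => ?_
  · simp only [pairing_add_right]; exact (i0 k).add (i1 k)
  · simp only [pairing_add_right]
    rw [integral_add (i0 k) (i1 k)]
    exact add_le_add_right ((le_abs_self _).trans ((hs k).2 M ψ ψ' hM (hψ _ _) i)) _

lemma ae_sliceIntegrable (hκ : 0 < κ) (h : CellSystem κ γ n z₀ a b p q ε D)
    (hz : ContinuousOn z₀ (Ioi 0 ×ˢ Ioi 0)) (hS : ∀ t, 0 < t → SliceIntegrable n fun r => z₀ (t, r)) :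
    ∀ᵐ t ∂volume.restrict (Ioi (0:ℝ)), SliceIntegrable n fun r => z₀ (t, r) + D (t, r) := by
  filter_upwards [h.ae_slice, h.ae_slice_exact, ae_restrict_mem measurableSet_Ioi] with t hs hex ht
  have hb : ∀ᵐ r ∂volume.restrict (Ioi (0:ℝ)), StBounds (z₀ (t, r) + D (t, r)) :=
    hex.mono fun r hr => stBounds_of_exact hκ hr.1 hr.2.1 hr.2.2
  refine ⟨(hS t ht).meas.add ?_, hb, fun R => ?_, ?_⟩
  · rw [← h.cells.iUnion_slice ht, aestronglyMeasurable_iUnion_iff]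
    exact fun k => (hs k).1.aestronglyMeasurable
  · obtain ⟨M, ψ, ψ', hM, hψ, hψ0, hψ1, R', hψR⟩ := exists_slice_cutoff R
    have key := h.integrableOn_coord hz ht hs hM hψ 0 ?_ ?_
    · refine IntegrableOn.congr_fun (key.mono_set Ioc_subset_Ioi_self) (fun r hr => ?_) measurableSet_Ioc
      simp [pairing, coordWeight, hψ1 r hr]
    · filter_upwards [hb, ae_restrict_mem measurableSet_Ioi] with r hr hr0
      simp only [pairing, coordWeight, zero_mul, add_zero]
      exact mul_nonneg (mul_nonneg (rad_nonneg n (le_of_lt hr0)) (hψ0 r)) hr.1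
    · have hdom := ((hS t ht).mass R').bdd_mul (c := M) (f := ψ)
        (hψ 0 0).continuous.aestronglyMeasurable
        (ae_restrict_of_forall_mem measurableSet_Ioc fun r hr => (hψ 0 R').le r hr)
      refine IntegrableOn.of_forall_sdiff_eq_zero (s := Ioc 0 R') ?_ measurableSet_Ioi fun r hr => ?_
      · refine hdom.congr (Eventually.of_forall fun r => ?_)
        simp only [pairing, coordWeight, zero_mul, add_zero]; ring
      · have : ψ r = 0 := hψR r fun h' => hr.2 ⟨hr.1, h'.2⟩
        simp [pairing, coordWeight, this]
  · have hψ : ∀ p q, SliceTest p q 1 (fun _ => 1) (fun _ => 0) := fun p q =>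
      ⟨fun r => hasDerivAt_const _ _, continuous_const, by simp, by simp⟩
    have key := h.integrableOn_coord hz ht hs zero_le_one hψ 2 ?_ ?_
    · simpa [pairing, coordWeight] using key
    · filter_upwards [hb, ae_restrict_mem measurableSet_Ioi] with r hr hr0
      simp only [pairing, coordWeight, zero_mul, add_zero, zero_add, mul_one]
      exact mul_nonneg (rad_nonneg n (le_of_lt hr0)) (hr.2.2.1.trans hr.2.2.2)
    · simpa [pairing, coordWeight] using (hS t ht).flux

end CellSystem

lemma hasDerivAt_slice_left {F : ℝ × ℝ → ℝ} (hF : ContDiff ℝ 1 F) (t r : ℝ) :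
    HasDerivAt (fun s => F (s, r)) (dt F (t, r)) t := by
  have h1 : HasDerivAt (fun s : ℝ => (s, r)) (1, 0) t :=
    (hasDerivAt_id t).prodMk (hasDerivAt_const t r)
  exact ((hF.differentiable one_ne_zero (t, r)).hasFDerivAt).comp_hasDerivAt t h1

namespace TestBounds

variable {φ : ℝ × ℝ → ℝ} {M R : ℝ}

lemma sliceTest (h : TestBounds φ M R) (t p q : ℝ) :
    SliceTest p q M (fun r => φ (t, r)) (fun r => dr φ (t, r)) where
  deriv r := hasDerivAt_slice (h.smooth.of_le (by norm_num)) t r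
  cont := (contDiff_dr (h.smooth.of_le (by norm_num))).continuous.comp (by fun_prop)
  le r _ := h.le _
  le' r _ := h.le_dr _

lemma sliceTest_dt (h : TestBounds φ M R) (t p q : ℝ) :
    SliceTest p q M (fun r => dt φ (t, r)) (fun r => dr (dt φ) (t, r)) where
  deriv r := hasDerivAt_slice (contDiff_dt (h.smooth.of_le (by norm_num))) t r
  cont := (contDiff_dr ((h.smooth.fderiv_right (m := 2) (by norm_num)).clm_apply
    contDiff_const)).continuous.comp (by fun_prop)
  le r _ := h.le_dt _
  le' r _ := h.le_dr_dt _

lemma sliceTest_dr (h : TestBounds φ M R) (t p q : ℝ) :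
    SliceTest p q M (fun r => dr φ (t, r)) (fun r => dr (dr φ) (t, r)) where
  deriv r := hasDerivAt_slice (contDiff_dr (h.smooth.of_le (by norm_num))) t r
  cont := (contDiff_dr ((h.smooth.fderiv_right (m := 2) (by norm_num)).clm_apply
    contDiff_const)).continuous.comp (by fun_prop)
  le r _ := h.le_dr _
  le' r _ := h.le_dr_dr _

end TestBounds

namespace CellSystem

variable {κ γ : ℝ} {n : ℕ} {z₀ : ℝ × ℝ → St} {a b p q ε : ℕ → ℝ} {D : ℝ × ℝ → St} {ρ₀ m₀ : ℝ → ℝ}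

lemma integral_mass (hκ : 0 < κ) (h : CellSystem κ γ n z₀ a b p q ε D)
    (hb : BaseSubsolution κ γ n ρ₀ m₀ z₀) {φ : ℝ × ℝ → ℝ} (hφ : ContDiff ℝ 3 φ)
    (hc : HasCompactSupport φ) :
    (∫ t in Ioi 0, ∫ r in Ioi 0, pairing (massWeight (rad n) φ (t, r)) (z₀ (t, r) + D (t, r)))
      + ∫ r in Ioi 0, ρ₀ r * φ (0, r) * r ^ (n - 1) = 0 := by
  obtain ⟨M, R, hM⟩ := exists_testBounds hφ hc
  have hφ2 : ContDiff ℝ 2 φ := hφ.of_le (by norm_num)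
  obtain ⟨i0, e0⟩ := hb.mass φ hφ hc
  rw [h.cells.integral_pairing_add_eq h.summable_mul (C := 2 * M) (continuous_massWeight hφ2)
    (fun k => (h.sol k).integrable) (fun k => (h.sol k).mass φ hφ2) ?_ ?_ ?_ i0]
  · exact e0
  · filter_upwards [h.ae_slice] with t ht k
    have hs := ht k
    have e : ∀ r, pairing (massWeight (rad n) φ (t, r)) (D (t, r))
        = pairing (coordWeight (rad n) (rad' n) (fun r => dt φ (t, r)) 0 r) (D (t, r))
          + pairing (coordWeight (rad n) (rad' n) (fun r => dr φ (t, r)) 1 r) (D (t, r)) := fun r => by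
      simp only [pairing, massWeight, coordWeight]; ring
    have W : ∀ i {M ψ ψ'}, SliceTest 0 0 M ψ ψ' →
        Continuous (coordWeight (rad n) (rad' n) ψ i) := fun i _ _ _ hψ =>
      continuous_coordWeight (continuous_rad n) (continuous_rad' n) hψ.continuous i
    simp only [e]
    rw [integral_add (integrableOn_pairing_slice (W 0 (hM.sliceTest_dt t 0 0)) hs.1)
      (integrableOn_pairing_slice (W 1 (hM.sliceTest_dr t 0 0)) hs.1)]
    refine (abs_add_le _ _).trans ?_
    linarith [hs.2 M _ _ hM.nonneg (hM.sliceTest_dt t _ _) 0,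
      hs.2 M _ _ hM.nonneg (hM.sliceTest_dr t _ _) 1]
  · filter_upwards [ae_restrict_mem measurableSet_Ioi] with t ht using (hb.slice t ht).integrableOn_mass hM t
  · filter_upwards [h.ae_sliceIntegrable hκ hb.cont hb.slice] with t ht using ht.integrableOn_mass hM t

lemma integral_mom (hκ : 0 < κ) (hn : 2 ≤ n) (h : CellSystem κ γ n z₀ a b p q ε D)
    (hb : BaseSubsolution κ γ n ρ₀ m₀ z₀) {φ : ℝ × ℝ → ℝ} (hφ : ContDiff ℝ 3 φ)
    (hc : HasCompactSupport φ) (h0 : ∀ t, 0 ≤ t → φ (t, 0) = 0) :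
    (∫ t in Ioi 0, ∫ r in Ioi 0, pairing (momWeight (rad n) (rad' n) φ (t, r)) (z₀ (t, r) + D (t, r)))
      + ∫ r in Ioi 0, m₀ r * φ (0, r) * r ^ (n - 1) = 0 := by
  obtain ⟨M, R, hM⟩ := exists_testBounds hφ hc
  have hφ2 : ContDiff ℝ 2 φ := hφ.of_le (by norm_num)
  obtain ⟨i0, e0⟩ := hb.mom φ hφ hc h0
  rw [h.cells.integral_pairing_add_eq h.summable_mul (C := 3 * M) (continuous_momWeight hφ2)
    (fun k => (h.sol k).integrable) (fun k => (h.sol k).mom φ hφ2) ?_ ?_ ?_ i0]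
  · exact e0
  · filter_upwards [h.ae_slice] with t ht k
    have hs := ht k
    have e : ∀ r, pairing (momWeight (rad n) (rad' n) φ (t, r)) (D (t, r))
        = pairing (coordWeight (rad n) (rad' n) (fun r => dt φ (t, r)) 1 r) (D (t, r))
          + (pairing (coordWeight (rad n) (rad' n) (fun r => dr φ (t, r)) 2 r) (D (t, r))
          + pairing (coordWeight (rad n) (rad' n) (fun r => φ (t, r)) 3 r) (D (t, r))) := fun r => by
      simp only [pairing, momWeight, coordWeight]; ring
    have W : ∀ i {M ψ ψ'}, SliceTest 0 0 M ψ ψ' →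
        Continuous (coordWeight (rad n) (rad' n) ψ i) := fun i _ _ _ hψ =>
      continuous_coordWeight (continuous_rad n) (continuous_rad' n) hψ.continuous i
    simp only [e]
    have j1 := integrableOn_pairing_slice (W 1 (hM.sliceTest_dt t 0 0)) hs.1
    have j2 := integrableOn_pairing_slice (W 2 (hM.sliceTest_dr t 0 0)) hs.1
    have j3 := integrableOn_pairing_slice (W 3 (hM.sliceTest t 0 0)) hs.1
    have e2 := integral_add j1 (j2.add j3)
    simp only [Pi.add_apply] at e2
    rw [e2, integral_add j2 j3]
    refine (abs_add_le _ _).trans ?_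
    refine (add_le_add_right (abs_add_le _ _) _).trans ?_
    linarith [hs.2 M _ _ hM.nonneg (hM.sliceTest_dt t _ _) 1,
      hs.2 M _ _ hM.nonneg (hM.sliceTest_dr t _ _) 2, hs.2 M _ _ hM.nonneg (hM.sliceTest t _ _) 3]
  · filter_upwards [ae_restrict_mem measurableSet_Ioi] with t ht using
      (hb.slice t ht).integrableOn_mom hn hM (h0 t (le_of_lt ht))
  · filter_upwards [h.ae_sliceIntegrable hκ hb.cont hb.slice, ae_restrict_mem measurableSet_Ioi]
      with t ht ht0 using ht.integrableOn_mom hn hM (h0 t (le_of_lt ht0))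

end CellSystem

lemma IsExact.kinetic {κ γ : ℝ} {v : St} (h : IsExact κ γ v) : v.2.1 ^ 2 / v.1 = v.2.2.1 - v.2.2.2 := by
  rw [div_eq_iff h.1.ne', ← h.2.2]; ring

lemma div_mul_rad {n : ℕ} (hn : 2 ≤ n) {r : ℝ} (hr : 0 < r) :
    ((n : ℝ) - 1) / r * r ^ (n - 1) = rad' n r := by
  rw [div_mul_eq_mul_div, div_eq_iff hr.ne', rad'_mul hn]; rfl

theorem exists_solution_of_baseSubsolution {n : ℕ} (hn : 2 ≤ n) {κ γ : ℝ} (hκ : 0 < κ) (hγ : 1 < γ)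
    {ρ₀ m₀ : ℝ → ℝ} {z₀ : ℝ × ℝ → St} (hb : BaseSubsolution κ γ n ρ₀ m₀ z₀) :
    ∃ ρ m : ℝ → ℝ → ℝ,
      (∀ t r, 0 ≤ ρ t r) ∧
      LocallyIntegrableOn (Function.uncurry ρ) (Set.Ioi 0 ×ˢ Set.Ioi 0) ∧
      LocallyIntegrableOn (Function.uncurry m) (Set.Ioi 0 ×ˢ Set.Ioi 0) ∧
      (∀ᵐ t ∂(volume.restrict (Set.Ioi (0:ℝ))),
        IntegrableOn
          (fun r => ((1/2) * (m t r) ^ (2:ℕ) / ρ t r + κ * (ρ t r) ^ γ / (γ - 1))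
            * r ^ (n - 1))
          (Set.Ioi 0)) ∧
      (∀ φ : ℝ → ℝ → ℝ,
        ContDiff ℝ (⊤ : ℕ∞) (Function.uncurry φ) →
        HasCompactSupport (Function.uncurry φ) →
        (∫ t in Set.Ioi (0:ℝ), ∫ r in Set.Ioi (0:ℝ),
            (ρ t r * deriv (fun s => φ s r) t + m t r * deriv (fun y => φ t y) r)
              * r ^ (n - 1))
          + (∫ r in Set.Ioi (0:ℝ), ρ₀ r * φ 0 r * r ^ (n - 1)) = 0) ∧
      (∀ φ : ℝ → ℝ → ℝ,
        ContDiff ℝ (⊤ : ℕ∞) (Function.uncurry φ) →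
        HasCompactSupport (Function.uncurry φ) →
        (∀ t : ℝ, 0 ≤ t → φ t 0 = 0) →
        (∫ t in Set.Ioi (0:ℝ), ∫ r in Set.Ioi (0:ℝ),
            (m t r * deriv (fun s => φ s r) t
              + (m t r) ^ (2:ℕ) / ρ t r * deriv (fun y => φ t y) r
              + κ * (ρ t r) ^ γ
                * (deriv (fun y => φ t y) r + ((n - 1 : ℝ) / r) * φ t r))
              * r ^ (n - 1))
          + (∫ r in Set.Ioi (0:ℝ), m₀ r * φ 0 r * r ^ (n - 1)) = 0) := by
  obtain ⟨a, b, p, q, ε, D, h⟩ := exists_cellSystem hκ hγ hn hb.cont hb.mem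
  set Z : ℝ × ℝ → St := fun x => z₀ x + D x with hZ
  have hloc : LocallyIntegrableOn Z (Ioi 0 ×ˢ Ioi 0) := h.locallyIntegrableOn hb.cont
  have hγ1 : 0 < γ - 1 := sub_pos.2 hγ
  have hder : ∀ φ : ℝ → ℝ → ℝ, ContDiff ℝ (⊤ : ℕ∞) (uncurry φ) → ContDiff ℝ 3 (uncurry φ) ∧
      (∀ t r, deriv (fun s => φ s r) t = dt (uncurry φ) (t, r)) ∧
      ∀ t r, deriv (fun y => φ t y) r = dr (uncurry φ) (t, r) := fun φ hφ => by
    have hφ3 : ContDiff ℝ 3 (uncurry φ) := contDiff_infty.1 hφ 3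
    have hφ1 : ContDiff ℝ 1 (uncurry φ) := hφ3.of_le (by norm_num)
    exact ⟨hφ3, fun t r => (hasDerivAt_slice_left hφ1 t r).deriv,
      fun t r => (hasDerivAt_slice hφ1 t r).deriv⟩
  refine ⟨fun t r => max 0 (Z (t, r)).1, fun t r => (Z (t, r)).2.1, fun t r => le_max_left _ _, ?_, ?_,
    ?_, fun φ hφ hc => ?_, fun φ hφ hc h0 => ?_⟩
  · intro x hx
    obtain ⟨s, hs, hi⟩ := hloc x hx
    exact ⟨s, hs, (integrable_zero _ _ _).sup hi.fst⟩
  · intro x hx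
    obtain ⟨s, hs, hi⟩ := hloc x hx
    exact ⟨s, hs, hi.snd.fst⟩
  · filter_upwards [h.ae_slice_exact, h.ae_sliceIntegrable hκ hb.cont hb.slice] with t hex hS
    have hmeas : AEStronglyMeasurable (fun r => ((1/2) * ((Z (t, r)).2.2.1 - (Z (t, r)).2.2.2)
        + (Z (t, r)).2.2.2 / (γ - 1)) * rad n r) (volume.restrict (Ioi 0)) := by
      have hc : Continuous fun v : St => (1/2) * (v.2.2.1 - v.2.2.2) + v.2.2.2 / (γ - 1) := by
        fun_prop
      exact (hc.comp_aestronglyMeasurable hS.meas).mul (continuous_rad n).aestronglyMeasurable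
    have hi : IntegrableOn (fun r => ((1/2) * ((Z (t, r)).2.2.1 - (Z (t, r)).2.2.2)
        + (Z (t, r)).2.2.2 / (γ - 1)) * rad n r) (Ioi 0) := by
      refine Integrable.mono' (hS.flux.const_mul (1 + 1 / (γ - 1))) hmeas ?_
      filter_upwards [hS.bounds, ae_restrict_mem measurableSet_Ioi] with r hr hr0
      have h0 : 0 ≤ rad n r := rad_nonneg n (le_of_lt hr0)
      have h3 : 0 ≤ (Z (t, r)).2.2.2 := hr.2.2.1
      have h4 : (Z (t, r)).2.2.2 ≤ (Z (t, r)).2.2.1 := hr.2.2.2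
      rw [norm_eq_abs, abs_mul, abs_of_nonneg h0]
      have e1 : (Z (t, r)).2.2.2 / (γ - 1) ≤ (Z (t, r)).2.2.1 / (γ - 1) :=
        div_le_div_of_nonneg_right h4 hγ1.le
      have e2 : 0 ≤ (Z (t, r)).2.2.2 / (γ - 1) := div_nonneg h3 hγ1.le
      rw [abs_of_nonneg (add_nonneg (by linarith) e2)]
      have e3 : (1/2) * ((Z (t, r)).2.2.1 - (Z (t, r)).2.2.2) + (Z (t, r)).2.2.2 / (γ - 1)
          ≤ (1 + 1 / (γ - 1)) * (Z (t, r)).2.2.1 := by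
        rw [add_mul, one_div_mul_eq_div (γ - 1)]
        linarith
      calc _ ≤ (1 + 1 / (γ - 1)) * (Z (t, r)).2.2.1 * rad n r := mul_le_mul_of_nonneg_right e3 h0
        _ = _ := by ring
    refine hi.congr ?_
    filter_upwards [hex] with r hr
    have hP : κ * (Z (t, r)).1 ^ γ = (Z (t, r)).2.2.2 := hr.2.1.symm
    rw [max_eq_right hr.1.le, mul_div_assoc, hr.kinetic, hP]
    rfl
  · obtain ⟨hφ3, ht, hr⟩ := hder φ hφ
    refine Eq.trans (congrArg (· + _) ?_) (h.integral_mass hκ hb hφ3 hc)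
    refine integral_congr_ae ?_
    filter_upwards [h.ae_slice_exact] with t hex
    refine integral_congr_ae ?_
    filter_upwards [hex] with r hr'
    simp only [ht, hr]
    rw [max_eq_right hr'.1.le]
    simp only [pairing, massWeight, hZ, rad]; ring
  · obtain ⟨hφ3, ht, hr⟩ := hder φ hφ
    refine Eq.trans (congrArg (· + _) ?_) (h.integral_mom hκ hn hb hφ3 hc h0)
    refine integral_congr_ae ?_
    filter_upwards [h.ae_slice_exact] with t hex
    refine integral_congr_ae ?_
    filter_upwards [hex, ae_restrict_mem measurableSet_Ioi] with r hr' hr0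
    simp only [ht, hr]
    rw [max_eq_right hr'.1.le, hr'.kinetic]
    have hP : κ * (Z (t, r)).1 ^ γ = (Z (t, r)).2.2.2 := hr'.2.1.symm
    rw [hP]
    have hd := div_mul_rad hn hr0
    simp only [pairing, momWeight, hZ, rad, uncurry_apply_pair, ← hd]; ring

lemma integral_Ioi_of_tendsto {Y K : ℝ → ℝ} {l : ℝ} (hder : ∀ t, 0 < t → HasDerivAt Y (K t) t)
    (h0 : Tendsto Y (𝓝[>] 0) (𝓝 l)) (hend : ∀ᶠ t in atTop, Y t = 0) (hK : IntegrableOn K (Ioi 0)) :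
    ∫ t in Ioi 0, K t = -l := by
  have hne : ∀ t, 0 < t → update Y 0 l =ᶠ[𝓝 t] Y := fun t ht => by
    filter_upwards [lt_mem_nhds ht] with x hx using update_of_ne hx.ne' _ _
  have := integral_Ioi_of_hasDerivAt_of_tendsto (f := update Y 0 l) (f' := K) (a := 0) (m := 0) ?_
    (fun t ht => (hder t ht).congr_of_eventuallyEq (hne t ht)) hK ?_
  · simpa using this
  · rw [← continuousWithinAt_Ioi_iff_Ici]
    simp only [ContinuousWithinAt, update_self]
    refine h0.congr' ?_
    filter_upwards [self_mem_nhdsWithin] with t ht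
    exact (update_of_ne (ne_of_gt ht) _ _).symm
  · refine tendsto_const_nhds.congr' ?_
    filter_upwards [hend, eventually_gt_atTop 0] with t ht ht0
    rw [update_of_ne ht0.ne', ht]

lemma particle_integral {Ω : Type*} [MeasurableSpace Ω] {ν : Measure Ω} [SFinite ν]
    {Y K : ℝ → Ω → ℝ} {l : Ω → ℝ}
    (hK : Integrable (uncurry K) ((volume.restrict (Ioi 0)).prod ν))
    (hder : ∀ᵐ o ∂ν, ∀ t, 0 < t → HasDerivAt (fun t => Y t o) (K t o) t)
    (h0 : ∀ᵐ o ∂ν, Tendsto (fun t => Y t o) (𝓝[>] 0) (𝓝 (l o)))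
    (hend : ∀ᵐ o ∂ν, ∀ᶠ t in atTop, Y t o = 0) :
    IntegrableOn (fun t => ∫ o, K t o ∂ν) (Ioi 0) ∧
      (∫ t in Ioi 0, ∫ o, K t o ∂ν) = -∫ o, l o ∂ν := by
  refine ⟨hK.integral_prod_left, ?_⟩
  rw [integral_integral_swap hK, ← integral_neg]
  refine integral_congr_ae ?_
  filter_upwards [hder, h0, hend, hK.prod_left_ae] with o h1 h2 h3 h4
  exact integral_Ioi_of_tendsto h1 h2 h3 h4

/-- The integral of `g` over the half line beyond the current radius. -/
def tail (g : ℝ × ℝ → ℝ) (x : ℝ × ℝ) : ℝ := ∫ y in Ioi x.2, g (x.1, y)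

section Tail

variable {g : ℝ × ℝ → ℝ} {B : ℝ → ℝ} {e : ℝ}

lemma integrableOn_decay {s c : ℝ} (hs : s < -1) (hc : 0 ≤ c) :
    IntegrableOn (fun y : ℝ => (1 + y) ^ s) (Ioi c) := by
  have := integrableOn_add_rpow_Ioi_of_lt (m := 1) hs (by linarith : -1 < c)
  simpa only [add_comm] using this

lemma integral_decay_le (he : 0 < e) {r : ℝ} (hr : 0 ≤ r) :
    ∫ y in Ioi r, (1 + y) ^ (-(2 + e)) ≤ (1 + r) ^ (-(1 + e)) := by
  have hd : ∀ y ∈ Ici r, HasDerivAt (fun y : ℝ => -(1 + y) ^ (-(1 + e)) / (1 + e))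
      ((1 + y) ^ (-(2 + e))) y := fun y hy => by
    have hy' : 0 < 1 + y := by linarith [mem_Ici.1 hy]
    have h1 := ((hasDerivAt_id y).const_add 1).rpow_const (p := -(1 + e)) (Or.inl hy'.ne')
    refine (h1.neg.div_const (1 + e)).congr_deriv ?_
    have : -(1 + e) - 1 = -(2 + e) := by ring
    simp only [id, this]
    field_simp
  have ht : Tendsto (fun y : ℝ => -(1 + y) ^ (-(1 + e)) / (1 + e)) atTop (𝓝 0) := by
    have h1 : Tendsto (fun y : ℝ => (1 + y) ^ (-(1 + e))) atTop (𝓝 0) :=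
      (tendsto_rpow_neg_atTop (by linarith)).comp (tendsto_atTop_add_const_left _ 1 tendsto_id)
    simpa using (h1.neg.div_const (1 + e))
  rw [integral_Ioi_of_hasDerivAt_of_tendsto' hd (integrableOn_decay (by linarith) hr) ht]
  have h0 : 0 ≤ (1 + r) ^ (-(1 + e)) := by positivity
  rw [zero_sub, neg_div, neg_neg]
  exact div_le_self h0 (by linarith)

lemma integrableOn_slice_of_decay (hg : ContinuousOn g (Ioi 0 ×ˢ Ioi 0)) (he : 0 < e)
    (hB : ∀ t r, 0 < t → 0 < r → |g (t, r)| ≤ B t * (1 + r) ^ (-(2 + e)))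
    {t : ℝ} (ht : 0 < t) : IntegrableOn (fun y => g (t, y)) (Ioi 0) := by
  have hc : ContinuousOn (fun y => g (t, y)) (Ioi 0) := hg.comp (by fun_prop) fun y hy => ⟨ht, hy⟩
  refine Integrable.mono' ((integrableOn_decay (s := -(2 + e)) (by linarith) le_rfl).const_mul (B t))
    (hc.aestronglyMeasurable measurableSet_Ioi) ?_
  exact ae_restrict_of_forall_mem measurableSet_Ioi fun r hr => hB t r ht hr

lemma abs_tail_le (he : 0 < e)
    (hB : ∀ t r, 0 < t → 0 < r → |g (t, r)| ≤ B t * (1 + r) ^ (-(2 + e)))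
    {t r : ℝ} (ht : 0 < t) (hr : 0 < r) : |tail g (t, r)| ≤ B t * (1 + r) ^ (-(1 + e)) := by
  have hB0 : 0 ≤ B t := by
    have := (abs_nonneg _).trans (hB t r ht hr)
    exact nonneg_of_mul_nonneg_left this (by positivity)
  have hd := (integrableOn_decay (s := -(2 + e)) (by linarith) hr.le).const_mul (B t)
  refine (norm_integral_le_of_norm_le (f := fun y => g (t, y)) hd (ae_restrict_of_forall_mem measurableSet_Ioi
    fun y hy => hB t y ht (hr.trans hy))).trans ?_
  rw [integral_const_mul]
  exact mul_le_mul_of_nonneg_left (integral_decay_le he hr.le) hB0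

lemma hasDerivAt_tail (hg : ContinuousOn g (Ioi 0 ×ˢ Ioi 0)) (he : 0 < e)
    (hB : ∀ t r, 0 < t → 0 < r → |g (t, r)| ≤ B t * (1 + r) ^ (-(2 + e)))
    {t r : ℝ} (ht : 0 < t) (hr : 0 < r) :
    HasDerivAt (fun r => tail g (t, r)) (-g (t, r)) r := by
  have hi := integrableOn_slice_of_decay hg he hB ht
  have hc : ContinuousOn (fun y => g (t, y)) (Ioi 0) := hg.comp (by fun_prop) fun y hy => ⟨ht, hy⟩
  have heq : (fun r => tail g (t, r)) =ᶠ[𝓝 r] fun x => tail g (t, r) - ∫ y in r..x, g (t, y) := by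
    filter_upwards [lt_mem_nhds hr] with x hx
    have := intervalIntegral.integral_Ioi_sub_Ioi' (hi.mono_set (Ioi_subset_Ioi hr.le))
      (hi.mono_set (Ioi_subset_Ioi (le_of_lt hx)))
    simp only [tail]; linarith
  refine HasDerivAt.congr_of_eventuallyEq ?_ heq
  have := intervalIntegral.integral_hasDerivAt_right (f := fun y => g (t, y)) (a := r) (b := r)
    (by simp) (hc.stronglyMeasurableAtFilter isOpen_Ioi r hr) (hc.continuousAt (Ioi_mem_nhds hr))
  simpa using this.const_sub (tail g (t, r))

lemma continuousOn_tail (hg : ContinuousOn g (Ioi 0 ×ˢ Ioi 0)) (he : 0 < e)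
    (hB : ∀ t r, 0 < t → 0 < r → |g (t, r)| ≤ B t * (1 + r) ^ (-(2 + e)))
    (hBc : ContinuousOn B (Ioi 0)) : ContinuousOn (tail g) (Ioi 0 ×ˢ Ioi 0) := by
  rintro ⟨t, r⟩ ⟨ht, hr⟩
  have ht' : 0 < t := ht
  have hr' : 0 < r := hr
  refine ContinuousAt.continuousWithinAt ?_
  have hq : (Ioi 0 ×ˢ Ioi 0 : Set (ℝ × ℝ)) ∈ 𝓝 (t, r) := prod_mem_nhds (Ioi_mem_nhds ht) (Ioi_mem_nhds hr)
  have heq : tail g =ᶠ[𝓝 (t, r)]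
      fun x => ∫ y in Ioi 0, (Ioi x.2).indicator (fun y => g (x.1, y)) y := by
    filter_upwards [hq] with x hx
    rw [setIntegral_indicator measurableSet_Ioi, inter_eq_right.2 (Ioi_subset_Ioi (le_of_lt hx.2)), tail]
  refine ContinuousAt.congr ?_ heq.symm
  have hBn : ∀ᶠ x : ℝ × ℝ in 𝓝 (t, r), B x.1 ≤ B t + 1 := by
    have : ContinuousAt (fun x : ℝ × ℝ => B x.1) (t, r) :=
      ContinuousAt.comp (f := Prod.fst) (hBc.continuousAt (Ioi_mem_nhds ht)) continuousAt_fst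
    filter_upwards [this.eventually (gt_mem_nhds (show B t < B t + 1 by linarith))] with x hx using hx.le
  refine continuousAt_of_dominated (bound := fun y => (B t + 1) * (1 + y) ^ (-(2 + e))) ?_ ?_
    ((integrableOn_decay (by linarith) le_rfl).const_mul _) ?_
  · filter_upwards [hq] with x hx
    exact (integrableOn_slice_of_decay hg he hB hx.1).aestronglyMeasurable.indicator measurableSet_Ioi
  · filter_upwards [hq, hBn] with x hx hx'
    refine ae_restrict_of_forall_mem measurableSet_Ioi fun y hy => ?_
    have hy0 : (0:ℝ) < y := hy
    refine (norm_indicator_le_norm_self _ _).trans ((hB x.1 y hx.1 hy).trans ?_)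
    exact mul_le_mul_of_nonneg_right hx' (by positivity)
  · have hne : ∀ᵐ y ∂volume.restrict (Ioi (0:ℝ)), y ≠ r := ae_restrict_of_ae (Measure.ae_ne volume r)
    filter_upwards [hne, ae_restrict_mem measurableSet_Ioi] with y hy hy0
    have hgc : ContinuousAt (fun x : ℝ × ℝ => g (x.1, y)) (t, r) := by
      refine ContinuousAt.comp (f := fun x : ℝ × ℝ => (x.1, y)) (hg.continuousAt ?_) (by fun_prop)
      exact prod_mem_nhds (Ioi_mem_nhds ht) (Ioi_mem_nhds hy0)
    rcases lt_or_gt_of_ne hy with h | h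
    · refine (continuousAt_const (y := (0:ℝ))).congr ?_
      filter_upwards [continuousAt_snd.eventually (lt_mem_nhds (show y < (t, r).2 from h))] with x hx
      exact (indicator_of_notMem (by simpa using le_of_lt hx) _).symm
    · refine hgc.congr ?_
      filter_upwards [continuousAt_snd.eventually (gt_mem_nhds (show (t, r).2 < y from h))] with x hx
      exact (indicator_of_mem (by simpa using hx) (fun y => g (x.1, y))).symm

lemma integrableOn_tail (hg : ContinuousOn g (Ioi 0 ×ˢ Ioi 0)) (he : 0 < e)
    (hB : ∀ t r, 0 < t → 0 < r → |g (t, r)| ≤ B t * (1 + r) ^ (-(2 + e)))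
    {t : ℝ} (ht : 0 < t) :
    IntegrableOn (fun r => tail g (t, r)) (Ioi 0) := by
  have hc : ContinuousOn (fun r => tail g (t, r)) (Ioi 0) := fun r hr =>
    (hasDerivAt_tail hg he hB ht hr).continuousAt.continuousWithinAt
  refine Integrable.mono' ((integrableOn_decay (s := -(1 + e)) (by linarith) le_rfl).const_mul (B t))
    (hc.aestronglyMeasurable measurableSet_Ioi) ?_
  exact ae_restrict_of_forall_mem measurableSet_Ioi fun r hr => abs_tail_le he hB ht hr

lemma integral_tail_mul (hg : ContinuousOn g (Ioi 0 ×ˢ Ioi 0)) (he : 0 < e)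
    (hB : ∀ t r, 0 < t → 0 < r → |g (t, r)| ≤ B t * (1 + r) ^ (-(2 + e)))
    {φ : ℝ × ℝ → ℝ} {M R t : ℝ} (hφ : TestBounds φ M R) (ht : 0 < t)
    (h0 : φ (t, 0) = 0) :
    IntegrableOn (fun r => tail g (t, r) * dr φ (t, r) - g (t, r) * φ (t, r)) (Ioi 0) ∧
    ∫ r in Ioi 0, (tail g (t, r) * dr φ (t, r) - g (t, r) * φ (t, r)) = 0 := by
  have hφ1 : ContDiff ℝ 1 φ := hφ.smooth.of_le (by norm_num)
  have c0 : Continuous fun r => φ (t, r) := hφ1.continuous.comp (by fun_prop)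
  have c1 : Continuous fun r => dr φ (t, r) :=
    (contDiff_dr (hφ.smooth.of_le (by norm_num))).continuous.comp (by fun_prop)
  have hInt : IntegrableOn (fun r => tail g (t, r) * dr φ (t, r) - g (t, r) * φ (t, r)) (Ioi 0) :=
    ((integrableOn_tail hg he hB ht).mul_bdd (c := M) c1.aestronglyMeasurable
      (Eventually.of_forall fun r => hφ.le_dr _)).sub
    ((integrableOn_slice_of_decay hg he hB ht).mul_bdd (c := M) c0.aestronglyMeasurable
      (Eventually.of_forall fun r => hφ.le _))
  refine ⟨hInt, ?_⟩
  have := integral_Ioi_of_tendsto (Y := fun r => tail g (t, r) * φ (t, r)) (l := 0) (fun r hr => ?_) ?_ ?_ hInt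
  · simpa using this
  · refine ((hasDerivAt_tail hg he hB ht hr).mul (hasDerivAt_slice hφ1 t r)).congr_deriv ?_
    ring
  · have hlim : Tendsto (fun r => B t * |φ (t, r)|) (𝓝[>] 0) (𝓝 0) := by
      have : Tendsto (fun r => B t * |φ (t, r)|) (𝓝 0) (𝓝 (B t * |φ (t, 0)|)) :=
        (continuous_const.mul c0.abs).tendsto 0
      rw [h0, abs_zero, mul_zero] at this
      exact this.mono_left nhdsWithin_le_nhds
    refine squeeze_zero_norm' ?_ hlim
    filter_upwards [self_mem_nhdsWithin] with r hr
    have hr0 : (0:ℝ) < r := hr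
    rw [norm_mul]
    refine mul_le_mul_of_nonneg_right ((abs_tail_le he hB ht hr).trans ?_) (norm_nonneg _)
    have hB0 : 0 ≤ B t :=
      nonneg_of_mul_nonneg_left ((abs_nonneg _).trans (hB t r ht hr)) (by positivity)
    refine mul_le_of_le_one_right hB0 ?_
    exact rpow_le_one_of_one_le_of_nonpos (by linarith) (by linarith)
  · filter_upwards [eventually_ge_atTop R] with r hr
    rw [(hφ.zero (t, r) hr).1, mul_zero]

end Tail

lemma hasDerivAt_comp_path {φ : ℝ × ℝ → ℝ} (hφ : ContDiff ℝ 1 φ) {X : ℝ → ℝ} {V t : ℝ}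
    (hX : HasDerivAt X V t) :
    HasDerivAt (fun t => φ (t, X t)) (dt φ (t, X t) + V * dr φ (t, X t)) t := by
  have h := ((hφ.differentiable (by norm_num)) (t, X t)).hasFDerivAt.comp_hasDerivAt t
    ((hasDerivAt_id t).prodMk hX)
  refine h.congr_deriv ?_
  have : ((1 : ℝ), V) = (1, 0) + V • ((0 : ℝ), (1 : ℝ)) := by simp
  rw [this, map_add, map_smul]
  rfl

lemma exists_time_bound {φ : ℝ × ℝ → ℝ} (hc : HasCompactSupport φ) :
    ∃ T, 0 < T ∧ ∀ x : ℝ × ℝ, T ≤ x.1 → φ x = 0 ∧ dt φ x = 0 ∧ dr φ x = 0 := by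
  obtain ⟨T, hT⟩ := hc.isCompact.isBounded.subset_closedBall 0
  refine ⟨max T 0 + 1, by positivity, fun x hx => ?_⟩
  have hx' : x ∉ tsupport φ := fun h => by
    have h1 : ‖x‖ ≤ T := by simpa using hT h
    have h2 : |x.1| ≤ ‖x‖ := norm_fst_le x
    linarith [le_abs_self x.1, le_max_left T 0]
  have hd : fderiv ℝ φ x = 0 := image_eq_zero_of_notMem_tsupport fun h => hx' (tsupport_fderiv_subset ℝ h)
  exact ⟨image_eq_zero_of_notMem_tsupport hx', by simp [dt, hd], by simp [dr, hd]⟩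

/-- A superposition of freely moving particles: density `a`, momentum `b`, kinetic stress `K` and
force `w`, all with respect to `dr`, issued from the density `A` and the momentum `D`. The function
`F` controls the pressure generated by the density. -/
structure Cloud (γ e : ℝ) (F : ℝ → ℝ) (a b K w : ℝ × ℝ → ℝ) (A D : ℝ → ℝ) : Prop where
  cont_a : ContinuousOn a (Ioi 0 ×ˢ Ioi 0)
  cont_b : ContinuousOn b (Ioi 0 ×ˢ Ioi 0)
  cont_K : ContinuousOn K (Ioi 0 ×ˢ Ioi 0)
  cont_w : ContinuousOn w (Ioi 0 ×ˢ Ioi 0)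
  nonneg : ∀ t r, 0 < t → 0 < r → 0 ≤ a (t, r)
  nonneg_K : ∀ t r, 0 < t → 0 < r → 0 ≤ K (t, r)
  sq_le : ∀ t r, 0 < t → 0 < r → b (t, r) ^ 2 ≤ a (t, r) * K (t, r)
  bound : ∃ B : ℝ → ℝ, ContinuousOn B (Ioi 0) ∧ ∀ t r, 0 < t → 0 < r → a (t, r) ≤ B t ∧
    K (t, r) ≤ B t * (1 + r) ^ (-(1 + e)) ∧ |w (t, r)| ≤ B t * (1 + r) ^ (-(2 + e))
  press : ∀ t r, 0 < t → 0 < r → r ^ (-(1 + e)) * a (t, r) ^ γ ≤ F t * (1 + r) ^ (-(2 + e))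
  mass : ∀ φ : ℝ × ℝ → ℝ, ContDiff ℝ 3 φ → HasCompactSupport φ →
    IntegrableOn (fun t => ∫ r in Ioi 0, (a (t, r) * dt φ (t, r) + b (t, r) * dr φ (t, r))) (Ioi 0) ∧
    (∫ t in Ioi 0, ∫ r in Ioi 0, (a (t, r) * dt φ (t, r) + b (t, r) * dr φ (t, r)))
      = -∫ s in Ioi 0, A s * φ (0, s)
  mom : ∀ φ : ℝ × ℝ → ℝ, ContDiff ℝ 3 φ → HasCompactSupport φ →
    IntegrableOn (fun t => ∫ r in Ioi 0, (b (t, r) * dt φ (t, r) + K (t, r) * dr φ (t, r)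
      + w (t, r) * φ (t, r))) (Ioi 0) ∧
    (∫ t in Ioi 0, ∫ r in Ioi 0, (b (t, r) * dt φ (t, r) + K (t, r) * dr φ (t, r)
      + w (t, r) * φ (t, r))) = -∫ s in Ioi 0, D s * φ (0, s)

section Packet

/-- The radial profile of the expanding packet. -/
def prof (n : ℕ) (e x : ℝ) : ℝ := (1 + e) * x ^ (n - 1) * (1 + x ^ (n + 1)) ^ (-(1 + e) / (n + 1) - 1)

/-- The cumulative moment `∫ y in Ioi x, y * prof y` of the profile. -/
def profTail (n : ℕ) (e x : ℝ) : ℝ := (1 + x ^ (n + 1)) ^ (-(1 + e) / (n + 1))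

variable {n : ℕ} {e : ℝ}

lemma continuousOn_prof : ContinuousOn (prof n e) (Ioi 0) := by
  unfold prof
  refine ContinuousOn.mul (by fun_prop) (ContinuousOn.rpow_const (by fun_prop) fun x hx => Or.inl ?_)
  have : (0:ℝ) < x := hx
  positivity

lemma prof_pos (he : 0 < e) {x : ℝ} (hx : 0 < x) : 0 < prof n e x := by
  unfold prof; positivity

/-- Constant in the decay estimate of the profile. -/
def profConst (n : ℕ) (e : ℝ) : ℝ := (1 + e) * 2 ^ (n + 2 + e)

lemma profConst_pos (he : 0 < e) : 0 < profConst n e := by unfold profConst; positivity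

lemma prof_le (he : 0 < e) {x : ℝ} (hx : 0 < x) :
    prof n e x ≤ profConst n e * (x ^ (n - 1) * (1 + x) ^ (-(n + 2 + e))) := by
  unfold prof profConst
  have h1 : (1 + x) ^ (n + 1) ≤ 2 ^ (n + 1) * (1 + x ^ (n + 1)) := by
    have := add_pow_le (zero_le_one) hx.le (n + 1)
    rw [one_pow] at this
    refine this.trans (mul_le_mul_of_nonneg_right ?_ (by positivity))
    exact pow_le_pow_right₀ (by norm_num) (by omega)
  have h2 : ((1 + x) / 2) ^ (n + 1) ≤ 1 + x ^ (n + 1) := by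
    rw [div_pow, div_le_iff₀ (by positivity)]; linarith
  have h3 : (1 + x ^ (n + 1)) ^ (-(1 + e) / (n + 1) - 1) ≤ 2 ^ (n + 2 + e) * (1 + x) ^ (-(n + 2 + e)) := by
    refine (rpow_le_rpow_of_nonpos (by positivity) h2 ?_).trans (le_of_eq ?_)
    · have : 0 ≤ (1 + e) / ((n:ℝ) + 1) := by positivity
      rw [neg_div]; linarith
    · rw [← rpow_natCast, ← rpow_mul (by positivity), div_rpow (by positivity) (by norm_num)]
      have : ((n + 1 : ℕ) : ℝ) * (-(1 + e) / (n + 1) - 1) = -(n + 2 + e) := by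
        push_cast; field_simp; ring
      rw [this, rpow_neg (by norm_num : (0:ℝ) ≤ 2), div_inv_eq_mul, mul_comm]
  calc (1 + e) * x ^ (n - 1) * (1 + x ^ (n + 1)) ^ (-(1 + e) / (n + 1) - 1)
      ≤ (1 + e) * x ^ (n - 1) * (2 ^ (n + 2 + e) * (1 + x) ^ (-(n + 2 + e))) := by gcongr
    _ = _ := by ring

lemma pow_mul_prof_le (he : 0 < e) {x : ℝ} (hx : 0 < x) (hn : 2 ≤ n) (j : ℕ) :
    x ^ j * prof n e x ≤ profConst n e * (1 + x) ^ ((j : ℝ) - (3 + e)) := by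
  have hC := profConst_pos (n := n) he
  have h1 : x ^ (j + (n - 1)) ≤ (1 + x) ^ ((j + (n - 1) : ℕ) : ℝ) := by
    rw [rpow_natCast]; exact pow_le_pow_left₀ hx.le (by linarith) _
  calc x ^ j * prof n e x ≤ x ^ j * (profConst n e * (x ^ (n - 1) * (1 + x) ^ (-(n + 2 + e)))) := by
        gcongr; exact prof_le he hx
    _ = profConst n e * (x ^ (j + (n - 1)) * (1 + x) ^ (-(n + 2 + e))) := by rw [pow_add]; ring
    _ ≤ profConst n e * ((1 + x) ^ ((j + (n - 1) : ℕ) : ℝ) * (1 + x) ^ (-(n + 2 + e))) := by gcongr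
    _ = _ := by
        rw [← rpow_add (by linarith)]
        congr 2
        push_cast [Nat.cast_sub (show 1 ≤ n by omega)]; ring

lemma prof_le_mul (he : 0 < e) {x : ℝ} (hx : 0 < x) (hn : 2 ≤ n) : prof n e x ≤ profConst n e * x := by
  have hC := profConst_pos (n := n) he
  obtain ⟨k, rfl⟩ : ∃ k, n = k + 2 := ⟨n - 2, by omega⟩
  refine (prof_le he hx).trans (mul_le_mul_of_nonneg_left ?_ hC.le)
  have h1 : x ^ k ≤ (1 + x) ^ ((k + 2 : ℕ) + 2 + e) := by
    calc x ^ k ≤ (1 + x) ^ k := pow_le_pow_left₀ hx.le (by linarith) _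
      _ = (1 + x) ^ (k : ℝ) := (rpow_natCast _ _).symm
      _ ≤ _ := rpow_le_rpow_of_exponent_le (by linarith) (by push_cast; linarith)
  rw [show k + 2 - 1 = k + 1 by omega, pow_succ, rpow_neg (by linarith), ← div_eq_mul_inv, mul_comm,
    mul_div_assoc]
  exact mul_le_of_le_one_right hx.le ((div_le_one (by positivity)).2 h1)

lemma le_profTail (he : 0 < e) {x : ℝ} (hx : 0 < x) : (1 + x) ^ (-(1 + e)) ≤ profTail n e x := by
  unfold profTail
  have h2 : 1 + x ^ (n + 1) ≤ (1 + x) ^ (n + 1) := by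
    have := pow_add_pow_le zero_le_one hx.le (Nat.succ_ne_zero n)
    simpa using this
  refine le_trans (le_of_eq ?_) (rpow_le_rpow_of_nonpos (by positivity) h2 ?_)
  · rw [← rpow_natCast, ← rpow_mul (by positivity)]
    congr 1; push_cast; field_simp
  · have : 0 ≤ (1 + e) / ((n:ℝ) + 1) := by positivity
    rw [neg_div]; linarith

lemma hasDerivAt_profTail (hn : 2 ≤ n) {x : ℝ} (hx : 0 < x) :
    HasDerivAt (profTail n e) (-(x * prof n e x)) x := by
  have h := (((hasDerivAt_pow (n + 1) x).const_add 1).rpow_const (p := -(1 + e) / (n + 1))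
    (Or.inl (by positivity)))
  refine h.congr_deriv ?_
  unfold prof
  have : x ^ n = x * x ^ (n - 1) := by rw [← pow_succ', Nat.sub_add_cancel (by omega)]
  rw [Nat.add_sub_cancel, this]
  push_cast
  field_simp

lemma tendsto_profTail (he : 0 < e) : Tendsto (profTail n e) atTop (𝓝 0) := by
  unfold profTail
  have h1 : Tendsto (fun x : ℝ => 1 + x ^ (n + 1)) atTop atTop :=
    tendsto_atTop_add_const_left _ 1 (tendsto_pow_atTop (Nat.succ_ne_zero n))
  have := (tendsto_rpow_neg_atTop (y := (1 + e) / (n + 1)) (by positivity)).comp h1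
  simpa only [neg_div, comp_def] using this

end Packet

/-- A length scale that blows up at least quadratically at time zero. -/
structure Scale (L L' L'' : ℝ → ℝ) (C : ℝ) : Prop where
  deriv : ∀ t, 0 < t → HasDerivAt L (L' t) t
  deriv' : ∀ t, 0 < t → HasDerivAt L' (L'' t) t
  cont : ContinuousOn L'' (Ioi 0)
  one_le : ∀ t, 0 < t → 1 ≤ L t
  inv_le : ∀ t, 0 < t → 1 ≤ L t * t ^ 2
  le' : ∀ t, 0 < t → t * |L' t| ≤ C * L t
  le'' : ∀ t, 0 < t → t ^ 2 * |L'' t| ≤ C * L t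

lemma exists_scale {c : ℝ} (hc : 1 ≤ c) {k : ℕ} (hk : 2 ≤ k) : ∃ L L' L'' C, Scale L L' L'' C ∧
    ∀ t, 0 < t → c * ((t⁻¹) ^ k + 1) ≤ L'' t := by
  have hd : ∀ (j : ℕ) (t : ℝ), 0 < t →
      HasDerivAt (fun t : ℝ => (t⁻¹) ^ j) (-(j * (t⁻¹) ^ (j + 1))) t := fun j t ht => by
    refine ((hasDerivAt_inv ht.ne').pow j).congr_deriv ?_
    rcases j with _ | j
    · simp
    · rw [Nat.add_sub_cancel, pow_succ (t⁻¹) (j + 1), pow_succ (t⁻¹) j]; field_simp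
  have hi : ∀ t : ℝ, 0 < t → ∀ j : ℕ, t * (t⁻¹) ^ (j + 1) = (t⁻¹) ^ j := fun t ht j => by
    rw [pow_succ']; field_simp
  have hone : ∀ t : ℝ, 0 < t → 1 ≤ (t⁻¹) ^ k + t ^ 2 := fun t ht => by
    have h0 : 0 < (t⁻¹) ^ k := by positivity
    rcases le_total t 1 with h | h
    · nlinarith [one_le_pow₀ ((one_le_inv₀ ht).2 h) (n := k), sq_nonneg t]
    · nlinarith
  refine ⟨fun t => c * ((t⁻¹) ^ k + t ^ 2), fun t => c * (-(k * (t⁻¹) ^ (k + 1)) + 2 * t),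
    fun t => c * (k * ((k + 1 : ℕ) * (t⁻¹) ^ (k + 2)) + 2), k * (k + 1) + 2, ⟨?_, ?_, ?_, ?_, ?_, ?_, ?_⟩, ?_⟩
  · intro t ht
    refine (((hd k t ht).add (hasDerivAt_pow 2 t)).const_mul c).congr_deriv ?_
    push_cast; ring
  · intro t ht
    refine ((((hd (k + 1) t ht).const_mul (k:ℝ)).neg.add ((hasDerivAt_id t).const_mul 2)).const_mul c).congr_deriv ?_
    push_cast; ring
  · have : ContinuousOn (fun t : ℝ => t⁻¹) (Ioi 0) := continuousOn_inv₀.mono fun x hx => (ne_of_gt hx : x ≠ 0)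
    fun_prop
  · intro t ht
    nlinarith [hone t ht]
  · intro t ht
    have h0 : 0 < (t⁻¹) ^ k := by positivity
    have h1 : 1 ≤ ((t⁻¹) ^ k + t ^ 2) * t ^ 2 := by
      rcases le_total t 1 with h | h
      · have h2 := pow_le_pow_right₀ ((one_le_inv₀ ht).2 h) hk
        have h3 : (t⁻¹) ^ 2 * t ^ 2 = 1 := by field_simp
        nlinarith [sq_nonneg t, sq_nonneg (t ^ 2)]
      · have : 1 ≤ t ^ 2 := by nlinarith
        nlinarith
    nlinarith
  · intro t ht
    have h0 : 0 < (t⁻¹) ^ k := by positivity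
    rw [abs_mul, abs_of_pos (by linarith : 0 < c)]
    have h1 : |-(k * (t⁻¹) ^ (k + 1)) + 2 * t| ≤ k * (t⁻¹) ^ (k + 1) + 2 * t := by
      refine (abs_add_le _ _).trans (le_of_eq ?_)
      rw [abs_neg, abs_of_nonneg (by positivity), abs_of_nonneg (by positivity)]
    have h2 : t * (k * (t⁻¹) ^ (k + 1) + 2 * t) ≤ (k * (k + 1) + 2) * ((t⁻¹) ^ k + t ^ 2) := by
      have : t * (k * (t⁻¹) ^ (k + 1) + 2 * t) = k * (t⁻¹) ^ k + 2 * t ^ 2 := by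
        rw [← hi t ht k]; ring
      rw [this]
      have : (0:ℝ) ≤ k := by positivity
      nlinarith [mul_nonneg this this, mul_nonneg (mul_nonneg this this) h0.le, mul_nonneg this (sq_nonneg t),
        mul_nonneg (mul_nonneg this this) (sq_nonneg t)]
    calc t * (c * |-(k * (t⁻¹) ^ (k + 1)) + 2 * t|) ≤ t * (c * (k * (t⁻¹) ^ (k + 1) + 2 * t)) := by gcongr
      _ = c * (t * (k * (t⁻¹) ^ (k + 1) + 2 * t)) := by ring
      _ ≤ c * ((k * (k + 1) + 2) * ((t⁻¹) ^ k + t ^ 2)) := by gcongr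
      _ = _ := by ring
  · intro t ht
    have h0 : 0 < (t⁻¹) ^ k := by positivity
    rw [abs_of_nonneg (by positivity)]
    have h2 : t ^ 2 * (t⁻¹) ^ (k + 2) = (t⁻¹) ^ k := by
      rw [← hi t ht k, ← hi t ht (k + 1)]; ring
    have h3 : t ^ 2 * (k * ((k + 1 : ℕ) * (t⁻¹) ^ (k + 2)) + 2) = k * (k + 1) * (t⁻¹) ^ k + 2 * t ^ 2 := by
      rw [← h2]; push_cast; ring
    have h4 : k * (k + 1) * (t⁻¹) ^ k + 2 * t ^ 2 ≤ ((k:ℝ) * (k + 1) + 2) * ((t⁻¹) ^ k + t ^ 2) := by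
      have : (0:ℝ) ≤ k * (k + 1) := by positivity
      nlinarith [mul_nonneg this (sq_nonneg t)]
    calc t ^ 2 * (c * (k * ((k + 1 : ℕ) * (t⁻¹) ^ (k + 2)) + 2))
        = c * (k * (k + 1) * (t⁻¹) ^ k + 2 * t ^ 2) := by rw [← h3]; ring
      _ ≤ c * (((k:ℝ) * (k + 1) + 2) * ((t⁻¹) ^ k + t ^ 2)) := by gcongr
      _ = _ := by ring
  · intro t ht
    have hk' : (2:ℝ) ≤ k := by exact_mod_cast hk
    have h0 : 0 < (t⁻¹) ^ (k + 2) := by positivity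
    have h5 : (t⁻¹) ^ k ≤ (t⁻¹) ^ (k + 2) + 1 := by
      rcases le_total t 1 with h | h
      · linarith [pow_le_pow_right₀ ((one_le_inv₀ ht).2 h) (show k ≤ k + 2 by omega)]
      · linarith [pow_le_one₀ (inv_nonneg.2 ht.le) (inv_le_one_of_one_le₀ h) (n := k)]
    have h6 : (t⁻¹) ^ (k + 2) ≤ k * ((k + 1 : ℕ) * (t⁻¹) ^ (k + 2)) := by
      push_cast
      have : (1:ℝ) ≤ k * (k + 1) := by nlinarith
      nlinarith
    exact mul_le_mul_of_nonneg_left (by linarith) (by linarith)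

section Packet

variable {n : ℕ} {e C : ℝ} {L L' L'' : ℝ → ℝ}

lemma Scale.cont_L (h : Scale L L' L'' C) : ContinuousOn L (Ioi 0) := fun t ht =>
  (h.deriv t ht).continuousAt.continuousWithinAt

lemma Scale.cont_L' (h : Scale L L' L'' C) : ContinuousOn L' (Ioi 0) := fun t ht =>
  (h.deriv' t ht).continuousAt.continuousWithinAt

/-- The fields of the packet: the weight `g t * x ^ j` transported by the scale. -/
def packet (n : ℕ) (e : ℝ) (L : ℝ → ℝ) (j : ℕ) (g : ℝ → ℝ) (x : ℝ × ℝ) : ℝ :=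
  g x.1 * ((x.2 / L x.1) ^ j * prof n e (x.2 / L x.1)) / L x.1

lemma Scale.continuousOn_packet (h : Scale L L' L'' C) {j : ℕ} {g : ℝ → ℝ} (hg : ContinuousOn g (Ioi 0)) :
    ContinuousOn (packet n e L j g) (Ioi 0 ×ˢ Ioi 0) := by
  have hpos : ∀ x ∈ (Ioi 0 ×ˢ Ioi 0 : Set (ℝ × ℝ)), 0 < L x.1 := fun x hx =>
    one_pos.trans_le (h.one_le x.1 hx.1)
  have hL : ContinuousOn (fun x : ℝ × ℝ => L x.1) (Ioi 0 ×ˢ Ioi 0) :=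
    h.cont_L.comp continuousOn_fst fun x hx => hx.1
  have hq : ContinuousOn (fun x : ℝ × ℝ => x.2 / L x.1) (Ioi 0 ×ˢ Ioi 0) :=
    continuousOn_snd.div hL fun x hx => (hpos x hx).ne'
  refine ((hg.comp continuousOn_fst fun x hx => hx.1).mul ((hq.pow j).mul
    (continuousOn_prof.comp hq fun x hx => ?_))).div hL fun x hx => (hpos x hx).ne'
  exact div_pos hx.2 (hpos x hx)

lemma rescale_decay {l r x : ℝ} (hl : 1 ≤ l) (hr : 0 < r) (hx : 0 ≤ x) :
    (1 + r / l) ^ (-x) ≤ l ^ x * (1 + r) ^ (-x) := by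
  have hl0 : 0 < l := by linarith
  have h1 : (1 + r) / l ≤ 1 + r / l := by
    rw [add_div]
    have := (div_le_one hl0).2 hl
    linarith
  refine (rpow_le_rpow_of_nonpos (by positivity) h1 (by linarith)).trans (le_of_eq ?_)
  rw [div_rpow (by positivity) hl0.le, rpow_neg hl0.le, div_inv_eq_mul, mul_comm]

lemma Scale.abs_packet_le (h : Scale L L' L'' C) (he : 0 < e) (hn : 2 ≤ n) {j : ℕ} {g : ℝ → ℝ} {x t r : ℝ}
    (hx : 0 ≤ x) (hj : (j : ℝ) - (3 + e) ≤ -x) (ht : 0 < t) (hr : 0 < r) :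
    |packet n e L j g (t, r)| ≤ profConst n e * |g t| * L t ^ x * (1 + r) ^ (-x) := by
  have hL := h.one_le t ht
  have hL0 : 0 < L t := by linarith
  have hq : 0 < r / L t := by positivity
  have hp := prof_pos (n := n) he hq
  have hC := profConst_pos (n := n) he
  unfold packet
  rw [abs_div, abs_mul, abs_of_pos hL0, abs_of_pos (by positivity : 0 < (r / L t) ^ j * prof n e (r / L t))]
  calc |g t| * ((r / L t) ^ j * prof n e (r / L t)) / L t
      ≤ |g t| * ((r / L t) ^ j * prof n e (r / L t)) := div_le_self (by positivity) hL
    _ ≤ |g t| * (profConst n e * (L t ^ x * (1 + r) ^ (-x))) := by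
        refine mul_le_mul_of_nonneg_left ((pow_mul_prof_le he hq hn j).trans ?_) (abs_nonneg _)
        refine mul_le_mul_of_nonneg_left ?_ hC.le
        exact (rpow_le_rpow_of_exponent_le (by linarith) hj).trans (rescale_decay hL hr hx)
    _ = _ := by ring

lemma Scale.press_packet_le (h : Scale L L' L'' C) {γ : ℝ} (hγ : 1 < γ) (he : e = (n - 1) * (γ - 1))
    (hn : 2 ≤ n) {t r : ℝ} (ht : 0 < t) (hr : 0 < r) :
    r ^ (-(1 + e)) * packet n e L 0 (fun _ => 1) (t, r) ^ γ
      ≤ profConst n e ^ γ * (1 + r) ^ (-(2 + e)) := by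
  have hn' : (2:ℝ) ≤ n := by exact_mod_cast hn
  have he0 : 0 < e := by rw [he]; exact mul_pos (by linarith) (by linarith)
  have hL := h.one_le t ht
  have hL0 : 0 < L t := by linarith
  set q := r / L t with hq
  have hq0 : 0 < q := by positivity
  have hrq : r = L t * q := by rw [hq]; field_simp
  have hC := profConst_pos (n := n) he0
  have hp := prof_pos (n := n) he0 hq0
  have hval : packet n e L 0 (fun _ => 1) (t, r) = prof n e q / L t := by simp [packet, hq]
  have h1 : packet n e L 0 (fun _ => 1) (t, r) ≤ profConst n e * (q ^ (n - 1) * (1 + q) ^ (-(n + 2 + e))) / L t := by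
    rw [hval]; gcongr; exact prof_le he0 hq0
  have h2 : packet n e L 0 (fun _ => 1) (t, r) ^ γ ≤
      profConst n e ^ γ * (q ^ ((n - 1) * γ) * (1 + q) ^ (-(n + 2 + e) * γ)) * L t ^ (-γ) := by
    refine (rpow_le_rpow (by rw [hval]; positivity) h1 (by linarith)).trans (le_of_eq ?_)
    rw [div_rpow (by positivity) hL0.le, mul_rpow hC.le (by positivity), mul_rpow (by positivity) (by positivity),
      ← rpow_natCast q (n - 1), ← rpow_mul hq0.le, ← rpow_mul (by positivity), rpow_neg hL0.le, div_eq_mul_inv,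
      Nat.cast_sub (by omega), Nat.cast_one]
  have h3 : r ^ (-(1 + e)) = L t ^ (-(1 + e)) * q ^ (-(1 + e)) := by rw [hrq, mul_rpow hL0.le hq0.le]
  have h4 : q ^ (-(1 + e)) * q ^ ((n - 1) * γ) ≤ (1 + q) ^ ((n:ℝ) - 2) := by
    rw [← rpow_add hq0, show -(1 + e) + (n - 1) * γ = (n:ℝ) - 2 by rw [he]; ring]
    exact rpow_le_rpow hq0.le (by linarith) (by linarith)
  have h5 : (1 + q) ^ ((n:ℝ) - 2) * (1 + q) ^ (-(n + 2 + e) * γ) ≤ (1 + q) ^ (-(2 + e)) := by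
    rw [← rpow_add (by linarith)]
    exact rpow_le_rpow_of_exponent_le (by linarith) (by nlinarith)
  have h6 := rescale_decay hL hr (x := 2 + e) (by linarith)
  have h7 : L t ^ (-(1 + e)) * L t ^ (-γ) * L t ^ (2 + e) ≤ 1 := by
    rw [← rpow_add hL0, ← rpow_add hL0]
    exact rpow_le_one_of_one_le_of_nonpos hL (by linarith)
  calc r ^ (-(1 + e)) * packet n e L 0 (fun _ => 1) (t, r) ^ γ
      ≤ L t ^ (-(1 + e)) * q ^ (-(1 + e)) *
        (profConst n e ^ γ * (q ^ ((n - 1) * γ) * (1 + q) ^ (-(n + 2 + e) * γ)) * L t ^ (-γ)) := by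
        rw [← h3]; gcongr
    _ = profConst n e ^ γ * (L t ^ (-(1 + e)) * L t ^ (-γ)) *
        ((q ^ (-(1 + e)) * q ^ ((n - 1) * γ)) * (1 + q) ^ (-(n + 2 + e) * γ)) := by ring
    _ ≤ profConst n e ^ γ * (L t ^ (-(1 + e)) * L t ^ (-γ)) *
        ((1 + q) ^ ((n:ℝ) - 2) * (1 + q) ^ (-(n + 2 + e) * γ)) := by gcongr
    _ ≤ profConst n e ^ γ * (L t ^ (-(1 + e)) * L t ^ (-γ)) * (L t ^ (2 + e) * (1 + r) ^ (-(2 + e))) := by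
        exact mul_le_mul_of_nonneg_left (h5.trans h6) (by positivity)
    _ = (profConst n e ^ γ * (1 + r) ^ (-(2 + e))) * (L t ^ (-(1 + e)) * L t ^ (-γ) * L t ^ (2 + e)) := by ring
    _ ≤ _ := mul_le_of_le_one_right (by positivity) h7

lemma Scale.tail_packet (h : Scale L L' L'' C) (he : 0 < e) (hn : 2 ≤ n) {g : ℝ → ℝ}
    (hg : ContinuousOn g (Ioi 0)) {t r : ℝ} (ht : 0 < t) (hr : 0 < r) :
    tail (packet n e L 1 g) (t, r) = g t * profTail n e (r / L t) := by
  have hL := h.one_le t ht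
  have hL0 : 0 < L t := by linarith
  have hi : IntegrableOn (fun y => packet n e L 1 g (t, y)) (Ioi 0) :=
    integrableOn_slice_of_decay (B := fun t => profConst n e * |g t| * L t ^ (2 + e))
      (h.continuousOn_packet hg) he
      (fun t r ht hr => h.abs_packet_le he hn (by linarith) (by push_cast; linarith) ht hr) ht
  have hd : ∀ y ∈ Ici r, HasDerivAt (fun y => -(g t * profTail n e (y / L t))) (packet n e L 1 g (t, y)) y := by
    intro y hy
    have hy0 : 0 < y := hr.trans_le hy
    refine (((hasDerivAt_profTail hn (by positivity : 0 < y / L t)).comp y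
      ((hasDerivAt_id y).div_const (L t))).const_mul (g t)).neg.congr_deriv ?_
    simp only [packet, pow_one]; ring
  have hlim : Tendsto (fun y => -(g t * profTail n e (y / L t))) atTop (𝓝 0) := by
    have := ((tendsto_profTail (n := n) he).comp (tendsto_id.atTop_div_const hL0)).const_mul (g t)
    simpa using this.neg
  have := integral_Ioi_of_hasDerivAt_of_tendsto' hd (hi.mono_set (Ioi_subset_Ioi hr.le)) hlim
  simpa [tail] using this

end Packet

section Packet

variable {n : ℕ} {e C : ℝ} {L L' L'' : ℝ → ℝ}

lemma Scale.lt_of_mul_lt (h : Scale L L' L'' C) {t x R : ℝ} (ht : 0 < t) (hx : 0 < x) (hR : L t * x < R) :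
    x ≤ R * t ^ 2 := by
  have h1 := h.inv_le t ht
  nlinarith [mul_le_mul_of_nonneg_left h1 hx.le, mul_le_mul_of_nonneg_right hR.le (sq_nonneg t)]

lemma Scale.integrable_of_bounded (h : Scale L L' L'' C) {G : ℝ → ℝ → ℝ} {T R N : ℝ} (hR : 0 < R)
    (hG : ContinuousOn (uncurry G) (Ioi 0 ×ˢ Ioi 0)) (hT : ∀ t x, 0 < t → 0 < x → T ≤ t → G t x = 0)
    (h0 : ∀ t x, 0 < t → 0 < x → R ≤ L t * x → G t x = 0)
    (hN : ∀ t x, 0 < t → 0 < x → t < T → L t * x < R → |G t x| ≤ N) :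
    Integrable (uncurry G) ((volume.restrict (Ioi 0)).prod (volume.restrict (Ioi 0))) := by
  rw [Measure.prod_restrict]
  have hS : (Ioc 0 T ×ˢ Ioc 0 (R * T ^ 2) : Set (ℝ × ℝ)) ⊆ Ioi 0 ×ˢ Ioi 0 := fun x hx => ⟨hx.1.1, hx.2.1⟩
  have key : ∀ t x, 0 < t → 0 < x → (T ≤ t ∨ R ≤ L t * x) ∨ (t < T ∧ L t * x < R ∧ x ≤ R * T ^ 2) := by
    intro t x ht hx
    by_cases h1 : T ≤ t
    · exact Or.inl (Or.inl h1)
    by_cases h2 : R ≤ L t * x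
    · exact Or.inl (Or.inr h2)
    push Not at h1 h2
    refine Or.inr ⟨h1, h2, (h.lt_of_mul_lt ht hx h2).trans ?_⟩
    gcongr
  have hi : IntegrableOn (uncurry G) (Ioc 0 T ×ˢ Ioc 0 (R * T ^ 2)) (volume.prod volume) := by
    have hms : MeasurableSet (Ioc 0 T ×ˢ Ioc 0 (R * T ^ 2) : Set (ℝ × ℝ)) := measurableSet_Ioc.prod measurableSet_Ioc
    refine IntegrableOn.of_bound ?_ ((hG.mono hS).aestronglyMeasurable hms) (max N 0) ?_
    · rw [Measure.prod_prod]; exact ENNReal.mul_lt_top (by simp) (by simp)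
    · refine ae_restrict_of_forall_mem (measurableSet_Ioc.prod measurableSet_Ioc) fun x hx => ?_
      rcases key x.1 x.2 hx.1.1 hx.2.1 with (h1 | h1) | h1
      · simp [uncurry, hT x.1 x.2 hx.1.1 hx.2.1 h1]
      · simp [uncurry, h0 x.1 x.2 hx.1.1 hx.2.1 h1]
      · exact (hN x.1 x.2 hx.1.1 hx.2.1 h1.1 h1.2.1).trans (le_max_left _ _)
  refine IntegrableOn.of_forall_sdiff_eq_zero hi (measurableSet_Ioi.prod measurableSet_Ioi) fun x hx => ?_
  rcases key x.1 x.2 hx.1.1 hx.1.2 with (h1 | h1) | h1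
  · exact hT x.1 x.2 hx.1.1 hx.1.2 h1
  · exact h0 x.1 x.2 hx.1.1 hx.1.2 h1
  · exact absurd ⟨⟨hx.1.1, h1.1.le⟩, hx.1.2, h1.2.2⟩ hx.2

lemma Scale.slice_eq (h : Scale L L' L'' C) {t : ℝ} (ht : 0 < t) (G : ℝ → ℝ → ℝ) :
    ∫ r in Ioi 0, G (r / L t) r / L t = ∫ x in Ioi 0, G x (L t * x) := by
  have hL0 : 0 < L t := one_pos.trans_le (h.one_le t ht)
  have := integral_comp_mul_left_Ioi (fun r => G (r / L t) r) 0 hL0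
  rw [mul_zero, smul_eq_mul] at this
  rw [integral_div, div_eq_inv_mul, ← this]
  simp only [mul_div_cancel_left₀ _ hL0.ne']

lemma Scale.weak (h : Scale L L' L'' C) {Y K : ℝ → ℝ → ℝ} {S : ℝ → ℝ} {T R : ℝ}
    (hInt : Integrable (uncurry K) ((volume.restrict (Ioi 0)).prod (volume.restrict (Ioi 0))))
    (hder : ∀ t x, 0 < t → HasDerivAt (fun t => Y t x) (K t x) t)
    (h0 : ∀ t x, R ≤ L t * x → Y t x = 0) (hT : ∀ t x, T ≤ t → Y t x = 0)
    (hS : ∀ t, 0 < t → ∫ x in Ioi 0, K t x = S t) :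
    IntegrableOn S (Ioi 0) ∧ ∫ t in Ioi 0, S t = 0 := by
  have hpart := particle_integral (l := fun _ => 0) hInt (Eventually.of_forall fun x t ht => hder t x ht) ?_
    (Eventually.of_forall fun x => (eventually_ge_atTop T).mono fun t ht => hT t x ht)
  · refine ⟨hpart.1.congr_fun hS measurableSet_Ioi, ?_⟩
    rw [← setIntegral_congr_fun measurableSet_Ioi hS, hpart.2]; simp
  · refine ae_restrict_of_forall_mem measurableSet_Ioi fun x hx => ?_
    have hx0 : (0:ℝ) < x := hx
    refine tendsto_const_nhds.congr' ?_
    have : ∀ᶠ t in 𝓝 (0:ℝ), R * t ^ 2 < x := by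
      have : Tendsto (fun t : ℝ => R * t ^ 2) (𝓝 0) (𝓝 (R * 0 ^ 2)) := (by fun_prop : Continuous _).tendsto _
      exact this.eventually (gt_mem_nhds (by simpa using hx0))
    filter_upwards [nhdsWithin_le_nhds this, self_mem_nhdsWithin] with t ht ht0
    refine (h0 t x ?_).symm
    by_contra hlt
    exact absurd (h.lt_of_mul_lt ht0 hx0 (not_le.1 hlt)) (not_le.2 ht)

variable (n e) in
lemma Scale.mass_packet (h : Scale L L' L'' C) (he : 0 < e) (hn : 2 ≤ n) {φ : ℝ × ℝ → ℝ}
    (hφ : ContDiff ℝ 3 φ) (hc : HasCompactSupport φ) :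
    IntegrableOn (fun t => ∫ r in Ioi 0, (packet n e L 0 (fun _ => 1) (t, r) * dt φ (t, r)
      + packet n e L 1 L' (t, r) * dr φ (t, r))) (Ioi 0) ∧
    (∫ t in Ioi 0, ∫ r in Ioi 0, (packet n e L 0 (fun _ => 1) (t, r) * dt φ (t, r)
      + packet n e L 1 L' (t, r) * dr φ (t, r))) = 0 := by
  obtain ⟨M, R, hM⟩ := exists_testBounds hφ hc
  obtain ⟨T, hT0, hT⟩ := exists_time_bound hc
  have hφ1 : ContDiff ℝ 1 φ := hφ.of_le (by norm_num)
  have hφ2 : ContDiff ℝ 2 φ := hφ.of_le (by norm_num)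
  have hR := hM.pos
  have hM0 := hM.nonneg
  have hCp := profConst_pos (n := n) he
  set K : ℝ → ℝ → ℝ := fun t x => prof n e x * (dt φ (t, L t * x) + L' t * x * dr φ (t, L t * x)) with hK
  have hpt : ContinuousOn (fun x : ℝ × ℝ => (x.1, L x.1 * x.2)) (Ioi 0 ×ˢ Ioi 0) :=
    continuousOn_fst.prodMk ((h.cont_L.comp continuousOn_fst fun x hx => hx.1).mul continuousOn_snd)
  have hInt : Integrable (uncurry K) ((volume.restrict (Ioi 0)).prod (volume.restrict (Ioi 0))) := by
    refine h.integrable_of_bounded (T := T) (N := profConst n e * M * (R * T ^ 2 + C * R ^ 2 * T)) hR ?_ ?_ ?_ ?_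
    · exact (continuousOn_prof.comp continuousOn_snd fun x hx => hx.2).mul
        (((contDiff_dt hφ2).continuous.comp_continuousOn hpt).add
        (((h.cont_L'.comp continuousOn_fst fun x hx => hx.1).mul continuousOn_snd).mul
        ((contDiff_dr hφ2).continuous.comp_continuousOn hpt)))
    · intro t x _ _ htT
      have := hT (t, L t * x) htT
      simp [hK, this]
    · intro t x _ _ hx
      have := hM.zero (t, L t * x) hx
      simp [hK, this]
    · intro t x ht hx htT hxR
      have h1 := prof_le_mul (n := n) he hx hn
      have h2 := h.lt_of_mul_lt ht hx hxR
      have h3 := h.le' t ht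
      have hp := prof_pos (n := n) he hx
      have hx1 : x ≤ R * T ^ 2 := h2.trans (by gcongr)
      have h4 : x * |L' t| * x ≤ C * R ^ 2 * T := by
        have hC0 : 0 ≤ C := by
          have : 0 ≤ C * L t := le_trans (by positivity) h3
          exact nonneg_of_mul_nonneg_left this (one_pos.trans_le (h.one_le t ht))
        have h5 : t * (x * |L' t| * x) ≤ t * (C * R ^ 2 * T) := by
          calc t * (x * |L' t| * x) = (t * |L' t|) * x * x := by ring
            _ ≤ (C * L t) * x * x := by gcongr
            _ = C * (L t * x) * x := by ring
            _ ≤ C * R * (R * t ^ 2) := by gcongr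
            _ = t * (C * R ^ 2 * t) := by ring
            _ ≤ t * (C * R ^ 2 * T) := by gcongr
        exact le_of_mul_le_mul_left h5 ht
      have h6 : |dt φ (t, L t * x) + L' t * x * dr φ (t, L t * x)| ≤ M + |L' t| * x * M := by
        refine (abs_add_le _ _).trans (add_le_add (hM.le_dt _) ?_)
        rw [abs_mul, abs_mul, abs_of_pos hx]
        gcongr; exact hM.le_dr _
      rw [hK]; dsimp only
      rw [abs_mul, abs_of_pos hp]
      calc prof n e x * |dt φ (t, L t * x) + L' t * x * dr φ (t, L t * x)|
          ≤ (profConst n e * x) * (M + |L' t| * x * M) := by gcongr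
        _ = profConst n e * M * (x + x * |L' t| * x) := by ring
        _ ≤ _ := by gcongr
  refine h.weak (Y := fun t x => prof n e x * φ (t, L t * x)) (T := T) (R := R) hInt ?_ ?_ ?_ ?_
  · exact fun t x ht => (hasDerivAt_comp_path hφ1 ((h.deriv t ht).mul_const x)).const_mul _
  · intro t x hx
    rw [(hM.zero (t, L t * x) hx).1, mul_zero]
  · intro t x ht
    rw [(hT (t, L t * x) ht).1, mul_zero]
  · intro t ht
    rw [← h.slice_eq ht (fun x r => prof n e x * (dt φ (t, r) + L' t * x * dr φ (t, r)))]
    refine setIntegral_congr_fun measurableSet_Ioi fun r _ => ?_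
    simp only [packet]; ring

variable (n e) in
lemma Scale.mom_packet (h : Scale L L' L'' C) (he : 0 < e) (hn : 2 ≤ n) {φ : ℝ × ℝ → ℝ}
    (hφ : ContDiff ℝ 3 φ) (hc : HasCompactSupport φ) :
    IntegrableOn (fun t => ∫ r in Ioi 0, (packet n e L 1 L' (t, r) * dt φ (t, r)
      + packet n e L 2 (fun t => L' t ^ 2) (t, r) * dr φ (t, r)
      + packet n e L 1 L'' (t, r) * φ (t, r))) (Ioi 0) ∧
    (∫ t in Ioi 0, ∫ r in Ioi 0, (packet n e L 1 L' (t, r) * dt φ (t, r)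
      + packet n e L 2 (fun t => L' t ^ 2) (t, r) * dr φ (t, r)
      + packet n e L 1 L'' (t, r) * φ (t, r))) = 0 := by
  obtain ⟨M, R, hM⟩ := exists_testBounds hφ hc
  obtain ⟨T, hT0, hT⟩ := exists_time_bound hc
  have hφ1 : ContDiff ℝ 1 φ := hφ.of_le (by norm_num)
  have hφ2 : ContDiff ℝ 2 φ := hφ.of_le (by norm_num)
  have hR := hM.pos
  have hM0 := hM.nonneg
  have hCp := profConst_pos (n := n) he
  set K : ℝ → ℝ → ℝ := fun t x => prof n e x * (L'' t * x * φ (t, L t * x) +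
    L' t * x * (dt φ (t, L t * x) + L' t * x * dr φ (t, L t * x))) with hK
  have hpt : ContinuousOn (fun x : ℝ × ℝ => (x.1, L x.1 * x.2)) (Ioi 0 ×ˢ Ioi 0) :=
    continuousOn_fst.prodMk ((h.cont_L.comp continuousOn_fst fun x hx => hx.1).mul continuousOn_snd)
  have hInt : Integrable (uncurry K) ((volume.restrict (Ioi 0)).prod (volume.restrict (Ioi 0))) := by
    refine h.integrable_of_bounded (T := T)
      (N := profConst n e * M * (C * R ^ 2 + C * R ^ 2 * T + C ^ 2 * R ^ 3)) hR ?_ ?_ ?_ ?_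
    · have c' : ContinuousOn (fun x : ℝ × ℝ => L' x.1 * x.2) (Ioi 0 ×ˢ Ioi 0) :=
        (h.cont_L'.comp continuousOn_fst fun x hx => hx.1).mul continuousOn_snd
      have c'' : ContinuousOn (fun x : ℝ × ℝ => L'' x.1 * x.2) (Ioi 0 ×ˢ Ioi 0) :=
        (h.cont.comp continuousOn_fst fun x hx => hx.1).mul continuousOn_snd
      exact (continuousOn_prof.comp continuousOn_snd fun x hx => hx.2).mul
        ((c''.mul (hφ1.continuous.comp_continuousOn hpt)).add
        (c'.mul (((contDiff_dt hφ2).continuous.comp_continuousOn hpt).add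
        (c'.mul ((contDiff_dr hφ2).continuous.comp_continuousOn hpt)))))
    · intro t x _ _ htT
      have := hT (t, L t * x) htT
      simp [hK, this]
    · intro t x _ _ hx
      have := hM.zero (t, L t * x) hx
      simp [hK, this]
    · intro t x ht hx htT hxR
      have h1 := prof_le_mul (n := n) he hx hn
      have h2 := h.lt_of_mul_lt ht hx hxR
      have h3 := h.le' t ht
      have hp := prof_pos (n := n) he hx
      have hC0 : 0 ≤ C := by
        have : 0 ≤ C * L t := le_trans (by positivity) h3
        exact nonneg_of_mul_nonneg_left this (one_pos.trans_le (h.one_le t ht))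
      have h4 : t * (|L' t| * x) ≤ C * R := by
        calc t * (|L' t| * x) = (t * |L' t|) * x := by ring
          _ ≤ (C * L t) * x := by gcongr
          _ = C * (L t * x) := by ring
          _ ≤ C * R := by gcongr
      have h5 : t ^ 2 * (|L'' t| * x) ≤ C * R := by
        calc t ^ 2 * (|L'' t| * x) = (t ^ 2 * |L'' t|) * x := by ring
          _ ≤ (C * L t) * x := mul_le_mul_of_nonneg_right (h.le'' t ht) hx.le
          _ = C * (L t * x) := by ring
          _ ≤ C * R := by gcongr
      have h6 : |L'' t * x * φ (t, L t * x) + L' t * x * (dt φ (t, L t * x) + L' t * x * dr φ (t, L t * x))|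
          ≤ |L'' t| * x * M + |L' t| * x * (M + |L' t| * x * M) := by
        refine (abs_add_le _ _).trans (add_le_add ?_ ?_)
        · rw [abs_mul, abs_mul, abs_of_pos hx]
          gcongr; exact hM.le _
        · rw [abs_mul, abs_mul, abs_of_pos hx]
          gcongr
          refine (abs_add_le _ _).trans (add_le_add (hM.le_dt _) ?_)
          rw [abs_mul, abs_mul, abs_of_pos hx]
          gcongr; exact hM.le_dr _
      rw [hK]; dsimp only
      rw [abs_mul, abs_of_pos hp]
      calc prof n e x * |_|
          ≤ (profConst n e * (R * t ^ 2)) * (|L'' t| * x * M + |L' t| * x * (M + |L' t| * x * M)) := by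
            gcongr; exact h1.trans (by gcongr)
        _ = profConst n e * M * (R * (t ^ 2 * (|L'' t| * x)) + R * (t * (|L' t| * x)) * t
            + R * (t * (|L' t| * x)) ^ 2) := by ring
        _ ≤ profConst n e * M * (R * (C * R) + R * (C * R) * T + R * (C * R) ^ 2) := by gcongr
        _ = _ := by ring
  refine h.weak (Y := fun t x => prof n e x * (L' t * x * φ (t, L t * x))) (T := T) (R := R) hInt ?_ ?_ ?_ ?_
  · exact fun t x ht => (((h.deriv' t ht).mul_const x).mul
      (hasDerivAt_comp_path hφ1 ((h.deriv t ht).mul_const x))).const_mul _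
  · intro t x hx
    rw [(hM.zero (t, L t * x) hx).1, mul_zero, mul_zero]
  · intro t x ht
    rw [(hT (t, L t * x) ht).1, mul_zero, mul_zero]
  · intro t ht
    rw [← h.slice_eq ht (fun x r => prof n e x * (L'' t * x * φ (t, r)
      + L' t * x * (dt φ (t, r) + L' t * x * dr φ (t, r))))]
    refine setIntegral_congr_fun measurableSet_Ioi fun r _ => ?_
    simp only [packet]; ring

/-- The expanding packet is a cloud without initial mass. -/
lemma Scale.cloud (h : Scale L L' L'' C) {γ : ℝ} (hγ : 1 < γ) (he : e = (n - 1) * (γ - 1)) (hn : 2 ≤ n) :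
    Cloud γ e (fun _ => profConst n e ^ γ) (packet n e L 0 fun _ => 1) (packet n e L 1 L')
      (packet n e L 2 fun t => L' t ^ 2) (packet n e L 1 L'') (fun _ => 0) (fun _ => 0) := by
  have hn' : (2:ℝ) ≤ n := by exact_mod_cast hn
  have he0 : 0 < e := by rw [he]; exact mul_pos (by linarith) (by linarith)
  have hCp := profConst_pos (n := n) he0
  have hLp : ∀ t, 0 < t → 0 < L t := fun t ht => one_pos.trans_le (h.one_le t ht)
  have hp : ∀ t r, 0 < t → 0 < r → 0 < prof n e (r / L t) := fun t r ht hr =>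
    prof_pos he0 (div_pos hr (hLp t ht))
  refine ⟨h.continuousOn_packet continuousOn_const, h.continuousOn_packet h.cont_L',
    h.continuousOn_packet (h.cont_L'.pow 2), h.continuousOn_packet h.cont, ?_, ?_, ?_, ?_,
    fun t r ht hr => h.press_packet_le hγ he hn ht hr, ?_, ?_⟩
  · intro t r ht hr
    have := hp t r ht hr; have := hLp t ht
    simp only [packet]; positivity
  · intro t r ht hr
    have := hp t r ht hr; have := hLp t ht
    simp only [packet]; positivity
  · intro t r ht hr
    exact le_of_eq (by simp only [packet]; ring)
  · refine ⟨fun t => profConst n e * (1 + L' t ^ 2 * L t ^ (1 + e) + |L'' t| * L t ^ (2 + e)), ?_, ?_⟩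
    · have hr : ∀ x : ℝ, ContinuousOn (fun t => L t ^ x) (Ioi 0) := fun x =>
        h.cont_L.rpow_const fun t ht => Or.inl (hLp t ht).ne'
      exact continuousOn_const.mul ((continuousOn_const.add ((h.cont_L'.pow 2).mul (hr _))).add
        (h.cont.abs.mul (hr _)))
    · intro t r ht hr
      have hL := hLp t ht
      have h1 : 0 ≤ L' t ^ 2 * L t ^ (1 + e) := by positivity
      have h2 : 0 ≤ |L'' t| * L t ^ (2 + e) := by positivity
      refine ⟨?_, ?_, ?_⟩
      · have := h.abs_packet_le he0 hn (j := 0) (g := fun _ => 1) (x := 0) le_rfl (by simp; linarith) ht hr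
        simp only [abs_one, mul_one, rpow_zero, neg_zero] at this
        exact ((le_abs_self _).trans this).trans (le_mul_of_one_le_right hCp.le (by linarith))
      · have := h.abs_packet_le he0 hn (j := 2) (g := fun t => L' t ^ 2) (x := 1 + e) (by linarith)
          (by push_cast; linarith) ht hr
        refine ((le_abs_self _).trans this).trans (mul_le_mul_of_nonneg_right ?_ (by positivity))
        rw [mul_assoc, abs_of_nonneg (sq_nonneg _)]
        exact mul_le_mul_of_nonneg_left (by linarith) hCp.le
      · have := h.abs_packet_le he0 hn (j := 1) (g := L'') (x := 2 + e) (by linarith)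
          (by push_cast; linarith) ht hr
        refine this.trans (mul_le_mul_of_nonneg_right ?_ (by positivity))
        rw [mul_assoc]
        exact mul_le_mul_of_nonneg_left (by linarith) hCp.le
  · intro φ hφ hc
    simpa using h.mass_packet n e he0 hn hφ hc
  · intro φ hφ hc
    simpa using h.mom_packet n e he0 hn hφ hc

end Packet

lemma integrableOn_slice_mul {g : ℝ × ℝ → ℝ} (hg : ContinuousOn g (Ioi 0 ×ˢ Ioi 0)) {ψ : ℝ → ℝ}
    (hψ : Continuous ψ) {t N M R : ℝ} (ht : 0 < t) (hN : ∀ r, 0 < r → |g (t, r)| ≤ N) (hM : ∀ r, |ψ r| ≤ M)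
    (hR : ∀ r, R ≤ r → ψ r = 0) : IntegrableOn (fun r => g (t, r) * ψ r) (Ioi 0) := by
  have hc : ContinuousOn (fun r => g (t, r)) (Ioi 0) := hg.comp (by fun_prop) fun y hy => ⟨ht, hy⟩
  have hi : IntegrableOn (fun r => g (t, r) * ψ r) (Ioc 0 R) := by
    refine IntegrableOn.of_bound (by simp) (((hc.mono Ioc_subset_Ioi_self).mul
      hψ.continuousOn).aestronglyMeasurable measurableSet_Ioc) (N * M) ?_
    refine ae_restrict_of_forall_mem measurableSet_Ioc fun r hr => ?_
    rw [norm_mul]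
    exact mul_le_mul (hN r hr.1) (hM r) (norm_nonneg _) ((abs_nonneg _).trans (hN r hr.1))
  refine hi.of_forall_sdiff_eq_zero measurableSet_Ioi fun r hr => ?_
  have : R < r := by
    by_contra h
    exact hr.2 ⟨hr.1, not_lt.1 h⟩
  simp [hR r this.le]

lemma rpow_add_le {γ x y : ℝ} (hγ : 1 < γ) (hx : 0 ≤ x) (hy : 0 ≤ y) :
    (x + y) ^ γ ≤ 2 ^ γ * (x ^ γ + y ^ γ) := by
  have h1 : 0 ≤ x ^ γ := by positivity
  have h2 : 0 ≤ y ^ γ := by positivity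
  rcases le_total x y with h | h
  · calc (x + y) ^ γ ≤ (2 * y) ^ γ := rpow_le_rpow (by positivity) (by linarith) (by linarith)
      _ = 2 ^ γ * y ^ γ := mul_rpow (by norm_num) hy
      _ ≤ _ := by gcongr; linarith
  · calc (x + y) ^ γ ≤ (2 * x) ^ γ := rpow_le_rpow (by positivity) (by linarith) (by linarith)
      _ = 2 ^ γ * x ^ γ := mul_rpow (by norm_num) hx
      _ ≤ _ := by gcongr; linarith

namespace Cloud

variable {γ e : ℝ} {F F' : ℝ → ℝ} {a b K w a' b' K' w' : ℝ × ℝ → ℝ} {A D : ℝ → ℝ}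

lemma exists_bound (h : Cloud γ e F a b K w A D) (he : 0 < e) {t : ℝ} (ht : 0 < t) :
    ∃ N, ∀ r, 0 < r → |a (t, r)| ≤ N ∧ |b (t, r)| ≤ N ∧ |K (t, r)| ≤ N ∧ |w (t, r)| ≤ N := by
  obtain ⟨B, -, hB⟩ := h.bound
  refine ⟨B t, fun r hr => ?_⟩
  obtain ⟨h1, h2, h3⟩ := hB t r ht hr
  have ha := h.nonneg t r ht hr
  have hK := h.nonneg_K t r ht hr
  have hB0 : 0 ≤ B t := ha.trans h1
  have hdec : ∀ x : ℝ, 0 ≤ x → (1 + r) ^ (-x) ≤ 1 := fun x hx =>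
    rpow_le_one_of_one_le_of_nonpos (by linarith) (by linarith)
  have h2' : K (t, r) ≤ B t := h2.trans (mul_le_of_le_one_right hB0 (hdec _ (by linarith)))
  have h3' : |w (t, r)| ≤ B t := h3.trans (mul_le_of_le_one_right hB0 (hdec _ (by linarith)))
  refine ⟨by rwa [abs_of_nonneg ha], abs_le_of_sq_le_sq ?_ hB0, by rwa [abs_of_nonneg hK], h3'⟩
  calc b (t, r) ^ 2 ≤ a (t, r) * K (t, r) := h.sq_le t r ht hr
    _ ≤ B t * B t := by gcongr
    _ = _ := by ring

lemma integrableOn_mass (h : Cloud γ e F a b K w A D) (he : 0 < e) {φ : ℝ × ℝ → ℝ} {M R : ℝ}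
    (hM : TestBounds φ M R) {t : ℝ} (ht : 0 < t) :
    IntegrableOn (fun r => a (t, r) * dt φ (t, r) + b (t, r) * dr φ (t, r)) (Ioi 0) := by
  obtain ⟨N, hN⟩ := h.exists_bound he ht
  have hφ2 : ContDiff ℝ 2 φ := hM.smooth.of_le (by norm_num)
  exact (integrableOn_slice_mul h.cont_a ((contDiff_dt hφ2).continuous.comp (by fun_prop)) ht
      (fun r hr => (hN r hr).1) (fun r => hM.le_dt _) fun r hr => (hM.zero (t, r) hr).2.1).add
    (integrableOn_slice_mul h.cont_b ((contDiff_dr hφ2).continuous.comp (by fun_prop)) ht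
      (fun r hr => (hN r hr).2.1) (fun r => hM.le_dr _) fun r hr => (hM.zero (t, r) hr).2.2)

lemma integrableOn_mom (h : Cloud γ e F a b K w A D) (he : 0 < e) {φ : ℝ × ℝ → ℝ} {M R : ℝ}
    (hM : TestBounds φ M R) {t : ℝ} (ht : 0 < t) :
    IntegrableOn (fun r => b (t, r) * dt φ (t, r) + K (t, r) * dr φ (t, r) + w (t, r) * φ (t, r)) (Ioi 0) := by
  obtain ⟨N, hN⟩ := h.exists_bound he ht
  have hφ2 : ContDiff ℝ 2 φ := hM.smooth.of_le (by norm_num)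
  exact ((integrableOn_slice_mul h.cont_b ((contDiff_dt hφ2).continuous.comp (by fun_prop)) ht
      (fun r hr => (hN r hr).2.1) (fun r => hM.le_dt _) fun r hr => (hM.zero (t, r) hr).2.1).add
    (integrableOn_slice_mul h.cont_K ((contDiff_dr hφ2).continuous.comp (by fun_prop)) ht
      (fun r hr => (hN r hr).2.2.1) (fun r => hM.le_dr _) fun r hr => (hM.zero (t, r) hr).2.2)).add
    (integrableOn_slice_mul h.cont_w (hφ2.continuous.comp (by fun_prop)) ht
      (fun r hr => (hN r hr).2.2.2) (fun r => hM.le _) fun r hr => (hM.zero (t, r) hr).1)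

/-- Superposition with a cloud that carries no initial mass. -/
lemma add (h : Cloud γ e F a b K w A D) (h' : Cloud γ e F' a' b' K' w' (fun _ => 0) fun _ => 0)
    (hγ : 1 < γ) (he : 0 < e) :
    Cloud γ e (fun t => 2 ^ γ * (F t + F' t)) (a + a') (b + b') (K + K') (w + w') A D := by
  refine ⟨h.cont_a.add h'.cont_a, h.cont_b.add h'.cont_b, h.cont_K.add h'.cont_K, h.cont_w.add h'.cont_w,
    fun t r ht hr => add_nonneg (h.nonneg t r ht hr) (h'.nonneg t r ht hr),
    fun t r ht hr => add_nonneg (h.nonneg_K t r ht hr) (h'.nonneg_K t r ht hr), ?_, ?_, ?_, ?_, ?_⟩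
  · intro t r ht hr
    simp only [Pi.add_apply]
    have h1 := h.sq_le t r ht hr; have h2 := h'.sq_le t r ht hr
    have ha := h.nonneg t r ht hr; have ha' := h'.nonneg t r ht hr
    have hK := h.nonneg_K t r ht hr; have hK' := h'.nonneg_K t r ht hr
    have h3 : 2 * b (t, r) * b' (t, r) ≤ a (t, r) * K' (t, r) + a' (t, r) * K (t, r) := by
      refine le_trans (le_abs_self _) (abs_le_of_sq_le_sq ?_ (by positivity))
      have h4 := mul_le_mul h1 h2 (sq_nonneg _) (mul_nonneg ha hK)
      nlinarith [sq_nonneg (a (t, r) * K' (t, r) - a' (t, r) * K (t, r))]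
    nlinarith
  · obtain ⟨B, hB, hb⟩ := h.bound
    obtain ⟨B', hB', hb'⟩ := h'.bound
    refine ⟨B + B', hB.add hB', fun t r ht hr => ?_⟩
    obtain ⟨h1, h2, h3⟩ := hb t r ht hr
    obtain ⟨h1', h2', h3'⟩ := hb' t r ht hr
    simp only [Pi.add_apply, add_mul]
    exact ⟨add_le_add h1 h1', add_le_add h2 h2', (abs_add_le _ _).trans (add_le_add h3 h3')⟩
  · intro t r ht hr
    have h1 := h.press t r ht hr; have h2 := h'.press t r ht hr
    simp only [Pi.add_apply]
    calc r ^ (-(1 + e)) * (a (t, r) + a' (t, r)) ^ γ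
        ≤ r ^ (-(1 + e)) * (2 ^ γ * (a (t, r) ^ γ + a' (t, r) ^ γ)) := by
          gcongr; exact rpow_add_le hγ (h.nonneg t r ht hr) (h'.nonneg t r ht hr)
      _ = 2 ^ γ * (r ^ (-(1 + e)) * a (t, r) ^ γ + r ^ (-(1 + e)) * a' (t, r) ^ γ) := by ring
      _ ≤ 2 ^ γ * (F t * (1 + r) ^ (-(2 + e)) + F' t * (1 + r) ^ (-(2 + e))) := by gcongr
      _ = _ := by ring
  · intro φ hφ hc
    obtain ⟨M, R, hM⟩ := exists_testBounds hφ hc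
    obtain ⟨i1, e1⟩ := h.mass φ hφ hc
    obtain ⟨i2, e2⟩ := h'.mass φ hφ hc
    have heq : ∀ t ∈ Ioi (0:ℝ), (∫ r in Ioi 0, (a (t, r) * dt φ (t, r) + b (t, r) * dr φ (t, r)))
        + (∫ r in Ioi 0, (a' (t, r) * dt φ (t, r) + b' (t, r) * dr φ (t, r)))
        = ∫ r in Ioi 0, ((a + a') (t, r) * dt φ (t, r) + (b + b') (t, r) * dr φ (t, r)) := by
      intro t ht
      rw [← integral_add (h.integrableOn_mass he hM ht) (h'.integrableOn_mass he hM ht)]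
      refine setIntegral_congr_fun measurableSet_Ioi fun r _ => ?_
      simp only [Pi.add_apply]; ring
    refine ⟨(i1.add i2).congr_fun heq measurableSet_Ioi, ?_⟩
    rw [← setIntegral_congr_fun measurableSet_Ioi heq, integral_add i1 i2, e1, e2]
    simp
  · intro φ hφ hc
    obtain ⟨M, R, hM⟩ := exists_testBounds hφ hc
    obtain ⟨i1, e1⟩ := h.mom φ hφ hc
    obtain ⟨i2, e2⟩ := h'.mom φ hφ hc
    have heq : ∀ t ∈ Ioi (0:ℝ),
        (∫ r in Ioi 0, (b (t, r) * dt φ (t, r) + K (t, r) * dr φ (t, r) + w (t, r) * φ (t, r)))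
        + (∫ r in Ioi 0, (b' (t, r) * dt φ (t, r) + K' (t, r) * dr φ (t, r) + w' (t, r) * φ (t, r)))
        = ∫ r in Ioi 0, ((b + b') (t, r) * dt φ (t, r) + (K + K') (t, r) * dr φ (t, r)
          + (w + w') (t, r) * φ (t, r)) := by
      intro t ht
      rw [← integral_add (h.integrableOn_mom he hM ht) (h'.integrableOn_mom he hM ht)]
      refine setIntegral_congr_fun measurableSet_Ioi fun r _ => ?_
      simp only [Pi.add_apply]; ring
    refine ⟨(i1.add i2).congr_fun heq measurableSet_Ioi, ?_⟩
    rw [← setIntegral_congr_fun measurableSet_Ioi heq, integral_add i1 i2, e1, e2]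
    simp

end Cloud

lemma two_le_critMoment {γ : ℝ} (hγ : 1 < γ) : 2 ≤ critMoment γ := by
  unfold critMoment
  rw [← rpow_mul (by norm_num)]
  calc (2:ℝ) = 2 ^ (1:ℝ) := (rpow_one 2).symm
    _ ≤ _ := rpow_le_rpow_of_exponent_le (by norm_num) ?_
  rw [div_mul_eq_mul_div, one_mul, le_div_iff₀ (by linarith)]; linarith

/-- Twice the geometric pressure source `rad' * p(ρ)`. -/
def source (κ γ e : ℝ) (n : ℕ) (a : ℝ × ℝ → ℝ) (x : ℝ × ℝ) : ℝ :=
  2 * (n - 1) * κ * (x.2 ^ (-(1 + e)) * a x ^ γ)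

/-- The subsolution assembled from a cloud. -/
def assemble (κ γ e : ℝ) (n : ℕ) (a b K w : ℝ × ℝ → ℝ) (x : ℝ × ℝ) : St :=
  (a x / rad n x.2, b x / rad n x.2, (K x + tail (w - source κ γ e n a) x) / rad n x.2,
    2 * pres κ γ (a x / rad n x.2))

lemma pres_div_rad {κ γ e a r : ℝ} {n : ℕ} (hn : 2 ≤ n) (he : e = (n - 1) * (γ - 1)) (ha : 0 ≤ a) (hr : 0 < r) :
    rad n r * pres κ γ (a / rad n r) = κ * (r * (r ^ (-(1 + e)) * a ^ γ)) := by
  have hrad : rad n r = r ^ ((n:ℝ) - 1) := by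
    rw [rad, ← rpow_natCast, Nat.cast_sub (by omega), Nat.cast_one]
  have h1 : r ^ ((n:ℝ) - 1) * (r ^ (((n:ℝ) - 1) * γ))⁻¹ = r * r ^ (-(1 + e)) := by
    rw [← rpow_neg hr.le, ← rpow_add hr]
    conv_rhs => rw [← rpow_one r, ← rpow_mul hr.le, ← rpow_add hr]
    congr 1; rw [he]; ring
  unfold pres
  rw [div_rpow ha (rad_nonneg n hr.le), hrad, ← rpow_mul hr.le]
  calc r ^ ((n:ℝ) - 1) * (κ * (a ^ γ / r ^ (((n:ℝ) - 1) * γ)))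
      = κ * a ^ γ * (r ^ ((n:ℝ) - 1) * (r ^ (((n:ℝ) - 1) * γ))⁻¹) := by ring
    _ = _ := by rw [h1]; ring

lemma rad'_mul_pres {κ γ e a r : ℝ} {n : ℕ} (hn : 2 ≤ n) (he : e = (n - 1) * (γ - 1)) (ha : 0 ≤ a) (hr : 0 < r) :
    rad' n r * (2 * pres κ γ (a / rad n r)) = 2 * (n - 1) * κ * (r ^ (-(1 + e)) * a ^ γ) := by
  have h1 := pres_div_rad (κ := κ) hn he ha hr
  have h2 := rad'_mul hn r
  have h3 : r * (rad' n r * (2 * pres κ γ (a / rad n r))) = r * (2 * (n - 1) * κ * (r ^ (-(1 + e)) * a ^ γ)) := by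
    calc _ = (rad' n r * r) * (2 * pres κ γ (a / rad n r)) := by ring
      _ = 2 * (n - 1) * (rad n r * pres κ γ (a / rad n r)) := by rw [h2]; ring
      _ = _ := by rw [h1]; ring
  exact mul_left_cancel₀ hr.ne' h3

section Base

variable {κ γ e : ℝ} {n : ℕ} {F : ℝ → ℝ} {a b K w : ℝ × ℝ → ℝ} {A D : ℝ → ℝ}

lemma Cloud.continuousOn_source (h : Cloud γ e F a b K w A D) (hγ : 1 < γ) :
    ContinuousOn (source κ γ e n a) (Ioi 0 ×ˢ Ioi 0) := by
  unfold source
  refine continuousOn_const.mul ((continuousOn_snd.rpow_const fun x hx => Or.inl (ne_of_gt hx.2)).mul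
    (h.cont_a.rpow_const fun x hx => Or.inr (by linarith)))

lemma Cloud.abs_source_le (h : Cloud γ e F a b K w A D) (hκ : 0 < κ) (hn : 2 ≤ n) {t r : ℝ} (ht : 0 < t)
    (hr : 0 < r) : |source κ γ e n a (t, r)| ≤ 2 * (n - 1) * κ * F t * (1 + r) ^ (-(2 + e)) := by
  have hn' : (2:ℝ) ≤ n := by exact_mod_cast hn
  have h0 : 0 ≤ 2 * ((n:ℝ) - 1) * κ := by
    have : 0 ≤ (n:ℝ) - 1 := by linarith
    positivity
  have h1 : 0 ≤ a (t, r) ^ γ := rpow_nonneg (h.nonneg t r ht hr) _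
  unfold source
  rw [abs_of_nonneg (by positivity)]
  have := mul_le_mul_of_nonneg_left (h.press t r ht hr) h0
  linarith

lemma Cloud.baseSubsolution (h : Cloud γ e F a b K w A D) (hF : ContinuousOn F (Ioi 0)) (hκ : 0 < κ)
    (hγ : 1 < γ) (hn : 2 ≤ n) (he : e = (n - 1) * (γ - 1)) (hpos : ∀ t r, 0 < t → 0 < r → 0 < a (t, r))
    (hdom : ∀ t r, 0 < t → 0 < r →
      (2 * (n - 1) + critMoment γ) * κ * F t * (1 + r) ^ (-(1 + e)) < tail w (t, r))
    {ρ₀ m₀ : ℝ → ℝ} (hA : ∀ᵐ r ∂volume.restrict (Ioi 0), A r = ρ₀ r * r ^ (n - 1))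
    (hD : ∀ᵐ r ∂volume.restrict (Ioi 0), D r = m₀ r * r ^ (n - 1)) :
    BaseSubsolution κ γ n ρ₀ m₀ (assemble κ γ e n a b K w) := by
  have hn' : (2:ℝ) ≤ n := by exact_mod_cast hn
  have he0 : 0 < e := by rw [he]; exact mul_pos (by linarith) (by linarith)
  have hcrit := two_le_critMoment hγ
  obtain ⟨B, hBc, hB⟩ := h.bound
  set g : ℝ × ℝ → ℝ := w - source κ γ e n a with hg
  set B₁ : ℝ → ℝ := fun t => B t + 2 * (n - 1) * κ * F t with hB₁
  have hB₁c : ContinuousOn B₁ (Ioi 0) := hBc.add (continuousOn_const.mul hF)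
  have hsc := h.continuousOn_source (κ := κ) (n := n) hγ
  have hgc : ContinuousOn g (Ioi 0 ×ˢ Ioi 0) := h.cont_w.sub hsc
  have hgB : ∀ t r, 0 < t → 0 < r → |g (t, r)| ≤ B₁ t * (1 + r) ^ (-(2 + e)) := fun t r ht hr => by
    rw [hB₁, add_mul]
    exact (abs_sub _ _).trans (add_le_add (hB t r ht hr).2.2 (h.abs_source_le hκ hn ht hr))
  have hR : ∀ r : ℝ, 0 < r → 0 < rad n r := fun r hr => pow_pos hr _
  have htail : ∀ t r, 0 < t → 0 < r →
      critMoment γ * (rad n r * pres κ γ (a (t, r) / rad n r)) < tail g (t, r) := by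
    intro t r ht hr
    have h1 : tail g (t, r) = tail w (t, r) - tail (source κ γ e n a) (t, r) := by
      simp only [tail, hg, Pi.sub_apply]
      exact integral_sub
        ((integrableOn_slice_of_decay h.cont_w he0 (fun t r ht hr => (hB t r ht hr).2.2) ht).mono_set
          (Ioi_subset_Ioi hr.le))
        ((integrableOn_slice_of_decay (B := fun t => 2 * (n - 1) * κ * F t) hsc he0
          (fun t r ht hr => h.abs_source_le hκ hn ht hr) ht).mono_set
          (Ioi_subset_Ioi hr.le))
    have h2 := (le_abs_self _).trans (abs_tail_le (B := fun t => 2 * (n - 1) * κ * F t) he0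
      (fun t r ht hr => h.abs_source_le hκ hn ht hr) ht hr)
    have h3 := hdom t r ht hr
    rw [pres_div_rad hn he (h.nonneg t r ht hr) hr, h1]
    have h4 : r * (1 + r) ^ (-(2 + e)) ≤ (1 + r) ^ (-(1 + e)) := by
      have : (1 + r) ^ (-(1 + e)) = (1 + r) * (1 + r) ^ (-(2 + e)) := by
        conv_rhs => rw [← rpow_one (1 + r), ← rpow_mul (by linarith), ← rpow_add (by linarith)]
        congr 1; ring
      rw [this]
      gcongr; linarith
    have hp := h.press t r ht hr
    have hF0 : 0 ≤ F t := by
      refine nonneg_of_mul_nonneg_left (le_trans ?_ hp) (by positivity)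
      exact mul_nonneg (by positivity) (rpow_nonneg (h.nonneg t r ht hr) _)
    have h5 : r * (r ^ (-(1 + e)) * a (t, r) ^ γ) ≤ F t * (1 + r) ^ (-(1 + e)) := by
      calc r * (r ^ (-(1 + e)) * a (t, r) ^ γ) ≤ r * (F t * (1 + r) ^ (-(2 + e))) := by gcongr
        _ = F t * (r * (1 + r) ^ (-(2 + e))) := by ring
        _ ≤ _ := by gcongr
    have h6 : critMoment γ * (κ * (r * (r ^ (-(1 + e)) * a (t, r) ^ γ)))
        ≤ critMoment γ * (κ * (F t * (1 + r) ^ (-(1 + e)))) := by gcongr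
    nlinarith
  have hpres : ∀ t r, 0 < t → 0 < r → 0 < pres κ γ (a (t, r) / rad n r) := fun t r ht hr => by
    have := hpos t r ht hr; have := hR r hr
    unfold pres; positivity
  have hradc : ContinuousOn (fun x : ℝ × ℝ => rad n x.2) (Ioi 0 ×ˢ Ioi 0) :=
    ((continuous_rad n).comp continuous_snd).continuousOn
  have hdiv : ∀ {f : ℝ × ℝ → ℝ}, ContinuousOn f (Ioi 0 ×ˢ Ioi 0) →
      ContinuousOn (fun x => f x / rad n x.2) (Ioi 0 ×ˢ Ioi 0) := fun hf =>
    hf.div hradc fun x hx => (hR x.2 hx.2).ne'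
  have htc := continuousOn_tail hgc he0 hgB hB₁c
  have hcont : ContinuousOn (assemble κ γ e n a b K w) (Ioi 0 ×ˢ Ioi 0) := by
    refine (hdiv h.cont_a).prodMk ((hdiv h.cont_b).prodMk ((hdiv (h.cont_K.add htc)).prodMk ?_))
    exact continuousOn_const.mul (continuousOn_const.mul
      ((hdiv h.cont_a).rpow_const fun x hx => Or.inr (by linarith)))
  refine ⟨hcont, ?_, ?_, ?_, ?_⟩
  · rintro ⟨t, r⟩ ⟨ht, hr⟩
    have ht : 0 < t := ht
    have hr : 0 < r := hr
    have hr' := hR r hr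
    have ha := hpos t r ht hr
    refine exists_mem_lamSet hκ hγ (div_pos ha hr') rfl ?_
    simp only [assemble]
    have h1 := htail t r ht hr
    have h2 := h.sq_le t r ht hr
    have h3 : a (t, r) * (critMoment γ * (rad n r * pres κ γ (a (t, r) / rad n r))) <
        a (t, r) * (K (t, r) + tail g (t, r)) - b (t, r) ^ 2 := by nlinarith
    have h4 : (a (t, r) * (critMoment γ * (rad n r * pres κ γ (a (t, r) / rad n r)))) / rad n r ^ 2 <
        (a (t, r) * (K (t, r) + tail g (t, r)) - b (t, r) ^ 2) / rad n r ^ 2 := by gcongr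
    convert h4 using 1
    · field_simp
    · field_simp
      rw [← hg]
  · intro t ht
    have hst : ∀ r, 0 < r → StBounds (assemble κ γ e n a b K w (t, r)) := by
      intro r hr
      have hr' := hR r hr
      have ha := hpos t r ht hr
      have hK := h.nonneg_K t r ht hr
      have h1 := htail t r ht hr
      have h2 := h.sq_le t r ht hr
      have h3 := hpres t r ht hr
      have h4 : 0 < rad n r * pres κ γ (a (t, r) / rad n r) := mul_pos hr' h3
      have h5 : 2 * (rad n r * pres κ γ (a (t, r) / rad n r)) ≤ K (t, r) + tail g (t, r) := by nlinarith
      refine ⟨(div_pos ha hr').le, ?_, by simp only [assemble]; positivity, ?_⟩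
      · simp only [assemble]
        rw [div_pow, div_mul_div_comm, ← sq]
        rw [← hg]
        have h6 : 0 ≤ tail g (t, r) := by nlinarith
        gcongr
        nlinarith
      · simp only [assemble]
        rw [le_div_iff₀ hr', ← hg]
        linarith
    refine ⟨?_, ae_restrict_of_forall_mem measurableSet_Ioi hst, ?_, ?_⟩
    · exact (hcont.comp (by fun_prop) fun y hy => ⟨ht, hy⟩ : ContinuousOn (fun r => assemble κ γ e n a b K w (t, r))
        (Ioi 0)).aestronglyMeasurable measurableSet_Ioi
    · intro R
      obtain ⟨N, hN⟩ := h.exists_bound he0 ht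
      have hc : ContinuousOn (fun r => a (t, r)) (Ioi 0) := h.cont_a.comp (by fun_prop) fun y hy => ⟨ht, hy⟩
      have : IntegrableOn (fun r => a (t, r)) (Ioc 0 R) :=
        IntegrableOn.of_bound (by simp) ((hc.mono Ioc_subset_Ioi_self).aestronglyMeasurable measurableSet_Ioc) N
          (ae_restrict_of_forall_mem measurableSet_Ioc fun r hr => (hN r hr.1).1)
      refine this.congr_fun (fun r hr => ?_) measurableSet_Ioc
      simp only [assemble]
      rw [mul_div_cancel₀ _ (hR r hr.1).ne']
    · have hc : ContinuousOn (fun r => K (t, r)) (Ioi 0) := h.cont_K.comp (by fun_prop) fun y hy => ⟨ht, hy⟩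
      have hi : IntegrableOn (fun r => K (t, r)) (Ioi 0) := by
        refine Integrable.mono' ((integrableOn_decay (s := -(1 + e)) (by linarith) le_rfl).const_mul (B t))
          (hc.aestronglyMeasurable measurableSet_Ioi) ?_
        refine ae_restrict_of_forall_mem measurableSet_Ioi fun r hr => ?_
        rw [norm_eq_abs, abs_of_nonneg (h.nonneg_K t r ht hr)]
        exact (hB t r ht hr).2.1
      refine (hi.add (integrableOn_tail hgc he0 hgB ht)).congr_fun (fun r hr => ?_) measurableSet_Ioi
      simp only [assemble, Pi.add_apply]
      rw [mul_div_cancel₀ _ (hR r hr).ne']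
  · intro φ hφ hc
    obtain ⟨i1, e1⟩ := h.mass φ hφ hc
    have heq : ∀ t ∈ Ioi (0:ℝ), (∫ r in Ioi 0, (a (t, r) * dt φ (t, r) + b (t, r) * dr φ (t, r)))
        = ∫ r in Ioi 0, pairing (massWeight (rad n) φ (t, r)) (assemble κ γ e n a b K w (t, r)) := by
      intro t ht
      refine setIntegral_congr_fun measurableSet_Ioi fun r hr => ?_
      have := (hR r hr).ne'
      simp only [pairing, massWeight, assemble]
      field_simp; ring
    refine ⟨i1.congr_fun heq measurableSet_Ioi, ?_⟩
    rw [← setIntegral_congr_fun measurableSet_Ioi heq, e1, neg_add_eq_zero]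
    refine integral_congr_ae ?_
    filter_upwards [hA] with r hr
    rw [hr]; ring
  · intro φ hφ hc hφ0
    obtain ⟨M, R, hM⟩ := exists_testBounds hφ hc
    obtain ⟨i1, e1⟩ := h.mom φ hφ hc
    have heq : ∀ t ∈ Ioi (0:ℝ),
        (∫ r in Ioi 0, (b (t, r) * dt φ (t, r) + K (t, r) * dr φ (t, r) + w (t, r) * φ (t, r)))
        = ∫ r in Ioi 0, pairing (momWeight (rad n) (rad' n) φ (t, r)) (assemble κ γ e n a b K w (t, r)) := by
      intro t ht
      have ht0 : (0:ℝ) < t := ht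
      obtain ⟨j1, j2⟩ := integral_tail_mul hgc he0 hgB hM ht (hφ0 t ht0.le)
      have hsum := integral_add (h.integrableOn_mom he0 hM ht) j1
      rw [j2, add_zero] at hsum
      rw [← hsum]
      refine setIntegral_congr_fun measurableSet_Ioi fun r hr => ?_
      have hr0 := (hR r hr).ne'
      have hs := rad'_mul_pres (κ := κ) hn he (h.nonneg t r ht hr) hr
      simp only [pairing, momWeight, assemble]
      have h1 : rad' n r * φ (t, r) * (2 * pres κ γ (a (t, r) / rad n r))
          = source κ γ e n a (t, r) * φ (t, r) := by rw [source, ← hs]; ring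
      have h2 : g (t, r) = w (t, r) - source κ γ e n a (t, r) := rfl
      rw [h1, h2, ← hg]
      field_simp; ring
    refine ⟨i1.congr_fun heq measurableSet_Ioi, ?_⟩
    rw [← setIntegral_congr_fun measurableSet_Ioi heq, e1, neg_add_eq_zero]
    refine integral_congr_ae ?_
    filter_upwards [hD] with r hr
    rw [hr]; ring

end Base

section Cutoff

/-- The truncated linear function `(1 - x)₊`. -/
def cut (x : ℝ) : ℝ := max (1 - x) 0

lemma cut_nonneg (x : ℝ) : 0 ≤ cut x := le_max_right _ _

lemma cut_le_one {x : ℝ} (hx : 0 ≤ x) : cut x ≤ 1 := max_le (by linarith) zero_le_one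

lemma cut_of_one_le {x : ℝ} (hx : 1 ≤ x) : cut x = 0 := max_eq_right (by linarith)

lemma cut_of_le_one {x : ℝ} (hx : x ≤ 1) : cut x = 1 - x := max_eq_left (by linarith)

@[fun_prop]
lemma continuous_cut : Continuous cut := by unfold cut; fun_prop

@[fun_prop]
lemma measurable_cut : Measurable cut := continuous_cut.measurable

lemma hasDerivAt_cut_pow (k : ℕ) (x : ℝ) :
    HasDerivAt (fun x => cut x ^ (k + 2)) (-((k + 2 : ℝ) * cut x ^ (k + 1))) x := by
  have hpoly : HasDerivAt (fun x : ℝ => (1 - x) ^ (k + 2)) (-((k + 2 : ℝ) * (1 - x) ^ (k + 1))) x := by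
    refine (((hasDerivAt_id x).const_sub 1).pow (k + 2)).congr_deriv ?_
    push_cast
    simp
  have hl : x ≤ 1 → HasDerivWithinAt (fun x => cut x ^ (k + 2)) (-((k + 2 : ℝ) * cut x ^ (k + 1))) (Iic 1) x :=
    fun hx => by
      rw [cut_of_le_one hx]
      exact hpoly.hasDerivWithinAt.congr (fun y hy => by rw [cut_of_le_one hy]) (by rw [cut_of_le_one hx])
  have hr : 1 ≤ x → HasDerivWithinAt (fun x => cut x ^ (k + 2)) (-((k + 2 : ℝ) * cut x ^ (k + 1))) (Ici 1) x :=
    fun hx => by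
      rw [cut_of_one_le hx]
      refine ((hasDerivAt_const x (0:ℝ)).hasDerivWithinAt.congr (fun y hy => ?_) ?_).congr_deriv (by simp)
      · rw [cut_of_one_le hy]; simp
      · rw [cut_of_one_le hx]; simp
  rcases lt_trichotomy x 1 with h | h | h
  · exact (hl h.le).hasDerivAt (Iic_mem_nhds h)
  · have := (hl h.le).union (hr h.ge)
    rwa [Iic_union_Ici, hasDerivWithinAt_univ] at this
  · exact (hr h.le).hasDerivAt (Ici_mem_nhds h)

/-- A probability density supported on `[1, 2]`. -/
def bump (y : ℝ) : ℝ := max (6 * (y - 1) * (2 - y)) 0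

@[fun_prop]
lemma continuous_bump : Continuous bump := by unfold bump; fun_prop

@[fun_prop]
lemma measurable_bump : Measurable bump := continuous_bump.measurable

lemma bump_nonneg (y : ℝ) : 0 ≤ bump y := le_max_right _ _

lemma bump_le (y : ℝ) : bump y ≤ 2 := max_le (by nlinarith [sq_nonneg (2 * y - 3)]) (by norm_num)

lemma mem_Icc_of_bump_ne_zero {y : ℝ} (h : bump y ≠ 0) : y ∈ Icc (1:ℝ) 2 := by
  by_contra hy
  refine h (max_eq_right ?_)
  rw [mem_Icc, not_and_or, not_le, not_le] at hy
  rcases hy with hy | hy <;> nlinarith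

lemma bump_eq_indicator : bump = (Ioc (1:ℝ) 2).indicator fun y => 6 * (y - 1) * (2 - y) := by
  funext y
  by_cases hy : y ∈ Ioc (1:ℝ) 2
  · rw [indicator_of_mem hy, bump, max_eq_left]
    have := hy.1; have := hy.2
    nlinarith
  · rw [indicator_of_notMem hy]
    by_contra h
    have := mem_Icc_of_bump_ne_zero h
    have h1 : y = 1 := by
      by_contra h1
      exact hy ⟨lt_of_le_of_ne this.1 (Ne.symm h1), this.2⟩
    exact h (by simp [bump, h1])

lemma integral_bump : ∫ y, bump y = 1 := by
  rw [bump_eq_indicator, integral_indicator measurableSet_Ioc, ← intervalIntegral.integral_of_le (by norm_num)]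
  have h : ∀ y ∈ uIcc (1:ℝ) 2, HasDerivAt (fun y : ℝ => -2 * y ^ 3 + 9 * y ^ 2 - 12 * y)
      (6 * (y - 1) * (2 - y)) y := fun y _ => by
    refine ((((hasDerivAt_pow 3 y).const_mul (-2)).add ((hasDerivAt_pow 2 y).const_mul 9)).sub
      ((hasDerivAt_id y).const_mul 12)).congr_deriv ?_
    norm_num; ring
  rw [intervalIntegral.integral_eq_sub_of_hasDerivAt h (Continuous.intervalIntegrable (by fun_prop) _ _)]
  norm_num

end Cutoff

/-- Mass density `A`, initial velocity `u` and time scale `ℓ` of a cloud of particles labelled by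
their initial radius. -/
structure Labels (γ : ℝ) (A u ℓ : ℝ → ℝ) : Prop where
  measurable_A : Measurable A
  measurable_u : Measurable u
  measurable_scale : Measurable ℓ
  nonneg : ∀ s, 0 ≤ A s
  one_le : ∀ s, 0 < s → 1 ≤ ℓ s
  le : ∀ s, 0 < s → s ≤ ℓ s
  bdd : ∀ R, ∃ Λ, ∀ s, 0 < s → s ≤ R → ℓ s ≤ Λ
  integrable : ∀ R, IntegrableOn A (Ioc 0 R)
  integrable_energy : ∀ R, IntegrableOn (fun s => A s * u s ^ 2) (Ioc 0 R)
  mass_le : ∀ x, 1 ≤ x → ∫ s in {s | 0 < s ∧ ℓ s ≤ x}, A s ≤ x ^ ((γ - 1) / γ)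

section Particle

/-- Rate at which the particle with label `s` is slowed down. -/
def rate (u ℓ : ℝ → ℝ) (s : ℝ) : ℝ := ℓ s + |u s| + 2 * |u s| / s

/-- Centre of the particle. -/
def ctr (u ℓ : ℝ → ℝ) (t s : ℝ) : ℝ := s + u s * ((1 - cut (t * rate u ℓ s) ^ 3) / 3) / rate u ℓ s

/-- Velocity of the centre. -/
def ctrVel (u ℓ : ℝ → ℝ) (t s : ℝ) : ℝ := u s * cut (t * rate u ℓ s) ^ 2

/-- Acceleration of the centre. -/
def ctrAcc (u ℓ : ℝ → ℝ) (t s : ℝ) : ℝ := -2 * u s * (rate u ℓ s * cut (t * rate u ℓ s))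

/-- Width of the particle. -/
def wid (ℓ : ℝ → ℝ) (t s : ℝ) : ℝ := ℓ s * (1 - 4 * cut (t * ℓ s) ^ 3 + 3 * cut (t * ℓ s) ^ 4)

/-- Time derivative of the width. -/
def widVel (ℓ : ℝ → ℝ) (t s : ℝ) : ℝ := ℓ s ^ 2 * (12 * cut (t * ℓ s) ^ 2 - 12 * cut (t * ℓ s) ^ 3)

/-- Second time derivative of the width. -/
def widAcc (ℓ : ℝ → ℝ) (t s : ℝ) : ℝ := ℓ s ^ 3 * (36 * cut (t * ℓ s) ^ 2 - 24 * cut (t * ℓ s))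

/-- Position of the component `y` of the smeared particle. -/
def pos (u ℓ : ℝ → ℝ) (t s y : ℝ) : ℝ := ctr u ℓ t s + wid ℓ t s * y

/-- Velocity of the component `y`. -/
def vel (u ℓ : ℝ → ℝ) (t s y : ℝ) : ℝ := ctrVel u ℓ t s + widVel ℓ t s * y

/-- Acceleration of the component `y`. -/
def acc (u ℓ : ℝ → ℝ) (t s y : ℝ) : ℝ := ctrAcc u ℓ t s + widAcc ℓ t s * y

variable {γ : ℝ} {A u ℓ : ℝ → ℝ} {s t y : ℝ}

namespace Labels

lemma scale_le_rate (hs : 0 < s) : ℓ s ≤ rate u ℓ s := by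
  have : 0 ≤ 2 * |u s| / s := by positivity
  have := abs_nonneg (u s)
  unfold rate; linarith

lemma abs_le_rate (h : Labels γ A u ℓ) (hs : 0 < s) : |u s| ≤ rate u ℓ s := by
  have : 0 ≤ 2 * |u s| / s := by positivity
  have := h.one_le s hs
  unfold rate; linarith

lemma rate_pos (h : Labels γ A u ℓ) (hs : 0 < s) : 0 < rate u ℓ s :=
  zero_lt_one.trans_le ((h.one_le s hs).trans (scale_le_rate hs))

lemma abs_div_rate_le (h : Labels γ A u ℓ) (hs : 0 < s) : |u s| / rate u ℓ s ≤ s / 2 := by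
  rw [div_le_iff₀ (h.rate_pos hs)]
  have h1 := h.one_le s hs
  have h2 := abs_nonneg (u s)
  have : s / 2 * rate u ℓ s = s / 2 * (ℓ s + |u s|) + |u s| := by
    unfold rate; field_simp
  rw [this]
  have : 0 ≤ s / 2 * (ℓ s + |u s|) := by positivity
  linarith

lemma abs_ctr_sub_le (h : Labels γ A u ℓ) (hs : 0 < s) (ht : 0 ≤ t) : |ctr u ℓ t s - s| ≤ s / 2 := by
  have hr := h.rate_pos hs
  have h0 := cut_nonneg (t * rate u ℓ s)
  have h1 := cut_le_one (mul_nonneg ht hr.le)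
  have h3 : cut (t * rate u ℓ s) ^ 3 ≤ 1 := pow_le_one₀ h0 h1
  have h4 : 0 ≤ cut (t * rate u ℓ s) ^ 3 := by positivity
  have h5 : |(1 - cut (t * rate u ℓ s) ^ 3) / 3| ≤ 1 := by rw [abs_le]; constructor <;> linarith
  have h6 := h.abs_div_rate_le hs
  have : ctr u ℓ t s - s = (u s / rate u ℓ s) * ((1 - cut (t * rate u ℓ s) ^ 3) / 3) := by
    unfold ctr; ring
  rw [this, abs_mul, abs_div, abs_of_pos hr]
  calc _ ≤ |u s| / rate u ℓ s * 1 := by gcongr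
    _ ≤ _ := by rwa [mul_one]

lemma wid_le (h : Labels γ A u ℓ) (hs : 0 < s) (ht : 0 ≤ t) : wid ℓ t s ≤ ℓ s := by
  have hl := h.one_le s hs
  have h0 := cut_nonneg (t * ℓ s)
  have h1 := cut_le_one (mul_nonneg ht (zero_le_one.trans hl))
  unfold wid
  have : 0 ≤ cut (t * ℓ s) ^ 3 := by positivity
  refine mul_le_of_le_one_right (by linarith) ?_
  nlinarith

lemma sq_le_wid (h : Labels γ A u ℓ) (hs : 0 < s) (ht : 0 ≤ t) : min t 1 ^ 2 ≤ wid ℓ t s := by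
  have hl := h.one_le s hs
  have hm : 0 ≤ min t 1 := le_min ht zero_le_one
  have hw : min t 1 ^ 2 ≤ 1 - 4 * cut (t * ℓ s) ^ 3 + 3 * cut (t * ℓ s) ^ 4 := by
    rcases le_total (t * ℓ s) 1 with h1 | h1
    · have h2 : min t 1 ≤ t * ℓ s := (min_le_left _ _).trans (le_mul_of_one_le_right ht hl)
      have h3 : min t 1 ^ 2 ≤ (t * ℓ s) ^ 2 := by gcongr
      rw [cut_of_le_one h1]
      set x := t * ℓ s
      have hx : 0 ≤ x := hm.trans h2
      have : 1 - 4 * (1 - x) ^ 3 + 3 * (1 - x) ^ 4 = x ^ 2 * (1 + (1 - x) * (5 - 3 * x)) := by ring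
      rw [this]
      refine h3.trans (le_mul_of_one_le_right (by positivity) ?_)
      nlinarith
    · rw [cut_of_one_le h1]
      have : min t 1 ^ 2 ≤ 1 := pow_le_one₀ hm (min_le_right _ _)
      linarith
  unfold wid
  have h0 : 0 ≤ min t 1 ^ 2 := by positivity
  nlinarith

lemma wid_pos (h : Labels γ A u ℓ) (hs : 0 < s) (ht : 0 < t) : 0 < wid ℓ t s := by
  refine lt_of_lt_of_le ?_ (h.sq_le_wid hs ht.le)
  have : 0 < min t 1 := lt_min ht zero_lt_one
  positivity

lemma half_le_pos (h : Labels γ A u ℓ) (hs : 0 < s) (ht : 0 ≤ t) (hy : y ∈ Icc (1:ℝ) 2) :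
    s / 2 ≤ pos u ℓ t s y ∧ wid ℓ t s ≤ pos u ℓ t s y ∧ pos u ℓ t s y ≤ 4 * ℓ s := by
  have h1 := abs_le.1 (h.abs_ctr_sub_le hs ht)
  have h2 := h.wid_le hs ht
  have h3 : 0 ≤ wid ℓ t s := le_trans (by positivity) (h.sq_le_wid hs ht)
  have h4 := h.le s hs
  have h5 := hy.1
  have h6 := hy.2
  unfold pos
  refine ⟨by nlinarith, by nlinarith, by nlinarith⟩

lemma abs_ctrVel_le (h : Labels γ A u ℓ) (hs : 0 < s) (ht : 0 ≤ t) : |ctrVel u ℓ t s| ≤ |u s| := by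
  have h1 := cut_le_one (mul_nonneg ht (h.rate_pos hs).le)
  unfold ctrVel
  rw [abs_mul]
  refine mul_le_of_le_one_right (abs_nonneg _) ?_
  rw [abs_of_nonneg (by positivity)]
  exact pow_le_one₀ (cut_nonneg _) h1

lemma abs_widVel_le (h : Labels γ A u ℓ) (hs : 0 < s) (ht : 0 ≤ t) : |widVel ℓ t s| ≤ 12 * ℓ s ^ 2 := by
  have hl := h.one_le s hs
  have h0 := cut_nonneg (t * ℓ s)
  have h1 := cut_le_one (mul_nonneg ht (zero_le_one.trans hl))
  unfold widVel
  have h2 : 0 ≤ cut (t * ℓ s) ^ 2 := by positivity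
  have h3 : cut (t * ℓ s) ^ 2 ≤ 1 := pow_le_one₀ h0 h1
  rw [abs_mul, abs_of_nonneg (by positivity : 0 ≤ ℓ s ^ 2), mul_comm]
  gcongr
  rw [abs_le]
  constructor <;> nlinarith

lemma abs_widAcc_le (h : Labels γ A u ℓ) (hs : 0 < s) (ht : 0 ≤ t) : |widAcc ℓ t s| ≤ 36 * ℓ s ^ 3 := by
  have hl := h.one_le s hs
  have h0 := cut_nonneg (t * ℓ s)
  have h1 := cut_le_one (mul_nonneg ht (zero_le_one.trans hl))
  unfold widAcc
  have h2 : 0 ≤ cut (t * ℓ s) ^ 2 := by positivity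
  have h3 : cut (t * ℓ s) ^ 2 ≤ 1 := pow_le_one₀ h0 h1
  rw [abs_mul, abs_of_nonneg (by positivity : 0 ≤ ℓ s ^ 3), mul_comm]
  gcongr
  rw [abs_le]
  constructor <;> nlinarith

lemma frozen (hs : 0 < s) (ht : 0 ≤ t) (hf : 1 ≤ t * ℓ s) :
    wid ℓ t s = ℓ s ∧ vel u ℓ t s y = 0 ∧ acc u ℓ t s y = 0 := by
  have h1 : 1 ≤ t * rate u ℓ s := hf.trans (by gcongr; exact scale_le_rate hs)
  simp [wid, vel, acc, ctrVel, ctrAcc, widVel, widAcc, cut_of_one_le hf, cut_of_one_le h1]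

lemma active_bounds (h : Labels γ A u ℓ) (hs : 0 < s) (ht : 0 < t) (hf : t * ℓ s < 1) (hy : y ∈ Icc (1:ℝ) 2) :
    ℓ s ≤ (min t 1)⁻¹ ∧ |vel u ℓ t s y| ≤ 25 * (min t 1)⁻¹ ^ 2 ∧ |acc u ℓ t s y| ≤ 74 * (min t 1)⁻¹ ^ 3 := by
  have hl := h.one_le s hs
  have ht1 : t < 1 := lt_of_le_of_lt (le_mul_of_one_le_right ht.le hl) hf
  rw [min_eq_left ht1.le]
  have hτ : 1 ≤ t⁻¹ := (one_le_inv₀ ht).2 ht1.le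
  have hlt : ℓ s ≤ t⁻¹ := by
    rw [← one_div, le_div_iff₀ ht]; linarith
  have hyy : |y| ≤ 2 := by rw [abs_le]; exact ⟨by linarith [hy.1], hy.2⟩
  have hr := h.rate_pos hs
  have hwv : |widVel ℓ t s| ≤ 12 * t⁻¹ ^ 2 := (h.abs_widVel_le hs ht.le).trans (by gcongr)
  have hwa : |widAcc ℓ t s| ≤ 36 * t⁻¹ ^ 3 := (h.abs_widAcc_le hs ht.le).trans (by gcongr)
  have hc : |ctrVel u ℓ t s| ≤ t⁻¹ ∧ |ctrAcc u ℓ t s| ≤ 2 * t⁻¹ ^ 2 := by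
    rcases le_total 1 (t * rate u ℓ s) with h1 | h1
    · simp only [ctrVel, ctrAcc, cut_of_one_le h1]
      simp only [ne_eq, OfNat.ofNat_ne_zero, not_false_eq_true, zero_pow, mul_zero, abs_zero]
      constructor <;> positivity
    · have h2 : rate u ℓ s ≤ t⁻¹ := by rw [← one_div, le_div_iff₀ ht]; linarith
      have h3 := h.abs_le_rate hs
      refine ⟨(h.abs_ctrVel_le hs ht.le).trans (h3.trans h2), ?_⟩
      unfold ctrAcc
      have h4 := cut_le_one (mul_nonneg ht.le hr.le)
      rw [abs_mul, abs_mul, abs_mul, abs_of_pos hr, abs_of_nonneg (cut_nonneg _)]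
      calc |(-2:ℝ)| * |u s| * (rate u ℓ s * cut (t * rate u ℓ s)) ≤ |(-2:ℝ)| * t⁻¹ * (t⁻¹ * 1) := by
            have := h3.trans h2
            have := cut_nonneg (t * rate u ℓ s)
            gcongr
        _ = _ := by norm_num; ring
  have p1 : t⁻¹ ≤ t⁻¹ ^ 2 := le_self_pow₀ hτ (by norm_num)
  have p2 : t⁻¹ ^ 2 ≤ t⁻¹ ^ 3 := pow_le_pow_right₀ hτ (by norm_num)
  refine ⟨hlt, ?_, ?_⟩
  · refine (abs_add_le _ _).trans ?_
    rw [abs_mul]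
    have : |widVel ℓ t s| * |y| ≤ 12 * t⁻¹ ^ 2 * 2 := by gcongr
    linarith [hc.1]
  · refine (abs_add_le _ _).trans ?_
    rw [abs_mul]
    have : |widAcc ℓ t s| * |y| ≤ 36 * t⁻¹ ^ 3 * 2 := by gcongr
    linarith [hc.2]

end Labels

lemma hasDerivAt_cut_pow_mul (k : ℕ) (c t : ℝ) :
    HasDerivAt (fun t => cut (t * c) ^ (k + 2)) (-((k + 2 : ℝ) * cut (t * c) ^ (k + 1)) * c) t := by
  have := (hasDerivAt_cut_pow k (t * c)).comp t ((hasDerivAt_id t).mul_const c)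
  simpa only [one_mul, comp_def, id] using this

lemma hasDerivAt_pos (h : Labels γ A u ℓ) (hs : 0 < s) :
    HasDerivAt (fun t => pos u ℓ t s y) (vel u ℓ t s y) t := by
  have hr := (h.rate_pos hs).ne'
  have h1 := hasDerivAt_cut_pow_mul 1 (rate u ℓ s) t
  have h2 := hasDerivAt_cut_pow_mul 1 (ℓ s) t
  have h3 := hasDerivAt_cut_pow_mul 2 (ℓ s) t
  have := ((((h1.const_sub 1).div_const 3).const_mul (u s)).div_const (rate u ℓ s)).const_add s |>.add
    (((((h2.const_mul 4).const_sub 1).add (h3.const_mul 3)).const_mul (ℓ s)).mul_const y)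
  refine this.congr_deriv ?_
  simp only [vel, ctrVel, widVel]
  push_cast
  field_simp
  ring

lemma hasDerivAt_vel : HasDerivAt (fun t => vel u ℓ t s y) (acc u ℓ t s y) t := by
  have h1 := hasDerivAt_cut_pow_mul 0 (rate u ℓ s) t
  have h2 := hasDerivAt_cut_pow_mul 0 (ℓ s) t
  have h3 := hasDerivAt_cut_pow_mul 1 (ℓ s) t
  have := (h1.const_mul (u s)).add ((((h2.const_mul 12).sub (h3.const_mul 12)).const_mul (ℓ s ^ 2)).mul_const y)
  refine this.congr_deriv ?_
  simp only [acc, ctrAcc, widAcc]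
  push_cast
  ring

lemma pos_zero : pos u ℓ 0 s y = s := by simp [pos, ctr, wid, cut]; norm_num

lemma vel_zero : vel u ℓ 0 s y = u s := by simp [vel, ctrVel, widVel, cut]

end Particle

section Field

/-- Component of the particle with label `s` sitting at radius `r` at time `t`. -/
def compAt (u ℓ : ℝ → ℝ) (t r s : ℝ) : ℝ := (r - ctr u ℓ t s) / wid ℓ t s

/-- Density of the particle with label `s` at radius `r`, weighted by `G`. -/
def kern (u ℓ A : ℝ → ℝ) (G : ℝ → ℝ → ℝ → ℝ) (t r s : ℝ) : ℝ :=
  A s * (bump (compAt u ℓ t r s) / wid ℓ t s) * G t s (compAt u ℓ t r s)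

/-- Field generated by the cloud of particles for the weight `G`. -/
def field (u ℓ A : ℝ → ℝ) (G : ℝ → ℝ → ℝ → ℝ) (x : ℝ × ℝ) : ℝ :=
  ∫ s in Ioi 0, kern u ℓ A G x.1 x.2 s

/-- Admissible weights. -/
structure Weight (G : ℝ → ℝ → ℝ → ℝ) (C : ℝ) (p : ℕ) : Prop where
  meas : Measurable fun q : ℝ × ℝ × ℝ => G q.1 q.2.1 q.2.2
  cont : ∀ s, 0 < s → Continuous fun q : ℝ × ℝ => G q.1 s q.2
  bound : ∀ t s y, 0 < t → 0 < s → y ∈ Icc (1:ℝ) 2 → |G t s y| ≤ C * (min t 1)⁻¹ ^ p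

variable {γ : ℝ} {A u ℓ : ℝ → ℝ} {s t r y : ℝ} {G : ℝ → ℝ → ℝ → ℝ} {C : ℝ} {p : ℕ}

lemma Weight.const_nonneg (hG : Weight G C p) : 0 ≤ C := by
  have := (abs_nonneg _).trans (hG.bound 1 1 1 one_pos one_pos ⟨le_rfl, one_le_two⟩)
  simpa using this

lemma weight_one : Weight (fun _ _ _ => 1) 1 0 := ⟨by fun_prop, by fun_prop, by simp⟩

namespace Labels

lemma measurable_rate (h : Labels γ A u ℓ) : Measurable (rate u ℓ) := by
  have := h.measurable_u; have := h.measurable_scale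
  unfold rate
  simp only [← norm_eq_abs]
  fun_prop

lemma measurable_ctr (h : Labels γ A u ℓ) : Measurable fun q : ℝ × ℝ => ctr u ℓ q.1 q.2 := by
  have := h.measurable_u; have := h.measurable_rate
  unfold ctr
  fun_prop

lemma measurable_wid (h : Labels γ A u ℓ) : Measurable fun q : ℝ × ℝ => wid ℓ q.1 q.2 := by
  have := h.measurable_scale
  unfold wid
  fun_prop

lemma measurable_compAt (h : Labels γ A u ℓ) :
    Measurable fun q : ℝ × ℝ × ℝ => compAt u ℓ q.1 q.2.1 q.2.2 := by
  have h1 : Measurable fun q : ℝ × ℝ × ℝ => ctr u ℓ q.1 q.2.2 := h.measurable_ctr.comp (measurable_fst.prodMk measurable_snd.snd)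
  have h2 : Measurable fun q : ℝ × ℝ × ℝ => wid ℓ q.1 q.2.2 :=
    h.measurable_wid.comp (measurable_fst.prodMk measurable_snd.snd)
  unfold compAt
  fun_prop

lemma measurable_kern (h : Labels γ A u ℓ) (hG : Weight G C p) :
    Measurable fun q : ℝ × ℝ × ℝ => kern u ℓ A G q.1 q.2.1 q.2.2 := by
  have h1 := h.measurable_compAt
  have h2 : Measurable fun q : ℝ × ℝ × ℝ => wid ℓ q.1 q.2.2 :=
    h.measurable_wid.comp (measurable_fst.prodMk measurable_snd.snd)
  have h3 : Measurable fun q : ℝ × ℝ × ℝ => G q.1 q.2.2 (compAt u ℓ q.1 q.2.1 q.2.2) :=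
    hG.meas.comp (by fun_prop : Measurable fun q : ℝ × ℝ × ℝ => (q.1, q.2.2, compAt u ℓ q.1 q.2.1 q.2.2))
  have h4 := h.measurable_A
  exact ((h4.comp measurable_snd.snd).mul ((measurable_bump.comp h1).div h2)).mul h3

lemma measurable_vel (h : Labels γ A u ℓ) : Measurable fun q : ℝ × ℝ × ℝ => vel u ℓ q.1 q.2.1 q.2.2 := by
  have := h.measurable_u; have := h.measurable_rate; have := h.measurable_scale
  unfold vel ctrVel widVel
  fun_prop

lemma measurable_acc (h : Labels γ A u ℓ) : Measurable fun q : ℝ × ℝ × ℝ => acc u ℓ q.1 q.2.1 q.2.2 := by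
  have := h.measurable_u; have := h.measurable_rate; have := h.measurable_scale
  unfold acc ctrAcc widAcc
  fun_prop

lemma measurable_pos (h : Labels γ A u ℓ) : Measurable fun q : ℝ × ℝ × ℝ => pos u ℓ q.1 q.2.1 q.2.2 := by
  have h1 : Measurable fun q : ℝ × ℝ × ℝ => ctr u ℓ q.1 q.2.1 := h.measurable_ctr.comp (measurable_fst.prodMk measurable_snd.fst)
  have h2 : Measurable fun q : ℝ × ℝ × ℝ => wid ℓ q.1 q.2.1 :=
    h.measurable_wid.comp (measurable_fst.prodMk measurable_snd.fst)
  unfold pos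
  fun_prop

lemma weight_vel (h : Labels γ A u ℓ) : Weight (vel u ℓ) 25 2 := by
  refine ⟨h.measurable_vel, fun s _ => by unfold vel ctrVel widVel; fun_prop, fun t s y ht hs hy => ?_⟩
  rcases lt_or_ge (t * ℓ s) 1 with hf | hf
  · exact (h.active_bounds hs ht hf hy).2.1
  · rw [(frozen hs ht.le hf).2.1, abs_zero]
    positivity

lemma weight_vel_sq (h : Labels γ A u ℓ) : Weight (fun t s y => vel u ℓ t s y ^ 2) 625 4 := by
  refine ⟨h.weight_vel.meas.pow_const 2, fun s hs => (h.weight_vel.cont s hs).pow 2, fun t s y ht hs hy => ?_⟩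
  rw [abs_pow]
  calc |vel u ℓ t s y| ^ 2 ≤ (25 * (min t 1)⁻¹ ^ 2) ^ 2 := by
        have := h.weight_vel.bound t s y ht hs hy
        gcongr
    _ = _ := by ring

lemma weight_acc (h : Labels γ A u ℓ) : Weight (acc u ℓ) 74 3 := by
  refine ⟨h.measurable_acc, fun s _ => by unfold acc ctrAcc widAcc; fun_prop, fun t s y ht hs hy => ?_⟩
  rcases lt_or_ge (t * ℓ s) 1 with hf | hf
  · exact (h.active_bounds hs ht hf hy).2.2
  · rw [(frozen hs ht.le hf).2.2, abs_zero]
    positivity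

lemma pos_compAt (h : Labels γ A u ℓ) (hs : 0 < s) (ht : 0 < t) : pos u ℓ t s (compAt u ℓ t r s) = r := by
  have := (h.wid_pos hs ht).ne'
  unfold pos compAt
  field_simp
  ring

lemma support_bounds (h : Labels γ A u ℓ) (hs : 0 < s) (ht : 0 < t) (hb : bump (compAt u ℓ t r s) ≠ 0) :
    s ≤ 2 * r ∧ wid ℓ t s ≤ r ∧ r ≤ 4 * ℓ s := by
  have := h.half_le_pos hs ht.le (mem_Icc_of_bump_ne_zero hb)
  rw [h.pos_compAt hs ht] at this
  exact ⟨by linarith, this.2⟩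

lemma abs_kern_le (h : Labels γ A u ℓ) (hG : Weight G C p) (hs : 0 < s) (ht : 0 < t) :
    |kern u ℓ A G t r s| ≤ (Iic (2 * r)).indicator (fun s => 2 * C * (min t 1)⁻¹ ^ (p + 2) * A s) s := by
  have hm : 0 < min t 1 := lt_min ht one_pos
  have hC := hG.const_nonneg
  by_cases hb : bump (compAt u ℓ t r s) = 0
  · rw [kern, hb]
    simp only [zero_div, mul_zero, zero_mul, abs_zero]
    exact indicator_nonneg (fun s _ => mul_nonneg (by positivity) (h.nonneg s)) s
  rw [indicator_of_mem (mem_Iic.2 (h.support_bounds hs ht hb).1)]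
  have hw := h.wid_pos hs ht
  have h1 : (wid ℓ t s)⁻¹ ≤ (min t 1)⁻¹ ^ 2 := by
    rw [inv_pow]
    gcongr
    exact h.sq_le_wid hs ht.le
  unfold kern
  rw [abs_mul, abs_mul, abs_of_nonneg (h.nonneg s), div_eq_mul_inv,
    abs_of_nonneg (mul_nonneg (bump_nonneg _) (by positivity))]
  calc A s * (bump (compAt u ℓ t r s) * (wid ℓ t s)⁻¹) * |G t s (compAt u ℓ t r s)|
      ≤ A s * (2 * (min t 1)⁻¹ ^ 2) * (C * (min t 1)⁻¹ ^ p) := by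
        have := h.nonneg s
        have := bump_le (compAt u ℓ t r s)
        have := bump_nonneg (compAt u ℓ t r s)
        have := hG.bound t s _ ht hs (mem_Icc_of_bump_ne_zero hb)
        gcongr
    _ = _ := by ring

lemma integrableOn_indicator (h : Labels γ A u ℓ) (c R : ℝ) :
    IntegrableOn (fun s => (Iic R).indicator (fun s => c * A s) s) (Ioi 0) := by
  have h1 : IntegrableOn (fun s => c * A s) (Ioc 0 R) := (h.integrable R).const_mul c
  have := h1.integrable_indicator measurableSet_Ioc
  rwa [← Ioi_inter_Iic, ← indicator_indicator, integrable_indicator_iff measurableSet_Ioi] at this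

lemma integrableOn_kern (h : Labels γ A u ℓ) (hG : Weight G C p) (ht : 0 < t) (r : ℝ) :
    IntegrableOn (fun s => kern u ℓ A G t r s) (Ioi 0) :=
  Integrable.mono' (h.integrableOn_indicator _ (2 * r))
    ((h.measurable_kern hG).comp (by fun_prop : Measurable fun s : ℝ => (t, r, s))).aestronglyMeasurable
    (ae_restrict_of_forall_mem measurableSet_Ioi fun _ hs => h.abs_kern_le hG hs ht)

lemma continuousOn_field (h : Labels γ A u ℓ) (hG : Weight G C p) :
    ContinuousOn (field u ℓ A G) (Ioi 0 ×ˢ Ioi 0) := by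
  rintro ⟨t, r⟩ ⟨ht, hr⟩
  have ht' : 0 < t := ht
  have hr' : 0 < r := hr
  refine ContinuousAt.continuousWithinAt ?_
  refine continuousAt_of_dominated (bound := fun s => (Iic (4 * r)).indicator
    (fun s => 2 * C * (min (t / 2) 1)⁻¹ ^ (p + 2) * A s) s) ?_ ?_ (h.integrableOn_indicator _ _) ?_
  · exact Eventually.of_forall fun x => ((h.measurable_kern hG).comp
      (by fun_prop : Measurable fun s : ℝ => (x.1, x.2, s))).aestronglyMeasurable
  · filter_upwards [prod_mem_nhds (Ioi_mem_nhds (half_lt_self ht')) (Iio_mem_nhds (by linarith : r < 2 * r))]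
      with x hx
    have hx1 : t / 2 < x.1 := hx.1
    have hx2 : x.2 < 2 * r := hx.2
    refine ae_restrict_of_forall_mem measurableSet_Ioi fun s hs => ?_
    have hm : 0 < min (t / 2) 1 := lt_min (by linarith) one_pos
    have hC := hG.const_nonneg
    refine (h.abs_kern_le hG hs (by linarith)).trans ?_
    refine (indicator_le_indicator_of_subset (Iic_subset_Iic.2 (by linarith)) (fun s => ?_) s).trans
      (indicator_le_indicator ?_)
    · have := h.nonneg s
      have : 0 < min x.1 1 := lt_min (by linarith) one_pos
      positivity
    · have := h.nonneg s
      have : 0 < min x.1 1 := lt_min (by linarith) one_pos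
      gcongr
  · refine ae_restrict_of_forall_mem measurableSet_Ioi fun s hs => ?_
    have hw := (h.wid_pos hs ht').ne'
    have h1 : ContinuousAt (fun x : ℝ × ℝ => compAt u ℓ x.1 x.2 s) (t, r) := by
      unfold compAt
      refine ContinuousAt.div (by unfold ctr; fun_prop) (by unfold wid; fun_prop) hw
    have h2 : ContinuousAt (fun x : ℝ × ℝ => bump (compAt u ℓ x.1 x.2 s) / wid ℓ x.1 s) (t, r) :=
      ContinuousAt.div (continuous_bump.continuousAt.comp h1) (by unfold wid; fun_prop) hw
    have h3 : ContinuousAt (fun x : ℝ × ℝ => G x.1 s (compAt u ℓ x.1 x.2 s)) (t, r) :=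
      ContinuousAt.comp (f := fun x : ℝ × ℝ => (x.1, compAt u ℓ x.1 x.2 s)) (hG.cont s hs).continuousAt
        (continuousAt_fst.prodMk h1)
    exact (continuousAt_const.mul h2).mul h3

lemma sq_field_vel_le (h : Labels γ A u ℓ) (ht : 0 < t) (r : ℝ) :
    field u ℓ A (vel u ℓ) (t, r) ^ 2 ≤
      field u ℓ A (fun _ _ _ => 1) (t, r) * field u ℓ A (fun t s y => vel u ℓ t s y ^ 2) (t, r) := by
  have i0 := h.integrableOn_kern weight_one ht r
  have i1 := h.integrableOn_kern h.weight_vel ht r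
  have i2 := h.integrableOn_kern h.weight_vel_sq ht r
  have key : ∀ x : ℝ, 0 ≤ field u ℓ A (fun _ _ _ => 1) (t, r) * (x * x) + (-2 * field u ℓ A (vel u ℓ) (t, r)) * x
      + field u ℓ A (fun t s y => vel u ℓ t s y ^ 2) (t, r) := fun x => by
    have e1 := integral_add (i2.add (i0.const_mul (x * x))) (i1.const_mul (-2 * x))
    have e2 := integral_add i2 (i0.const_mul (x * x))
    simp only [Pi.add_apply, integral_const_mul] at e1 e2
    rw [e2] at e1
    have : 0 ≤ ∫ s in Ioi 0, (kern u ℓ A (fun t s y => vel u ℓ t s y ^ 2) t r s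
        + x * x * kern u ℓ A (fun _ _ _ => 1) t r s + -2 * x * kern u ℓ A (vel u ℓ) t r s) := by
      refine setIntegral_nonneg measurableSet_Ioi fun s hs => ?_
      have hw := h.wid_pos hs ht
      have : 0 ≤ A s * (bump (compAt u ℓ t r s) / wid ℓ t s) :=
        mul_nonneg (h.nonneg s) (div_nonneg (bump_nonneg _) hw.le)
      have e : kern u ℓ A (fun t s y => vel u ℓ t s y ^ 2) t r s
        + x * x * kern u ℓ A (fun _ _ _ => 1) t r s + -2 * x * kern u ℓ A (vel u ℓ) t r s
        = A s * (bump (compAt u ℓ t r s) / wid ℓ t s) * (vel u ℓ t s (compAt u ℓ t r s) - x) ^ 2 := by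
        unfold kern; ring
      rw [e]
      positivity
    rw [e1] at this
    unfold field
    dsimp only
    linarith
  have := discrim_le_zero key
  unfold discrim at this
  linarith

end Labels

end Field

section Decay

variable {γ : ℝ} {A u ℓ : ℝ → ℝ} {s t r y : ℝ} {G : ℝ → ℝ → ℝ → ℝ} {C : ℝ} {p : ℕ}

lemma one_le_inv_min (ht : 0 < t) : 1 ≤ (min t 1)⁻¹ :=
  (one_le_inv₀ (lt_min ht one_pos)).2 (min_le_right _ _)

namespace Labels

lemma abs_field_le_of_indicator (h : Labels γ A u ℓ) {c x : ℝ} (hx : 1 ≤ x) (hc : 0 ≤ c)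
    (hk : ∀ s, 0 < s → |kern u ℓ A G t r s| ≤ {s | ℓ s ≤ x}.indicator (fun s => c * A s) s) :
    |field u ℓ A G (t, r)| ≤ c * x ^ ((γ - 1) / γ) := by
  have hm : MeasurableSet {s | ℓ s ≤ x} := measurableSet_le h.measurable_scale measurable_const
  have hset : Ioi 0 ∩ {s | ℓ s ≤ x} = {s | 0 < s ∧ ℓ s ≤ x} := rfl
  have hInt : IntegrableOn (fun s => c * A s) {s | 0 < s ∧ ℓ s ≤ x} :=
    IntegrableOn.mono_set ((h.integrable x).const_mul c) fun s hs => ⟨hs.1, (h.le s hs.1).trans hs.2⟩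
  have hi : IntegrableOn ({s | ℓ s ≤ x}.indicator fun s => c * A s) (Ioi 0) := by
    rw [← integrable_indicator_iff measurableSet_Ioi, indicator_indicator, hset,
      integrable_indicator_iff (hset ▸ measurableSet_Ioi.inter hm)]
    exact hInt
  have h1 := norm_integral_le_of_norm_le hi (f := fun s => kern u ℓ A G t r s)
    (ae_restrict_of_forall_mem measurableSet_Ioi hk)
  refine h1.trans ?_
  rw [setIntegral_indicator hm, hset, integral_const_mul]
  exact mul_le_mul_of_nonneg_left (h.mass_le x hx) hc

lemma kern_of_bump (hb : bump (compAt u ℓ t r s) = 0) : kern u ℓ A G t r s = 0 := by simp [kern, hb]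

lemma field_decay (h : Labels γ A u ℓ) (hγ : 1 < γ) (hG : Weight G C p)
    (hv : ∀ t s y, 0 < t → 0 < s → 1 ≤ t * ℓ s → G t s y = 0) {N : ℝ} (hN : 0 ≤ N) (ht : 0 < t) (hr : 0 < r) :
    |field u ℓ A G (t, r)| ≤ 2 * C * (min t 1)⁻¹ ^ (p + 3) * ((5 * (min t 1)⁻¹) ^ N * (1 + r) ^ (-N)) := by
  have hC := hG.const_nonneg
  have hτ := one_le_inv_min ht
  have hact : ∀ s, 0 < s → kern u ℓ A G t r s ≠ 0 → ℓ s ≤ (min t 1)⁻¹ ∧ r ≤ 4 * (min t 1)⁻¹ := fun s hs hk => by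
    have hb : bump (compAt u ℓ t r s) ≠ 0 := fun hb => hk (kern_of_bump hb)
    have hf : t * ℓ s < 1 := by
      by_contra hf
      exact hk (by simp [kern, hv t s _ ht hs (not_lt.1 hf)])
    have h1 := (h.active_bounds hs ht hf (mem_Icc_of_bump_ne_zero hb)).1
    exact ⟨h1, by linarith [(h.support_bounds hs ht hb).2.2]⟩
  rcases le_or_gt r (4 * (min t 1)⁻¹) with hr4 | hr4
  · have h1 := h.abs_field_le_of_indicator (G := G) (t := t) (r := r) (c := 2 * C * (min t 1)⁻¹ ^ (p + 2)) hτ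
      (by positivity) fun s hs => by
        by_cases hk : kern u ℓ A G t r s = 0
        · rw [hk, abs_zero]
          exact indicator_nonneg (fun s _ => mul_nonneg (by positivity) (h.nonneg s)) s
        · rw [indicator_of_mem (show s ∈ {s | ℓ s ≤ (min t 1)⁻¹} from (hact s hs hk).1)]
          have h2 := h.abs_kern_le hG hs ht (r := r)
          refine h2.trans (indicator_le_self' (fun x _ => ?_) s)
          exact mul_nonneg (by positivity) (h.nonneg x)
    have h2 : (min t 1)⁻¹ ^ ((γ - 1) / γ) ≤ (min t 1)⁻¹ :=
      rpow_le_self_of_one_le hτ ((div_le_one (by linarith)).2 (by linarith))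
    have h3 : 1 ≤ (5 * (min t 1)⁻¹) ^ N * (1 + r) ^ (-N) := by
      rw [rpow_neg (by positivity), ← div_eq_mul_inv, one_le_div (by positivity)]
      exact rpow_le_rpow (by positivity) (by linarith) hN
    calc |field u ℓ A G (t, r)| ≤ 2 * C * (min t 1)⁻¹ ^ (p + 2) * (min t 1)⁻¹ := h1.trans (by gcongr)
      _ = 2 * C * (min t 1)⁻¹ ^ (p + 3) * 1 := by ring
      _ ≤ _ := by gcongr
  · have : field u ℓ A G (t, r) = 0 := by
      refine setIntegral_eq_zero_of_forall_eq_zero fun s hs => ?_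
      by_contra hk
      exact (hact s hs hk).2.not_gt hr4
    rw [this, abs_zero]
    positivity

lemma density_le (h : Labels γ A u ℓ) (hγ : 1 < γ) (ht : 0 < t) (hr : 0 < r) :
    field u ℓ A (fun _ _ _ => 1) (t, r) ≤ 16 * (min t 1)⁻¹ ^ 4 * (1 + r) ^ (-(1 / γ)) := by
  have hτ := one_le_inv_min ht
  have h1 := h.abs_field_le_of_indicator (G := fun _ _ _ => 1) (t := t) (r := r)
    (c := 16 * (min t 1)⁻¹ ^ 3 * (1 + r)⁻¹) (x := (1 + r) * (min t 1)⁻¹) (by nlinarith)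
    (by positivity) fun s hs => by
      by_cases hb : bump (compAt u ℓ t r s) = 0
      · rw [kern_of_bump hb, abs_zero]
        exact indicator_nonneg (fun s _ => mul_nonneg (by positivity) (h.nonneg s)) s
      obtain ⟨hs1, hs2, hs3⟩ := h.support_bounds hs ht hb
      have hw := h.wid_pos hs ht
      have hl := h.one_le s hs
      have key : ℓ s ≤ (1 + r) * (min t 1)⁻¹ ∧ (wid ℓ t s)⁻¹ ≤ 8 * (min t 1)⁻¹ ^ 3 * (1 + r)⁻¹ := by
        rcases lt_or_ge (t * ℓ s) 1 with hf | hf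
        · have h1 := (h.active_bounds hs ht hf (mem_Icc_of_bump_ne_zero hb)).1
          refine ⟨by nlinarith, ?_⟩
          have h2 : (wid ℓ t s)⁻¹ ≤ (min t 1)⁻¹ ^ 2 := by
            rw [inv_pow]
            have : 0 < min t 1 := lt_min ht one_pos
            gcongr
            exact h.sq_le_wid hs ht.le
          refine h2.trans ?_
          rw [← div_eq_mul_inv, le_div_iff₀ (by positivity)]
          have : 1 + r ≤ 5 * (min t 1)⁻¹ := by linarith
          calc (min t 1)⁻¹ ^ 2 * (1 + r) ≤ (min t 1)⁻¹ ^ 2 * (5 * (min t 1)⁻¹) := by gcongr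
            _ ≤ _ := by nlinarith [pow_pos (zero_lt_one.trans_le hτ) 3]
        · rw [(frozen (u := u) (y := 0) hs ht.le hf).1] at hs2 ⊢
          refine ⟨by nlinarith, ?_⟩
          rw [← div_eq_mul_inv, inv_le_comm₀ (by linarith) (by positivity), inv_div]
          have : 1 ≤ (min t 1)⁻¹ ^ 3 := one_le_pow₀ hτ
          rw [div_le_iff₀ (by positivity)]
          nlinarith
      rw [indicator_of_mem (show s ∈ {s | ℓ s ≤ (1 + r) * (min t 1)⁻¹} from key.1), kern, mul_one,
        abs_of_nonneg (mul_nonneg (h.nonneg s) (div_nonneg (bump_nonneg _) hw.le)), div_eq_mul_inv]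
      calc A s * (bump (compAt u ℓ t r s) * (wid ℓ t s)⁻¹) ≤ A s * (2 * (8 * (min t 1)⁻¹ ^ 3 * (1 + r)⁻¹)) := by
            have := h.nonneg s
            have := bump_le (compAt u ℓ t r s)
            have := key.2
            gcongr
        _ = _ := by ring
  refine (le_abs_self _).trans (h1.trans ?_)
  have h2 : (min t 1)⁻¹ ^ ((γ - 1) / γ) ≤ (min t 1)⁻¹ :=
    rpow_le_self_of_one_le hτ ((div_le_one (by linarith)).2 (by linarith))
  rw [mul_rpow (by positivity) (by positivity)]
  have h3 : (1 + r) ^ (-(1 / γ)) = (1 + r)⁻¹ * (1 + r) ^ ((γ - 1) / γ) := by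
    rw [← rpow_neg_one, ← rpow_add (by positivity)]
    congr 1
    field_simp; ring
  rw [h3]
  calc _ ≤ 16 * (min t 1)⁻¹ ^ 3 * (1 + r)⁻¹ * ((1 + r) ^ ((γ - 1) / γ) * (min t 1)⁻¹) := by gcongr
    _ = _ := by ring

lemma density_eq_zero (h : Labels γ A u ℓ) (ht : 0 < t) (hr : r < min t 1 ^ 2) :
    field u ℓ A (fun _ _ _ => 1) (t, r) = 0 := by
  refine setIntegral_eq_zero_of_forall_eq_zero fun s hs => kern_of_bump ?_
  by_contra hb
  have h1 := (h.support_bounds hs ht hb).2.1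
  have h2 := h.sq_le_wid hs ht.le
  linarith

lemma density_nonneg (h : Labels γ A u ℓ) (ht : 0 < t) : 0 ≤ field u ℓ A (fun _ _ _ => 1) (t, r) :=
  setIntegral_nonneg measurableSet_Ioi fun s hs => by
    have hw := h.wid_pos hs ht
    simp only [kern, mul_one]
    exact mul_nonneg (h.nonneg s) (div_nonneg (bump_nonneg _) hw.le)

lemma pressure_le (h : Labels γ A u ℓ) (hγ : 1 < γ) {e : ℝ} (he : 0 < e) (ht : 0 < t) (hr : 0 < r) :
    r ^ (-(1 + e)) * field u ℓ A (fun _ _ _ => 1) (t, r) ^ γ ≤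
      2 ^ (1 + e) * 16 ^ γ * (min t 1)⁻¹ ^ (2 + 2 * e + 4 * γ) * (1 + r) ^ (-(2 + e)) := by
  have hm : 0 < min t 1 := lt_min ht one_pos
  have hm1 : min t 1 ≤ 1 := min_le_right _ _
  rcases lt_or_ge r (min t 1 ^ 2) with h0 | h0
  · rw [h.density_eq_zero ht h0, zero_rpow (by linarith), mul_zero]
    positivity
  have h1 : r ^ (-(1 + e)) ≤ 2 ^ (1 + e) * (min t 1)⁻¹ ^ (2 + 2 * e) * (1 + r) ^ (-(1 + e)) := by
    have h2 : (min t 1 ^ 2 * (1 + r)) / 2 ≤ r := by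
      have : min t 1 ^ 2 ≤ 1 := pow_le_one₀ hm.le hm1
      nlinarith
    have h3 := rpow_le_rpow_of_nonpos (z := -(1 + e)) (by positivity) h2 (by linarith)
    refine h3.trans (le_of_eq ?_)
    have h4 : (min t 1 ^ 2 : ℝ) ^ (-(1 + e)) = (min t 1)⁻¹ ^ (2 + 2 * e) := by
      rw [inv_rpow hm.le, ← rpow_neg hm.le, ← rpow_natCast, ← rpow_mul hm.le]
      congr 1
      push_cast; ring
    rw [div_rpow (by positivity) (by norm_num), mul_rpow (by positivity) (by positivity), h4,
      rpow_neg (by norm_num : (0:ℝ) ≤ 2), div_inv_eq_mul]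
    ring
  have h5 : field u ℓ A (fun _ _ _ => 1) (t, r) ^ γ ≤ 16 ^ γ * (min t 1)⁻¹ ^ (4 * γ) * (1 + r) ^ (-1 : ℝ) := by
    refine (rpow_le_rpow (h.density_nonneg ht) (h.density_le hγ ht hr) (by linarith)).trans (le_of_eq ?_)
    rw [mul_rpow (by positivity) (by positivity), mul_rpow (by positivity) (by positivity), ← rpow_mul (by positivity),
      ← rpow_natCast, ← rpow_mul (by positivity)]
    congr 2
    have : γ ≠ 0 := by linarith
    field_simp
  calc _ ≤ (2 ^ (1 + e) * (min t 1)⁻¹ ^ (2 + 2 * e) * (1 + r) ^ (-(1 + e))) *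
        (16 ^ γ * (min t 1)⁻¹ ^ (4 * γ) * (1 + r) ^ (-1 : ℝ)) := by
          have := rpow_nonneg (h.density_nonneg (r := r) ht) γ
          gcongr
    _ = 2 ^ (1 + e) * 16 ^ γ * ((min t 1)⁻¹ ^ (2 + 2 * e) * (min t 1)⁻¹ ^ (4 * γ)) *
        ((1 + r) ^ (-(1 + e)) * (1 + r) ^ (-1 : ℝ)) := by ring
    _ = _ := by
      rw [← rpow_add (by positivity), ← rpow_add (by positivity)]
      congr 2; ring

end Labels

end Decay

section Slice

/-- Reference measure on the components `(s, y)` of the particles. -/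
abbrev labelMeasure : Measure (ℝ × ℝ) := (volume.restrict (Ioi 0)).prod volume

variable {γ : ℝ} {A u ℓ : ℝ → ℝ} {s t r y : ℝ} {G : ℝ → ℝ → ℝ → ℝ} {C M R : ℝ} {p : ℕ} {χ : ℝ → ℝ}

lemma ae_labelMeasure {P : ℝ × ℝ → Prop} (hP : ∀ s y, 0 < s → P (s, y)) : ∀ᵐ o ∂labelMeasure, P o := by
  have : labelMeasure = ((volume : Measure ℝ).prod volume).restrict (Ioi 0 ×ˢ univ) := by
    rw [← Measure.prod_restrict, Measure.restrict_univ]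
  rw [this]
  exact ae_restrict_of_forall_mem (measurableSet_Ioi.prod .univ) fun o ho => hP o.1 o.2 ho.1

lemma integral_affine_div {g : ℝ → ℝ} {a b : ℝ} (hb : 0 < b) : ∫ r, g ((r - a) / b) / b = ∫ y, g y := by
  rw [integral_sub_right_eq_self (fun r => g (r / b) / b) a, integral_div, Measure.integral_comp_div g b,
    smul_eq_mul, abs_of_pos hb, mul_div_cancel_left₀ _ hb.ne']

lemma integrable_cutoff_label {f g : ℝ → ℝ} (hf : IntegrableOn f (Ioc 0 R)) (hg : Integrable g) :
    Integrable (fun o : ℝ × ℝ => (Iic R).indicator f o.1 * g o.2) labelMeasure := by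
  refine Integrable.mul_prod ?_ hg
  have := hf.integrable_indicator measurableSet_Ioc
  rwa [← Ioi_inter_Iic, ← indicator_indicator, integrable_indicator_iff measurableSet_Ioi] at this

lemma integrable_bump : Integrable bump := by
  rw [bump_eq_indicator, integrable_indicator_iff measurableSet_Ioc]
  exact (Continuous.integrableOn_Icc (by fun_prop)).mono_set Ioc_subset_Icc_self

namespace Labels

lemma slice (h : Labels γ A u ℓ) (hG : Weight G C p) (hχ : Continuous χ) (hM : ∀ r, |χ r| ≤ M)
    (hR : ∀ r, R ≤ r → χ r = 0) (ht : 0 < t) :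
    IntegrableOn (fun r => field u ℓ A G (t, r) * χ r) (Ioi 0) ∧
    Integrable (fun o => A o.1 * bump o.2 * (G t o.1 o.2 * χ (pos u ℓ t o.1 o.2))) labelMeasure ∧
    ∫ r in Ioi 0, field u ℓ A G (t, r) * χ r =
      ∫ o, A o.1 * bump o.2 * (G t o.1 o.2 * χ (pos u ℓ t o.1 o.2)) ∂labelMeasure := by
  have hM0 : 0 ≤ M := (abs_nonneg _).trans (hM 0)
  have hC := hG.const_nonneg
  have hτ : 0 ≤ (min t 1)⁻¹ := zero_le_one.trans (one_le_inv_min ht)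
  have hk0 : ∀ s r, 0 < s → r ≤ 0 → kern u ℓ A G t r s = 0 := fun s r hs hr => by
    refine kern_of_bump ?_
    by_contra hb
    linarith [(h.support_bounds hs ht hb).1]
  have hf : Integrable (fun q : ℝ × ℝ => kern u ℓ A G t q.2 q.1 * χ q.2) labelMeasure := by
    have hb := integrable_cutoff_label (R := 2 * R) (f := fun s => 2 * C * (min t 1)⁻¹ ^ (p + 2) * A s)
      (g := (Icc 0 R).indicator fun _ => M) ((h.integrable _).const_mul _)
      ((integrableOn_const (by simp)).integrable_indicator measurableSet_Icc)
    refine hb.mono' ?_ (ae_labelMeasure fun s r hs => ?_)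
    · exact (((h.measurable_kern hG).comp (by fun_prop : Measurable fun q : ℝ × ℝ => (t, q.2, q.1))).mul
        (hχ.measurable.comp measurable_snd)).aestronglyMeasurable
    · have hnn : ∀ x, 0 ≤ (Iic (2 * R)).indicator (fun s => 2 * C * (min t 1)⁻¹ ^ (p + 2) * A s) x := fun x =>
        indicator_nonneg (fun s _ => mul_nonneg (by positivity) (h.nonneg s)) x
      dsimp only
      by_cases hr : r ∈ Icc 0 R
      · rw [indicator_of_mem hr, norm_mul]
        refine mul_le_mul ((h.abs_kern_le hG hs ht).trans ?_) (hM r) (norm_nonneg _) (hnn s)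
        exact indicator_le_indicator_of_subset (Iic_subset_Iic.2 (by linarith [hr.2]))
          (fun s => mul_nonneg (by positivity) (h.nonneg s)) s
      · have : kern u ℓ A G t r s * χ r = 0 := by
          rcases lt_or_ge r 0 with h0 | h0
          · rw [hk0 s r hs h0.le, zero_mul]
          · rw [hR r (le_of_not_ge fun h1 => hr ⟨h0, h1⟩), mul_zero]
        rw [this, norm_zero]
        exact mul_nonneg (hnn s) (indicator_nonneg (fun _ _ => hM0) r)
  have hg : Integrable (fun o => A o.1 * bump o.2 * (G t o.1 o.2 * χ (pos u ℓ t o.1 o.2))) labelMeasure := by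
    have hb := (integrable_cutoff_label (R := 2 * R) (h.integrable _) integrable_bump).const_mul
      (C * (min t 1)⁻¹ ^ p * M)
    refine hb.mono' ?_ (ae_labelMeasure fun s y hs => ?_)
    · have h1 := hG.meas.comp (by fun_prop : Measurable fun o : ℝ × ℝ => (t, o.1, o.2))
      have h2 := h.measurable_pos.comp (by fun_prop : Measurable fun o : ℝ × ℝ => (t, o.1, o.2))
      exact (((h.measurable_A.comp measurable_fst).mul (measurable_bump.comp measurable_snd)).mul
        (h1.mul (hχ.measurable.comp h2))).aestronglyMeasurable
    · dsimp only
      have hnn : 0 ≤ (Iic (2 * R)).indicator A s := indicator_nonneg (fun s _ => h.nonneg s) s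
      have hb0 := bump_nonneg y
      by_cases hb : bump y = 0
      · simp [hb]
      have hy := mem_Icc_of_bump_ne_zero hb
      rcases le_or_gt s (2 * R) with hsR | hsR
      · rw [indicator_of_mem (mem_Iic.2 hsR), norm_mul, norm_mul, norm_mul, norm_of_nonneg (h.nonneg s),
          norm_of_nonneg hb0]
        calc A s * bump y * (‖G t s y‖ * ‖χ (pos u ℓ t s y)‖)
            ≤ A s * bump y * ((C * (min t 1)⁻¹ ^ p) * M) := by
              have := h.nonneg s
              have h1 := hG.bound t s y ht hs hy
              have h2 := hM (pos u ℓ t s y)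
              rw [← norm_eq_abs] at h1 h2
              gcongr
          _ = _ := by ring
      · rw [hR _ (by linarith [(h.half_le_pos hs ht.le hy).1])]
        simp only [mul_zero, norm_zero]
        positivity
  have e1 : ∀ r, ∫ s in Ioi 0, kern u ℓ A G t r s * χ r = field u ℓ A G (t, r) * χ r := fun r =>
    integral_mul_const _ _
  have hi : Integrable fun r => field u ℓ A G (t, r) * χ r := by
    have := hf.integral_prod_right
    simpa only [e1] using this
  refine ⟨hi.integrableOn, hg, ?_⟩
  rw [setIntegral_eq_integral_of_forall_compl_eq_zero, integral_prod _ hg]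
  · simp only [← e1]
    rw [← integral_integral_swap (f := fun s r => kern u ℓ A G t r s * χ r) hf]
    refine setIntegral_congr_fun measurableSet_Ioi fun s hs => ?_
    have hw := h.wid_pos hs ht
    rw [← integral_affine_div (g := fun y => A s * bump y * (G t s y * χ (pos u ℓ t s y)))
      (a := ctr u ℓ t s) hw]
    refine integral_congr_ae (Eventually.of_forall fun r => ?_)
    have := h.pos_compAt (r := r) hs ht
    rw [compAt] at this
    simp only [this, kern, compAt]
    ring
  · intro r hr
    rw [← e1]
    refine setIntegral_eq_zero_of_forall_eq_zero fun s hs => ?_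
    rw [hk0 s r hs (not_lt.1 hr), zero_mul]

end Labels

end Slice

section Weak

variable {γ : ℝ} {A u ℓ : ℝ → ℝ}

lemma ae_time_label {P : ℝ × ℝ × ℝ → Prop} (hP : ∀ t s y, 0 < t → 0 < s → P (t, s, y)) :
    ∀ᵐ q ∂((volume.restrict (Ioi 0)).prod labelMeasure), P q := by
  have : (volume.restrict (Ioi 0)).prod labelMeasure =
      ((volume : Measure ℝ).prod ((volume : Measure ℝ).prod volume)).restrict (Ioi 0 ×ˢ (Ioi 0 ×ˢ univ)) := by
    rw [← Measure.prod_restrict, ← Measure.prod_restrict, Measure.restrict_univ]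
  rw [this]
  exact ae_restrict_of_forall_mem (measurableSet_Ioi.prod (measurableSet_Ioi.prod .univ))
    fun q hq => hP q.1 q.2.1 q.2.2 hq.1 hq.2.1

lemma integrableOn_cut : IntegrableOn cut (Ioi 0) := by
  have h : IntegrableOn cut (Ioc 0 1) := continuous_cut.integrableOn_Icc.mono_set Ioc_subset_Icc_self
  refine h.of_forall_sdiff_eq_zero measurableSet_Ioi fun x hx => cut_of_one_le ?_
  by_contra h
  exact hx.2 ⟨hx.1, (not_le.1 h).le⟩

lemma integrable_cut_kernel {g rt : ℝ × ℝ → ℝ} (hg : Integrable g labelMeasure) (hgm : Measurable g)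
    (hrt : Measurable rt) (hpos : ∀ s y, 0 < s → 0 < rt (s, y)) :
    Integrable (fun q : ℝ × ℝ × ℝ => g q.2 * (rt q.2 * cut (q.1 * rt q.2)))
      ((volume.restrict (Ioi 0)).prod labelMeasure) := by
  have hm : Measurable fun q : ℝ × ℝ × ℝ => g q.2 * (rt q.2 * cut (q.1 * rt q.2)) := by fun_prop
  rw [integrable_prod_iff' hm.aestronglyMeasurable]
  constructor
  · refine ae_labelMeasure fun s y hs => ?_
    have hp := hpos s y hs
    have : IntegrableOn (fun t => cut (t * rt (s, y))) (Ioi 0) := by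
      rw [integrableOn_Ioi_comp_mul_right_iff _ _ hp, zero_mul]
      exact integrableOn_cut
    exact (this.const_mul (rt (s, y))).const_mul (g (s, y))
  · refine (hg.norm.mul_const (∫ t in Ioi 0, cut t)).congr (ae_labelMeasure fun s y hs => ?_)
    have hp := hpos s y hs
    have e1 : ∀ t, ‖g (s, y) * (rt (s, y) * cut (t * rt (s, y)))‖ =
        ‖g (s, y)‖ * rt (s, y) * cut (t * rt (s, y)) := fun t => by
      rw [norm_mul, norm_mul, norm_of_nonneg hp.le, norm_of_nonneg (cut_nonneg _), mul_assoc]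
    simp only [e1]
    rw [integral_const_mul, integral_comp_mul_right_Ioi _ _ hp, zero_mul, smul_eq_mul]
    field_simp

lemma integrable_time_label {f : ℝ → ℝ} {R T : ℝ} (hf : IntegrableOn f (Ioc 0 R)) :
    Integrable (fun q : ℝ × ℝ × ℝ => (Iic T).indicator (fun _ => (1:ℝ)) q.1 * ((Iic R).indicator f q.2.1 * bump q.2.2))
      ((volume.restrict (Ioi 0)).prod labelMeasure) := by
  refine Integrable.mul_prod ?_ (integrable_cutoff_label hf integrable_bump)
  have h1 : IntegrableOn (fun _ : ℝ => (1:ℝ)) (Ioc 0 T) := integrableOn_const (by simp)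
  have := h1.integrable_indicator measurableSet_Ioc
  rwa [← Ioi_inter_Iic, ← indicator_indicator, integrable_indicator_iff measurableSet_Ioi] at this

namespace Labels

/-- Dominating density for the particle integrands. -/
def dom (A u : ℝ → ℝ) (M Λ s : ℝ) : ℝ :=
  M * (3 * (A s * u s ^ 2) + (2 + 24 * Λ ^ 2 + 2 * (24 * Λ ^ 2) ^ 2 + 72 * Λ ^ 3) * A s)

lemma integrableOn_dom (h : Labels γ A u ℓ) (M Λ R : ℝ) : IntegrableOn (dom A u M Λ) (Ioc 0 R) :=
  (((h.integrable_energy R).const_mul 3).add ((h.integrable R).const_mul _)).const_mul M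

lemma abs_vel_le (h : Labels γ A u ℓ) {t s y Λ : ℝ} (ht : 0 < t) (hs : 0 < s) (hy : y ∈ Icc (1:ℝ) 2) (hΛ : ℓ s ≤ Λ) :
    |vel u ℓ t s y| ≤ |u s| + 24 * Λ ^ 2 ∧ |acc u ℓ t s y| ≤ 2 * |u s| * (rate u ℓ s * cut (t * rate u ℓ s)) + 72 * Λ ^ 3 := by
  have hl := h.one_le s hs
  have hyy : |y| ≤ 2 := by rw [abs_le]; exact ⟨by linarith [hy.1], hy.2⟩
  have h1 : |widVel ℓ t s| ≤ 12 * Λ ^ 2 := (h.abs_widVel_le hs ht.le).trans (by gcongr)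
  have h2 : |widAcc ℓ t s| ≤ 36 * Λ ^ 3 := (h.abs_widAcc_le hs ht.le).trans (by gcongr)
  constructor
  · refine (abs_add_le _ _).trans ?_
    rw [abs_mul]
    have : |widVel ℓ t s| * |y| ≤ 12 * Λ ^ 2 * 2 := by gcongr
    linarith [h.abs_ctrVel_le hs ht.le]
  · refine (abs_add_le _ _).trans ?_
    rw [abs_mul]
    have h3 : |widAcc ℓ t s| * |y| ≤ 36 * Λ ^ 3 * 2 := by
      have : 0 ≤ Λ := by linarith
      gcongr
    have h4 : |ctrAcc u ℓ t s| = 2 * |u s| * (rate u ℓ s * cut (t * rate u ℓ s)) := by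
      unfold ctrAcc
      rw [abs_mul, abs_mul, abs_mul, abs_of_pos (h.rate_pos hs), abs_of_nonneg (cut_nonneg _), abs_neg]
      norm_num
    linarith

lemma measurable_path (h : Labels γ A u ℓ) {f : ℝ × ℝ → ℝ} (hf : Continuous f) :
    Measurable fun q : ℝ × ℝ × ℝ => f (q.1, pos u ℓ q.1 q.2.1 q.2.2) :=
  hf.measurable.comp (measurable_fst.prodMk h.measurable_pos)

lemma integral_initial (f : ℝ → ℝ) : ∫ o : ℝ × ℝ, f o.1 * bump o.2 ∂labelMeasure = ∫ s in Ioi 0, f s := by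
  rw [integral_prod_mul f bump, integral_bump, mul_one]

lemma mass (h : Labels γ A u ℓ) {φ : ℝ × ℝ → ℝ} (hφ : ContDiff ℝ 3 φ) (hc : HasCompactSupport φ) :
    IntegrableOn (fun t => ∫ r in Ioi 0, (field u ℓ A (fun _ _ _ => 1) (t, r) * dt φ (t, r)
      + field u ℓ A (vel u ℓ) (t, r) * dr φ (t, r))) (Ioi 0) ∧
    (∫ t in Ioi 0, ∫ r in Ioi 0, (field u ℓ A (fun _ _ _ => 1) (t, r) * dt φ (t, r)
      + field u ℓ A (vel u ℓ) (t, r) * dr φ (t, r))) = -∫ s in Ioi 0, A s * φ (0, s) := by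
  obtain ⟨M, R, hM⟩ := exists_testBounds hφ hc
  obtain ⟨T, hT0, hT⟩ := exists_time_bound hc
  obtain ⟨Λ, hΛ⟩ := h.bdd (2 * R)
  have hφ1 : ContDiff ℝ 1 φ := hφ.of_le (by norm_num)
  have hφ2 : ContDiff ℝ 2 φ := hφ.of_le (by norm_num)
  have ct := (contDiff_dt hφ2).continuous
  have cr := (contDiff_dr hφ2).continuous
  have hM0 := hM.nonneg
  set K : ℝ → ℝ × ℝ → ℝ := fun t o => A o.1 * bump o.2 *
    (dt φ (t, pos u ℓ t o.1 o.2) + vel u ℓ t o.1 o.2 * dr φ (t, pos u ℓ t o.1 o.2)) with hK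
  have hS : ∀ t ∈ Ioi (0:ℝ), ∫ o, K t o ∂labelMeasure = ∫ r in Ioi 0, (field u ℓ A (fun _ _ _ => 1) (t, r) * dt φ (t, r)
      + field u ℓ A (vel u ℓ) (t, r) * dr φ (t, r)) := fun t ht => by
    obtain ⟨i1, j1, e1⟩ := h.slice weight_one (χ := fun r => dt φ (t, r)) (by fun_prop) (fun r => hM.le_dt _)
      (fun r hr => (hM.zero (t, r) hr).2.1) ht
    obtain ⟨i2, j2, e2⟩ := h.slice h.weight_vel (χ := fun r => dr φ (t, r)) (by fun_prop) (fun r => hM.le_dr _)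
      (fun r hr => (hM.zero (t, r) hr).2.2) ht
    rw [integral_add i1 i2, e1, e2, ← integral_add j1 j2]
    refine integral_congr_ae (Eventually.of_forall fun o => ?_)
    simp only [hK]; ring
  have hInt : Integrable (uncurry K) ((volume.restrict (Ioi 0)).prod labelMeasure) := by
    refine (integrable_time_label (T := T) (h.integrableOn_dom M Λ (2 * R))).mono' ?_ (ae_time_label fun t s y ht hs => ?_)
    · have m1 := h.measurable_path ct
      have m2 := h.measurable_path cr
      have m3 := h.measurable_vel
      exact (((h.measurable_A.comp measurable_snd.fst).mul (measurable_bump.comp measurable_snd.snd)).mul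
        (m1.add (m3.mul m2))).aestronglyMeasurable
    · have hA0 := h.nonneg s
      have hd : s ≤ 2 * R → 0 ≤ dom A u M Λ s := fun hsR => by
        have : 1 ≤ Λ := (h.one_le s hs).trans (hΛ s hs hsR)
        unfold dom
        positivity
      have hnn : 0 ≤ (Iic T).indicator (fun _ => (1:ℝ)) t * ((Iic (2 * R)).indicator (dom A u M Λ) s * bump y) := by
        refine mul_nonneg (indicator_nonneg (fun _ _ => zero_le_one) t) (mul_nonneg ?_ (bump_nonneg y))
        exact indicator_apply_nonneg hd
      simp only [uncurry, hK]
      by_cases hb : bump y = 0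
      · simp [hb]
      have hy := mem_Icc_of_bump_ne_zero hb
      rcases le_or_gt t T with htT | htT
      swap
      · have := hT (t, pos u ℓ t s y) htT.le
        rw [this.2.1, this.2.2]
        simpa using hnn
      rcases le_or_gt s (2 * R) with hsR | hsR
      swap
      · have := hM.zero (t, pos u ℓ t s y) (by dsimp only; linarith [(h.half_le_pos hs ht.le hy).1])
        rw [this.2.1, this.2.2]
        simpa using hnn
      rw [indicator_of_mem (mem_Iic.2 htT), indicator_of_mem (mem_Iic.2 hsR), one_mul, norm_mul, norm_mul,
        norm_of_nonneg hA0, norm_of_nonneg (bump_nonneg y)]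
      have hv := (h.abs_vel_le ht hs hy (hΛ s hs hsR)).1
      have hΛ1 : 1 ≤ Λ := (h.one_le s hs).trans (hΛ s hs hsR)
      have hu : |u s| ≤ 1 + u s ^ 2 := by nlinarith [sq_abs (u s), sq_nonneg (|u s| - 1), abs_nonneg (u s)]
      have h1 : ‖dt φ (t, pos u ℓ t s y) + vel u ℓ t s y * dr φ (t, pos u ℓ t s y)‖
          ≤ M + (1 + u s ^ 2 + 24 * Λ ^ 2) * M := by
        refine (norm_add_le _ _).trans (add_le_add (hM.le_dt _) ?_)
        rw [norm_mul]
        exact mul_le_mul (by rw [norm_eq_abs]; linarith) (hM.le_dr _) (norm_nonneg _) (by positivity)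
      have h2 : M + (1 + u s ^ 2 + 24 * Λ ^ 2) * M ≤
          M * (3 * u s ^ 2 + (2 + 24 * Λ ^ 2 + 2 * (24 * Λ ^ 2) ^ 2 + 72 * Λ ^ 3)) := by
        have : 0 ≤ M * (2 * u s ^ 2 + 2 * (24 * Λ ^ 2) ^ 2 + 72 * Λ ^ 3) := by positivity
        linarith
      calc _ ≤ A s * bump y * (M * (3 * u s ^ 2 + (2 + 24 * Λ ^ 2 + 2 * (24 * Λ ^ 2) ^ 2 + 72 * Λ ^ 3))) := by
            have := bump_nonneg y
            gcongr
            exact h1.trans h2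
        _ = _ := by unfold dom; ring
  have hpart := particle_integral (Y := fun t o => A o.1 * bump o.2 * φ (t, pos u ℓ t o.1 o.2))
    (l := fun o => A o.1 * φ (0, o.1) * bump o.2) hInt ?_ ?_ ?_
  · refine ⟨hpart.1.congr_fun hS measurableSet_Ioi, ?_⟩
    rw [← setIntegral_congr_fun measurableSet_Ioi hS, hpart.2, integral_initial fun s => A s * φ (0, s)]
  · exact ae_labelMeasure fun s y hs t _ =>
      (hasDerivAt_comp_path hφ1 (hasDerivAt_pos h hs)).const_mul (A s * bump y)
  · refine ae_labelMeasure fun s y hs => ?_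
    have := ((hasDerivAt_comp_path hφ1 (hasDerivAt_pos h hs (y := y) (t := 0))).const_mul
      (A s * bump y)).continuousAt.tendsto
    simp only [pos_zero] at this
    have e : A s * φ (0, s) * bump y = A s * bump y * φ (0, s) := by ring
    rw [e]
    exact this.mono_left nhdsWithin_le_nhds
  · refine Eventually.of_forall fun o => ?_
    filter_upwards [eventually_ge_atTop T] with t ht
    rw [(hT _ ht).1, mul_zero]

lemma mom (h : Labels γ A u ℓ) {φ : ℝ × ℝ → ℝ} (hφ : ContDiff ℝ 3 φ) (hc : HasCompactSupport φ) :
    IntegrableOn (fun t => ∫ r in Ioi 0, (field u ℓ A (vel u ℓ) (t, r) * dt φ (t, r)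
      + field u ℓ A (fun t s y => vel u ℓ t s y ^ 2) (t, r) * dr φ (t, r)
      + field u ℓ A (acc u ℓ) (t, r) * φ (t, r))) (Ioi 0) ∧
    (∫ t in Ioi 0, ∫ r in Ioi 0, (field u ℓ A (vel u ℓ) (t, r) * dt φ (t, r)
      + field u ℓ A (fun t s y => vel u ℓ t s y ^ 2) (t, r) * dr φ (t, r)
      + field u ℓ A (acc u ℓ) (t, r) * φ (t, r))) = -∫ s in Ioi 0, A s * u s * φ (0, s) := by
  obtain ⟨M, R, hM⟩ := exists_testBounds hφ hc
  obtain ⟨T, hT0, hT⟩ := exists_time_bound hc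
  obtain ⟨Λ, hΛ⟩ := h.bdd (2 * R)
  have hφ1 : ContDiff ℝ 1 φ := hφ.of_le (by norm_num)
  have hφ2 : ContDiff ℝ 2 φ := hφ.of_le (by norm_num)
  have c0 := hφ.continuous
  have ct := (contDiff_dt hφ2).continuous
  have cr := (contDiff_dr hφ2).continuous
  have hM0 := hM.nonneg
  set K : ℝ → ℝ × ℝ → ℝ := fun t o => A o.1 * bump o.2 *
    (acc u ℓ t o.1 o.2 * φ (t, pos u ℓ t o.1 o.2) + vel u ℓ t o.1 o.2 *
      (dt φ (t, pos u ℓ t o.1 o.2) + vel u ℓ t o.1 o.2 * dr φ (t, pos u ℓ t o.1 o.2))) with hK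
  have hS : ∀ t ∈ Ioi (0:ℝ), ∫ o, K t o ∂labelMeasure = ∫ r in Ioi 0, (field u ℓ A (vel u ℓ) (t, r) * dt φ (t, r)
      + field u ℓ A (fun t s y => vel u ℓ t s y ^ 2) (t, r) * dr φ (t, r)
      + field u ℓ A (acc u ℓ) (t, r) * φ (t, r)) := fun t ht => by
    obtain ⟨i1, j1, e1⟩ := h.slice h.weight_vel (χ := fun r => dt φ (t, r)) (by fun_prop) (fun r => hM.le_dt _)
      (fun r hr => (hM.zero (t, r) hr).2.1) ht
    obtain ⟨i2, j2, e2⟩ := h.slice h.weight_vel_sq (χ := fun r => dr φ (t, r)) (by fun_prop) (fun r => hM.le_dr _)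
      (fun r hr => (hM.zero (t, r) hr).2.2) ht
    obtain ⟨i3, j3, e3⟩ := h.slice h.weight_acc (χ := fun r => φ (t, r)) (by fun_prop) (fun r => hM.le _)
      (fun r hr => (hM.zero (t, r) hr).1) ht
    have s1 := integral_add (i1.add i2) i3
    have s2 := integral_add (j1.add j2) j3
    simp only [Pi.add_apply] at s1 s2
    rw [s1, integral_add i1 i2, e1, e2, e3, ← integral_add j1 j2, ← s2]
    refine integral_congr_ae (Eventually.of_forall fun o => ?_)
    simp only [hK]; ring
  have hInt : Integrable (uncurry K) ((volume.restrict (Ioi 0)).prod labelMeasure) := by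
    have hAu : IntegrableOn (fun s => A s * |u s|) (Ioc 0 (2 * R)) := by
      refine ((h.integrable (2 * R)).add (h.integrable_energy (2 * R))).mono'
        (h.measurable_A.mul h.measurable_u.norm).aestronglyMeasurable (Eventually.of_forall fun s => ?_)
      have hA0 := h.nonneg s
      have hu : |u s| ≤ 1 + u s ^ 2 := by nlinarith [sq_abs (u s), sq_nonneg (|u s| - 1), abs_nonneg (u s)]
      rw [norm_mul, norm_of_nonneg hA0, norm_abs_eq_norm, norm_eq_abs, Pi.add_apply]
      nlinarith
    have hcut := (integrable_cut_kernel (integrable_cutoff_label hAu integrable_bump)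
      (((h.measurable_A.mul h.measurable_u.norm).indicator measurableSet_Iic |>.comp measurable_fst).mul
        (measurable_bump.comp measurable_snd)) (h.measurable_rate.comp measurable_fst)
      fun s y hs => h.rate_pos hs).const_mul (2 * M)
    refine ((integrable_time_label (T := T) (h.integrableOn_dom M Λ (2 * R))).add hcut).mono' ?_
      (ae_time_label fun t s y ht hs => ?_)
    · have m0 := h.measurable_path c0
      have m1 := h.measurable_path ct
      have m2 := h.measurable_path cr
      have m3 := h.measurable_vel
      have m4 := h.measurable_acc
      exact (((h.measurable_A.comp measurable_snd.fst).mul (measurable_bump.comp measurable_snd.snd)).mul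
        ((m4.mul m0).add (m3.mul (m1.add (m3.mul m2))))).aestronglyMeasurable
    · have hA0 := h.nonneg s
      have hb0 := bump_nonneg y
      have hr0 := (h.rate_pos hs).le
      have hd : s ≤ 2 * R → 0 ≤ dom A u M Λ s := fun hsR => by
        have : 1 ≤ Λ := (h.one_le s hs).trans (hΛ s hs hsR)
        unfold dom
        positivity
      simp only [uncurry, hK, Pi.add_apply, comp_apply]
      have hnn : 0 ≤ (Iic T).indicator (fun _ => (1:ℝ)) t * ((Iic (2 * R)).indicator (dom A u M Λ) s * bump y)
          + 2 * M * ((Iic (2 * R)).indicator (fun s => A s * |u s|) s * bump y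
            * (rate u ℓ s * cut (t * rate u ℓ s))) := by
        have g1 : 0 ≤ (Iic T).indicator (fun _ => (1:ℝ)) t := indicator_nonneg (fun _ _ => zero_le_one) t
        have g2 : 0 ≤ (Iic (2 * R)).indicator (dom A u M Λ) s := indicator_apply_nonneg hd
        have g3 : 0 ≤ (Iic (2 * R)).indicator (fun s => A s * |u s|) s :=
          indicator_nonneg (fun s _ => mul_nonneg (h.nonneg s) (abs_nonneg _)) s
        have g4 := cut_nonneg (t * rate u ℓ s)
        positivity
      by_cases hb : bump y = 0
      · simp [hb]
      have hy := mem_Icc_of_bump_ne_zero hb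
      rcases le_or_gt t T with htT | htT
      swap
      · have := hT (t, pos u ℓ t s y) htT.le
        rw [this.1, this.2.1, this.2.2]
        simpa using hnn
      rcases le_or_gt s (2 * R) with hsR | hsR
      swap
      · have := hM.zero (t, pos u ℓ t s y) (by dsimp only; linarith [(h.half_le_pos hs ht.le hy).1])
        rw [this.1, this.2.1, this.2.2]
        simpa using hnn
      rw [indicator_of_mem (mem_Iic.2 htT), indicator_of_mem (mem_Iic.2 hsR), indicator_of_mem (mem_Iic.2 hsR),
        one_mul, norm_mul, norm_mul, norm_of_nonneg hA0, norm_of_nonneg hb0]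
      obtain ⟨hv, hw⟩ := h.abs_vel_le ht hs hy (hΛ s hs hsR)
      have hΛ1 : 1 ≤ Λ := (h.one_le s hs).trans (hΛ s hs hsR)
      have hu : |u s| ≤ 1 + u s ^ 2 := by nlinarith [sq_abs (u s), sq_nonneg (|u s| - 1), abs_nonneg (u s)]
      have hv2 : |vel u ℓ t s y| ^ 2 ≤ 2 * u s ^ 2 + 2 * (24 * Λ ^ 2) ^ 2 := by
        calc |vel u ℓ t s y| ^ 2 ≤ (|u s| + 24 * Λ ^ 2) ^ 2 := by gcongr
          _ ≤ _ := by nlinarith [sq_abs (u s), sq_nonneg (|u s| - 24 * Λ ^ 2)]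
      set c := rate u ℓ s * cut (t * rate u ℓ s)
      set V := vel u ℓ t s y
      set W := acc u ℓ t s y
      set x := (t, pos u ℓ t s y)
      have h1 : ‖W * φ x + V * (dt φ x + V * dr φ x)‖
          ≤ M * (3 * u s ^ 2 + (2 + 24 * Λ ^ 2 + 2 * (24 * Λ ^ 2) ^ 2 + 72 * Λ ^ 3)) + 2 * M * (|u s| * c) := by
        have b0 := hM.le x
        have b1 := hM.le_dt x
        have b2 := hM.le_dr x
        calc ‖W * φ x + V * (dt φ x + V * dr φ x)‖ ≤ |W| * M + |V| * (M + |V| * M) := by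
              refine (norm_add_le _ _).trans (add_le_add ?_ ?_)
              · rw [norm_mul]
                exact mul_le_mul_of_nonneg_left b0 (norm_nonneg _)
              · rw [norm_mul]
                refine mul_le_mul_of_nonneg_left ((norm_add_le _ _).trans (add_le_add b1 ?_)) (norm_nonneg _)
                rw [norm_mul]
                exact mul_le_mul_of_nonneg_left b2 (norm_nonneg _)
          _ = M * (|W| + |V| + |V| ^ 2) := by ring
          _ ≤ M * ((2 * |u s| * c + 72 * Λ ^ 3) + (1 + u s ^ 2 + 24 * Λ ^ 2) + (2 * u s ^ 2 + 2 * (24 * Λ ^ 2) ^ 2)) := by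
              gcongr
              linarith
          _ ≤ _ := by linarith
      calc _ ≤ A s * bump y * (M * (3 * u s ^ 2 + (2 + 24 * Λ ^ 2 + 2 * (24 * Λ ^ 2) ^ 2 + 72 * Λ ^ 3))
              + 2 * M * (|u s| * c)) := by gcongr
        _ = _ := by unfold dom; ring
  have hpart := particle_integral (Y := fun t o => A o.1 * bump o.2 * (vel u ℓ t o.1 o.2 * φ (t, pos u ℓ t o.1 o.2)))
    (l := fun o => A o.1 * u o.1 * φ (0, o.1) * bump o.2) hInt ?_ ?_ ?_
  · refine ⟨hpart.1.congr_fun hS measurableSet_Ioi, ?_⟩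
    rw [← setIntegral_congr_fun measurableSet_Ioi hS, hpart.2, integral_initial fun s => A s * u s * φ (0, s)]
  · exact ae_labelMeasure fun s y hs t _ =>
      (hasDerivAt_vel.mul (hasDerivAt_comp_path hφ1 (hasDerivAt_pos h hs))).const_mul (A s * bump y)
  · refine ae_labelMeasure fun s y hs => ?_
    have := (((hasDerivAt_vel (u := u) (ℓ := ℓ) (s := s) (y := y) (t := 0)).mul (hasDerivAt_comp_path hφ1 (hasDerivAt_pos h hs (y := y) (t := 0)))).const_mul
      (A s * bump y)).continuousAt.tendsto
    simp only [Pi.mul_apply, pos_zero, vel_zero] at this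
    have e : A s * u s * φ (0, s) * bump y = A s * bump y * (u s * φ (0, s)) := by ring
    rw [e]
    exact this.mono_left nhdsWithin_le_nhds
  · refine Eventually.of_forall fun o => ?_
    filter_upwards [eventually_ge_atTop T] with t ht
    rw [(hT _ ht).1, mul_zero, mul_zero]

end Labels

end Weak

section Inner

variable {γ e : ℝ} {A u ℓ : ℝ → ℝ} {t r : ℝ}

lemma inv_min_rpow_le (ht : 0 < t) {x : ℝ} {k : ℕ} (hx : x ≤ k) : (min t 1)⁻¹ ^ x ≤ (t⁻¹) ^ k + 1 := by
  have h0 : 0 < (t⁻¹) ^ k := by positivity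
  calc (min t 1)⁻¹ ^ x ≤ (min t 1)⁻¹ ^ (k:ℝ) := rpow_le_rpow_of_exponent_le (one_le_inv_min ht) hx
    _ = (min t 1)⁻¹ ^ k := rpow_natCast _ _
    _ ≤ _ := by
      rcases le_total t 1 with h | h
      · rw [min_eq_left h]; linarith
      · rw [min_eq_right h, inv_one, one_pow]; linarith

lemma Labels.field_decay_le (h : Labels γ A u ℓ) (hγ : 1 < γ) (he : 0 < e) {G : ℝ → ℝ → ℝ → ℝ} {C : ℝ} {p k : ℕ}
    (hG : Weight G C p) (hv : ∀ t s y, 0 < t → 0 < s → 1 ≤ t * ℓ s → G t s y = 0) (hk : p + 5 + e ≤ k)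
    (ht : 0 < t) (hr : 0 < r) :
    |field u ℓ A G (t, r)| ≤ 2 * C * 5 ^ (2 + e) * ((t⁻¹) ^ k + 1) * (1 + r) ^ (-(2 + e)) := by
  have hτ := one_le_inv_min ht
  have hτ0 : 0 < (min t 1)⁻¹ := one_pos.trans_le hτ
  have hC := hG.const_nonneg
  refine (h.field_decay hγ hG hv (by linarith : 0 ≤ 2 + e) ht hr).trans ?_
  have e1 : (min t 1)⁻¹ ^ (p + 3) * (min t 1)⁻¹ ^ (2 + e) = (min t 1)⁻¹ ^ ((p:ℝ) + 5 + e) := by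
    rw [← rpow_natCast, ← rpow_add hτ0]; congr 1; push_cast; ring
  calc _ = 2 * C * 5 ^ (2 + e) * ((min t 1)⁻¹ ^ (p + 3) * (min t 1)⁻¹ ^ (2 + e)) * (1 + r) ^ (-(2 + e)) := by
        rw [mul_rpow (by norm_num) hτ0.le]; ring
    _ ≤ _ := by
        rw [e1]
        gcongr
        exact inv_min_rpow_le ht hk

/-- The cloud of particles issuing from the initial data. -/
lemma Labels.exists_cloud (h : Labels γ A u ℓ) (hγ : 1 < γ) (he : 0 < e) : ∃ (C : ℝ) (k : ℕ), 0 ≤ C ∧ 2 ≤ k ∧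
    Cloud γ e (fun t => C * ((t⁻¹) ^ k + 1)) (field u ℓ A fun _ _ _ => 1) (field u ℓ A (vel u ℓ))
      (field u ℓ A fun t s y => vel u ℓ t s y ^ 2) (field u ℓ A (acc u ℓ)) A (fun s => A s * u s) ∧
    ∀ t r, 0 < t → 0 < r → |field u ℓ A (acc u ℓ) (t, r)| ≤ C * ((t⁻¹) ^ k + 1) * (1 + r) ^ (-(2 + e)) := by
  obtain ⟨k, hk⟩ := exists_nat_ge (9 + 2 * e + 4 * γ)
  set C : ℝ := 2 * 625 * 5 ^ (2 + e) + 16 + 2 ^ (1 + e) * 16 ^ γ with hC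
  have c1 : (0:ℝ) < 5 ^ (2 + e) := by positivity
  have c2 : (0:ℝ) < 2 ^ (1 + e) * 16 ^ γ := by positivity
  have hP : ∀ t : ℝ, 0 < t → 0 < (t⁻¹) ^ k + 1 := fun t ht => by positivity
  have hacc : ∀ t r, 0 < t → 0 < r →
      |field u ℓ A (acc u ℓ) (t, r)| ≤ C * ((t⁻¹) ^ k + 1) * (1 + r) ^ (-(2 + e)) := fun t r ht hr => by
    have := hP t ht
    refine (h.field_decay_le hγ he h.weight_acc (fun t s y ht hs hf => (frozen hs ht.le hf).2.2)
      (k := k) (by push_cast; linarith) ht hr).trans ?_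
    gcongr
    linarith
  refine ⟨C, k, by positivity, by exact_mod_cast (by linarith : (2:ℝ) ≤ k),
    ⟨h.continuousOn_field weight_one, h.continuousOn_field h.weight_vel, h.continuousOn_field h.weight_vel_sq,
      h.continuousOn_field h.weight_acc, fun t r ht hr => h.density_nonneg ht, fun t r ht hr => ?_,
      fun t r ht hr => h.sq_field_vel_le ht r, ⟨fun t => C * ((t⁻¹) ^ k + 1), ?_, fun t r ht hr =>
      ⟨?_, ?_, hacc t r ht hr⟩⟩, fun t r ht hr => ?_, fun φ hφ hc => h.mass hφ hc, fun φ hφ hc => h.mom hφ hc⟩, hacc⟩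
  · refine setIntegral_nonneg measurableSet_Ioi fun s hs => ?_
    have hw := h.wid_pos hs ht
    exact mul_nonneg (mul_nonneg (h.nonneg s) (div_nonneg (bump_nonneg _) hw.le)) (sq_nonneg _)
  · exact continuousOn_const.mul (((continuousOn_inv₀.mono fun t ht => ne_of_gt ht).pow k).add continuousOn_const)
  · have := hP t ht
    have h1 := inv_min_rpow_le ht (x := (4:ℕ)) (k := k) (by push_cast; linarith)
    rw [rpow_natCast] at h1
    have h2 : (1 + r) ^ (-(1 / γ)) ≤ 1 := rpow_le_one_of_one_le_of_nonpos (by linarith)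
      (neg_nonpos.2 (by positivity))
    calc _ ≤ _ := h.density_le hγ ht hr
      _ ≤ 16 * ((t⁻¹) ^ k + 1) * 1 := by gcongr
      _ ≤ C * ((t⁻¹) ^ k + 1) := by rw [mul_one]; gcongr; linarith
  · have := hP t ht
    refine (le_abs_self _).trans ((h.field_decay_le hγ he h.weight_vel_sq (fun t s y ht hs hf => by
      rw [(frozen hs ht.le hf).2.1]; norm_num) (k := k) (by push_cast; linarith) ht hr).trans ?_)
    beta_reduce
    have h1 : (1 + r) ^ (-(2 + e)) ≤ (1 + r) ^ (-(1 + e)) :=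
      rpow_le_rpow_of_exponent_le (by linarith) (by linarith)
    gcongr
    linarith
  · have := hP t ht
    refine (h.pressure_le hγ he ht hr).trans ?_
    have h1 := inv_min_rpow_le ht (x := 2 + 2 * e + 4 * γ) (k := k) (by linarith)
    gcongr
    linarith

end Inner

/-- Every labelled family of particles extends to a subsolution. -/
lemma Labels.exists_baseSubsolution {κ γ : ℝ} {n : ℕ} {A u ℓ ρ₀ m₀ : ℝ → ℝ} (h : Labels γ A u ℓ) (hκ : 0 < κ)
    (hγ : 1 < γ) (hn : 2 ≤ n) (hA : ∀ᵐ r ∂volume.restrict (Ioi 0), A r = ρ₀ r * r ^ (n - 1))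
    (hD : ∀ᵐ r ∂volume.restrict (Ioi 0), A r * u r = m₀ r * r ^ (n - 1)) :
    ∃ z₀, BaseSubsolution κ γ n ρ₀ m₀ z₀ := by
  have hn' : (2:ℝ) ≤ n := by exact_mod_cast hn
  obtain ⟨e, he⟩ : ∃ e : ℝ, e = (n - 1) * (γ - 1) := ⟨_, rfl⟩
  have he0 : 0 < e := by rw [he]; exact mul_pos (by linarith) (by linarith)
  obtain ⟨C, k, hC, hk, hin, hacc⟩ := h.exists_cloud hγ he0
  have hcrit := two_le_critMoment hγ
  have hPC := profConst_pos (n := n) he0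
  set Q : ℝ := (2 * (n - 1) + critMoment γ) * κ * 2 ^ γ with hQ
  have hQ0 : 0 < Q := by
    have : 0 < 2 * ((n:ℝ) - 1) + critMoment γ := by linarith
    positivity
  set c : ℝ := Q * (C + profConst n e ^ γ) + C + 1 with hc
  have hc1 : 1 ≤ c := by
    have : 0 < profConst n e ^ γ := by positivity
    have : 0 ≤ Q * (C + profConst n e ^ γ) := by positivity
    linarith
  obtain ⟨L, L', L'', C', hL, hL''⟩ := exists_scale hc1 hk
  have hout := hL.cloud hγ he hn
  refine ⟨_, (hin.add hout hγ he0).baseSubsolution ?_ hκ hγ hn he ?_ ?_ hA hD⟩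
  · exact continuousOn_const.mul ((continuousOn_const.mul (((continuousOn_inv₀.mono fun t ht => ne_of_gt ht).pow k).add
      continuousOn_const)).add continuousOn_const)
  · intro t r ht hr
    have hLt := one_pos.trans_le (hL.one_le t ht)
    refine add_pos_of_nonneg_of_pos (h.density_nonneg ht) ?_
    have := prof_pos (n := n) he0 (div_pos hr hLt)
    simp only [packet]
    positivity
  · intro t r ht hr
    obtain ⟨B, -, hB⟩ := hout.bound
    have i1 := (integrableOn_slice_of_decay hin.cont_w he0 hacc ht).mono_set (Ioi_subset_Ioi hr.le)
    have i2 := (integrableOn_slice_of_decay hout.cont_w he0 (fun t r ht hr => (hB t r ht hr).2.2) ht).mono_set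
      (Ioi_subset_Ioi hr.le)
    have htail : tail (field u ℓ A (acc u ℓ) + packet n e L 1 L'') (t, r) =
        tail (field u ℓ A (acc u ℓ)) (t, r) + L'' t * profTail n e (r / L t) := by
      rw [← hL.tail_packet he0 hn hL.cont ht hr]
      exact integral_add i1 i2
    have h1 := abs_tail_le he0 hacc ht hr
    have h2 := neg_le_of_abs_le h1
    set P := (t⁻¹) ^ k + 1 with hP
    set d := (1 + r) ^ (-(1 + e)) with hd
    have hP1 : 1 ≤ P := by have : 0 < (t⁻¹) ^ k := by positivity
                           linarith
    have hd0 : 0 < d := by positivity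
    have hLt := hL.one_le t ht
    have hx : 0 < r / L t := by positivity
    have h3 : d ≤ profTail n e (r / L t) := by
      refine le_trans ?_ (le_profTail he0 hx)
      refine rpow_le_rpow_of_nonpos (by positivity) ?_ (by linarith)
      have := div_le_self hr.le hLt
      linarith
    have h4 : c * P * d ≤ L'' t * profTail n e (r / L t) :=
      mul_le_mul (hL'' t ht) h3 hd0.le (by have := hL'' t ht; nlinarith)
    have h5 : (2 * (n - 1) + critMoment γ) * κ * (2 ^ γ * (C * P + profConst n e ^ γ)) * d
        ≤ Q * (C + profConst n e ^ γ) * P * d := by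
      have : profConst n e ^ γ ≤ profConst n e ^ γ * P := le_mul_of_one_le_right (by positivity) hP1
      calc _ = Q * (C * P + profConst n e ^ γ) * d := by rw [hQ]; ring
        _ ≤ Q * (C * P + profConst n e ^ γ * P) * d := by gcongr
        _ = _ := by ring
    rw [htail]
    have h6 : 0 < P * d := by positivity
    have h7 : c * P * d = Q * (C + profConst n e ^ γ) * P * d + C * P * d + P * d := by rw [hc]; ring
    linarith

section Data

variable {γ : ℝ} {A u : ℝ → ℝ}

/-- Every mass distribution with locally finite mass and energy can be labelled. -/
lemma exists_labels (hγ : 1 < γ) (hAm : Measurable A) (hum : Measurable u) (hA : ∀ s, 0 ≤ A s)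
    (hi : ∀ R, IntegrableOn A (Ioc 0 R)) (hE : ∀ R, IntegrableOn (fun s => A s * u s ^ 2) (Ioc 0 R)) :
    ∃ ℓ, Labels γ A u ℓ := by
  set ψ : ℝ → ℝ := fun s => ∫ x in Ioc 0 s, A x with hψ
  have hψ0 : ∀ s, 0 ≤ ψ s := fun s => setIntegral_nonneg measurableSet_Ioc fun x _ => hA x
  have hγ0 : 0 < γ / (γ - 1) := div_pos (by linarith) (by linarith)
  have hmono : Monotone fun s => 1 + s + ψ s ^ (γ / (γ - 1)) := fun s s' hs => by
    have : ψ s ≤ ψ s' := setIntegral_mono_set (hi s') (Eventually.of_forall hA) (Ioc_subset_Ioc_right hs).eventuallyLE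
    have := rpow_le_rpow (hψ0 s) this hγ0.le
    dsimp only
    linarith
  have hp : ∀ s, 0 ≤ ψ s ^ (γ / (γ - 1)) := fun s => rpow_nonneg (hψ0 s) _
  refine ⟨_, hAm, hum, hmono.measurable, hA, fun s hs => by linarith [hp s], fun s hs => by linarith [hp s],
    fun R => ⟨_, fun s _ hs => hmono hs⟩, hi, hE, fun x hx => ?_⟩
  have hc : ContinuousOn ψ (Icc 0 x) :=
    intervalIntegral.continuousOn_primitive ((integrableOn_Icc_iff_integrableOn_Ioc (by simp)).2 (hi x))
  have hK : IsCompact (Icc 0 x ∩ ψ ⁻¹' Iic (x ^ ((γ - 1) / γ))) :=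
    isCompact_Icc.of_isClosed_subset (hc.preimage_isClosed_of_isClosed isClosed_Icc isClosed_Iic) inter_subset_left
  have hne : (Icc 0 x ∩ ψ ⁻¹' Iic (x ^ ((γ - 1) / γ))).Nonempty :=
    ⟨0, ⟨le_rfl, by linarith⟩, by simp [hψ]; positivity⟩
  obtain ⟨s', hs', hmax⟩ := hK.exists_isGreatest hne
  have hsub : {s | 0 < s ∧ 1 + s + ψ s ^ (γ / (γ - 1)) ≤ x} ⊆ Ioc 0 s' := fun s hs => by
    refine ⟨hs.1, hmax ⟨⟨hs.1.le, ?_⟩, ?_⟩⟩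
    · linarith [hp s, hs.2]
    · have h1 : ψ s ^ (γ / (γ - 1)) ≤ x := by linarith [hs.1, hs.2]
      have h2 := rpow_le_rpow (hp s) h1 (z := (γ - 1) / γ) (div_nonneg (by linarith) (by linarith))
      rwa [← rpow_mul (hψ0 s), div_mul_div_cancel₀' (by linarith : γ ≠ 0), div_self (by linarith), rpow_one] at h2
  exact (setIntegral_mono_set (hi s') (Eventually.of_forall hA) hsub.eventuallyLE).trans hs'.2

lemma exists_labels_of_energy {κ : ℝ} {n : ℕ} {ρ₀ m₀ u₀ : ℝ → ℝ} (hγ : 1 < γ) (hκ : 0 < κ)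
    (hρ₀ : ∀ r, 0 ≤ ρ₀ r) (hm₀ : ∀ r, m₀ r = ρ₀ r * u₀ r) (hρ₀_loc : LocallyIntegrableOn ρ₀ (Ioi 0))
    (hm₀_loc : LocallyIntegrableOn m₀ (Ioi 0))
    (hE₀ : IntegrableOn (fun r => (1 / 2 * m₀ r ^ 2 / ρ₀ r + κ * ρ₀ r ^ γ / (γ - 1)) * r ^ (n - 1)) (Ioi 0)) :
    ∃ A u ℓ, Labels γ A u ℓ ∧ (∀ᵐ r ∂volume.restrict (Ioi 0), A r = ρ₀ r * r ^ (n - 1)) ∧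
      ∀ᵐ r ∂volume.restrict (Ioi 0), A r * u r = m₀ r * r ^ (n - 1) := by
  have hf := hρ₀_loc.aestronglyMeasurable
  have hg := hm₀_loc.aestronglyMeasurable
  set f := hf.mk ρ₀
  set g := hg.mk m₀
  have hfm : Measurable f := hf.stronglyMeasurable_mk.measurable
  have hgm : Measurable g := hg.stronglyMeasurable_mk.measurable
  set A : ℝ → ℝ := fun s => max (f s) 0 * |s| ^ (n - 1)
  set u : ℝ → ℝ := fun s => g s / max (f s) 0
  have hAm : Measurable A := by simp only [A, ← norm_eq_abs]; fun_prop
  have hum : Measurable u := by fun_prop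
  have hA0 : ∀ s, 0 ≤ A s := fun s => by positivity
  have hγ1 : 0 < γ - 1 := by linarith
  have key : ∀ᵐ r ∂volume.restrict (Ioi 0), 0 < r ∧ A r = ρ₀ r * r ^ (n - 1) ∧ u r = m₀ r / ρ₀ r := by
    filter_upwards [hf.ae_eq_mk, hg.ae_eq_mk, ae_restrict_mem measurableSet_Ioi] with r h1 h2 hr
    have hr' : (0:ℝ) < r := hr
    have h3 : max (f r) 0 = ρ₀ r := by rw [show f r = ρ₀ r from h1.symm, max_eq_left (hρ₀ r)]
    exact ⟨hr', by simp only [A, h3, abs_of_pos hr'], by simp only [u, h3, show g r = m₀ r from h2.symm]⟩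
  have hEn : ∀ R : ℝ, IntegrableOn (fun r => (1 / 2 * m₀ r ^ 2 / ρ₀ r + κ * ρ₀ r ^ γ / (γ - 1)) * r ^ (n - 1)) (Ioc 0 R) :=
    fun R => hE₀.mono_set Ioc_subset_Ioi_self
  have keyR : ∀ R : ℝ, ∀ᵐ r ∂volume.restrict (Ioc 0 R), 0 < r ∧ A r = ρ₀ r * r ^ (n - 1) ∧ u r = m₀ r / ρ₀ r :=
    fun R => ae_restrict_of_ae_restrict_of_subset Ioc_subset_Ioi_self key
  have hi : ∀ R, IntegrableOn A (Ioc 0 R) := fun R => by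
    have hpow : IntegrableOn (fun r : ℝ => r ^ (n - 1)) (Ioc 0 R) :=
      (continuous_pow _).integrableOn_Icc.mono_set Ioc_subset_Icc_self
    refine Integrable.mono' (hpow.add ((hEn R).const_mul ((γ - 1) / κ))) hAm.aestronglyMeasurable
      ((keyR R).mono fun r h => ?_)
    have hr := h.1
    have hρ := hρ₀ r
    have h1 : ρ₀ r ≤ 1 + ρ₀ r ^ γ := by
      rcases le_total (ρ₀ r) 1 with h1 | h1
      · linarith [rpow_nonneg hρ γ]
      · linarith [self_le_rpow_of_one_le h1 hγ.le]
    have h2 : ρ₀ r ^ γ ≤ (γ - 1) / κ * (1 / 2 * m₀ r ^ 2 / ρ₀ r + κ * ρ₀ r ^ γ / (γ - 1)) := by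
      have : (γ - 1) / κ * (κ * ρ₀ r ^ γ / (γ - 1)) = ρ₀ r ^ γ := by field_simp
      rw [mul_add, this]
      have : 0 ≤ (γ - 1) / κ * (1 / 2 * m₀ r ^ 2 / ρ₀ r) := by positivity
      linarith
    rw [norm_of_nonneg (hA0 r), h.2.1]
    calc ρ₀ r * r ^ (n - 1) ≤ (1 + (γ - 1) / κ * (1 / 2 * m₀ r ^ 2 / ρ₀ r + κ * ρ₀ r ^ γ / (γ - 1))) * r ^ (n - 1) := by
          gcongr; linarith
      _ = _ := by simp only [Pi.add_apply]; ring
  have hE : ∀ R, IntegrableOn (fun s => A s * u s ^ 2) (Ioc 0 R) := fun R => by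
    refine Integrable.mono' ((hEn R).const_mul 2) (hAm.mul (hum.pow_const 2)).aestronglyMeasurable
      ((keyR R).mono fun r h => ?_)
    have hr := h.1
    have hρ := hρ₀ r
    rw [norm_of_nonneg (mul_nonneg (hA0 r) (sq_nonneg _)), h.2.1, h.2.2]
    have h1 : ρ₀ r * (m₀ r / ρ₀ r) ^ 2 = m₀ r ^ 2 / ρ₀ r := by
      rcases eq_or_ne (ρ₀ r) 0 with h0 | h0
      · simp [h0]
      · field_simp
    have h2 : 0 ≤ κ * ρ₀ r ^ γ / (γ - 1) := by positivity
    calc _ = m₀ r ^ 2 / ρ₀ r * r ^ (n - 1) := by rw [← h1]; ring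
      _ ≤ (m₀ r ^ 2 / ρ₀ r + 2 * (κ * ρ₀ r ^ γ / (γ - 1))) * r ^ (n - 1) := by gcongr; linarith
      _ = _ := by ring
  obtain ⟨ℓ, hℓ⟩ := exists_labels hγ hAm hum hA0 hi hE
  refine ⟨A, u, ℓ, hℓ, key.mono fun r h => h.2.1, key.mono fun r h => ?_⟩
  rw [h.2.1, h.2.2]
  rcases eq_or_ne (ρ₀ r) 0 with h0 | h0
  · simp [h0, hm₀ r]
  · field_simp

end Data

end RadialEuler

/-- existence of a finite-energy weak solution of the spherically symmetric
isentropic Euler equations for arbitrary finite-energy initial data `(ρ₀, m₀)`,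
`m₀ = ρ₀u₀`, with `p(ρ) = κρ^γ`, `κ = (γ−1)²/(4γ)`, `γ > 1`, `n ≥ 2`. -/
theorem spherically_symmetric_euler_weak_solution
    (n : ℕ) (hn : 2 ≤ n) (γ : ℝ) (hγ : 1 < γ)
    (κ : ℝ) (hκ : κ = (γ - 1) ^ (2:ℕ) / (4 * γ))
    (ρ₀ m₀ u₀ : ℝ → ℝ)
    (hρ₀_nonneg : ∀ r, 0 ≤ ρ₀ r)
    (hm₀ : ∀ r, m₀ r = ρ₀ r * u₀ r)
    (hρ₀_loc : LocallyIntegrableOn ρ₀ (Set.Ioi 0))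
    (hm₀_loc : LocallyIntegrableOn m₀ (Set.Ioi 0))
    (hE₀ : IntegrableOn
      (fun r => ((1/2) * (m₀ r) ^ (2:ℕ) / ρ₀ r + κ * (ρ₀ r) ^ γ / (γ - 1)) * r ^ (n - 1))
      (Set.Ioi 0)) :
    ∃ ρ m : ℝ → ℝ → ℝ,
      (∀ t r, 0 ≤ ρ t r) ∧
      LocallyIntegrableOn (Function.uncurry ρ) (Set.Ioi 0 ×ˢ Set.Ioi 0) ∧
      LocallyIntegrableOn (Function.uncurry m) (Set.Ioi 0 ×ˢ Set.Ioi 0) ∧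
      -- finite energy for a.e. `t > 0`
      (∀ᵐ t ∂(volume.restrict (Set.Ioi (0:ℝ))),
        IntegrableOn
          (fun r => ((1/2) * (m t r) ^ (2:ℕ) / ρ t r + κ * (ρ t r) ^ γ / (γ - 1))
            * r ^ (n - 1))
          (Set.Ioi 0)) ∧
      -- weak form of the continuity equation
      (∀ φ : ℝ → ℝ → ℝ,
        ContDiff ℝ (⊤ : ℕ∞) (Function.uncurry φ) →
        HasCompactSupport (Function.uncurry φ) →
        (∫ t in Set.Ioi (0:ℝ), ∫ r in Set.Ioi (0:ℝ),
            (ρ t r * deriv (fun s => φ s r) t + m t r * deriv (fun y => φ t y) r)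
              * r ^ (n - 1))
          + (∫ r in Set.Ioi (0:ℝ), ρ₀ r * φ 0 r * r ^ (n - 1)) = 0) ∧
      -- weak form of the momentum equation, for test functions vanishing at the origin
      (∀ φ : ℝ → ℝ → ℝ,
        ContDiff ℝ (⊤ : ℕ∞) (Function.uncurry φ) →
        HasCompactSupport (Function.uncurry φ) →
        (∀ t : ℝ, 0 ≤ t → φ t 0 = 0) →
        (∫ t in Set.Ioi (0:ℝ), ∫ r in Set.Ioi (0:ℝ),
            (m t r * deriv (fun s => φ s r) t
              + (m t r) ^ (2:ℕ) / ρ t r * deriv (fun y => φ t y) r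
              + κ * (ρ t r) ^ γ
                * (deriv (fun y => φ t y) r + ((n - 1 : ℝ) / r) * φ t r))
              * r ^ (n - 1))
          + (∫ r in Set.Ioi (0:ℝ), m₀ r * φ 0 r * r ^ (n - 1)) = 0) := by

  have hκ0 : 0 < κ := by
    rw [hκ]
    have : 0 < γ - 1 := by linarith
    positivity
  obtain ⟨A, u, ℓ, h, hA, hD⟩ :=
    RadialEuler.exists_labels_of_energy hγ hκ0 hρ₀_nonneg hm₀ hρ₀_loc hm₀_loc hE₀
  obtain ⟨z₀, hz⟩ := h.exists_baseSubsolution hκ0 hγ hn hA hD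
  exact RadialEuler.exists_solution_of_baseSubsolution hn hκ0 hγ hz
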